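/- Let X ⊆ P^r_K be a variety of almost minimal degree which is not arithmetically Cohen–Macaulay and is not a generic projection of (a cone over) the Veronese surface F ⊆ P^5_K. Then there exists a variety Y ⊆ P^r_K of minimal degree such that X ⊆ Y and codim(X, Y) = 1. Moreover, with c = codim X and q = codepth A_X, for all 1 ≤ i ≤ c + q there are integers u_i, v_i ≥ 0 with a graded isomorphism Tor_i^S(K, A_X) ≅ K^{u_i}(−i−1) ⊕ K^{v_i}(−i−2). -/

import Mathlib

noncomputable section

open MvPolynomial

/-- The polynomial ring `S = K[x_0, …, x_r]`, the homogeneous coordinate ring of `ℙ^r_K`. -/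
abbrev PS (K : Type) [Field K] (r : ℕ) : Type := MvPolynomial (Fin (r + 1)) K

namespace AMD

variable (K : Type) [Field K] (r : ℕ)

/-- `I` is a homogeneous ideal of `S = K[x_0, …, x_r]`. -/
def IsHomIdeal (I : Ideal (PS K r)) : Prop :=
  ∀ p ∈ I, ∀ n : ℕ, homogeneousComponent n p ∈ I

/-- `X = V_+(I)` is non-degenerate: `I` contains no nonzero linear form. -/
def Nondeg (I : Ideal (PS K r)) : Prop :=
  ∀ p ∈ I, p.IsHomogeneous 1 → p = 0

/-- The irrelevant maximal ideal of the homogeneous coordinate ring `A_X = S/I`. -/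
def maxIdl (I : Ideal (PS K r)) : Ideal (PS K r ⧸ I) :=
  (Ideal.span (Set.range (X : Fin (r + 1) → PS K r))).map (Ideal.Quotient.mk I)

/-- `dim X = d`, i.e. the Krull dimension of `A_X = S/I` equals `d + 1`. -/
def DimEq (I : Ideal (PS K r)) (d : ℕ) : Prop :=
  ringKrullDim (PS K r ⧸ I) = (((d : ℕ∞) + 1 : ℕ∞) : WithBot ℕ∞)

/-- The degree-`n` homogeneous component of `A_X = S/I`, as a `K`-subspace. -/
def quotComponent (I : Ideal (PS K r)) (n : ℕ) : Submodule K (PS K r ⧸ I) :=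
  (homogeneousSubmodule (Fin (r + 1)) K n).map (Ideal.Quotient.mkₐ K I).toLinearMap

/-- The Hilbert series of the graded algebra `A_X = S/I`. -/
def hilbSeries (I : Ideal (PS K r)) : PowerSeries ℤ :=
  PowerSeries.mk fun n => (Module.finrank K (quotComponent K r I n) : ℤ)

/-- `deg X = e`, where `d = dim X`:  the numerator polynomial of the Hilbert series of
`A_X` with respect to the denominator `(1 - λ)^(d+1)` takes the value `e` at `λ = 1`. -/
def DegreeEq (I : Ideal (PS K r)) (d e : ℕ) : Prop :=
  ∃ h : Polynomial ℤ,
    hilbSeries K r I * (1 - PowerSeries.X) ^ (d + 1) = PowerSeries.mk (fun n => h.coeff n) ∧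
    h.eval 1 = (e : ℤ)

/-- A graded automorphism of `S`, i.e. a linear change of coordinates of `ℙ^r_K`. -/
def IsGrAut (φ : PS K r ≃ₐ[K] PS K r) : Prop :=
  ∀ i, (φ (X i)).IsHomogeneous 1

/-- `X = V_+(I) ⊆ ℙ^r_K` is a cone (over a variety lying in some hyperplane): after a
linear change of coordinates, `I` is generated by polynomials not involving the last
variable. -/
def IsConeIdeal (I : Ideal (PS K r)) : Prop :=
  ∃ φ : PS K r ≃ₐ[K] PS K r, IsGrAut K r φ ∧
    ∃ J : Ideal (MvPolynomial (Fin r) K),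
      Ideal.map φ I = Ideal.map (rename (Fin.castSucc : Fin r → Fin (r + 1))) J

/-- A (weakly) regular sequence on the ring `A`. -/
def IsRegSeq {A : Type} [CommRing A] (rs : List A) : Prop :=
  ∀ (i : Fin rs.length) (y : A),
    rs.get i * y ∈ Ideal.span {x | x ∈ rs.take i.1} → y ∈ Ideal.span {x | x ∈ rs.take i.1}

/-- `depth A_X = t`: the maximal length of a regular sequence on `A_X = S/I` consisting
of elements of the irrelevant maximal ideal is `t`. -/
def DepthEq (I : Ideal (PS K r)) (t : ℕ) : Prop :=
  (∃ rs : List (PS K r ⧸ I), rs.length = t ∧ (∀ x ∈ rs, x ∈ maxIdl K r I) ∧ IsRegSeq rs) ∧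
  ∀ rs : List (PS K r ⧸ I), (∀ x ∈ rs, x ∈ maxIdl K r I) → IsRegSeq rs → rs.length ≤ t

/-- `X` is arithmetically Cohen-Macaulay: `depth A_X = dim A_X`. -/
def IsACM (I : Ideal (PS K r)) : Prop :=
  ∃ t : ℕ, ringKrullDim (PS K r ⧸ I) = ((t : ℕ∞) : WithBot ℕ∞) ∧ DepthEq K r I t

/-- The socle `{y | m·y = 0}` of `B`, as a `K`-subspace of `B`. -/
def socle (B : Type) [CommRing B] [Algebra K B] (m : Ideal B) : Submodule K B where
  carrier := {y | ∀ z ∈ m, z * y = 0}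
  add_mem' := by
    intro a b ha hb z hz
    rw [mul_add, ha z hz, hb z hz, add_zero]
  zero_mem' := by
    intro z hz
    rw [mul_zero]
  smul_mem' := by
    intro c y hy z hz
    rw [mul_smul_comm, hy z hz, smul_zero]

/-- `X` is arithmetically Gorenstein: `A_X = S/I` is Cohen-Macaulay and its Artinian
reduction by a maximal regular sequence has a one-dimensional socle. -/
def IsArithGorenstein (I : Ideal (PS K r)) : Prop :=
  ∃ (t : ℕ) (rs : List (PS K r ⧸ I)),
    ringKrullDim (PS K r ⧸ I) = ((t : ℕ∞) : WithBot ℕ∞) ∧ rs.length = t ∧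
    (∀ x ∈ rs, x ∈ maxIdl K r I) ∧ IsRegSeq rs ∧
    Module.finrank K
      (socle K ((PS K r ⧸ I) ⧸ Ideal.span {x | x ∈ rs})
        (Ideal.map (Ideal.Quotient.mk (Ideal.span {x | x ∈ rs})) (maxIdl K r I))) = 1

/-- The graded free `S`-module with `β j` generators in "row `j`" for each `j : ℕ`. -/
abbrev FreeGr (β : ℕ → ℕ) : Type := ((j : ℕ) × Fin (β j)) →₀ PS K r

/-- `φ` is a minimal graded homomorphism of graded free modules, where the generator
`(j, t)` of the source has degree `m₁ + j` and the generator `(j', t')` of the target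
has degree `m₂ + j'`: every matrix entry of `φ` is either zero or homogeneous of the
appropriate positive degree. -/
def IsMinGrMap (b₁ b₂ : ℕ → ℕ) (m₁ m₂ : ℕ)
    (φ : FreeGr K r b₁ →ₗ[PS K r] FreeGr K r b₂) : Prop :=
  ∀ (j : ℕ) (t : Fin (b₁ j)) (j' : ℕ) (t' : Fin (b₂ j')),
    (φ (Finsupp.single ⟨j, t⟩ 1)) ⟨j', t'⟩ = 0 ∨
      ∃ dd : ℕ, 1 ≤ dd ∧ dd + (m₂ + j') = m₁ + j ∧
        ((φ (Finsupp.single ⟨j, t⟩ 1)) ⟨j', t'⟩).IsHomogeneous dd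

/-- `b` is the Betti diagram of the ideal `I ⊆ S`, i.e.
`b i j = dim_K Tor_i^S(K, S/I)_{i+j}` for all `i ≥ 1`.  This is expressed by the
existence of a minimal graded free resolution `⋯ → F₂ → F₁ → S → S/I → 0` of `S/I`
in which, for `i ≥ 1`, the free module `F_i` has exactly `b i j` generators of degree
`i + j`. -/
def HasBettiDiagram (I : Ideal (PS K r)) (b : ℕ → ℕ → ℕ) : Prop :=
  ∃ (φ : (i : ℕ) → (FreeGr K r (b (i + 2)) →ₗ[PS K r] FreeGr K r (b (i + 1))))
    (ε : FreeGr K r (b 1) →ₗ[PS K r] PS K r),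
    (∀ (j : ℕ) (t : Fin (b 1 j)), (ε (Finsupp.single ⟨j, t⟩ 1)).IsHomogeneous (1 + j)) ∧
    (∀ i, IsMinGrMap K r (b (i + 2)) (b (i + 1)) (i + 2) (i + 1) (φ i)) ∧
    LinearMap.range ε = I ∧
    LinearMap.ker ε = LinearMap.range (φ 0) ∧
    ∀ i, LinearMap.ker (φ i) = LinearMap.range (φ (i + 1))

/-- The Pfaffian of a (skew-symmetric) `4 × 4` matrix. -/
def pfaff4 {R : Type} [CommRing R] (N : Matrix (Fin 4) (Fin 4) R) : R :=
  N 0 1 * N 2 3 - N 0 2 * N 1 3 + N 0 3 * N 1 2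

/-- The five submaximal (`4 × 4`) Pfaffians of a skew-symmetric `5 × 5` matrix. -/
def subPfaffian {R : Type} [CommRing R] (M : Matrix (Fin 5) (Fin 5) R) (i : Fin 5) : R :=
  pfaff4 (M.submatrix i.succAbove i.succAbove)

/-- `X = V_+(I)` is the Pfaffian variety defined by the five `4 × 4` Pfaffians of a
skew-symmetric `5 × 5` matrix of linear forms. -/
def IsPfaffianVariety (I : Ideal (PS K r)) : Prop :=
  ∃ M : Matrix (Fin 5) (Fin 5) (PS K r),
    M.transpose = -M ∧ (∀ i j, (M i j).IsHomogeneous 1) ∧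
    I = Ideal.span (Set.range (subPfaffian M))

/-- The vanishing ideal of the coordinate point `(0 : ⋯ : 0 : 1) ∈ ℙ^{r+1}_K`. -/
def pointIdl : Ideal (PS K (r + 1)) :=
  Ideal.span ((X : Fin (r + 2) → PS K (r + 1)) '' {i : Fin (r + 2) | i ≠ Fin.last (r + 1)})

/-- `X = V_+(I) ⊆ ℙ^r_K` is the image of `Z = V_+(J) ⊆ ℙ^{r+1}_K` under the projection
from a point `P ∈ ℙ^{r+1}_K ∖ Z`: after a linear change of coordinates moving `P` to
`(0 : ⋯ : 0 : 1)`, the ideal `I` is the contraction of `J` to `K[x_0, …, x_r]`. -/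
def IsProjectionOf (I : Ideal (PS K r)) (J : Ideal (PS K (r + 1))) : Prop :=
  ∃ ψ : PS K (r + 1) ≃ₐ[K] PS K (r + 1), IsGrAut K (r + 1) ψ ∧
    ¬ Ideal.map ψ J ≤ pointIdl K r ∧
    I = Ideal.comap (rename (Fin.castSucc : Fin (r + 1) → Fin (r + 2))) (Ideal.map ψ J)

/-- The ideal of the Veronese surface `F ⊆ ℙ^5_K`, generated by the `2 × 2` minors of
the generic symmetric `3 × 3` matrix with rows `(x₀,x₁,x₂), (x₁,x₃,x₄), (x₂,x₄,x₅)`. -/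
def veroneseIdeal : Ideal (PS K 5) :=
  Ideal.span {X 0 * X 3 - X 1 * X 1, X 0 * X 4 - X 1 * X 2, X 1 * X 4 - X 2 * X 3,
    X 0 * X 5 - X 2 * X 2, X 1 * X 5 - X 2 * X 4, X 3 * X 5 - X 4 * X 4}

/-- The determinant of the generic symmetric `3 × 3` matrix defining the Veronese
surface; it cuts out the secant variety of `F ⊆ ℙ^5_K`. -/
def veroneseDet : PS K 5 :=
  X 0 * X 3 * X 5 - X 0 * X 4 * X 4 - X 1 * X 1 * X 5 + 2 * (X 1 * X 2 * X 4) -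
    X 2 * X 2 * X 3

/-- `X = V_+(I) ⊆ ℙ^4_K` is a generic projection of the Veronese surface `F ⊆ ℙ^5_K`,
i.e. the projection of `F` from a point `P ∈ ℙ^5_K ∖ F` at which the generic symmetric
`3 × 3` matrix `M` has rank `3` (equivalently, `P` does not lie on the secant variety
`{det M = 0}` of `F`). -/
def IsGenProjVeronese4 (I : Ideal (PS K 4)) : Prop :=
  ∃ ψ : PS K 5 ≃ₐ[K] PS K 5, IsGrAut K 5 ψ ∧
    ¬ Ideal.map ψ (Ideal.span {veroneseDet K}) ≤ pointIdl K 4 ∧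
    I = Ideal.comap (rename (Fin.castSucc : Fin 5 → Fin 6)) (Ideal.map ψ (veroneseIdeal K))

/-- `X = V_+(I) ⊆ ℙ^r_K` is a generic projection of the Veronese surface (which forces
`r = 4`). -/
def IsGenProjVeronese (I : Ideal (PS K r)) : Prop :=
  ∃ h : r + 1 = 5, IsGenProjVeronese4 K (Ideal.map (rename (Fin.cast h)) I)

/-- `X = V_+(I) ⊆ ℙ^r_K` is a generic projection of (a cone over) the Veronese surface
`F ⊆ ℙ^5_K`:  `X` is the projection of a cone `Z ⊆ ℙ^{r+1}_K` over `F` from a point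
not lying on the (cone over the) secant variety of `F`. -/
def IsGenProjVeroneseCone (I : Ideal (PS K r)) : Prop :=
  ∃ (h : 6 ≤ r + 2) (ψ : PS K (r + 1) ≃ₐ[K] PS K (r + 1)), IsGrAut K (r + 1) ψ ∧
    ¬ Ideal.map ψ (Ideal.map (rename (Fin.castLE h))
        (Ideal.span {veroneseDet K})) ≤ pointIdl K r ∧
    I = Ideal.comap (rename (Fin.castSucc : Fin (r + 1) → Fin (r + 2)))
      (Ideal.map ψ (Ideal.map (rename (Fin.castLE h)) (veroneseIdeal K)))

/-- The ideal of the rational normal scroll `S(a_1, …, a_k)`, generated by the `2 × 2`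
minors of the standard `2 × (Σ a_i)` matrix of indeterminates. -/
def scrollIdeal (k : ℕ) (a : Fin k → ℕ) :
    Ideal (MvPolynomial ((i : Fin k) × Fin (a i + 1)) K) :=
  Ideal.span {p | ∃ (i : Fin k) (j : Fin (a i)) (i' : Fin k) (j' : Fin (a i')),
    p = X ⟨i, j.castSucc⟩ * X ⟨i', j'.succ⟩ - X ⟨i, j.succ⟩ * X ⟨i', j'.castSucc⟩}

/-- The affine cone in `K^{r+2}` of the projective scheme `V_+(J) ⊆ ℙ^{r+1}_K`. -/
def zeroSet (J : Ideal (PS K (r + 1))) : Set (Fin (r + 2) → K) :=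
  {v | ∀ f ∈ J, MvPolynomial.eval v f = 0}

/-- Restriction of polynomials to the plane spanned by the vectors `p` and `q`
(i.e. to the line through the corresponding projective points). -/
def lineRestrict (p q : Fin (r + 2) → K) : PS K (r + 1) →ₐ[K] MvPolynomial (Fin 2) K :=
  aeval fun i => MvPolynomial.C (p i) * X 0 + MvPolynomial.C (q i) * X 1

/-- The line through the (independent) points `p`, `q` is a secant line of
`Z = V_+(J)`: the scheme `Z ∩ L ⊆ L ≅ ℙ^1` has length at least `2`, i.e. the
restriction of `J` to the line is contained in a principal ideal generated by a
form of degree `≥ 2` (or is zero, in which case `L ⊆ Z`). -/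
def IsSecantLine (J : Ideal (PS K (r + 1))) (p q : Fin (r + 2) → K) : Prop :=
  ∃ h : MvPolynomial (Fin 2) K,
    (∀ f ∈ J, lineRestrict K r p q f ∈ Ideal.span {h}) ∧
    (h = 0 ∨ ∃ dd : ℕ, 2 ≤ dd ∧ h.IsHomogeneous dd)

/-- The (affine cone over the) secant cone `Sec_P(Z)` of `Z = V_+(J)` with respect to
the point `P = [p]`: the union of `{P}` and of all secant lines of `Z` through `P`. -/
def secantCone (J : Ideal (PS K (r + 1))) (p : Fin (r + 2) → K) : Set (Fin (r + 2) → K) :=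
  {v | ∃ a : K, v = a • p} ∪
    {v | ∃ q : Fin (r + 2) → K, LinearIndependent K ![p, q] ∧ IsSecantLine K r J p q ∧
      ∃ a b : K, v = a • p + b • q}

/-- The (homogeneous) vanishing ideal of a subset of the affine cone `K^{r+2}`. -/
def vanishingIdl (T : Set (Fin (r + 2) → K)) : Ideal (PS K (r + 1)) where
  carrier := {f | ∀ v ∈ T, MvPolynomial.eval v f = 0}
  add_mem' := by
    intro a b ha hb v hv
    rw [map_add, ha v hv, hb v hv, add_zero]
  zero_mem' := by
    intro v hv
    rw [map_zero]
  smul_mem' := by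
    intro c f hf v hv
    rw [smul_eq_mul, map_mul, hf v hv, mul_zero]

/-- `X = V_+(I) ⊆ ℙ^r_K` is the image of `Z = V_+(J) ⊆ ℙ^{r+1}_K` under the linear
projection `π : ℙ^{r+1}_K ∖ {P} → ℙ^r_K` from the point `P = [p]`:  `I` is the
contraction of `J` along the substitution homomorphism induced by a surjective linear
map `K^{r+2} → K^{r+1}` with kernel `K·p`. -/
def IsProjectionFromPoint (I : Ideal (PS K r)) (J : Ideal (PS K (r + 1)))
    (p : Fin (r + 2) → K) : Prop :=
  ∃ π : (Fin (r + 2) → K) →ₗ[K] (Fin (r + 1) → K),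
    Function.Surjective π ∧ LinearMap.ker π = Submodule.span K {p} ∧
    I = Ideal.comap
      (aeval (fun j : Fin (r + 1) =>
        ∑ i : Fin (r + 2), MvPolynomial.C (π (Pi.single i 1) j) * X i) :
          PS K r →ₐ[K] PS K (r + 1)) J

end AMD


section
open Finset (range sum_congr sum_eq_single mul_sum sum_eq_zero sum_add_distrib sum_sub_distrib sum_mul sum_comm smul_sum
  sum_range_succ mem_univ mem_range card_univ sum_smul)
open Submodule (smul_mem subset_span span)
open Fintype (sum_option card_fin)
open Finsupp (single)
open Function (Injective Surjective)
open Module (finrank)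

local notation "tower_apply" => IsScalarTower.algebraMap_apply
local notation "HC" => HahnSeries.C
local notation "PC" => Polynomial.C
local notation "PX" => Polynomial.X

abbrev MP (K : Type) [Field K] (d : ℕ) : Type := MvPolynomial (Fin d) K


namespace AMDP

/-! ### Koszul complexes as iterated mapping cones -/

def KC (M : Type) : ℕ → Type
  | 0 => M
  | k + 1 => KC M k × KC M k

section
variable {S : Type} [CommRing S]

@[reducible] def kcGrp (M : Type) [AddCommGroup M] : (k : ℕ) → AddCommGroup (KC M k)
  | 0 => inferInstanceAs (AddCommGroup M)
  | k + 1 => by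
      letI := kcGrp M k; exact inferInstanceAs (AddCommGroup (KC M k × KC M k))

instance instKCGrp (M : Type) [AddCommGroup M] (k : ℕ) : AddCommGroup (KC M k) := kcGrp M k

@[reducible] def kcMod (M : Type) [AddCommGroup M] [Module S M] : (k : ℕ) → Module S (KC M k)
  | 0 => inferInstanceAs (Module S M)
  | k + 1 => by
      letI := kcMod M k; exact inferInstanceAs (Module S (KC M k × KC M k))

instance instKCMod (M : Type) [AddCommGroup M] [Module S M] (k : ℕ) : Module S (KC M k) := kcMod M k

variable (x : ℕ → S) (M : Type) [AddCommGroup M] [Module S M]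

/-- pairing into the next Koszul stage -/
def kmk {M : Type} {k : ℕ} (a b : KC M k) : KC M (k + 1) := (a, b)

variable {M}

lemma kmk_add {k : ℕ} (a b a' b' : KC M k) : kmk (a + a') (b + b') = kmk a b + kmk a' b' := rfl
lemma kmk_zero {k : ℕ} : kmk (0 : KC M k) 0 = 0 := rfl
lemma kmk_smul {k : ℕ} (s : S) (a b : KC M k) : kmk (s • a) (s • b) = s • kmk a b := rfl
lemma kmk_inj {k : ℕ} {a b a' b' : KC M k} : kmk a b = kmk a' b' ↔ a = a' ∧ b = b' := Prod.mk_inj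

variable (M)

def dK : (k : ℕ) → KC M k →ₗ[S] KC M k
  | 0 => 0
  | k + 1 =>
    { toFun := fun c => kmk (dK k c.1 + x k • c.2) (- dK k c.2)
      map_add' := by
        intro a b; rw [← kmk_add]; have h1 : (a + b).1 = a.1 + b.1 := rfl; have h2 : (a + b).2 = a.2 + b.2 := rfl
        rw [h1, h2, map_add, map_add, smul_add]; refine kmk_inj.2 ⟨by abel, by abel⟩
      map_smul' := by
        intro s a; have h1 : (s • a).1 = s • a.1 := rfl; have h2 : (s • a).2 = s • a.2 := rfl
        rw [h1, h2, RingHom.id_apply, ← kmk_smul, map_smul, map_smul]; refine kmk_inj.2 ⟨?_, ?_⟩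
        · rw [smul_add, smul_comm]
        · rw [smul_neg] }

variable {M}

lemma dK_mk {k : ℕ} (a b : KC M k) : dK x M (k + 1) (kmk a b) = kmk (dK x M k a + x k • b) (- dK x M k b) := rfl

lemma dK_dK : ∀ (k : ℕ) (c : KC M k), dK x M k (dK x M k c) = 0
  | 0, _ => rfl
  | k + 1, (a, b) => by
    change dK x M (k+1) (dK x M (k + 1) (kmk a b)) = 0; rw [dK_mk, dK_mk, map_add, map_neg, map_smul, dK_dK k a, dK_dK k b, ← kmk_zero]
    exact kmk_inj.2 ⟨by rw [smul_neg]; abel, by simp⟩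

/-- homogeneous pieces -/
def kdeg (G : ℤ → AddSubgroup M) : (k : ℕ) → ℤ → ℤ → AddSubgroup (KC M k)
  | 0, i, D => {
      carrier := {m | (m : M) ∈ G D ∧ (i ≠ 0 → m = 0)}
      add_mem' := fun {a b} ha hb =>
        ⟨(G D).add_mem ha.1 hb.1, fun h => by rw [ha.2 h, hb.2 h, add_zero]⟩
      zero_mem' := ⟨(G D).zero_mem, fun _ => rfl⟩
      neg_mem' := fun {a} ha => ⟨(G D).neg_mem ha.1, fun h => by rw [ha.2 h, neg_zero]⟩ }
  | k + 1, i, D => {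
      carrier := {c | c.1 ∈ kdeg G k i D ∧ c.2 ∈ kdeg G k (i - 1) (D - 1)}
      add_mem' := fun {a b} ha hb => ⟨add_mem ha.1 hb.1, add_mem ha.2 hb.2⟩
      zero_mem' := ⟨zero_mem _, zero_mem _⟩
      neg_mem' := fun {a} ha => ⟨neg_mem ha.1, neg_mem ha.2⟩ }

lemma mk_mem_kdeg (G : ℤ → AddSubgroup M) {k : ℕ} (i D : ℤ) (a b : KC M k) :
    kmk a b ∈ kdeg G (k + 1) i D ↔ a ∈ kdeg G k i D ∧ b ∈ kdeg G k (i - 1) (D - 1) := Iff.rfl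

/-- the grading is compatible with the operators -/
def Compat (G : ℤ → AddSubgroup M) : Prop := ∀ (k : ℕ) (D : ℤ) (m : M), m ∈ G D → x k • m ∈ G (D + 1)

variable {x}

lemma smul_mem_kdeg {G : ℤ → AddSubgroup M} (hG : Compat x G) (l : ℕ) :
    ∀ (k : ℕ) (i D : ℤ) (c : KC M k), c ∈ kdeg G k i D → x l • c ∈ kdeg G k i (D + 1)
  | 0, i, D, c, hc => ⟨hG l D c hc.1, fun h => by rw [hc.2 h, smul_zero]⟩
  | k + 1, i, D, (a, b), hc => by
    refine ⟨smul_mem_kdeg hG l k i D a hc.1, ?_⟩; have := smul_mem_kdeg hG l k (i-1) (D-1) b hc.2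
    rwa [show D - 1 + 1 = D + 1 - 1 by ring] at this

lemma dK_mem_kdeg {G : ℤ → AddSubgroup M} (hG : Compat x G) :
    ∀ (k : ℕ) (i D : ℤ) (c : KC M k), c ∈ kdeg G k i D → dK x M k c ∈ kdeg G k (i - 1) D
  | 0, i, D, c, _ => zero_mem _
  | k + 1, i, D, (a, b), hc => by
    change dK x M (k + 1) (kmk a b) ∈ _; rw [dK_mk, mk_mem_kdeg]
    refine ⟨add_mem (dK_mem_kdeg hG k i D a hc.1) ?_, neg_mem (dK_mem_kdeg hG k _ _ b hc.2)⟩; have := smul_mem_kdeg hG k k _ _ b hc.2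
    rwa [sub_add_cancel] at this

variable (x)

/-- vanishing of the homology in bidegree `(i, D)` -/
def HV (G : ℤ → AddSubgroup M) (k : ℕ) (i D : ℤ) : Prop := ∀ c ∈ kdeg G k i D, dK x M k c = 0 → ∃ e ∈ kdeg G k (i + 1) D, dK x M k e = c

variable {x}

lemma HV_succ' {G : ℤ → AddSubgroup M} (hG : Compat x G) {k : ℕ} {i D : ℤ} (h1 : HV x G k i D)
    (h2 : ∀ b ∈ kdeg G k (i - 1) (D - 1), dK x M k b = 0 → (∃ a ∈ kdeg G k i D, dK x M k a + x k • b = 0) →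
      ∃ e ∈ kdeg G k i (D - 1), dK x M k e = b) : HV x G (k + 1) i D := by
  rintro ⟨a, b⟩ hc hd; change dK x M (k + 1) (kmk a b) = 0 at hd; rw [dK_mk, ← kmk_zero, kmk_inj, neg_eq_zero] at hd
  obtain ⟨b', hb', rfl⟩ := h2 b hc.2 hd.2 ⟨a, hc.1, hd.1⟩; have h3 : a + x k • b' ∈ kdeg G k i D := by
    refine add_mem hc.1 ?_; have := smul_mem_kdeg hG k k _ _ b' hb'; rwa [sub_add_cancel] at this
  obtain ⟨a', ha', hda⟩ := h1 _ h3 (by rw [map_add, map_smul]; exact hd.1); refine ⟨kmk a' (-b'), (mk_mem_kdeg _ _ _ _ _).2 ⟨ha', ?_⟩, ?_⟩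
  · rw [add_sub_cancel_right]; exact neg_mem hb'
  · rw [dK_mk]; refine kmk_inj.2 ⟨?_, ?_⟩
    · rw [hda, smul_neg]; abel
    · rw [map_neg, neg_neg]

lemma HV_succ {G : ℤ → AddSubgroup M} (hG : Compat x G) {k : ℕ} {i D : ℤ}
    (h1 : HV x G k i D) (h2 : HV x G k (i - 1) (D - 1)) : HV x G (k + 1) i D := HV_succ' hG h1 (fun b hb hdb _ => by
    have := h2 b hb hdb; rwa [sub_add_cancel] at this)

lemma kdeg_neg {G : ℤ → AddSubgroup M} : ∀ (k : ℕ) (i D : ℤ) (c : KC M k), i < 0 → c ∈ kdeg G k i D → c = 0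
  | 0, i, D, c, hi, hc => hc.2 hi.ne
  | k + 1, i, D, (a, b), hi, hc => by
    have h1 := kdeg_neg k i D a hi hc.1; have h2 := kdeg_neg k (i-1) (D-1) b (by omega) hc.2; change kmk a b = 0; rw [h1, h2, kmk_zero]

lemma HV_neg {G : ℤ → AddSubgroup M} (k : ℕ) (i D : ℤ) (hi : i < 0) : HV x G k i D := fun c hc _ => by
  exact ⟨0, zero_mem _, by rw [map_zero, kdeg_neg k i D c hi hc]⟩

/-- propagation of upper vanishing -/
lemma HV_up {G : ℤ → AddSubgroup M} (hG : Compat x G) (s : ℤ) (k : ℕ)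
    (h : ∀ i D : ℤ, i + s ≤ D → HV x G k i D) (l : ℕ) : ∀ i D : ℤ, i + s ≤ D → HV x G (k + l) i D := by
  induction l with
  | zero => exact h
  | succ l ih =>
    intro i D hD; exact HV_succ hG (ih i D hD) (ih _ _ (by omega))

/-- inclusion of `M` in homological degree `0` -/
def kι : (k : ℕ) → M → KC M k
  | 0 => fun m => m
  | k + 1 => fun m => kmk (kι k m) 0

lemma mem_kdeg_h0 {G : ℤ → AddSubgroup M} : ∀ (k : ℕ) (D : ℤ) (c : KC M k), c ∈ kdeg G k 0 D ↔ ∃ m ∈ G D, c = kι k m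
  | 0, D, c => ⟨fun h => ⟨c, h.1, rfl⟩, by rintro ⟨m, hm, rfl⟩; exact ⟨hm, fun h => (h rfl).elim⟩⟩
  | k + 1, D, (a, b) => by
    constructor
    · intro hc; obtain ⟨m, hm, h⟩ := (mem_kdeg_h0 k D a).1 hc.1; refine ⟨m, hm, ?_⟩; have hb := kdeg_neg k _ _ b (by omega) hc.2
      rw [h, hb]; rfl
    · rintro ⟨m, hm, h⟩; rw [h]; exact (mk_mem_kdeg _ _ _ _ _).2 ⟨(mem_kdeg_h0 k D _).2 ⟨m, hm, rfl⟩, zero_mem _⟩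

lemma kι_add : ∀ (k : ℕ) (m m' : M), kι k (m + m') = kι k m + kι k m'
  | 0, _, _ => rfl
  | k + 1, m, m' => by
    change kmk _ _ = kmk _ _ + kmk _ _; rw [← kmk_add, kι_add k, add_zero]
lemma kι_smul : ∀ (k : ℕ) (s : S) (m : M), kι k (s • m) = s • kι k m
  | 0, _, _ => rfl
  | k + 1, s, m => by
    change kmk _ _ = s • kmk _ _; rw [← kmk_smul, kι_smul k, smul_zero]
/-- `m ∈ Σ_{l<k} x_l G_{D-1}` -/
def KB (x : ℕ → S) (G : ℤ → AddSubgroup M) (k : ℕ) (D : ℤ) (m : M) : Prop :=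
  ∃ g : ℕ → M, (∀ l, g l ∈ G (D - 1)) ∧ m = ∑ l ∈ range k, x l • g l

lemma dK_h1 {G : ℤ → AddSubgroup M} : ∀ (k : ℕ) (D : ℤ) (m : M), (∃ e ∈ kdeg G k 1 D, dK x M k e = kι k m) ↔ KB x G k D m
  | 0, D, m => by
    constructor
    · rintro ⟨e, he, h⟩; refine ⟨fun _ => 0, fun _ => zero_mem _, ?_⟩; have : (0 : M) = m := h; rw [← this]; simp
    · rintro ⟨g, hg, h⟩; refine ⟨0, zero_mem _, ?_⟩; change (0 : M) = m; rw [h]; simp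
  | k + 1, D, m => by
    constructor
    · rintro ⟨⟨a, b⟩, he, h⟩; change dK x M (k + 1) (kmk a b) = _ at h; rw [dK_mk] at h; have h1 := (kmk_inj.1 h).1
      obtain ⟨m', hm', rfl⟩ := (mem_kdeg_h0 k _ b).1 he.2; rw [← kι_smul, ← eq_sub_iff_add_eq] at h1
      have h2 : kι k m - kι k (x k • m') = kι k (m - x k • m') := by rw [sub_eq_iff_eq_add, ← kι_add, sub_add_cancel]
      rw [h2] at h1; obtain ⟨g, hg, hs⟩ := (dK_h1 k D _).1 ⟨a, he.1, h1⟩; refine ⟨Function.update g k m', fun l => ?_, ?_⟩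
      · by_cases hl : l = k
        · subst hl; simpa using hm'
        · simpa [Function.update_of_ne hl] using hg l
      · rw [sum_range_succ, Function.update_self, ← sub_eq_iff_eq_add, hs]; refine sum_congr rfl fun l hl => ?_
        rw [Function.update_of_ne (mem_range.1 hl).ne]
    · rintro ⟨g, hg, h⟩; obtain ⟨a, ha, hda⟩ := (dK_h1 k D (∑ l ∈ range k, x l • g l)).2 ⟨g, hg, rfl⟩
      refine ⟨kmk a (kι k (g k)), (mk_mem_kdeg _ _ _ _ _).2 ⟨ha, ?_⟩, ?_⟩
      · rw [sub_self]; exact (mem_kdeg_h0 k _ _).2 ⟨_, hg k, rfl⟩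
      · rw [dK_mk]; refine kmk_inj.2 ⟨?_, ?_⟩
        · rw [hda, h, ← kι_smul, ← kι_add, sum_range_succ]
        · have : kι k (g k) ∈ kdeg G k 0 (D - 1) := (mem_kdeg_h0 k _ _).2 ⟨_, hg k, rfl⟩; have h0 : dK x M k (kι k (g k)) = 0 := by
            clear * -; generalize g k = m
            induction k with
            | zero => rfl
            | succ k ih =>
              change dK x M (k+1) (kmk _ _) = 0; rw [dK_mk, ih, ← kmk_zero]; exact kmk_inj.2 ⟨by simp, by simp⟩
          rw [h0, neg_zero]

lemma dK_kι (k : ℕ) (m : M) : dK x M k (kι k m) = 0 := by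
  induction k with
  | zero => rfl
  | succ k ih =>
    change dK x M (k+1) (kmk _ _) = 0; rw [dK_mk, ih, ← kmk_zero]; exact kmk_inj.2 ⟨by simp, by simp⟩

lemma HV_h0 {G : ℤ → AddSubgroup M} (k : ℕ) (D : ℤ) : HV x G k 0 D ↔ ∀ m ∈ G D, KB x G k D m := by
  constructor
  · intro h m hm; exact (dK_h1 k D m).1 (h _ ((mem_kdeg_h0 k D _).2 ⟨m, hm, rfl⟩) (dK_kι k m))
  · rintro h c hc -; obtain ⟨m, hm, rfl⟩ := (mem_kdeg_h0 k D c).1 hc; exact (dK_h1 k D m).2 (h m hm)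

/-- regular sequences -/
lemma HV_reg {G : ℤ → AddSubgroup M} (hG : Compat x G) (k : ℕ)
    (hreg : ∀ l < k, ∀ D, ∀ m ∈ G D, KB x G l (D + 1) (x l • m) → KB x G l D m) : ∀ i D : ℤ, 1 ≤ i → HV x G k i D := by
  induction k with
  | zero =>
    intro i D hi c hc _; exact ⟨0, zero_mem _, by rw [map_zero, hc.2 (by omega)]⟩
  | succ k ih =>
    have ih' := ih (fun l hl => hreg l (by omega)); intro i D hi; by_cases h1 : i = 1
    · subst h1; refine HV_succ' hG (ih' 1 D le_rfl) ?_; rintro b hb - ⟨a, ha, hab⟩; rw [sub_self] at hb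
      obtain ⟨m, hm, rfl⟩ := (mem_kdeg_h0 k _ b).1 hb; refine (dK_h1 k (D - 1) m).2 (hreg k (by omega) _ m hm ?_)
      rw [sub_add_cancel, ← dK_h1]; refine ⟨-a, neg_mem ha, ?_⟩; rw [map_neg, neg_eq_iff_add_eq_zero, kι_smul, hab]
    · exact HV_succ hG (ih' i D hi) (ih' _ _ (by omega))

/-! functoriality -/
variable {M' : Type} [AddCommGroup M'] [Module S M']

def kmap (f : M → M') : (k : ℕ) → KC M k → KC M' k
  | 0 => f
  | k + 1 => fun c => kmk (kmap f k c.1) (kmap f k c.2)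

lemma kmap_zero (f : M →+ M') : ∀ (k : ℕ), kmap f k 0 = 0
  | 0 => map_zero f
  | k + 1 => by
    change kmk (kmap f k 0) (kmap f k 0) = 0; rw [kmap_zero f k, kmk_zero]

lemma kmap_add (f : M →+ M') : ∀ (k : ℕ) (c c' : KC M k), kmap f k (c + c') = kmap f k c + kmap f k c'
  | 0, c, c' => map_add f _ _
  | k + 1, (a, b), (a', b') => by
    change kmk (kmap f k (a + a')) (kmap f k (b + b')) = kmk _ _ + kmk _ _; rw [kmap_add f k, kmap_add f k, kmk_add]

lemma kmap_neg (f : M →+ M') (k : ℕ) (c : KC M k) : kmap f k (-c) = - kmap f k c := by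
  have := kmap_add f k c (-c); rw [add_neg_cancel, kmap_zero] at this; exact (neg_eq_of_add_eq_zero_right this.symm).symm

lemma kmap_sub (f : M →+ M') (k : ℕ) (c c' : KC M k) : kmap f k (c - c') = kmap f k c - kmap f k c' := by
  rw [sub_eq_add_neg, kmap_add, kmap_neg, sub_eq_add_neg]

variable {S' : Type} [CommRing S'] {M'' : Type} [AddCommGroup M''] [Module S' M'']

lemma kmap_smul (f : M →+ M'') (s : S) (s' : S') (hf : ∀ m, f (s • m) = s' • f m) :
    ∀ (k : ℕ) (c : KC M k), kmap f k (s • c) = s' • kmap f k c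
  | 0, c => hf c
  | k + 1, (a, b) => by
    change kmk (kmap f k (s • a)) (kmap f k (s • b)) = s' • kmk _ _; rw [kmap_smul f s s' hf k, kmap_smul f s s' hf k, kmk_smul]

lemma kmap_dK {x' : ℕ → S'} (f : M →+ M'') (k : ℕ) (hf : ∀ l < k, ∀ m, f (x l • m) = x' l • f m) :
    ∀ (c : KC M k), kmap f k (dK x M k c) = dK x' M'' k (kmap f k c) := by
  induction k with
  | zero => intro c; exact map_zero f
  | succ k ih =>
    rintro ⟨a, b⟩; have ih' := ih (fun l hl => hf l (by omega))
    change kmap f (k + 1) (dK x M (k + 1) (kmk a b)) = dK x' M'' (k+1) (kmk _ _); rw [dK_mk, dK_mk]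
    change kmk (kmap f k (dK x M k a + x k • b)) (kmap f k (- dK x M k b)) =
      kmk (dK x' M'' k (kmap f k a) + x' k • kmap f k b) (- dK x' M'' k (kmap f k b))
    rw [kmap_add, kmap_neg, ih', ih', kmap_smul f (x k) (x' k) (hf k (by omega))]

lemma kmap_mem {G : ℤ → AddSubgroup M} {G' : ℤ → AddSubgroup M''} (f : M →+ M'') (hf : ∀ D, ∀ m ∈ G D, f m ∈ G' D) :
    ∀ (k : ℕ) (i D : ℤ) (c : KC M k), c ∈ kdeg G k i D → kmap f k c ∈ kdeg G' k i D
  | 0, i, D, c, hc => ⟨hf D c hc.1, fun h => by rw [hc.2 h]; exact map_zero f⟩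
  | k + 1, i, D, (a, b), hc =>
    ⟨kmap_mem f hf k i D a hc.1, kmap_mem f hf k _ _ b hc.2⟩

lemma kmap_surj {G : ℤ → AddSubgroup M} {G' : ℤ → AddSubgroup M''} (f : M →+ M'') (hf : ∀ D, ∀ m' ∈ G' D, ∃ m ∈ G D, f m = m') :
    ∀ (k : ℕ) (i D : ℤ) (c' : KC M'' k), c' ∈ kdeg G' k i D → ∃ c ∈ kdeg G k i D, kmap f k c = c'
  | 0, i, D, c', hc => by
    by_cases hi : i = 0
    · obtain ⟨m, hm, h⟩ := hf D c' hc.1; exact ⟨m, ⟨hm, fun h => (h hi).elim⟩, h⟩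
    · exact ⟨0, zero_mem _, by rw [kmap_zero, hc.2 hi]⟩
  | k + 1, i, D, (a', b'), hc => by
    obtain ⟨a, ha, h1⟩ := kmap_surj f hf k i D a' hc.1; obtain ⟨b, hb, h2⟩ := kmap_surj f hf k _ _ b' hc.2; refine ⟨kmk a b, ⟨ha, hb⟩, ?_⟩
    change kmk _ _ = kmk _ _; rw [← h1, ← h2]; rfl

lemma kmap_ker {G G₀ : ℤ → AddSubgroup M} (f : M →+ M'') (hf : ∀ D, ∀ m ∈ G D, f m = 0 → m ∈ G₀ D) :
    ∀ (k : ℕ) (i D : ℤ) (c : KC M k), c ∈ kdeg G k i D → kmap f k c = 0 → c ∈ kdeg G₀ k i D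
  | 0, i, D, c, hc, h => ⟨hf D c hc.1 h, hc.2⟩
  | k + 1, i, D, (a, b), hc, h => by
    change kmk (kmap f k a) (kmap f k b) = 0 at h; rw [← kmk_zero, kmk_inj] at h
    exact ⟨kmap_ker f hf k i D a hc.1 h.1, kmap_ker f hf k _ _ b hc.2 h.2⟩

/-- the long exact sequence, chain level: `0 → G₀ → G → G' → 0` -/
lemma HV_les {G G₀ : ℤ → AddSubgroup M} {G' : ℤ → AddSubgroup M''} {x' : ℕ → S'} (f : M →+ M'')
    (hG : Compat x G) (k : ℕ)
    (hfx : ∀ l < k, ∀ m, f (x l • m) = x' l • f m)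
    (hle : ∀ D, G₀ D ≤ G D)
    (hmap : ∀ D, ∀ m ∈ G D, f m ∈ G' D)
    (hsurj : ∀ D, ∀ m' ∈ G' D, ∃ m ∈ G D, f m = m')
    (hker : ∀ D, ∀ m ∈ G D, f m = 0 → m ∈ G₀ D)
    (hker' : ∀ D, ∀ m ∈ G₀ D, f m = 0)
    {i D : ℤ} (h1 : HV x G k i D) (h2 : HV x' G' k (i + 1) D) : HV x G₀ k i D := by
  intro c hc hdc; have hcG : c ∈ kdeg G k i D := by
    have : ∀ (k : ℕ) (i D : ℤ) (c : KC M k), c ∈ kdeg G₀ k i D → c ∈ kdeg G k i D := fun k => by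
      induction k with
      | zero => exact fun i D c h => ⟨hle D h.1, h.2⟩
      | succ k ih => exact fun i D c h => ⟨ih _ _ _ h.1, ih _ _ _ h.2⟩
    exact this k i D c hc
  have hfc : kmap f k c = 0 := by
    have : ∀ (k : ℕ) (i D : ℤ) (c : KC M k), c ∈ kdeg G₀ k i D → kmap f k c = 0 := fun k => by
      induction k with
      | zero => exact fun i D c h => hker' D c h.1
      | succ k ih =>
        intro i D c h; change kmk _ _ = 0; rw [ih _ _ _ h.1, ih _ _ _ h.2, kmk_zero]
    exact this k i D c hc
  obtain ⟨e, he, rfl⟩ := h1 c hcG hdc; have h3 := kmap_mem f hmap k _ _ e he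
  have h4 : dK x' M'' k (kmap f k e) = 0 := by rw [← kmap_dK f k hfx, hfc]
  obtain ⟨g, hg, hge⟩ := h2 _ h3 h4; obtain ⟨g', hg', rfl⟩ := kmap_surj f hsurj k _ _ g hg
  refine ⟨e - dK x M k g', kmap_ker f hker k _ _ _ (sub_mem he ?_) ?_, ?_⟩
  · have := dK_mem_kdeg hG k _ _ g' hg'; rwa [add_sub_cancel_right] at this
  · rw [kmap_sub, kmap_dK f k hfx, hge, sub_self]
  · rw [map_sub, dK_dK, sub_zero]

end

/-! ### integer-graded homogeneous pieces of polynomial rings -/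
section HG
variable {K : Type} [Field K] {σ : Type}

/-- polynomials homogeneous of degree `D : ℤ` (zero if `D < 0`) -/
def HG (D : ℤ) : Submodule K (MvPolynomial σ K) where
  carrier := {p | ∀ s, coeff s p ≠ 0 → ((Finsupp.degree s : ℕ) : ℤ) = D}
  add_mem' := by
    intro a b ha hb s hs; by_cases h : coeff s a = 0
    · refine hb s ?_; rw [coeff_add, h, zero_add] at hs; exact hs
    · exact ha s h
  zero_mem' := by
    intro s hs; simp at hs
  smul_mem' := by
    intro c p hp s hs; refine hp s ?_; intro h; rw [coeff_smul, h, smul_zero] at hs; exact hs rfl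

lemma mem_HG {D : ℤ} {p : MvPolynomial σ K} : p ∈ HG D ↔ ∀ s, coeff s p ≠ 0 → ((Finsupp.degree s : ℕ) : ℤ) = D := Iff.rfl

lemma mem_HG_nat {n : ℕ} {p : MvPolynomial σ K} : p ∈ HG n ↔ p.IsHomogeneous n := by
  rw [mem_HG]; constructor
  · intro h s hs; have := h s hs; have h2 : Finsupp.weight (1 : σ → ℕ) s = Finsupp.degree s :=
      (DFunLike.congr_fun (Finsupp.degree_eq_weight_one (R := ℕ) (σ := σ)) s).symm
    rw [h2]; exact_mod_cast this
  · intro h s hs; have := h hs; have h2 : Finsupp.weight (1 : σ → ℕ) s = Finsupp.degree s :=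
      (DFunLike.congr_fun (Finsupp.degree_eq_weight_one (R := ℕ) (σ := σ)) s).symm
    rw [h2] at this; exact_mod_cast this

lemma mem_HG_neg {D : ℤ} (hD : D < 0) {p : MvPolynomial σ K} : p ∈ HG D ↔ p = 0 := by
  constructor
  · intro h; ext s; by_contra hs; have := h s hs; omega
  · rintro rfl; exact zero_mem _

lemma HG_zero_of_neg {D : ℤ} (hD : D < 0) {p : MvPolynomial σ K} (h : p ∈ HG D) : p = 0 := (mem_HG_neg hD).1 h

lemma HG_mul {a b : ℤ} {p q : MvPolynomial σ K} (hp : p ∈ HG a) (hq : q ∈ HG b) : p * q ∈ HG (a + b) := by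
  by_cases ha : a < 0
  · rw [HG_zero_of_neg ha hp, zero_mul]; exact zero_mem _
  by_cases hb : b < 0
  · rw [HG_zero_of_neg hb hq, mul_zero]; exact zero_mem _
  lift a to ℕ using by omega
  lift b to ℕ using by omega
  rw [← Nat.cast_add]; exact mem_HG_nat.2 ((mem_HG_nat.1 hp).mul (mem_HG_nat.1 hq))

lemma HG_C (c : K) : (C c : MvPolynomial σ K) ∈ HG 0 := mem_HG_nat.2 (isHomogeneous_C σ c)

lemma HG_one : (1 : MvPolynomial σ K) ∈ HG 0 := mem_HG_nat.2 (isHomogeneous_one σ K)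

lemma HG_X (i : σ) : (X i : MvPolynomial σ K) ∈ HG 1 := mem_HG_nat.2 (isHomogeneous_X K i)

lemma HG_zero_eq {p : MvPolynomial σ K} (h : p ∈ HG 0) : p = C (coeff 0 p) := by
  have := mem_HG_nat.1 h; exact totalDegree_eq_zero_iff_eq_C.1 (Nat.le_zero.1 this.totalDegree_le)

/-- homogeneous component with integer index -/
def hcmp (D : ℤ) : MvPolynomial σ K →ₗ[K] MvPolynomial σ K :=
  if 0 ≤ D then homogeneousComponent D.toNat else 0

lemma hcmp_nat (n : ℕ) (p : MvPolynomial σ K) : hcmp n p = homogeneousComponent n p := by simp [hcmp]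

lemma hcmp_mem (D : ℤ) (p : MvPolynomial σ K) : hcmp D p ∈ HG D := by
  by_cases h : 0 ≤ D
  · lift D to ℕ using h; rw [hcmp_nat]; exact mem_HG_nat.2 (homogeneousComponent_isHomogeneous _ _)
  · simp [hcmp, h]

lemma hcmp_of_mem {D : ℤ} {p : MvPolynomial σ K} (h : p ∈ HG D) : hcmp D p = p := by
  by_cases hD : 0 ≤ D
  · lift D to ℕ using hD; rw [hcmp_nat, homogeneousComponent_of_mem (mem_HG_nat.1 h), if_pos rfl]
  · rw [HG_zero_of_neg (by omega) h, map_zero]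

lemma hcmp_of_mem_ne {D D' : ℤ} {p : MvPolynomial σ K} (h : p ∈ HG D) (hne : D' ≠ D) : hcmp D' p = 0 := by
  by_cases hD : 0 ≤ D
  · by_cases hD' : 0 ≤ D'
    · lift D to ℕ using hD; lift D' to ℕ using hD'
      rw [hcmp_nat, homogeneousComponent_of_mem (mem_HG_nat.1 h), if_neg (by exact_mod_cast hne)]
    · simp [hcmp, hD']
  · rw [HG_zero_of_neg (by omega) h, map_zero]

lemma hcmp_sum (p : MvPolynomial σ K) (N : ℕ) (hN : p.totalDegree < N) : ∑ i ∈ range N, hcmp i p = p := by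
  rw [← Finset.sum_subset (Finset.range_subset_range.2 (Nat.succ_le_of_lt hN))]
  · conv_rhs => rw [← sum_homogeneousComponent p]
    exact sum_congr rfl fun i _ => hcmp_nat i p
  · intro i _ hi; rw [hcmp_nat]; apply homogeneousComponent_eq_zero; simpa using hi

instance HG_fin [Finite σ] (D : ℤ) : FiniteDimensional K (HG D : Submodule K (MvPolynomial σ K)) := by
  by_cases hD : 0 ≤ D
  · lift D to ℕ using hD; have h : (HG D : Submodule K (MvPolynomial σ K)) ≤ restrictTotalDegree σ K D := fun p hp => by
      rw [mem_restrictTotalDegree]; exact (mem_HG_nat.1 hp).totalDegree_le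
    have : FiniteDimensional K (restrictTotalDegree σ K D) := by infer_instance
    exact Submodule.finiteDimensional_of_le h
  · have : (HG D : Submodule K (MvPolynomial σ K)) = ⊥ := by rw [eq_bot_iff]; intro p hp; exact HG_zero_of_neg (by omega) hp
    rw [this]; infer_instance
end HG

section Res
variable {K : Type} [Field K] {r : ℕ}

/-- good sequence of linear forms -/
structure GoodXS (K : Type) [Field K] (r : ℕ) (x : ℕ → PS K r) : Prop where
  deg : ∀ l, x l ∈ HG 1
  gen : ∀ a : ℤ, 1 ≤ a → ∀ f ∈ HG a, KB x (fun D => (HG D : Submodule K (PS K r)).toAddSubgroup) (r + 1) a f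
  reg : ∀ l < r + 1, ∀ D, ∀ f ∈ HG D, KB x (fun D => (HG D : Submodule K (PS K r)).toAddSubgroup) l (D + 1) (x l • f) →
    KB x (fun D => (HG D : Submodule K (PS K r)).toAddSubgroup) l D f

variable {M : Type} [AddCommGroup M] [Module (PS K r) M] [Module K M] [IsScalarTower K (PS K r) M]

structure GrMod (G : ℤ → Submodule K M) : Prop where
  smul : ∀ (a D : ℤ) (f : PS K r) (m : M), f ∈ HG a → m ∈ G D → f • m ∈ G (a + D)
  indep : ∀ (t : Finset ℤ) (g : ℤ → M), (∀ D, g D ∈ G D) → ∑ D ∈ t, g D = 0 → ∀ D ∈ t, g D = 0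
  fin : ∀ D, FiniteDimensional K (G D)

def NG (G : ℤ → Submodule K M) (N : Submodule (PS K r) M) (D : ℤ) : Submodule K M := G D ⊓ N.restrictScalars K

def gp (G : ℤ → Submodule K M) (D : ℤ) : AddSubgroup M := (G D).toAddSubgroup

structure ResSt (x : ℕ → PS K r) (G : ℤ → Submodule K M) (N : Submodule (PS K r) M) (s : ℤ) : Prop where
  graded : ∀ n ∈ N, ∃ (t : Finset ℤ) (g : ℤ → M), (∀ D, g D ∈ NG G N D) ∧ n = ∑ D ∈ t, g D
  low : ∀ D < s, ∀ n ∈ NG G N D, n = 0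
  hv : ∀ p D : ℤ, p + s + 2 ≤ D → HV x (gp (NG G N)) (r + 1) p D

/-- grading on the free module, generator `(j,t)` in degree `m + j` -/
def FG (β : ℕ → ℕ) (m : ℤ) (D : ℤ) : Submodule K (AMD.FreeGr K r β) where
  carrier := {f | ∀ i, f i ∈ (HG (D - (m + i.1)) : Submodule K (PS K r))}
  add_mem' := fun ha hb i => by rw [Finsupp.add_apply]; exact add_mem (ha i) (hb i)
  zero_mem' := fun i => zero_mem _
  smul_mem' := fun c f hf i => by rw [Finsupp.smul_apply]; exact smul_mem _ c (hf i)

lemma grMod_FG (β : ℕ → ℕ) (m : ℤ) (hβ : ∀ j, β j ≠ 0 → j = 1 ∨ j = 2) : GrMod (K := K) (r := r) (FG (K := K) (r := r) β m) where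
  smul := by
    intro a D f g hf hg i; have := HG_mul hf (hg i); rw [Finsupp.smul_apply, smul_eq_mul]; rwa [← add_sub_assoc] at this
  indep := by
    intro t g hg h D hD
    ext1 i
    have h1 := DFunLike.congr_fun h i; rw [Finsupp.finsetSum_apply, Finsupp.zero_apply] at h1; have h2 := congrArg (hcmp (D - (m + i.1))) h1
    rw [map_sum, map_zero, sum_eq_single D] at h2
    · rwa [hcmp_of_mem (hg D i)] at h2
    · intro D' _ hne; exact hcmp_of_mem_ne (hg D' i) (by omega)
    · intro h; exact (h hD).elim
  fin := by
    intro D; have hfin : Finite ((j : ℕ) × Fin (β j)) := by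
      let f : ((j : ℕ) × Fin (β j)) → ((j : Fin 3) × Fin (β j)) := fun i => 
        ⟨⟨i.1, by
          have := hβ i.1 (by have := i.2.pos; omega); omega⟩, i.2⟩
      refine Finite.of_injective f ?_; rintro ⟨a, b⟩ ⟨a', b'⟩ h; simp only [f, Sigma.mk.injEq, Fin.mk.injEq] at h; obtain ⟨rfl, h2⟩ := h
      simpa using h2
    let F : FG (K := K) (r := r) β m D →ₗ[K]
        ((i : (j : ℕ) × Fin (β j)) → (HG (D - (m + i.1)) : Submodule K (PS K r))) :=
      { toFun := fun f i => ⟨f.1 i, f.2 i⟩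
        map_add' := fun a b => rfl
        map_smul' := fun a b => rfl }
    have hF : Injective F := by
      intro a b h
      ext1; ext1 i
      have := congrFun h i; exact congrArg Subtype.val this
    exact FiniteDimensional.of_injective F hF

lemma compat_of_grMod {x : ℕ → PS K r} (hx : GoodXS K r x) {G : ℤ → Submodule K M} (hG : GrMod (K := K) (r := r) G) : Compat x (gp G) := fun k D m hm => by
  have := hG.smul 1 D (x k) m (hx.deg k) hm; rwa [add_comm] at this

lemma KB_FG {x : ℕ → PS K r} (β : ℕ → ℕ) (m : ℤ) (k : ℕ) (D : ℤ) (f : AMD.FreeGr K r β)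
    (h : ∀ i, f i ≠ 0 → KB x (fun D => (HG D : Submodule K (PS K r)).toAddSubgroup) k (D - (m + i.1)) (f i)) :
    KB x (gp (FG (K := K) (r := r) β m)) k D f := by
  have h' : ∀ i, ∃ g : ℕ → PS K r, (∀ l, g l ∈ (HG (D - (m + i.1) - 1) : Submodule K (PS K r))) ∧
      f i = ∑ l ∈ range k, x l • g l ∧ (f i = 0 → g = 0) := fun i => by
    by_cases hi : f i = 0
    · refine ⟨0, fun l => zero_mem _, by simp [hi], fun _ => rfl⟩
    · obtain ⟨g, hg, he⟩ := h i hi; exact ⟨g, hg, he, fun h => (hi h).elim⟩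
  choose g hg he hz using h'; refine ⟨fun l => Finsupp.onFinset f.support (fun i => g i l) ?_, ?_, ?_⟩
  · intro i hi; rw [Finsupp.mem_support_iff]; intro h0; rw [hz i h0] at hi; exact hi rfl
  · intro l i; rw [Finsupp.onFinset_apply]; have := hg i l; rwa [show D - (m + (i.1 : ℤ)) - 1 = D - 1 - (m + i.1) by ring] at this
  · ext1 i
    rw [he i, Finsupp.finsetSum_apply]; rfl

lemma KB_FG_apply {x : ℕ → PS K r} (β : ℕ → ℕ) (m : ℤ) (k : ℕ) (D : ℤ) (f : AMD.FreeGr K r β)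
    (h : KB x (gp (FG (K := K) (r := r) β m)) k D f) (i) :
    KB x (fun D => (HG D : Submodule K (PS K r)).toAddSubgroup) k (D - (m + i.1)) (f i) := by
  obtain ⟨g, hg, he⟩ := h; refine ⟨fun l => g l i, fun l => ?_, ?_⟩
  · have : g l i ∈ (HG (D - 1 - (m + i.1)) : Submodule K (PS K r)) := hg l i
    rwa [show D - 1 - (m + (i.1 : ℤ)) = D - (m + i.1) - 1 by ring] at this
  · rw [he, Finsupp.finsetSum_apply]; rfl

lemma HV_FG {x : ℕ → PS K r} (hx : GoodXS K r x) (β : ℕ → ℕ) (m : ℤ)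
    (hβ : ∀ j, β j ≠ 0 → j = 1 ∨ j = 2) (p D : ℤ) (hD : p + (m + 1) + 2 ≤ D) : HV x (gp (FG (K := K) (r := r) β m)) (r + 1) p D := by
  by_cases hp : p < 0
  · exact HV_neg _ _ _ hp
  by_cases hp0 : p = 0
  · subst hp0; rw [HV_h0]; intro f hf; refine KB_FG β m _ _ f fun i hi => hx.gen _ ?_ _ (hf i); have := hβ i.1 (by have := i.2.pos; omega)
    omega
  · refine HV_reg (compat_of_grMod hx (grMod_FG β m hβ)) (r + 1) ?_ p D (by omega); intro l hl D f hf h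
    refine KB_FG β m _ _ f fun i hi => hx.reg l hl _ _ (hf i) ?_; have := KB_FG_apply β m _ _ _ h i
    rwa [show D + 1 - (m + (i.1 : ℤ)) = D - (m + i.1) + 1 by ring] at this

/-- one step of the minimal resolution -/
lemma res_step {x : ℕ → PS K r} (hx : GoodXS K r x) {G : ℤ → Submodule K M}
    (hG : GrMod (K := K) (r := r) G) (N : Submodule (PS K r) M) (m : ℤ)
    (hN : ResSt x G N (m + 1)) : ∃ (β : ℕ → ℕ) (ε : AMD.FreeGr K r β →ₗ[PS K r] M), (∀ j, β j ≠ 0 → j = 1 ∨ j = 2) ∧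
      LinearMap.range ε = N ∧ (∀ (j : ℕ) t, ε (single ⟨j, t⟩ 1) ∈ NG G N (m + j)) ∧ (∀ f ∈ LinearMap.ker ε, ∀ i, coeff 0 (f i) = 0) ∧
      ResSt x (FG (K := K) (r := r) β m) (LinearMap.ker ε) (m + 2) := by
  classical
  have hfin := hG.fin
  set V : ℤ → Submodule K M := NG G N with hV
  have hVfin : ∀ D, FiniteDimensional K (V D) := fun D => Submodule.finiteDimensional_of_le (inf_le_left : V D ≤ G D)
  have hVsmul : ∀ (a D : ℤ) (f : PS K r) (v : M), f ∈ HG a → v ∈ V D → f • v ∈ V (a + D) := fun a D f v hf hv =>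
    ⟨hG.smul a D f v hf hv.1, N.smul_mem f hv.2⟩
  -- the decomposable part
  let W : ℤ → Submodule K M := fun D =>
    { carrier := {w | KB x (gp V) (r + 1) D w}
      add_mem' := by
        rintro a b ⟨g, hg, rfl⟩ ⟨g', hg', rfl⟩; refine ⟨fun l => g l + g' l, fun l => add_mem (hg l) (hg' l), ?_⟩
        simp [smul_add, sum_add_distrib]
      zero_mem' := ⟨fun _ => 0, fun _ => zero_mem _, by simp⟩
      smul_mem' := by
        rintro c a ⟨g, hg, rfl⟩; refine ⟨fun l => c • g l, fun l => smul_mem _ c (hg l), ?_⟩; rw [smul_sum]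
        exact sum_congr rfl fun l _ => (smul_algebra_smul_comm c (x l) (g l)).symm }
  have hWV : ∀ D, W D ≤ V D := by
    rintro D w ⟨g, hg, rfl⟩; refine sum_mem fun l _ => ?_; have := hVsmul 1 (D - 1) (x l) (g l) (hx.deg l) (hg l)
    rwa [add_sub_cancel] at this
  have hU : ∀ D, ∃ U : Submodule K M, U ≤ V D ∧ W D ⊓ U = ⊥ ∧ V D ≤ W D ⊔ U := fun D => by
    obtain ⟨U', hU'⟩ := Submodule.exists_isCompl (W D); refine ⟨U' ⊓ V D, inf_le_right, ?_, ?_⟩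
    · rw [eq_bot_iff, ← hU'.inf_eq_bot]; exact inf_le_inf le_rfl inf_le_left
    · intro v hv; have : v ∈ W D ⊔ U' := by rw [hU'.sup_eq_top]; trivial
      obtain ⟨w, hw, u, hu, rfl⟩ := Submodule.mem_sup.1 this; refine Submodule.add_mem_sup hw ⟨hu, ?_⟩; have := sub_mem hv (hWV D hw)
      rwa [add_sub_cancel_left] at this
  choose U hUV hWU hVWU using hU; have hUfin : ∀ D, FiniteDimensional K (U D) := fun D => Submodule.finiteDimensional_of_le (hUV D)
  let β : ℕ → ℕ := fun j => finrank K (U (m + j)); let e : ((j : ℕ) × Fin (β j)) → M := fun i => (Module.finBasis K (U (m + i.1)) i.2 : M)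
  have he : ∀ i, e i ∈ U (m + i.1) := fun i => (Module.finBasis K (U (m + i.1)) i.2).2
  let ε : AMD.FreeGr K r β →ₗ[PS K r] M := Finsupp.linearCombination (PS K r) e
  have hεs : ∀ i, ε (single i 1) = e i := fun i => by simp [ε, Finsupp.linearCombination_single]
  have hβ : ∀ j, β j ≠ 0 → j = 1 ∨ j = 2 := fun j hj => by
    by_contra hcon; apply hj; change finrank K (U (m + j)) = 0; rw [Submodule.finrank_eq_zero, eq_bot_iff]; intro u hu; by_cases h0 : j = 0
    · subst h0; exact hN.low _ (by push_cast; omega) u (hUV _ hu)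
    · have := hN.hv 0 (m + j) (by omega); rw [HV_h0] at this; have hw : u ∈ W (m + j) := this u (hUV _ hu); rw [← hWU (m + j)]
      exact ⟨hw, hu⟩
  have hεmem : ∀ D, ∀ f ∈ FG (K := K) (r := r) β m D, ε f ∈ V D := fun D f hf => by
    change Finsupp.linearCombination (PS K r) e f ∈ _; rw [Finsupp.linearCombination_apply]; refine sum_mem fun i _ => ?_
    have := hVsmul _ _ _ _ (hf i) (hUV _ (he i)); rwa [sub_add_cancel] at this
  have hεsurj : ∀ (k : ℕ), ∀ v ∈ V (m + k), ∃ f ∈ FG (K := K) (r := r) β m (m + k), ε f = v := fun k => by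
    induction k with
    | zero =>
      intro v hv; exact ⟨0, zero_mem _, by rw [map_zero, hN.low _ (by push_cast; omega) v hv]⟩
    | succ k ih =>
      intro v hv; obtain ⟨w, hw, u, hu, rfl⟩ := Submodule.mem_sup.1 (hVWU _ hv); obtain ⟨g, hg, rfl⟩ := hw
      have hg' : ∀ l, g l ∈ V (m + k) := fun l => by
        have := hg l; rwa [show m + ((k + 1 : ℕ) : ℤ) - 1 = m + k by push_cast; ring] at this
      choose f hf hfe using fun l => ih (g l) (hg' l); let bs := Module.finBasis K (U (m + ((k + 1 : ℕ) : ℤ)))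
      let f' : AMD.FreeGr K r β := ∑ t : Fin (β (k + 1)), single ⟨k + 1, t⟩ (C (bs.repr ⟨u, hu⟩ t))
      refine ⟨∑ l ∈ range (r + 1), x l • f l + f', add_mem ?_ ?_, ?_⟩
      · refine sum_mem fun l _ => ?_; have := (grMod_FG β m hβ).smul 1 _ (x l) (f l) (hx.deg l) (hf l)
        rwa [show 1 + (m + (k : ℤ)) = m + ((k + 1 : ℕ) : ℤ) by push_cast; ring] at this
      · refine sum_mem fun t _ i => ?_; rw [Finsupp.single_apply]
        split_ifs with h
        · rw [← h, sub_self]; exact HG_C _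
        · exact zero_mem _
      · rw [map_add, map_sum]; congr 1
        · exact sum_congr rfl fun l _ => by rw [map_smul, hfe]
        · rw [map_sum]; have h1 : ∀ t, ε (single ⟨k + 1, t⟩ (C (bs.repr ⟨u, hu⟩ t))) = bs.repr ⟨u, hu⟩ t • (bs t : M) := fun t => by
            change Finsupp.linearCombination (PS K r) e _ = _
            rw [Finsupp.linearCombination_single, ← MvPolynomial.algebraMap_eq, algebraMap_smul]
          simp_rw [h1]; have h2 := congrArg Subtype.val (bs.sum_repr ⟨u, hu⟩); rw [Submodule.coe_sum] at h2; exact h2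
  have hεsurj' : ∀ D, ∀ v ∈ V D, ∃ f ∈ FG (K := K) (r := r) β m D, ε f = v := fun D v hv => by
    by_cases hD : D < m
    · exact ⟨0, zero_mem _, by rw [map_zero, hN.low _ (by omega) v hv]⟩
    · obtain ⟨k, hk⟩ := Int.le.dest (not_lt.1 hD); rw [← hk] at hv ⊢; exact hεsurj k v hv
  have hrange : LinearMap.range ε = N := by
    apply le_antisymm
    · rintro _ ⟨f, rfl⟩; change Finsupp.linearCombination (PS K r) e f ∈ _; rw [Finsupp.linearCombination_apply]
      exact sum_mem fun i _ => N.smul_mem _ (hUV _ (he i)).2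
    · intro n hn; obtain ⟨t, g, hg, rfl⟩ := hN.graded n hn; refine sum_mem fun D _ => ?_; obtain ⟨f, _, hf⟩ := hεsurj' D _ (hg D)
      exact ⟨f, hf⟩
  -- homogeneous components of kernel elements
  have hcmpF : ∀ f : AMD.FreeGr K r β, ∃ (t : Finset ℤ) (g : ℤ → AMD.FreeGr K r β),
      (∀ D, g D ∈ FG (K := K) (r := r) β m D) ∧ f = ∑ D ∈ t, g D := fun f => by
    induction f using Finsupp.induction_linear with
    | zero => exact ⟨∅, fun _ => 0, fun _ => zero_mem _, by simp⟩
    | add a b ha hb =>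
      obtain ⟨t, g, hg, rfl⟩ := ha; obtain ⟨t', g', hg', rfl⟩ := hb
      refine ⟨t ∪ t', fun D => (if D ∈ t then g D else 0) + (if D ∈ t' then g' D else 0), ?_, ?_⟩
      · intro D; refine add_mem ?_ ?_ <;> split_ifs
        · exact hg D
        · exact zero_mem _
        · exact hg' D
        · exact zero_mem _
      · rw [sum_add_distrib]; congr 1
        · rw [← Finset.sum_filter]; refine sum_congr ?_ fun _ _ => rfl; ext; simp +contextual
        · rw [← Finset.sum_filter]; refine sum_congr ?_ fun _ _ => rfl; ext; simp +contextual
    | single i p =>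
      refine ⟨(range (p.totalDegree + 1)).image (fun a : ℕ => (a : ℤ) + (m + i.1)), fun D => single i (hcmp (D - (m + i.1)) p), ?_, ?_⟩
      · intro D i'; rw [Finsupp.single_apply]
        split_ifs with h
        · rw [← h]; exact hcmp_mem _ _
        · exact zero_mem _
      · rw [Finset.sum_image (by intro a _ b _ h; simpa using h), ← Finsupp.single_finsetSum]; congr 1
        conv_lhs => rw [← hcmp_sum p _ (Nat.lt_succ_self _)]
        refine sum_congr rfl fun a _ => by rw [add_sub_cancel_right]
  have hker : ∀ f ∈ LinearMap.ker ε, ∃ (t : Finset ℤ) (g : ℤ → AMD.FreeGr K r β),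
      (∀ D, g D ∈ NG (FG (K := K) (r := r) β m) (LinearMap.ker ε) D) ∧ f = ∑ D ∈ t, g D := fun f hf => by
    obtain ⟨t, g, hg, rfl⟩ := hcmpF f; rw [LinearMap.mem_ker, map_sum] at hf
    have h0 := hG.indep t (fun D => ε (g D)) (fun D => (hεmem D _ (hg D)).1) hf
    refine ⟨t, fun D => if D ∈ t then g D else 0, fun D => ?_, ?_⟩
    · dsimp only
      split_ifs with h
      · exact ⟨hg D, h0 D h⟩
      · exact zero_mem _
    · exact sum_congr rfl fun D hD => by dsimp only; rw [if_pos hD]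
  have hminD : ∀ D, ∀ f ∈ NG (FG (K := K) (r := r) β m) (LinearMap.ker ε) D, ∀ i, coeff 0 (f i) = 0 := by
    rintro D f ⟨hf, hf0⟩ ⟨j, t⟩; by_cases hjD : D = m + j
    · subst hjD; have hf0' : ε f = 0 := hf0
      -- split the sum
      let u : M := ∑ t : Fin (β j), coeff 0 (f ⟨j, t⟩) • e ⟨j, t⟩; have hu : u ∈ U (m + j) := sum_mem fun t _ => smul_mem _ _ (he ⟨j, t⟩)
      have hsplit : ε (f - ∑ t : Fin (β j), single ⟨j, t⟩ (f ⟨j, t⟩)) ∈ W (m + j) := by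
        change Finsupp.linearCombination (PS K r) e _ ∈ _; rw [Finsupp.linearCombination_apply]; refine sum_mem ?_; rintro ⟨j', t'⟩ hi
        dsimp only; rw [Finsupp.mem_support_iff, Finsupp.sub_apply, Finsupp.finsetSum_apply] at hi
        rw [Finsupp.sub_apply, Finsupp.finsetSum_apply]; by_cases hjj : j' = j
        · subst hjj; exfalso; apply hi; rw [sum_eq_single t']
          · simp
          · intro b _ hb; rw [Finsupp.single_apply, if_neg]; intro h; apply hb; simpa using h
          · simp
        · have hz : ∑ t : Fin (β j), (single (⟨j, t⟩ : (j : ℕ) × Fin (β j)) (f ⟨j, t⟩)) ⟨j', t'⟩ = 0 := by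
            refine sum_eq_zero fun t _ => ?_; rw [Finsupp.single_apply, if_neg]; intro h; apply hjj; exact (congrArg Sigma.fst h).symm
          rw [hz, sub_zero] at hi ⊢; have hfi : f ⟨j', t'⟩ ∈ (HG (m + j - (m + j')) : Submodule K (PS K r)) := hf ⟨j', t'⟩
          have hpos : 1 ≤ m + j - (m + (j' : ℤ)) := by
            by_contra hcon; exact hi (HG_zero_of_neg (by omega) hfi)
          obtain ⟨g, hg, hfe⟩ := hx.gen _ hpos _ hfi; refine ⟨fun l => g l • e ⟨j', t'⟩, fun l => ?_, ?_⟩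
          · have := hVsmul _ _ (g l) _ (hg l) (hUV _ (he ⟨j', t'⟩))
            rw [show m + (j : ℤ) - (m + j') - 1 + (m + j') = m + j - 1 by ring] at this; exact this
          · rw [hfe, sum_smul]; exact sum_congr rfl fun l _ => by rw [smul_assoc]
      rw [map_sub, hf0', zero_sub, map_sum, neg_mem_iff] at hsplit; have h1 : ∑ t : Fin (β j), ε (single ⟨j, t⟩ (f ⟨j, t⟩)) = u := by
        refine sum_congr rfl fun t _ => ?_; change Finsupp.linearCombination (PS K r) e _ = _; rw [Finsupp.linearCombination_single]
        have h3 : f ⟨j, t⟩ ∈ (HG (m + j - (m + j)) : Submodule K (PS K r)) := hf ⟨j, t⟩; rw [sub_self] at h3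
        conv_lhs => rw [HG_zero_eq h3]
        rw [← MvPolynomial.algebraMap_eq, algebraMap_smul]
      rw [h1] at hsplit; have h4 : u = 0 := by
        have : u ∈ W (m + j) ⊓ U (m + j) := ⟨hsplit, hu⟩; rw [hWU] at this; exact this
      have hli := (Module.finBasis K (U (m + j))).linearIndependent
      have hli' : LinearIndependent K (fun t : Fin (β j) => e ⟨j, t⟩) := hli.map' (U (m + j)).subtype (Submodule.ker_subtype _)
      exact Fintype.linearIndependent_iff.1 hli' _ h4 t
    · by_contra hcon; have := hf ⟨j, t⟩ 0 hcon; rw [map_zero] at this; push_cast at this; omega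
  refine ⟨β, ε, hβ, hrange, ?_, ?_, ?_⟩
  · intro j t; rw [hεs]; exact hUV _ (he ⟨j, t⟩)
  · intro f hf i; obtain ⟨t, g, hg, rfl⟩ := hker f hf; rw [Finsupp.finsetSum_apply, coeff_sum]
    exact sum_eq_zero fun D _ => hminD D _ (hg D) i
  · refine ⟨hker, ?_, ?_⟩
    · intro D hD f hf
      ext1 i
      have hm := hminD D f hf i; have hfi := hf.1 i; have hi := hβ i.1 (by have := i.2.pos; omega); by_cases h0 : D - (m + (i.1 : ℤ)) < 0
      · exact HG_zero_of_neg h0 hfi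
      · have : D - (m + (i.1 : ℤ)) = 0 := by omega
        rw [this] at hfi; rw [HG_zero_eq hfi, hm, map_zero]; rfl
    · intro p D hD; refine HV_les (x := x) (x' := x) (G := gp (FG (K := K) (r := r) β m)) (G' := gp V)
        (G₀ := gp (NG (FG (K := K) (r := r) β m) (LinearMap.ker ε))) ε.toAddMonoidHom (compat_of_grMod hx (grMod_FG β m hβ)) (r + 1)
        (fun l _ f => map_smul ε (x l) f) (fun D f hf => hf.1) hεmem hεsurj'
        (fun D f hf h => ⟨hf, h⟩) (fun D f hf => hf.2) ?_ ?_
      · exact HV_FG hx β m hβ p D (by omega)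
      · exact hN.hv _ _ (by omega)

end Res

section Res2
variable {K : Type} [Field K] {r : ℕ}

structure StT (x : ℕ → PS K r) (i : ℕ) where
  β : ℕ → ℕ
  N : Submodule (PS K r) (AMD.FreeGr K r β)
  hβ : ∀ j, β j ≠ 0 → j = 1 ∨ j = 2
  hN : ResSt x (FG (K := K) (r := r) β i) N (i + 2)
  hmin : ∀ f ∈ N, ∀ i, coeff 0 (f i) = 0

lemma st_next {x : ℕ → PS K r} (hx : GoodXS K r x) (i : ℕ) (s : StT x i) :
    ∃ (s' : StT x (i + 1)) (ε : AMD.FreeGr K r s'.β →ₗ[PS K r] AMD.FreeGr K r s.β), LinearMap.range ε = s.N ∧ LinearMap.ker ε = s'.N ∧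
      (∀ (j : ℕ) t, ε (single ⟨j, t⟩ 1) ∈ NG (FG (K := K) (r := r) s.β i) s.N ((i + 1 : ℕ) + j)) := by
  have h := s.hN; have e1 : (i : ℤ) + 2 = ((i + 1 : ℕ) : ℤ) + 1 := by push_cast; ring
  rw [e1] at h; obtain ⟨β, ε, hβ, hr, hd, hm, hs⟩ := res_step hx (grMod_FG s.β i s.hβ) s.N _ h
  exact ⟨⟨β, LinearMap.ker ε, hβ, hs, hm⟩, ε, hr, rfl, hd⟩

theorem betti_of_HV {x : ℕ → PS K r} (hx : GoodXS K r x) (I : Ideal (PS K r)) (hI : AMD.IsHomIdeal K r I)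
    (hlow : ∀ D : ℤ, D < 2 → ∀ f ∈ NG HG I D, f = 0) (hhv : ∀ p D : ℤ, p + 4 ≤ D → HV x (gp (NG HG I)) (r + 1) p D) :
    ∃ b : ℕ → ℕ → ℕ, AMD.HasBettiDiagram K r I b ∧ ∀ i : ℕ, 1 ≤ i → ∀ j : ℕ, b i j ≠ 0 → j = 1 ∨ j = 2 := by
  classical
  have hG : GrMod (K := K) (r := r) (HG : ℤ → Submodule K (PS K r)) := by
    refine ⟨fun a D f m hf hm => HG_mul hf hm, ?_, fun D => inferInstance⟩; intro t g hg h D hD; have h2 := congrArg (hcmp D) h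
    rw [map_sum, map_zero, sum_eq_single D] at h2
    · rwa [hcmp_of_mem (hg D)] at h2
    · intro D' _ hne; exact hcmp_of_mem_ne (hg D') (by omega)
    · intro h; exact (h hD).elim
  have hst : ResSt x (HG : ℤ → Submodule K (PS K r)) I ((1 : ℤ) + 1) := by
    refine ⟨?_, hlow, fun p D h => hhv p D (by omega)⟩; intro f hf
    refine ⟨(range (f.totalDegree + 1)).image (fun a : ℕ => (a : ℤ)), fun D => hcmp D f, ?_, ?_⟩
    · intro D; refine ⟨hcmp_mem _ _, ?_⟩; show hcmp D f ∈ I; by_cases h : 0 ≤ D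
      · lift D to ℕ using h; rw [hcmp_nat]; exact hI f hf D
      · have : hcmp D f = 0 := HG_zero_of_neg (by omega) (hcmp_mem D f); rw [this]; exact zero_mem _
    · rw [Finset.sum_image (by intro a _ b _ h; simpa using h)]; exact (hcmp_sum f _ (Nat.lt_succ_self _)).symm
  obtain ⟨β, ε, hβ, hr, hd, hm, hs⟩ := res_step hx hG I 1 hst
  have hs' : ResSt x (FG (K := K) (r := r) β ((1 : ℕ) : ℤ)) (LinearMap.ker ε) (((1 : ℕ) : ℤ) + 2) := hs
  let s0 : StT x (0 + 1) := ⟨β, LinearMap.ker ε, hβ, hs', hm⟩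
  let nx : (i : ℕ) → StT x i → StT x (i + 1) := fun i s => (st_next hx i s).choose
  let st : (i : ℕ) → StT x (i + 1) := fun i => Nat.rec s0 (fun i s => nx (i + 1) s) i
  let b : ℕ → ℕ → ℕ := fun i => Nat.casesOn i (fun _ => 0) (fun i => (st i).β)
  have hspec : ∀ i, ∃ ε : AMD.FreeGr K r (st (i + 1)).β →ₗ[PS K r] AMD.FreeGr K r (st i).β,
      LinearMap.range ε = (st i).N ∧ LinearMap.ker ε = (st (i + 1)).N ∧ (∀ (j : ℕ) t, ε (single ⟨j, t⟩ 1) ∈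
        NG (FG (K := K) (r := r) (st i).β (i + 1 : ℕ)) (st i).N ((i + 1 + 1 : ℕ) + j)) := fun i => (st_next hx (i + 1) (st i)).choose_spec
  choose φ hφr hφk hφd using hspec; refine ⟨b, ⟨φ, ε, ?_, ?_, hr, ?_, ?_⟩, ?_⟩
  · intro j t; have := (hd j t).1; rw [← mem_HG_nat]; push_cast; exact this
  · intro i j t j' t'; have h1 := hφd i j t; have h2 := h1.1 ⟨j', t'⟩; have h3 := (st i).hmin _ h1.2 ⟨j', t'⟩
    by_cases h0 : (φ i (single ⟨j, t⟩ 1)) ⟨j', t'⟩ = 0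
    · exact Or.inl h0
    · right; dsimp only at h2; have hpos : 0 < ((i + 1 + 1 : ℕ) : ℤ) + j - ((i + 1 : ℕ) + j') := by
        by_contra hcon
        rcases lt_or_eq_of_le (not_lt.1 hcon) with h | h
        · exact h0 (HG_zero_of_neg h h2)
        · rw [h] at h2; apply h0; rw [HG_zero_eq h2, h3, map_zero]
      obtain ⟨k, hk⟩ := Int.eq_ofNat_of_zero_le hpos.le; rw [hk] at h2; refine ⟨k, by omega, by omega, mem_HG_nat.1 h2⟩
  · exact (hφr 0).symm
  · intro i; rw [hφk i, hφr (i + 1)]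
  · intro i hi j hj; obtain ⟨k, rfl⟩ : ∃ k, i = k + 1 := ⟨i - 1, by omega⟩; exact (st k).hβ j hj

end Res2

/-! ### general tools: Krull dimension, dimension of homogeneous pieces, linear changes -/

lemma krull_integral {R A : Type} [CommRing R] [CommRing A] (f : R →+* A)
    (hf : Injective f) (hi : f.IsIntegral) : ringKrullDim R = ringKrullDim A := by
  let _ : Algebra R A := f.toAlgebra; have : Algebra.IsIntegral R A := ⟨hi⟩; have hinj : Injective (algebraMap R A) := hf; apply le_antisymm
  · unfold ringKrullDim Order.krullDim; apply iSup_le; intro p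
    obtain ⟨P, -, hP, hPc⟩ := Ideal.exists_ideal_over_prime_of_isIntegral (S := A)
      (RelSeries.head p).asIdeal (⊥ : Ideal A) (by
        intro x hx; have : algebraMap R A x = 0 := hx; rw [hinj (this.trans (map_zero _).symm)]; exact zero_mem _)
    have := hP; have : P.LiesOver (RelSeries.head p).asIdeal := ⟨hPc.symm⟩; obtain ⟨L, hL, -⟩ := Ideal.exists_ltSeries_of_hasGoingUp p P
    exact le_iSup_of_le L (by rw [hL])
  · apply Order.krullDim_le_of_strictMono (PrimeSpectrum.comap (algebraMap R A)); intro a b hab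
    exact Ideal.IsIntegral.comap_lt_comap (R := R) (I := a.asIdeal) (J := b.asIdeal) hab

section
variable {K : Type} [Field K]

lemma finrank_HG {σ : Type} [Fintype σ] [DecidableEq σ] (n : ℕ) : finrank K (HG n : Submodule K (MvPolynomial σ K)) =
      (Fintype.card σ).multichoose n := by
  have h : (HG n : Submodule K (MvPolynomial σ K)) = restrictSupport K ((Finset.univ : Finset σ).finsuppAntidiag n : Set (σ →₀ ℕ)) := by
    ext p; rw [mem_HG, mem_restrictSupport_iff]; constructor
    · intro h s hs; have := h s (by simpa using hs); simp [Finset.mem_finsuppAntidiag]; rw [Finsupp.degree_eq_sum] at this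
      exact_mod_cast this
    · intro h s hs; have := h (by simpa using hs : s ∈ (p.support : Set _)); simp [Finset.mem_finsuppAntidiag] at this
      rw [Finsupp.degree_eq_sum]; exact_mod_cast this
  rw [h, Module.finrank_eq_card_basis (basisRestrictSupport K _)]
  have h3 := Finset.card_finsuppAntidiag_nat_eq_multichoose (s := (Finset.univ : Finset σ)) n; rw [card_univ] at h3; rw [← h3]
  exact Fintype.card_coe _

/-- dimension of the degree `n` piece of a polynomial ring in `m` variables -/
lemma series_HG (m : ℕ) : (PowerSeries.mk fun n => ((m.multichoose n : ℕ) : ℤ)) * (1 - PowerSeries.X) ^ m = 1 := by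
  rcases m with _ | m
  · simp only [pow_zero, mul_one]; ext n
    rcases n with _ | n <;> simp [PowerSeries.coeff_one]
  · have := (PowerSeries.invOneSubPow ℤ (m + 1)).val_inv
    rw [PowerSeries.invOneSubPow_inv_eq_one_sub_pow, PowerSeries.invOneSubPow_val_succ_eq_mk_add_choose] at this; refine Eq.trans ?_ this
    congr 1; ext n; simp only [PowerSeries.coeff_mk]; rw [Nat.multichoose_eq]; have : m + 1 + n - 1 = n + m := by omega
    rw [this, Nat.choose_symm_add, add_comm]

/-- a family of linear forms spanning the linear forms -/
structure LinBasis (K : Type) [Field K] (r : ℕ) (τ : Type) (b : τ → PS K r) : Prop where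
  deg : ∀ i, (b i).IsHomogeneous 1
  span : ∀ p : PS K r, p.IsHomogeneous 1 → p ∈ span K (Set.range b)

lemma deg_one {σ : Type} {s : σ →₀ ℕ} (h : Finsupp.degree s = 1) : ∃ i, single i 1 = s := by
  classical
  have hne : s ≠ 0 := by rintro rfl; simp at h
  obtain ⟨i, hi⟩ := Finsupp.ne_iff.1 hne; have h1 : single i 1 ≤ s := by
    rw [Finsupp.single_le_iff]; exact Nat.one_le_iff_ne_zero.2 hi
  obtain ⟨t, ht⟩ := exists_add_of_le h1; have h2 : Finsupp.degree t = 0 := by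
    rw [ht, map_add, Finsupp.degree_single] at h; omega
  rw [Finsupp.degree_eq_zero_iff] at h2; exact ⟨i, by rw [ht, h2, add_zero]⟩

lemma hom1_eq {σ : Type} [Fintype σ] [DecidableEq σ] (p : MvPolynomial σ K) (hp : p.IsHomogeneous 1) :
    p = ∑ i, coeff (single i 1) p • X i := by
  ext s; rw [coeff_sum]; by_cases hs : coeff s p = 0
  · rw [hs]; symm; apply sum_eq_zero; intro i _; rw [coeff_smul, coeff_X, smul_eq_mul]
    split_ifs with h
    · rw [h, hs, zero_mul]
    · rw [mul_zero]
  · have hd : ((Finsupp.degree s : ℕ) : ℤ) = 1 := (mem_HG_nat (n := 1)).2 hp s hs; have hd' : Finsupp.degree s = 1 := by exact_mod_cast hd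
    obtain ⟨i, hi⟩ : ∃ i, single i 1 = s := deg_one hd'; rw [sum_eq_single i]
    · rw [coeff_smul, coeff_X, if_pos hi, smul_eq_mul, mul_one, hi]
    · intro j _ hj; rw [coeff_smul, coeff_X, if_neg, smul_zero]; intro h; apply hj; rw [← hi] at h
      exact (Finsupp.single_left_inj one_ne_zero).1 h
    · intro h; exact (h (mem_univ _)).elim

lemma LinBasis.equiv {r : ℕ} {τ : Type} [Fintype τ] [DecidableEq τ] {b : τ → PS K r} (hb : LinBasis K r τ b) (hc : Fintype.card τ = r + 1) :
    ∃ e : MvPolynomial τ K ≃ₐ[K] PS K r, (∀ i, e (X i) = b i) ∧ ∀ i, (e.symm (X i)).IsHomogeneous 1 := by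
  have hsp : ∀ i : Fin (r + 1), ∃ m : τ → K, ∑ j, m j • b j = X i := fun i => by
    have := hb.span (X i) (isHomogeneous_X K i); exact (Submodule.mem_span_range_iff_exists_fun K).1 this
  choose M hM using hsp; let N : Matrix τ (Fin (r + 1)) K := fun j i => coeff (single i 1) (b j)
  have hN : ∀ j, b j = ∑ i, N j i • X i := fun j => hom1_eq (b j) (hb.deg j); have hMN : (Matrix.of M) * N = 1 := by
    ext i k; have h := hM i; have h2 := congrArg (coeff (single k 1)) h; rw [coeff_sum] at h2
    simp only [coeff_smul, smul_eq_mul, coeff_X] at h2; rw [Matrix.mul_apply, Matrix.one_apply]; simp only [Matrix.of_apply]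
    refine h2.trans ?_; simp [Finsupp.single_left_inj (one_ne_zero : (1 : ℕ) ≠ 0)]
  have hNM : N * (Matrix.of M) = 1 := (Matrix.mul_eq_one_comm_of_card_eq _ _ _ (by rw [hc]; simp)).1 hMN
  let f : MvPolynomial τ K →ₐ[K] PS K r := aeval b; let g : PS K r →ₐ[K] MvPolynomial τ K := aeval fun i => ∑ j, M i j • X j
  have hfg : f.comp g = AlgHom.id K _ := by
    apply algHom_ext; intro i; simp only [AlgHom.comp_apply, g, f, aeval_X, map_sum, map_smul, AlgHom.id_apply]; exact hM i
  have hgf : g.comp f = AlgHom.id K _ := by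
    apply algHom_ext; intro j; simp only [AlgHom.comp_apply, f, aeval_X, AlgHom.id_apply]; rw [hN j, map_sum]
    simp only [map_smul, g, aeval_X, smul_sum, smul_smul]; rw [sum_comm]; simp only [← sum_smul]
    have h : ∀ k, ∑ i, N j i * M i k = (1 : Matrix τ τ K) j k := fun k => by rw [← hNM, Matrix.mul_apply]; rfl
    simp only [h, Matrix.one_apply]; simp
  refine ⟨AlgEquiv.ofAlgHom f g hfg hgf, fun i => aeval_X _ _, ?_⟩; intro i
  have : (AlgEquiv.ofAlgHom f g hfg hgf).symm (X i) = ∑ j, M i j • X j := aeval_X _ _; rw [this]; apply IsHomogeneous.sum; intro j _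
  rw [smul_eq_C_mul]; simpa using (isHomogeneous_C τ (M i j)).mul (isHomogeneous_X K j)
end

/-! ### construction of the variety of minimal degree -/
section JC
variable {K : Type} [Field K]

lemma HG_aeval {σ τ : Type} {f : σ → MvPolynomial τ K} (hf : ∀ i, f i ∈ HG 1) {m : ℤ}
    {p : MvPolynomial σ K} (hp : p ∈ HG m) : aeval f p ∈ HG m := by
  by_cases h : 0 ≤ m
  · lift m to ℕ using h; rw [mem_HG_nat] at hp ⊢; have := IsHomogeneous.aeval hp f (n := 1) (fun i => (mem_HG_nat (n := 1)).1 (hf i))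
    simpa using this
  · rw [HG_zero_of_neg (by omega) hp, map_zero]; exact zero_mem _

lemma HG_algHom {σ τ : Type} (f : MvPolynomial σ K →ₐ[K] MvPolynomial τ K) (hf : ∀ i, f (X i) ∈ HG 1) {m : ℤ}
    {p : MvPolynomial σ K} (hp : p ∈ HG m) : f p ∈ HG m := by
  rw [aeval_unique f]; exact HG_aeval hf hp

/-- if multiplication by variables preserves `N`, then `N` contains all forms -/
lemma HG_le_of_mul {σ : Type} (N : ℕ → Submodule K (MvPolynomial σ K)) (h1 : 1 ∈ N 0)
    (hX : ∀ i m p, p ∈ N m → X i * p ∈ N (m + 1)) (m : ℕ) : (HG m : Submodule K (MvPolynomial σ K)) ≤ N m := by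
  classical
  have hmon : ∀ (m : ℕ) (s : σ →₀ ℕ), Finsupp.degree s = m → monomial s (1 : K) ∈ N m := fun m => by
    induction m with
    | zero =>
      intro s hs; rw [Finsupp.degree_eq_zero_iff] at hs; rw [hs]; exact h1
    | succ m ih =>
      intro s hs; have hne : s ≠ 0 := by rintro rfl; simp at hs
      obtain ⟨i, hi⟩ := Finsupp.ne_iff.1 hne; have h1 : single i 1 ≤ s := by
        rw [Finsupp.single_le_iff]; exact Nat.one_le_iff_ne_zero.2 hi
      obtain ⟨t, ht⟩ := exists_add_of_le h1; have h2 : Finsupp.degree t = m := by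
        rw [ht, map_add, Finsupp.degree_single] at hs; omega
      have : monomial s (1 : K) = X i * monomial t 1 := by rw [X, monomial_mul, one_mul, ht]
      rw [this]; exact hX i m _ (ih t h2)
  intro p hp; rw [p.as_sum]; refine sum_mem fun s hs => ?_; have hd := hp s (by simpa using hs)
  have : monomial s (coeff s p) = coeff s p • monomial s 1 := by rw [smul_monomial, smul_eq_mul, mul_one]
  rw [this]; exact (N m).smul_mem _ (hmon m s (by exact_mod_cast hd))

variable (d c : ℕ) (ν : ℕ → MvPolynomial (Option (Fin d)) K)

/-- `K[l, Y_0]` -/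
abbrev JE (K : Type) [Field K] (d : ℕ) : Type := MvPolynomial (Option (Fin d)) K
/-- `K[l, Y_0, Y_c]` -/
abbrev JR (K : Type) [Field K] (d : ℕ) : Type := MvPolynomial (Option (Option (Fin d))) K
/-- `K[l, Y_0, …, Y_c]` -/
abbrev JT (K : Type) [Field K] (d c : ℕ) : Type := MvPolynomial (Fin d ⊕ Fin (c + 1)) K

/-- the images of the `Y_k` -/
def jp : ℕ → Polynomial (JE K d)
  | 0 => PC (X none)
  | k + 1 => PX * jp k - PC (ν k)

/-- the variable `Y_k` -/
def jY (k : ℕ) : JT K d c := X (Sum.inr (Fin.ofNat (c + 1) k))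

lemma jY_val (j : Fin (c + 1)) : jY (K := K) d c j.val = X (Sum.inr j) := by
  unfold jY; congr 2; ext; simp [Fin.ofNat, Nat.mod_eq_of_lt j.2]

/-- the parametrization -/
def jPsi : JT K d c →ₐ[K] Polynomial (JE K d) := aeval fun i => Sum.elim (fun a => PC (X (some a))) (fun k : Fin (c + 1) => jp d ν k.val) i

lemma jPsi_Y {k : ℕ} (hk : k ≤ c) : jPsi d c ν (jY d c k) = jp d ν k := by
  unfold jPsi jY; rw [aeval_X]; simp [Fin.ofNat, Nat.mod_eq_of_lt (Nat.lt_succ_of_le hk)]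

/-- `K[l, Y_0] → K[l, Y]` -/
def jι : JE K d →ₐ[K] JT K d c := aeval fun i => Option.elim i (jY d c 0) (fun a => X (Sum.inl a))

/-- `K[l, Y_0, Y_c] → K[l, Y]` -/
def jι' : JR K d →ₐ[K] JT K d c := aeval fun i => Option.elim i (jY d c c) (fun a => jι d c (X a))

lemma jPsi_ι (p : JE K d) : jPsi d c ν (jι d c p) = PC p := by
  have : (jPsi d c ν).comp (jι d c) = (Polynomial.CAlgHom : JE K d →ₐ[K] Polynomial (JE K d)) := by
    apply algHom_ext; intro i
    rcases i with _ | a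
    · simp only [AlgHom.comp_apply, jι, aeval_X, Option.elim]; rw [jPsi_Y _ _ _ (Nat.zero_le _)]; rfl
    · simp only [AlgHom.comp_apply, jι, aeval_X, Option.elim, jPsi]; rfl
  exact DFunLike.congr_fun this p

lemma jPsi_ι' (p : JR K d) : jPsi d c ν (jι' d c p) = (optionEquivLeft K (Option (Fin d)) p).comp (jp d ν c) := by
  have : (jPsi d c ν).comp (jι' d c) = ((Polynomial.compRingHom (jp d ν c)).comp
        (optionEquivLeft K (Option (Fin d))).toAlgHom.toRingHom : JR K d →+* _) := by
    apply ringHom_ext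
    · intro a; simp only [RingHom.comp_apply, jι', Polynomial.coe_compRingHom]
      have : (optionEquivLeft K (Option (Fin d))).toAlgHom.toRingHom (C a) = PC (C a) := by simp [optionEquivLeft_apply]
      rw [this, Polynomial.C_comp]; simp
    · intro i; simp only [RingHom.comp_apply, Polynomial.coe_compRingHom]
      rcases i with _ | a
      · have : (optionEquivLeft K (Option (Fin d))).toAlgHom.toRingHom (X none) = PX := by simp
        rw [this, Polynomial.X_comp]; simp only [RingHom.coe_coe, AlgHom.comp_apply, jι', aeval_X, Option.elim]; exact jPsi_Y _ _ _ le_rfl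
      · have : (optionEquivLeft K (Option (Fin d))).toAlgHom.toRingHom (X (some a)) = PC (X a) := by simp
        rw [this, Polynomial.C_comp]; simp only [RingHom.coe_coe, AlgHom.comp_apply, jι', aeval_X, Option.elim]; exact jPsi_ι _ _ _ _
  exact DFunLike.congr_fun this p

lemma jp_degree (k : ℕ) : (jp d ν k).natDegree = k ∧ (jp d ν k).leadingCoeff = X none := by
  induction k with
  | zero => simp [jp]
  | succ k ih =>
    have hne : jp d ν k ≠ 0 := by
      intro h; rw [h] at ih; have := ih.2; simp at this; exact X_ne_zero _ this.symm
    have h1 : (PX * jp d ν k).natDegree = k + 1 := by rw [Polynomial.natDegree_X_mul hne, ih.1]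
    have hd : (PC (ν k)).degree < (PX * jp d ν k).degree := by
      apply lt_of_le_of_lt Polynomial.degree_C_le; rw [Polynomial.degree_eq_natDegree (mul_ne_zero Polynomial.X_ne_zero hne), h1]
      exact_mod_cast Nat.succ_pos k
    constructor
    · unfold jp; rw [Polynomial.natDegree_sub_eq_left_of_natDegree_lt, h1]; rw [Polynomial.natDegree_C, h1]; omega
    · unfold jp; rw [Polynomial.leadingCoeff_sub_of_degree_lt hd, Polynomial.leadingCoeff_mul, Polynomial.leadingCoeff_X, one_mul, ih.2]

/-- module generators -/
def jy (i : ℕ) : JT K d c := if i = 0 then 1 else jY d c i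

/-- weights of the generators -/
def jw (i : ℕ) : ℤ := if i = 0 then 0 else 1

lemma j_indep (e : Fin c → JR K d) (h : jPsi d c ν (∑ i, jι' d c (e i) * jy d c i.val) = 0) : e = 0 := by
  classical
  by_contra hne; let q : Fin c → Polynomial (JE K d) := fun i => optionEquivLeft K (Option (Fin d)) (e i)
  let p : Fin c → Polynomial (JE K d) := fun i => (q i).comp (jp d ν c) * (if i.val = 0 then 1 else jp d ν i.val)
  have hsum : ∑ i, p i = 0 := by
    rw [← h, map_sum]; refine sum_congr rfl fun i _ => ?_; rw [map_mul, jPsi_ι']; simp only [p, q, jy]; split_ifs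
    · simp
    · rw [jPsi_Y _ _ _ i.2.le]
  have hjne : ∀ k, jp d ν k ≠ 0 := fun k h => by
    have := (jp_degree d ν k).2; rw [h] at this; simp at this; exact X_ne_zero _ this.symm
  have hpne : ∀ i, e i ≠ 0 → p i ≠ 0 ∧ (p i).natDegree = (q i).natDegree * c + i.val := fun i hi => by
    have hc : 0 < c := lt_of_le_of_lt (Nat.zero_le _) i.2; have hq : q i ≠ 0 := by simp only [q]; simpa using hi
    have hq1 : (q i).comp (jp d ν c) ≠ 0 := by
      intro h0; rw [Polynomial.comp_eq_zero_iff] at h0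
      rcases h0 with h0 | h0
      · exact hq h0
      · have := congrArg Polynomial.natDegree h0.2; rw [(jp_degree d ν c).1, Polynomial.natDegree_C] at this; omega
    have hq2 : ((if i.val = 0 then 1 else jp d ν i.val) : Polynomial (JE K d)) ≠ 0 := by
      split_ifs
      · exact one_ne_zero
      · exact hjne _
    refine ⟨mul_ne_zero hq1 hq2, ?_⟩; rw [Polynomial.natDegree_mul hq1 hq2, Polynomial.natDegree_comp, (jp_degree d ν c).1]; congr 1
    split_ifs with h0
    · rw [Polynomial.natDegree_one, h0]
    · exact (jp_degree d ν _).1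
  obtain ⟨i0, hi0⟩ := Function.ne_iff.1 hne; have hs := Polynomial.degree_sum_eq_of_disjoint p Finset.univ (by
    intro i hi j hj hij heq; have hi' : e i ≠ 0 := by intro h0; apply hi.2; simp [p, q, h0]
    have hj' : e j ≠ 0 := by intro h0; apply hj.2; simp [p, q, h0]
    have h1 : (p i).natDegree = (p j).natDegree := Polynomial.natDegree_eq_of_degree_eq heq; rw [(hpne i hi').2, (hpne j hj').2] at h1
    have h2 := congrArg (· % c) h1; simp only [Nat.mul_add_mod', Nat.mod_eq_of_lt i.2, Nat.mod_eq_of_lt j.2] at h2; exact hij (Fin.ext h2))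
  rw [hsum, Polynomial.degree_zero] at hs; have h3 := Finset.le_sup (f := fun i => (p i).degree) (mem_univ i0); rw [← hs, le_bot_iff] at h3
  exact (hpne i0 hi0).1 (Polynomial.degree_eq_bot.1 h3)

/-- the minors -/
def jminor (k m : ℕ) : JT K d c := jY d c k * (jY d c (m + 1) + jι d c (ν m)) - jY d c m * (jY d c (k + 1) + jι d c (ν k))

/-- ideal of minors -/
def jM : Ideal (JT K d c) := Ideal.span {f | ∃ k m, k < c ∧ m < c ∧ f = jminor d c ν k m}

lemma jM_le : jM d c ν ≤ RingHom.ker (jPsi d c ν) := by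
  rw [jM, Ideal.span_le]; rintro f ⟨k, m, hk, hm, rfl⟩; show jPsi d c ν _ = 0; unfold jminor
  rw [map_sub, map_mul, map_mul, map_add, map_add, jPsi_ι, jPsi_ι, jPsi_Y _ _ _ hk.le,
    jPsi_Y _ _ _ hm.le, jPsi_Y _ _ _ (Nat.succ_le_of_lt hk), jPsi_Y _ _ _ (Nat.succ_le_of_lt hm)]
  simp only [jp]; ring

/-- normal forms of degree `m` -/
def jNF (m : ℤ) : Submodule K (JT K d c) := span K {f | ∃ i, i < c ∧ ∃ e ∈ HG (m - jw i), f = jι' d c e * jy d c i} ⊔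
    (jM d c ν).restrictScalars K

lemma jNF_mul {a b : ℤ} {e : JR K d} (he : e ∈ HG a) {f : JT K d c} (hf : f ∈ jNF d c ν b) : jι' d c e * f ∈ jNF d c ν (a + b) := by
  obtain ⟨f1, h1, f2, h2, rfl⟩ := Submodule.mem_sup.1 hf; rw [mul_add]
  refine add_mem ?_ (Submodule.mem_sup_right ((jM d c ν).mul_mem_left _ h2)); refine Submodule.mem_sup_left ?_; clear hf
  induction h1 using Submodule.span_induction with
  | mem x hx =>
    obtain ⟨i, hi, e', he', rfl⟩ := hx; apply subset_span; refine ⟨i, hi, e * e', ?_, by rw [map_mul, mul_assoc]⟩; rw [add_sub_assoc]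
    exact HG_mul he he'
  | zero => simp
  | add x y _ _ hx hy =>
    rw [mul_add]; exact add_mem hx hy
  | smul a x _ hx =>
    rw [mul_smul_comm]; exact smul_mem _ _ hx

lemma jNF_mul2 {e : JR K d} (he : e ∈ HG 1) {f : JT K d c} (hf : f ∈ jNF d c ν 1) : jι' d c e * f ∈ jNF d c ν 2 := by
  have := jNF_mul d c ν he hf; norm_num at this; exact this

lemma jι'_some (p : JE K d) : jι' d c (rename some p) = jι d c p := by
  unfold jι'; rw [aeval_rename]
  have : (aeval ((fun i : Option (Option (Fin d)) => Option.elim i (jY d c c) fun a => jι d c (X a)) ∘ some) :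
      JE K d →ₐ[K] JT K d c) = jι d c := by
    apply algHom_ext; intro i; simp
  rw [this]

variable (hν : ∀ k, ν k ∈ HG 1) (hc : 0 < c)

include hc in
lemma jNF_ι {m : ℤ} {e : JR K d} (he : e ∈ HG m) : jι' d c e ∈ jNF d c ν m := by
  refine Submodule.mem_sup_left (subset_span ⟨0, hc, e, ?_, ?_⟩)
  · simpa [jw] using he
  · simp [jy]

include hc in
lemma jNF_Y {k : ℕ} (hk : k ≤ c) : jY d c k ∈ jNF d c ν 1 := by
  rcases Nat.eq_zero_or_pos k with rfl | hk0
  · have : jY d c 0 = jι' d c (X (some none) : JR K d) := by simp [jι', jι]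
    rw [this]; exact jNF_ι _ _ _ hc (HG_X _)
  rcases hk.eq_or_lt with rfl | hk
  · have : jY d k k = jι' d k (X none : JR K d) := by simp [jι']
    rw [this]; exact jNF_ι _ _ _ hc (HG_X _)
  · refine Submodule.mem_sup_left (subset_span ⟨k, hk, 1, ?_, ?_⟩)
    · simpa [jw, hk0.ne'] using (HG_one : (1 : JR K d) ∈ HG 0)
    · simp [jy, hk0.ne']

include hc hν in
lemma jNF_YY (i : ℕ) : ∀ j, i ≤ c → j ≤ c → jY d c i * jY d c j ∈ jNF d c ν 2 := by
  induction i with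
  | zero =>
    intro j _ hj; have : jY d c 0 = jι' d c (X (some none) : JR K d) := by simp [jι', jι]
    rw [this]; exact jNF_mul2 _ _ _ (HG_X _) (jNF_Y _ _ _ hc hj)
  | succ i ih =>
    intro j hi hj
    rcases hj.eq_or_lt with rfl | hj'
    · have : jY d j j = jι' d j (X none : JR K d) := by simp [jι']
      rw [mul_comm, this]; exact jNF_mul2 _ _ _ (HG_X _) (jNF_Y _ _ _ hc hi)
    · have h1 := ih (j + 1) (by omega) hj'; have hνm : ∀ (k l : ℕ), l ≤ c → jι d c (ν k) * jY d c l ∈ jNF d c ν 2 := fun k l hl => by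
        rw [← jι'_some]; refine jNF_mul2 _ _ _ ?_ (jNF_Y _ _ _ hc hl); rw [← aeval_X_left_apply (rename some (ν k)), aeval_rename]
        exact HG_aeval (fun _ => HG_X _) (hν k)
      have hM : jminor d c ν i j ∈ jNF d c ν 2 := Submodule.mem_sup_right (Ideal.subset_span ⟨i, j, by omega, hj', rfl⟩)
      have : jY d c (i + 1) * jY d c j = jY d c i * jY d c (j + 1) + jι d c (ν j) * jY d c i
          - jι d c (ν i) * jY d c j - jminor d c ν i j := by unfold jminor; ring
      rw [this]; exact sub_mem (sub_mem (add_mem h1 (hνm _ _ (by omega))) (hνm _ _ hj)) hM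

include hc hν in
lemma jNF_X (i : Fin d ⊕ Fin (c + 1)) (m : ℕ) (p : JT K d c) (hp : p ∈ jNF d c ν m) : X i * p ∈ jNF d c ν ((m + 1 : ℕ) : ℤ) := by
  have hm : ((m + 1 : ℕ) : ℤ) = 1 + m := by push_cast; ring
  rw [hm]
  rcases i with a | k
  · have : (X (Sum.inl a) : JT K d c) = jι' d c (X (some (some a))) := by simp [jι', jι]
    rw [this]; exact jNF_mul _ _ _ (HG_X _) hp
  · rw [← jY_val]; obtain ⟨f1, h1, f2, h2, rfl⟩ := Submodule.mem_sup.1 hp; rw [mul_add]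
    refine add_mem ?_ (Submodule.mem_sup_right ((jM d c ν).mul_mem_left _ h2)); clear hp
    induction h1 using Submodule.span_induction with
    | mem x hx =>
      obtain ⟨i, hi, e', he', rfl⟩ := hx; rw [mul_left_comm]; by_cases h0 : i = 0
      · have := jNF_mul d c ν he' (jNF_Y d c ν hc (Nat.lt_succ_iff.1 k.2)); subst h0; simpa [jw, jy, add_comm] using this
      · have := jNF_mul d c ν he' (jNF_YY d c ν hν hc k.val i (Nat.lt_succ_iff.1 k.2) hi.le); rw [jy, if_neg h0]; rw [jw, if_neg h0] at this
        have h5 : (1 + m : ℤ) = m - 1 + 2 := by ring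
        rw [h5]; exact this
    | zero => simp
    | add x y _ _ hx hy => rw [mul_add]; exact add_mem hx hy
    | smul a x _ hx => rw [mul_smul_comm]; exact smul_mem _ _ hx

include hc hν in
lemma jNF_all {m : ℤ} {f : JT K d c} (hf : f ∈ HG m) : f ∈ jNF d c ν m := by
  by_cases h : 0 ≤ m
  · lift m to ℕ using h; refine HG_le_of_mul (fun m => jNF d c ν m) ?_ (jNF_X d c ν hν hc) m hf
    have := jNF_ι d c ν hc (m := 0) (e := (1 : JR K d)) HG_one; simpa using this
  · rw [HG_zero_of_neg (by omega) hf]; exact zero_mem _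

include hc hν in
lemma jNF_ex {m : ℤ} {f : JT K d c} (hf : f ∈ HG m) : ∃ e : Fin c → JR K d, (∀ i, e i ∈ HG (m - jw i.val)) ∧
      f - ∑ i, jι' d c (e i) * jy d c i.val ∈ jM d c ν := by
  classical
  obtain ⟨f1, h1, f2, h2, rfl⟩ := Submodule.mem_sup.1 (jNF_all d c ν hν hc hf); clear hf
  suffices h : ∃ e : Fin c → JR K d, (∀ i, e i ∈ HG (m - jw i.val)) ∧ f1 = ∑ i, jι' d c (e i) * jy d c i.val by
    obtain ⟨e, he, rfl⟩ := h; exact ⟨e, he, by simpa using h2⟩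
  induction h1 using Submodule.span_induction with
  | mem x hx =>
    obtain ⟨i, hi, e', he', rfl⟩ := hx; refine ⟨Pi.single ⟨i, hi⟩ e', ?_, ?_⟩
    · intro j; by_cases hj : j = ⟨i, hi⟩
      · subst hj; simpa using he'
      · rw [Pi.single_eq_of_ne hj]; exact zero_mem _
    · rw [sum_eq_single ⟨i, hi⟩]
      · simp
      · intro j _ hj; rw [Pi.single_eq_of_ne hj]; simp
      · simp
  | zero => exact ⟨0, fun _ => zero_mem _, by simp⟩
  | add x y _ _ hx hy =>
    obtain ⟨e, he, rfl⟩ := hx; obtain ⟨e', he', rfl⟩ := hy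
    exact ⟨e + e', fun i => add_mem (he i) (he' i), by simp [add_mul, sum_add_distrib]⟩
  | smul a x _ hx =>
    obtain ⟨e, he, rfl⟩ := hx; exact ⟨a • e, fun i => smul_mem _ _ (he i), by simp [smul_sum]⟩

include hc hν in
lemma jker_cmp {f : JT K d c} (hf : jPsi d c ν f = 0) (n : ℤ) : hcmp n f ∈ jM d c ν := by
  by_cases hn : 0 ≤ n; swap
  · rw [HG_zero_of_neg (by omega) (hcmp_mem n f)]; exact zero_mem _
  lift n to ℕ using hn; let N := f.totalDegree + n + 1; have hex : ∀ m : ℕ, ∃ e : Fin c → JR K d, (∀ i, e i ∈ HG ((m : ℤ) - jw i.val)) ∧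
      hcmp m f - ∑ i, jι' d c (e i) * jy d c i.val ∈ jM d c ν := fun m => jNF_ex d c ν hν hc (hcmp_mem _ _)
  choose e he hm using hex; have hz : (fun i => ∑ m ∈ range N, e m i) = 0 := by
    apply j_indep d c ν
    have h1 : ∑ i, jι' d c (∑ m ∈ range N, e m i) * jy d c i.val = ∑ m ∈ range N, ∑ i, jι' d c (e m i) * jy d c i.val := by
      simp only [map_sum, sum_mul]; rw [sum_comm]
    rw [h1, map_sum]; have h2 : ∀ m, jPsi d c ν (∑ i, jι' d c (e m i) * jy d c i.val) = jPsi d c ν (hcmp m f) := fun m => by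
      have := jM_le d c ν (hm m); rw [RingHom.mem_ker] at this
      have h3 : jPsi d c ν (hcmp m f - ∑ i, jι' d c (e m i) * jy d c i.val) = 0 := this; rw [map_sub, sub_eq_zero] at h3; exact h3.symm
    simp only [h2]; rw [← map_sum, hcmp_sum f N (by omega), hf]
  have hzero : e n = 0 := by
    funext i; have h1 := congrArg (hcmp ((n : ℤ) - jw i.val)) (congrFun hz i); simp only [map_sum, Pi.zero_apply, map_zero] at h1
    rw [sum_eq_single n] at h1
    · rw [hcmp_of_mem (he n i)] at h1; exact h1
    · intro m _ hmn; exact hcmp_of_mem_ne (he m i) (by omega)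
    · intro h; exact (h (mem_range.2 (by omega))).elim
  have := hm n; rw [hzero] at this; simpa using this

include hc hν in
lemma jker_eq : RingHom.ker (jPsi d c ν) = jM d c ν := by
  apply le_antisymm _ (jM_le d c ν); intro f hf; rw [← hcmp_sum f _ (Nat.lt_succ_self _)]
  exact sum_mem fun m _ => jker_cmp d c ν hν hc hf m

end JC

theorem isIntegral_of_gen {R A : Type*} [CommRing R] [CommRing A] (g : R →+* A) {ι : Type*}
    [Fintype ι] (y : ι → A) (h : ∀ a : A, ∃ f : ι → R, a = ∑ i, g (f i) * y i) : g.IsIntegral := by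
  classical
  let _ : Algebra R A := g.toAlgebra; have hfin : Module.Finite R A := by
    refine ⟨⟨Finset.univ.image y, ?_⟩⟩; rw [eq_top_iff]; rintro a -; obtain ⟨f, rfl⟩ := h a; refine sum_mem fun i _ => ?_
    exact smul_mem _ (f i) (subset_span (by simp))
  exact RingHom.Finite.to_isIntegral (f := g) hfin

section JF
variable {K : Type} [Field K]

theorem J_final {r d c : ℕ} (hr : d + c = r) (hc : 0 < c) (I : Ideal (PS K r))
    (hnd : AMD.Nondeg K r I) (l : Fin d → PS K r) (Y : ℕ → PS K r) (ν : ℕ → PS K r)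
    (hb : LinBasis K r (Fin d ⊕ Fin (c + 1)) (Sum.elim l (fun k => Y k.val))) (hν : ∀ k < c, ν k ∈ span K (Set.range l))
    (hmin : ∀ k m, k < c → m < c → Y k * (Y (m + 1) + ν m) - Y m * (Y (k + 1) + ν k) ∈ I) :
    ∃ J : Ideal (PS K r), J.IsPrime ∧ AMD.IsHomIdeal K r J ∧ AMD.Nondeg K r J ∧
      J ≤ I ∧ AMD.DimEq K r J (d + 1) ∧ AMD.DegreeEq K r J (d + 1) c := by
  classical
  obtain ⟨e, heX, hes⟩ := hb.equiv (by simp; omega); have hcoef : ∀ k, ∃ a : Fin d → K, k < c → ∑ i, a i • l i = ν k := fun k => by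
    by_cases hk : k < c
    · obtain ⟨a, ha⟩ := (Submodule.mem_span_range_iff_exists_fun K).1 (hν k hk); exact ⟨a, fun _ => ha⟩
    · exact ⟨0, fun h => (hk h).elim⟩
  choose a ha using hcoef; let μ : ℕ → JE K d := fun k => ∑ i, a k i • X (some i)
  have hμ : ∀ k, μ k ∈ HG 1 := fun k => sum_mem fun i _ => smul_mem _ _ (HG_X _); have heY : ∀ k ≤ c, e (jY d c k) = Y k := fun k hk => by
    rw [jY, heX]; simp [Fin.ofNat, Nat.mod_eq_of_lt (Nat.lt_succ_of_le hk)]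
  have heμ : ∀ k < c, e (jι d c (μ k)) = ν k := fun k hk => by
    rw [← ha k hk]; simp only [μ, jι, map_sum, map_smul, aeval_X, Option.elim, heX, Sum.elim_inl]
  have heHG : ∀ {m : ℤ} {p : JT K d c}, p ∈ HG m → e p ∈ HG m := by
    intro m p hp; refine HG_algHom e.toAlgHom (fun i => ?_) hp; show e (X i) ∈ HG 1; rw [heX]; exact (mem_HG_nat (n := 1)).2 (hb.deg i)
  have hesHG : ∀ {m : ℤ} {p : PS K r}, p ∈ HG m → e.symm p ∈ HG m := by
    intro m p hp; exact HG_algHom e.symm.toAlgHom (fun i => (mem_HG_nat (n := 1)).2 (hes i)) hp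
  have hecmp : ∀ (m : ℤ) (p : PS K r), e.symm (hcmp m p) = hcmp m (e.symm p) := fun m p => by
    conv_rhs => rw [← hcmp_sum p _ (Nat.lt_succ_self _)]
    rw [map_sum, map_sum]; by_cases hm : 0 ≤ m ∧ m < p.totalDegree + 1
    · lift m to ℕ using hm.1; rw [sum_eq_single m]
      · rw [hcmp_of_mem (hesHG (hcmp_mem _ _))]
      · intro b _ hb; exact hcmp_of_mem_ne (hesHG (hcmp_mem _ _)) (by omega)
      · intro h; exact (h (mem_range.2 (by omega))).elim
    · have : hcmp m p = 0 := by
        by_cases h0 : 0 ≤ m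
        · lift m to ℕ using h0; rw [hcmp_nat, homogeneousComponent_eq_zero]; omega
        · exact HG_zero_of_neg (by omega) (hcmp_mem _ _)
      rw [this, map_zero]; symm; apply sum_eq_zero; intro b hb; apply hcmp_of_mem_ne (hesHG (hcmp_mem _ _)); rintro rfl; apply hm
      have := mem_range.1 hb; omega
  let Ψ : PS K r →ₐ[K] Polynomial (JE K d) := (jPsi d c μ).comp e.symm.toAlgHom; have hΨ : ∀ p, Ψ p = jPsi d c μ (e.symm p) := fun _ => rfl
  let J : Ideal (PS K r) := RingHom.ker Ψ; have hJ : ∀ p, p ∈ J ↔ e.symm p ∈ jM d c μ := fun p => by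
    rw [← jker_eq d c μ hμ hc]; rfl
  have hJI : J ≤ I := fun p hp => by
    rw [hJ] at hp; have h1 : jM d c μ ≤ I.comap (e : JT K d c →+* PS K r) := by
      rw [jM, Ideal.span_le]; rintro f ⟨k, m, hk, hm, rfl⟩; show e (jminor d c μ k m) ∈ I; have := hmin k m hk hm; unfold jminor
      rw [map_sub, map_mul, map_mul, map_add, map_add, heμ _ hk, heμ _ hm, heY _ hk.le,
        heY _ hm.le, heY _ (Nat.succ_le_of_lt hk), heY _ (Nat.succ_le_of_lt hm)]
      exact this
    have h2 : e (e.symm p) ∈ I := h1 hp; rwa [AlgEquiv.apply_symm_apply] at h2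
  -- the normal form map
  let nf : (Fin c → JR K d) →ₗ[K] (PS K r) :=
    { toFun := fun f => e (∑ i, jι' d c (f i) * jy d c i.val)
      map_add' := by
        intro f g; simp [add_mul, sum_add_distrib]
      map_smul' := by
        intro a f; simp [smul_sum] }
  have hnf0 : ∀ f, nf f ∈ J → f = 0 := fun f hf => by
    refine j_indep d c μ f ?_; have : Ψ (nf f) = 0 := hf; rw [hΨ] at this; simpa [nf] using this
  have hnfm : ∀ {m : ℤ} {p : PS K r}, p ∈ HG m → ∃ f : Fin c → JR K d, (∀ i, f i ∈ HG (m - jw i.val)) ∧ p - nf f ∈ J := by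
    intro m p hp; obtain ⟨f, hf, hf2⟩ := jNF_ex d c μ hμ hc (hesHG hp); refine ⟨f, hf, ?_⟩; rw [hJ, map_sub]; simpa [nf] using hf2
  have hιHG : ∀ {m : ℤ} {p : JR K d}, p ∈ HG m → jι' d c p ∈ HG m := by
    intro m p hp; refine HG_algHom _ (fun i => ?_) hp
    rcases i with _ | _ | i <;> simp [jι', jι, jY, HG_X]
  have hnfHG : ∀ {m : ℤ} {f : Fin c → JR K d}, (∀ i, f i ∈ HG (m - jw i.val)) → nf f ∈ HG m := by
    intro m f hf; apply heHG; refine sum_mem fun i _ => ?_; have hy : jy (K := K) d c i.val ∈ HG (jw i.val) := by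
      unfold jy jw; split_ifs
      · exact HG_one
      · exact HG_X _
    have := HG_mul (hιHG (hf i)) hy; simpa using this
  have hprime : J.IsPrime := RingHom.ker_isPrime _; refine ⟨J, hprime, ?_, ?_, hJI, ?_, ?_⟩
  · intro p hp n; rw [← hcmp_nat, hJ, hecmp]; exact jker_cmp d c μ hμ hc hp n
  · intro p hp h1; exact hnd p (hJI hp) h1
  · unfold AMD.DimEq; let g : JR K d →ₐ[K] PS K r ⧸ J := (Ideal.Quotient.mkₐ K J).comp (e.toAlgHom.comp (jι' d c))
    have hg : Injective g := by
      rw [injective_iff_map_eq_zero]; intro p hp; have h1 : e (jι' d c p) ∈ J := Ideal.Quotient.eq_zero_iff_mem.1 hp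
      have h2 : nf (Pi.single ⟨0, hc⟩ p) ∈ J := by
        convert h1 using 1; simp only [nf, LinearMap.coe_mk, AddHom.coe_mk]; congr 1; rw [sum_eq_single ⟨0, hc⟩]
        · simp [jy]
        · intro j _ hj; rw [Pi.single_eq_of_ne hj]; simp
        · simp
      have h3 := congrFun (hnf0 _ h2) ⟨0, hc⟩; simpa using h3
    have hitg : (g : JR K d →+* PS K r ⧸ J).IsIntegral := by
      refine isIntegral_of_gen _ (fun i : Fin c => Ideal.Quotient.mk J (e (jy d c i.val))) ?_; intro q
      obtain ⟨p, rfl⟩ := Ideal.Quotient.mk_surjective q; rw [← hcmp_sum p _ (Nat.lt_succ_self _), map_sum]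
      have : ∀ m : ℕ, ∃ f : Fin c → JR K d, Ideal.Quotient.mk J (hcmp m p) =
          ∑ i, (g : JR K d →+* PS K r ⧸ J) (f i) * Ideal.Quotient.mk J (e (jy d c i.val)) := fun m => by
        obtain ⟨f, hf, hf2⟩ := hnfm (hcmp_mem (m : ℤ) p); refine ⟨f, ?_⟩; rw [Ideal.Quotient.eq.2 hf2]
        simp only [nf, LinearMap.coe_mk, AddHom.coe_mk, map_sum, map_mul]; rfl
      choose F hF using this; refine ⟨fun i => ∑ m ∈ range (p.totalDegree + 1), F m i, ?_⟩; simp only [hF, map_sum, sum_mul]; exact sum_comm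
    rw [← krull_integral (g : JR K d →+* PS K r ⧸ J) hg hitg, MvPolynomial.ringKrullDim_of_isNoetherianRing, ringKrullDim_eq_zero_of_field]
    simp only [Nat.card_eq_fintype_card, Fintype.card_option, card_fin]; push_cast; rw [zero_add]
  · -- Hilbert series
    have hrank : ∀ m : ℕ, finrank K (AMD.quotComponent K r J m) =
        ∑ i : Fin c, finrank K (HG ((m : ℤ) - jw i.val) : Submodule K (JR K d)) := by
      intro m; let inc : ((i : Fin c) → (HG ((m : ℤ) - jw i.val) : Submodule K (JR K d))) →ₗ[K]
          (Fin c → JR K d) := LinearMap.pi fun i => (Submodule.subtype _).comp (LinearMap.proj i)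
      let L : ((i : Fin c) → (HG ((m : ℤ) - jw i.val) : Submodule K (JR K d))) →ₗ[K]
          (PS K r ⧸ J) := (Ideal.Quotient.mkₐ K J).toLinearMap.comp (nf.comp inc)
      have hL : Injective L := by
        rw [injective_iff_map_eq_zero]; intro f hf; have h1 : nf (inc f) ∈ J := Ideal.Quotient.eq_zero_iff_mem.1 hf; have h2 := hnf0 _ h1
        funext i; exact Subtype.ext (congrFun h2 i)
      have hrange : LinearMap.range L = AMD.quotComponent K r J m := by
        apply le_antisymm
        · rintro _ ⟨f, rfl⟩; refine ⟨nf (inc f), ?_, rfl⟩; exact mem_HG_nat.1 (hnfHG fun i => (f i).2)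
        · rintro _ ⟨p, hp, rfl⟩; obtain ⟨f, hf, hf2⟩ := hnfm (mem_HG_nat.2 hp); refine ⟨fun i => ⟨f i, hf i⟩, ?_⟩
          exact (Ideal.Quotient.eq.2 hf2).symm
      rw [← hrange, LinearMap.finrank_range_of_inj hL, Module.finrank_pi_fintype]
    have hrank2 : ∀ m : ℕ, finrank K (AMD.quotComponent K r J m) =
        (d + 2).multichoose m + (c - 1) * (if m = 0 then 0 else (d + 2).multichoose (m - 1)) := by
      intro m; obtain ⟨c', rfl⟩ : ∃ c', c = c' + 1 := ⟨c - 1, by omega⟩; rw [hrank, Fin.sum_univ_succ]; congr 1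
      · have : ((m : ℤ) - jw ((0 : Fin (c' + 1)).val)) = m := by simp [jw]
        rw [this, finrank_HG]; simp
      · rw [sum_congr rfl (g := fun _ => (if m = 0 then 0 else (d + 2).multichoose (m - 1)))]
        · simp
        · intro i _; have h1 : ((m : ℤ) - jw (i.succ : Fin (c' + 1)).val) = m - 1 := by simp [jw]
          rw [h1]
          split_ifs with h0
          · have : (HG ((m : ℤ) - 1) : Submodule K (JR K d)) = ⊥ := by rw [eq_bot_iff]; intro p hp; exact HG_zero_of_neg (by omega) hp
            rw [this, finrank_bot]
          · have : (m : ℤ) - 1 = ((m - 1 : ℕ) : ℤ) := by omega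
            rw [this, finrank_HG]; simp
    refine ⟨1 + PC ((c : ℤ) - 1) * PX, ?_, by simp⟩
    have hser : AMD.hilbSeries K r J = (PowerSeries.mk fun n => (((d + 2).multichoose n : ℕ) : ℤ)) *
          (1 + PowerSeries.C ((c : ℤ) - 1) * PowerSeries.X) := by
      ext m; rw [AMD.hilbSeries, PowerSeries.coeff_mk, hrank2, mul_add, mul_one, map_add,
        PowerSeries.coeff_mk, mul_left_comm, PowerSeries.coeff_C_mul]
      push_cast; congr 1; rw [Nat.cast_sub (by omega : 1 ≤ c)]; push_cast; congr 1
      rcases m with _ | m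
      · simp
      · rw [PowerSeries.coeff_succ_mul_X, PowerSeries.coeff_mk]; simp
    rw [hser, mul_right_comm, show d + 1 + 1 = d + 2 from rfl, series_HG, one_mul]; ext m
    rw [PowerSeries.coeff_mk, map_add, Polynomial.coeff_add, PowerSeries.coeff_C_mul,
      Polynomial.coeff_C_mul, PowerSeries.coeff_one, PowerSeries.coeff_X, Polynomial.coeff_one, Polynomial.coeff_X]
    simp [eq_comm]

end JF

/-! ### Laurent series -/

open HahnSeries in
/-- `f` has no terms below `a`. -/
def Lo {R : Type} [CommRing R] (a : ℤ) (f : HahnSeries ℤ R) : Prop := ∀ i < a, f.coeff i = 0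

section hahn
variable {R : Type} [CommRing R]

lemma Lo.mono {a b : ℤ} (h : a ≤ b) {f : HahnSeries ℤ R} (hf : Lo b f) : Lo a f := fun i hi => hf i (lt_of_lt_of_le hi h)

lemma Lo.add {a : ℤ} {f g : HahnSeries ℤ R} (hf : Lo a f) (hg : Lo a g) : Lo a (f + g) := by intro i hi; simp [hf i hi, hg i hi]

lemma Lo.neg {a : ℤ} {f : HahnSeries ℤ R} (hf : Lo a f) : Lo a (-f) := by intro i hi; simp [hf i hi]

lemma Lo.sub {a : ℤ} {f g : HahnSeries ℤ R} (hf : Lo a f) (hg : Lo a g) : Lo a (f - g) := by intro i hi; simp [hf i hi, hg i hi]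

lemma Lo.zero {a : ℤ} : Lo a (0 : HahnSeries ℤ R) := by intro i hi; simp

lemma Lo.C (p : R) : Lo 0 (HC p : HahnSeries ℤ R) := by intro i hi; simp [HahnSeries.C_apply, hi.ne]

lemma coeff_C_ne {p : R} {i : ℤ} (hi : i ≠ 0) : (HC p : HahnSeries ℤ R).coeff i = 0 := by simp [HahnSeries.C_apply, hi]

@[simp] lemma coeff_C_zero' {p : R} : (HC p : HahnSeries ℤ R).coeff 0 = p := by simp [HahnSeries.C_apply]

@[simp] lemma coeff_Cmul {p : R} {f : HahnSeries ℤ R} {i : ℤ} :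
    (HC p * f).coeff i = p * f.coeff i := by rw [HahnSeries.C_mul_eq_smul, HahnSeries.coeff_smul, smul_eq_mul]

lemma coeff_mul_lo {a b : ℤ} {x y : HahnSeries ℤ R} (hx : Lo a x) (hy : Lo b y) (k : ℕ) :
    (x * y).coeff (a + b + k) = ∑ i ∈ range (k + 1), x.coeff (a + i) * y.coeff (b + (k - i : ℤ)) := by
  classical
  rw [HahnSeries.coeff_mul]; refine Finset.sum_bij_ne_zero (fun ij _ _ => (ij.1 - a).toNat) ?_ ?_ ?_ ?_
  · intro ij h1 h2; simp only [Finset.mem_antidiagonal, HahnSeries.mem_support] at h1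
    have hi : a ≤ ij.1 := by by_contra h; exact h1.1 (hx _ (not_le.1 h))
    have hj : b ≤ ij.2 := by by_contra h; exact h1.2.1 (hy _ (not_le.1 h))
    rw [mem_range]; omega
  · intro ij h1 h2 ij' h1' h2' h; simp only [Finset.mem_antidiagonal, HahnSeries.mem_support] at h1 h1'
    have hi : a ≤ ij.1 := by by_contra h; exact h1.1 (hx _ (not_le.1 h))
    have hi' : a ≤ ij'.1 := by by_contra h; exact h1'.1 (hx _ (not_le.1 h))
    ext <;> omega
  · intro i hi h; refine ⟨(a + i, b + (k - i : ℤ)), ?_, h, ?_⟩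
    · simp only [Finset.mem_antidiagonal, HahnSeries.mem_support]; exact ⟨left_ne_zero_of_mul h, right_ne_zero_of_mul h, by ring⟩
    · simp
  · intro ij h1 h2; simp only [Finset.mem_antidiagonal, HahnSeries.mem_support] at h1
    have hi : a ≤ ij.1 := by by_contra h; exact h1.1 (hx _ (not_le.1 h))
    have e1 : a + ((ij.1 - a).toNat : ℤ) = ij.1 := by omega
    have e2 : b + ((k : ℤ) - ((ij.1 - a).toNat : ℤ)) = ij.2 := by omega
    rw [e1, e2]

lemma Lo.mul {a b : ℤ} {x y : HahnSeries ℤ R} (hx : Lo a x) (hy : Lo b y) : Lo (a + b) (x * y) := by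
  intro i hi; rw [HahnSeries.coeff_mul]; refine sum_eq_zero fun ij h1 => ?_
  simp only [Finset.mem_antidiagonal, HahnSeries.mem_support] at h1; have hi : a ≤ ij.1 := by by_contra h; exact h1.1 (hx _ (not_le.1 h))
  have hj : b ≤ ij.2 := by by_contra h; exact h1.2.1 (hy _ (not_le.1 h))
  omega

lemma coeff_mul_lo0 {a b : ℤ} {x y : HahnSeries ℤ R} (hx : Lo a x) (hy : Lo b y) : (x * y).coeff (a + b) = x.coeff a * y.coeff b := by
  simpa using coeff_mul_lo hx hy 0

lemma coeff_mul_lo1 {a b : ℤ} {x y : HahnSeries ℤ R} (hx : Lo a x) (hy : Lo b y) :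
    (x * y).coeff (a + b + 1) = x.coeff a * y.coeff (b + 1) + x.coeff (a + 1) * y.coeff b := by
  have := coeff_mul_lo hx hy 1; simpa [sum_range_succ] using this

/-- The subring of series without pole. -/
def LoR (R : Type) [CommRing R] : Subring (HahnSeries ℤ R) where
  carrier := {f | Lo 0 f}
  mul_mem' := fun ha hb => by simpa using Lo.mul ha hb
  one_mem' := by
    have := Lo.C (1 : R); rwa [map_one] at this
  add_mem' := fun ha hb => Lo.add ha hb
  zero_mem' := Lo.zero
  neg_mem' := fun ha => Lo.neg ha

lemma Lo.sum {ι : Type} {s : Finset ι} {a : ℤ} {f : ι → HahnSeries ℤ R} (h : ∀ i ∈ s, Lo a (f i)) : Lo a (∑ i ∈ s, f i) := by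
  classical
  induction s using Finset.induction_on with
  | empty => simpa using Lo.zero
  | insert i s hi ih =>
    rw [Finset.sum_insert hi]; exact (h i (by simp)).add (ih fun j hj => h j (by simp [hj]))

lemma Lo.pow {a : ℤ} {f : HahnSeries ℤ R} (hf : Lo a f) (k : ℕ) : Lo (k * a) (f ^ k) := by
  induction k with
  | zero =>
    have : Lo 0 (1 : HahnSeries ℤ R) := (LoR R).one_mem; simpa using this
  | succ k ih =>
    rw [pow_succ]; convert ih.mul hf using 1; push_cast; ring

lemma coeff_pow_lo {a : ℤ} {f : HahnSeries ℤ R} (hf : Lo a f) (k : ℕ) : (f ^ k).coeff (k * a) = f.coeff a ^ k := by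
  induction k with
  | zero => simp
  | succ k ih =>
    rw [pow_succ, pow_succ, ← ih, ← coeff_mul_lo0 (hf.pow k) hf]; congr 1; push_cast; ring

lemma eq_C_of_coeff {f : HahnSeries ℤ R} (h : ∀ i ≠ 0, f.coeff i = 0) : f = HC (f.coeff 0) := by
  ext i; by_cases hi : i = 0
  · subst hi; simp
  · rw [h i hi, coeff_C_ne hi]

lemma prod_coeff_mem {B : Type} [CommRing B] {ι : Type} (N : Subring B) (T : Finset ι) (u : ι → B) (h : ∀ t ∈ T, u t ∈ N) (k : ℕ) :
    (∏ t ∈ T, (PX - PC (u t))).coeff k ∈ N := by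
  classical
  induction T using Finset.induction_on generalizing k with
  | empty =>
    rw [Finset.prod_empty, Polynomial.coeff_one]; split_ifs
    · exact N.one_mem
    · exact N.zero_mem
  | insert t T ht ih =>
    rw [Finset.prod_insert ht, sub_mul, Polynomial.coeff_sub, Polynomial.coeff_C_mul]
    refine N.sub_mem ?_ (N.mul_mem (h t (by simp)) (ih (fun s hs => h s (by simp [hs])) k))
    rcases k with _ | k
    · simp
    · rw [Polynomial.coeff_X_mul]; exact ih (fun s hs => h s (by simp [hs])) k

lemma alg_const [IsDomain R] {ι : Type} (T : Finset ι) (u : ι → HahnSeries ℤ R) (h0 : ∀ t ∈ T, Lo 0 (u t)) (hs : ∀ k, ∀ e : ℤ, 0 < e →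
      ((∏ t ∈ T, (PX - PC (u t))).coeff k).coeff e = 0)
    {t : ι} (ht : t ∈ T) {i : ℤ} (hi : i ≠ 0) : (u t).coeff i = 0 := by
  classical
  set q := ∏ t ∈ T, (PX - PC (u t)) with hq
  have hl : ∀ k, q.coeff k ∈ (HC : R →+* HahnSeries ℤ R).range := fun k => by
    have h1 : Lo 0 (q.coeff k) := prod_coeff_mem (LoR R) T u h0 k; refine ⟨(q.coeff k).coeff 0, (eq_C_of_coeff fun i hi => ?_).symm⟩
    rcases lt_or_gt_of_ne hi with hi | hi
    · exact h1 i hi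
    · exact hs k i hi
  have hl2 : q ∈ Polynomial.lifts (HC : R →+* HahnSeries ℤ R) := by
    rw [Polynomial.lifts_iff_coeff_lifts]; exact fun k => hl k
  obtain ⟨q0, hq0⟩ := hl2; rw [Polynomial.coe_mapRingHom] at hq0
  have hqm : q.Monic := Polynomial.monic_prod_of_monic _ _ fun t _ => Polynomial.monic_X_sub_C _; have hq0ne : q0 ≠ 0 := by
    rintro rfl; rw [Polynomial.map_zero] at hq0; exact hqm.ne_zero hq0.symm
  have hroot : Polynomial.eval₂ (HC : R →+* HahnSeries ℤ R) (u t) q0 = 0 := by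
    rw [← Polynomial.eval_map, hq0, hq, Polynomial.eval_prod]; exact Finset.prod_eq_zero ht (by simp)
  set v := u t - HC ((u t).coeff 0) with hv
  have hv1 : Lo 1 v := by
    intro i hi; by_cases h : i = 0
    · subst h; simp [hv]
    · rw [hv, HahnSeries.coeff_sub, coeff_C_ne h, h0 t ht i (by omega), sub_zero]
  set p := q0.comp (PX + PC ((u t).coeff 0)) with hp
  have hpne : p ≠ 0 := by
    rw [hp]; intro h; apply hq0ne; have : (q0.comp (PX + PC ((u t).coeff 0))).comp
      (PX - PC ((u t).coeff 0)) = 0 := by rw [h]; simp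
    rw [Polynomial.comp_assoc] at this; simpa using this
  have hproot : Polynomial.eval₂ (HC : R →+* HahnSeries ℤ R) v p = 0 := by
    rw [hp, Polynomial.eval₂_comp]; simpa [hv] using hroot
  obtain ⟨p', hp', hnd⟩ := Polynomial.exists_eq_pow_rootMultiplicity_mul_and_not_dvd p hpne 0; rw [map_zero, sub_zero] at hp' hnd
  rw [Polynomial.X_dvd_iff] at hnd; rw [hp', Polynomial.eval₂_mul, Polynomial.eval₂_pow, Polynomial.eval₂_X] at hproot
  have hv0 : v = 0 := by
    rcases mul_eq_zero.1 hproot with h | h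
    · exact (pow_eq_zero_iff (by rintro h0; rw [h0] at h; simp at h)).1 h
    · exfalso; rw [← Polynomial.divX_mul_X_add p', Polynomial.eval₂_add, Polynomial.eval₂_mul, Polynomial.eval₂_X, Polynomial.eval₂_C] at h
      have hlo : Lo 0 (Polynomial.eval₂ (HC : R →+* HahnSeries ℤ R) v p'.divX) := by
        rw [Polynomial.eval₂_eq_sum_range]; refine Lo.sum fun i _ => ?_
        have := (Lo.C (p'.divX.coeff i)).mul ((hv1.mono (by norm_num : (0:ℤ) ≤ 1)).pow i); simpa using this
      have h2 := congrArg (fun f => HahnSeries.coeff f (0:ℤ)) h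
      simp only [HahnSeries.coeff_add, HahnSeries.coeff_zero, coeff_C_zero'] at h2; rw [(hlo.mul hv1) 0 (by norm_num), zero_add] at h2
      exact hnd h2
  rw [hv, sub_eq_zero] at hv0; rw [hv0, coeff_C_ne hi]

/-- Coefficientwise application of a ring homomorphism. -/
def hmap {R' : Type} [CommRing R'] (f : R →+* R') : HahnSeries ℤ R →+* HahnSeries ℤ R' where
  toFun x := x.map f
  map_one' := by ext i; simp [HahnSeries.coeff_one, apply_ite f]
  map_zero' := by ext i; simp
  map_add' x y := by ext i; simp
  map_mul' x y := by exact HahnSeries.map_mul (f : R →ₙ+* R')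

@[simp] lemma hmap_coeff {R' : Type} [CommRing R'] (f : R →+* R') (x : HahnSeries ℤ R) (i : ℤ) :
    (hmap f x).coeff i = f (x.coeff i) := rfl

end hahn

variable {K : Type} [Field K]

/-- Laurent series over the polynomial ring in `d` variables. -/
abbrev LS (K : Type) [Field K] (d : ℕ) : Type := HahnSeries ℤ (MvPolynomial (Fin d) K)

instance (priority := 2000) lsAlg {d : ℕ} : Algebra K (LS K d) := HahnSeries.instAlgebra

/-- Graded pieces of the Laurent series. -/
def GG {d : ℕ} (m : ℤ) : Submodule K (LS K d) where
  carrier := {f | ∀ i : ℤ, f.coeff i ∈ HG (m + i)}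
  add_mem' := fun ha hb i => by rw [HahnSeries.coeff_add]; exact add_mem (ha i) (hb i)
  zero_mem' := fun i => by simp
  smul_mem' := fun a f hf i => by rw [HahnSeries.coeff_smul]; exact smul_mem _ _ (hf i)

variable {d : ℕ}

lemma GG_lo {m : ℤ} {f : LS K d} (hf : f ∈ GG m) : Lo (-m) f := by
  intro i hi; exact HG_zero_of_neg (by omega) (hf i)

lemma GG_mul {m m' : ℤ} {f g : LS K d} (hf : f ∈ GG m) (hg : g ∈ GG m') : f * g ∈ GG (m + m') := by
  intro i; rw [HahnSeries.coeff_mul]; refine sum_mem fun ij h1 => ?_; simp only [Finset.mem_antidiagonal] at h1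
  have := HG_mul (hf ij.1) (hg ij.2); convert this using 2; omega

lemma GG_C {m : ℤ} {p : MP K d} (hp : p ∈ HG m) : (HC p : LS K d) ∈ GG m := by
  intro i; by_cases hi : i = 0
  · subst hi; simpa using hp
  · rw [coeff_C_ne hi]; exact zero_mem _

lemma GG_one : (1 : LS K d) ∈ GG 0 := by
  have := GG_C (d := d) (K := K) HG_one; rwa [map_one] at this

lemma GG_single : (HahnSeries.single (-1 : ℤ) (1 : MP K d)) ∈ GG (K := K) (d := d) 1 := by
  intro i; by_cases hi : i = -1
  · subst hi; simpa using HG_one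
  · rw [HahnSeries.coeff_single_of_ne hi]; exact zero_mem _

lemma GG_pow {m : ℤ} {f : LS K d} (hf : f ∈ GG m) (k : ℕ) : f ^ k ∈ GG (k * m) := by
  induction k with
  | zero => simpa using GG_one
  | succ k ih =>
    rw [pow_succ]; convert GG_mul ih hf using 1; push_cast; ring

/-- The local expansion data at infinity of a projective variety. -/
structure Setup (K : Type) [Field K] (r : ℕ) (I : Ideal (PS K r)) (d c : ℕ) (ι : Type) [Fintype ι] where
  Φ : ι → PS K r →ₐ[K] LS K d
  ker : ∀ j f, Φ j f = 0 ↔ f ∈ I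
  gr : ∀ j (m : ℤ) (f : PS K r), f ∈ HG m → Φ j f ∈ GG m
  l0 : PS K r
  l : Fin d → PS K r
  l0d : l0 ∈ HG 1
  ld : ∀ i, l i ∈ HG 1
  Φl0 : ∀ j, Φ j l0 = HahnSeries.single (-1 : ℤ) 1
  Φl : ∀ j i, Φ j (l i) = HC (X i)
  sym : ∀ a : PS K r, ∃ T : Finset ι, (∀ j, ∃ t ∈ T, Φ j a = Φ t a) ∧
    ∀ k, ∀ e : ℤ, 0 < e → ((∏ t ∈ T, (PX - PC (Φ t a))).coeff k).coeff e = 0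
  γ : ι → K
  γne : ∀ j, γ j ≠ 0
  γsum : ∀ x : PS K r, x ∈ HG 1 → ∑ j, γ j • (Φ j x).coeff (-1) = 0
  card : Fintype.card ι = c + 2
  hr : d + c = r
  nondeg : AMD.Nondeg K r I

namespace Setup
variable {r : ℕ} {I : Ideal (PS K r)} {c : ℕ} {ι : Type} [Fintype ι] (s : Setup K r I d c ι)

/-- The inclusion of the polynomial ring in the finite part. -/
def P : MP K d →ₐ[K] PS K r := aeval s.l

lemma ΦP (j : ι) (p : MP K d) : s.Φ j (s.P p) = HC p := by
  induction p using MvPolynomial.induction_on with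
  | C a =>
    have h1 : s.P (MvPolynomial.C a) = algebraMap K _ a := by simp [P]
    rw [h1, AlgHom.commutes, HahnSeries.algebraMap_apply]; rfl
  | add p q hp hq => rw [map_add, map_add, hp, hq, map_add]
  | mul_X p i hp =>
    rw [map_mul, map_mul, hp, map_mul]; simp [P, s.Φl]

lemma P_HG {m : ℤ} {p : MP K d} (hp : p ∈ HG m) : s.P p ∈ HG m := HG_aeval s.ld hp

/-- Elements with expansions that become regular functions after multiplication by the finite part. -/
def HH : Subring (ι → LS K d) where
  carrier := {G | ∃ h : MP K d, h ≠ 0 ∧ ∃ a, ∀ j, HC h * G j = s.Φ j a}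
  mul_mem' := by
    rintro G G' ⟨h, hh, a, ha⟩ ⟨h', hh', a', ha'⟩; refine ⟨h * h', mul_ne_zero hh hh', a * a', fun j => ?_⟩
    rw [map_mul (s.Φ j), ← ha, ← ha', map_mul, Pi.mul_apply]; ring
  one_mem' := ⟨1, one_ne_zero, 1, fun j => by simp⟩
  add_mem' := by
    rintro G G' ⟨h, hh, a, ha⟩ ⟨h', hh', a', ha'⟩; refine ⟨h * h', mul_ne_zero hh hh', s.P h' * a + s.P h * a', fun j => ?_⟩
    rw [map_add (s.Φ j), map_mul (s.Φ j), map_mul (s.Φ j), ← ha, ← ha', map_mul, Pi.add_apply, ΦP, ΦP]; ring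
  zero_mem' := ⟨1, one_ne_zero, 0, fun j => by simp⟩
  neg_mem' := by
    rintro G ⟨h, hh, a, ha⟩; exact ⟨h, hh, -a, fun j => by rw [map_neg, ← ha, Pi.neg_apply]; ring⟩

lemma HH_div {G : ι → LS K d} {p : MP K d} (hp : p ≠ 0) (h : (fun j => HC p * G j) ∈ s.HH) : G ∈ s.HH := by
  obtain ⟨h, hh, a, ha⟩ := h; exact ⟨h * p, mul_ne_zero hh hp, a, fun j => by rw [← ha, map_mul]; ring⟩

/-- The combined expansion. -/
def F : PS K r →ₐ[K] (ι → LS K d) := AlgHom.pi s.Φ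

@[simp] lemma F_apply (a : PS K r) (j : ι) : s.F a j = s.Φ j a := rfl

lemma F_HH (a : PS K r) : s.F a ∈ s.HH := ⟨1, one_ne_zero, a, fun j => by simp⟩

/-- Graded pieces of `HH`. -/
def HD (m : ℤ) : Submodule K (ι → LS K d) where
  carrier := {G | G ∈ s.HH ∧ ∀ j, G j ∈ GG m}
  add_mem' := fun ha hb => ⟨s.HH.add_mem ha.1 hb.1, fun j => add_mem (ha.2 j) (hb.2 j)⟩
  zero_mem' := ⟨s.HH.zero_mem, fun j => Submodule.zero_mem _⟩
  smul_mem' := fun a f hf => ⟨by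
    have h1 : a • f = s.F (algebraMap K _ a) * f := by
      funext j; rw [AlgHom.commutes, Pi.mul_apply, Pi.algebraMap_apply, HahnSeries.algebraMap_apply]; ext i
      rw [coeff_Cmul, Pi.smul_apply, HahnSeries.coeff_smul, Algebra.smul_def]
    rw [h1]; exact s.HH.mul_mem (s.F_HH _) hf.1, fun j => smul_mem _ _ (hf.2 j)⟩

lemma HD_mul {m m' : ℤ} {f g : ι → LS K d} (hf : f ∈ s.HD m) (hg : g ∈ s.HD m') :
    f * g ∈ s.HD (m + m') := ⟨s.HH.mul_mem hf.1 hg.1, fun j => GG_mul (hf.2 j) (hg.2 j)⟩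

lemma HD_F {m : ℤ} {f : PS K r} (hf : f ∈ HG m) : s.F f ∈ s.HD m := ⟨s.F_HH _, fun j => s.gr j m f hf⟩

lemma HH_inj {G : ι → LS K d} (hG : G ∈ s.HH) {j : ι} (h : G j = 0) : G = 0 := by
  obtain ⟨h', hh, a, ha⟩ := hG; have h1 : a ∈ I := by rw [← s.ker j, ← ha, h, mul_zero]
  funext k; have h2 := ha k; rw [(s.ker k a).2 h1] at h2
  rcases mul_eq_zero.1 h2 with h3 | h3
  · exact absurd (by simpa using congrArg (fun f => HahnSeries.coeff f (0 : ℤ)) h3) hh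
  · exact h3

/-- Elements modulo a prime `q` without pole mod `q` are constant mod `q`. -/
lemma const_mod (q : Ideal (MP K d)) [q.IsPrime] {G : ι → LS K d} (hG : G ∈ s.HH)
    (h0 : ∀ j, ∀ i < 0, (G j).coeff i ∈ q) (j : ι) {i : ℤ} (hi : i ≠ 0) : (G j).coeff i ∈ q := by
  classical
  obtain ⟨h, hh, a, ha⟩ := hG; obtain ⟨T, hT, hs⟩ := s.sym a; obtain ⟨t, ht, hjt⟩ := hT j
  have hCne : (HC h : LS K d) ≠ 0 := fun h3 => absurd (by simpa using congrArg (fun f => HahnSeries.coeff f (0 : ℤ)) h3) hh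
  have hGt : G j = G t := mul_left_cancel₀ hCne (by rw [ha, ha, hjt])
  -- symmetric functions of `G`
  have hsG : ∀ k, ∀ e : ℤ, 0 < e → ((∏ t ∈ T, (PX - PC (G t))).coeff k).coeff e = 0 := fun k e he => by
    have h1 : ∀ T : Finset ι, (∏ t ∈ T, (PX - PC (s.Φ t a))) = (∏ t ∈ T, (PX - PC (G t))).scaleRoots (HC h) := fun T => by
      induction T using Finset.induction_on with
      | empty => simp
      | insert t T ht ih =>
        rw [Finset.prod_insert ht, Finset.prod_insert ht, Polynomial.mul_scaleRoots_of_noZeroDivisors, ← ih]; congr 1; rw [← ha]; ext k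
        rw [Polynomial.coeff_scaleRoots, Polynomial.natDegree_X_sub_C]
        rcases k with _ | _ | k
        · simp [mul_comm]
        · simp
        · simp [Polynomial.coeff_X, Polynomial.coeff_C]
    have h2 := hs k e he; rw [h1 T, Polynomial.coeff_scaleRoots, ← map_pow, mul_comm, coeff_Cmul] at h2
    exact (mul_eq_zero.1 h2).resolve_left (pow_ne_zero _ hh)
  let f := Ideal.Quotient.mk q; have key := alg_const (R := MP K d ⧸ q) T (fun t => hmap f (G t))
    (fun t _ i hi => by rw [hmap_coeff]; exact Ideal.Quotient.eq_zero_iff_mem.2 (h0 t i hi))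
    (by
      intro k e he
      have h1 : (∏ t ∈ T, (PX - PC (hmap f (G t)))) = (∏ t ∈ T, (PX - PC (G t))).map (hmap f) := by rw [Polynomial.map_prod]; simp
      rw [h1, Polynomial.coeff_map, hmap_coeff, hsG k e he, map_zero]) ht hi
  rw [hGt]; rw [hmap_coeff] at key; exact Ideal.Quotient.eq_zero_iff_mem.1 key

lemma U1 [Nonempty ι] {G : ι → LS K d} (hG : G ∈ s.HH) (h0 : ∀ j, Lo 0 (G j)) : ∃ p, ∀ j, G j = HC p := by
  have h1 : ∀ j, G j = HC ((G j).coeff 0) := fun j => by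
    refine eq_C_of_coeff fun i hi => ?_; have := s.const_mod ⊥ hG (fun j i hi => by simp [h0 j i hi]) j hi; simpa using this
  obtain ⟨j0⟩ := ‹Nonempty ι›; refine ⟨(G j0).coeff 0, fun j => ?_⟩; have h2 : G - s.F (s.P ((G j0).coeff 0)) = 0 := by
    refine s.HH_inj (s.HH.sub_mem hG (s.F_HH _)) (j := j0) ?_; rw [Pi.sub_apply, F_apply, ΦP, ← h1, sub_self]
  have h3 := congrFun h2 j; rw [Pi.sub_apply, F_apply, ΦP, Pi.zero_apply, sub_eq_zero] at h3; exact h3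

lemma U1' [Nonempty ι] {m : ℤ} {G : ι → LS K d} (hG : G ∈ s.HD m) (h0 : ∀ j, Lo 0 (G j)) : ∃ p ∈ HG m, G = s.F (s.P p) := by
  obtain ⟨p, hp⟩ := s.U1 hG.1 h0; obtain ⟨j0⟩ := ‹Nonempty ι›; refine ⟨p, ?_, ?_⟩
  · have := hG.2 j0 0; rwa [hp j0, coeff_C_zero', add_zero] at this
  · funext j; rw [hp j, F_apply, ΦP]

end Setup
end AMDP
namespace AMDP

variable {K : Type} [Field K] {d : ℕ}

/-! ### divisibility of homogeneous polynomials -/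

lemma hcmp_HG_mul {σ : Type} {e m : ℤ} {p q : MvPolynomial σ K} (hp : p ∈ HG e) : hcmp m (p * q) = p * hcmp (m - e) q := by
  classical
  conv_lhs => rw [← hcmp_sum q _ (Nat.lt_succ_self _)]
  rw [mul_sum, map_sum]; have h1 : ∀ i : ℕ, hcmp m (p * hcmp i q) = if (i : ℤ) = m - e then p * hcmp (i:ℤ) q else 0 := fun i => by
    have h2 := HG_mul hp (hcmp_mem (i : ℤ) q)
    split_ifs with h
    · refine hcmp_of_mem ?_; rw [h, add_sub_cancel] at h2; rw [h]; exact h2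
    · exact hcmp_of_mem_ne h2 (by omega)
  simp_rw [h1]
  rcases lt_or_ge (m - e) 0 with h | h
  · rw [HG_zero_of_neg h (hcmp_mem _ q), mul_zero]; refine sum_eq_zero fun i _ => if_neg (by omega)
  · obtain ⟨k, hk⟩ := Int.eq_ofNat_of_zero_le h; rw [hk]; by_cases hk2 : k < q.totalDegree + 1
    · rw [sum_eq_single k]
      · simp
      · intro b _ hb; rw [if_neg (by omega)]
      · intro h; simp at h; omega
    · rw [sum_eq_zero, hcmp_nat, homogeneousComponent_eq_zero _ _ (by omega), mul_zero]
      intro i hi; rw [mem_range] at hi; rw [if_neg (by omega)]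

lemma HG_div {σ : Type} {e m : ℤ} {p q : MvPolynomial σ K} (hp : p ∈ HG e) (hp0 : p ≠ 0) (h : p * q ∈ HG m) : q ∈ HG (m - e) := by
  rw [← hcmp_sum q _ (Nat.lt_succ_self _)]; refine sum_mem fun i _ => ?_; by_cases hi : (i : ℤ) = m - e
  · rw [← hi]; exact hcmp_mem _ _
  · have h1 : hcmp ((i : ℤ) + e) (p * q) = p * hcmp i q := by rw [hcmp_HG_mul hp, add_sub_cancel_right]
    rw [hcmp_of_mem_ne h (by omega)] at h1; rw [(mul_eq_zero.1 h1.symm).resolve_left hp0]; exact zero_mem _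

/-- The polynomial `p(tX)`. -/
def thom {σ : Type} : MvPolynomial σ K →ₐ[K] Polynomial (MvPolynomial σ K) := aeval fun i => PC (X i) * PX

lemma thom_HG {σ : Type} {m : ℕ} {p : MvPolynomial σ K} (hp : p ∈ HG m) : thom p = PC p * PX ^ m := by
  classical
  rw [mem_HG_nat] at hp
  conv_lhs => rw [p.as_sum]
  conv_rhs => rw [p.as_sum]
  rw [map_sum, map_sum, sum_mul]; refine sum_congr rfl fun s hs => ?_; have hd : s.degree = m := by
    have := hp (mem_support_iff.1 hs); rw [Finsupp.degree_eq_weight_one]; exact this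
  rw [thom, aeval_monomial, monomial_eq, map_mul]
  have : (algebraMap K (Polynomial (MvPolynomial σ K))) (coeff s p) = PC (C (coeff s p)) := rfl; rw [this, mul_assoc]; congr 1
  rw [← hd, Finsupp.degree_apply, Finsupp.prod, Finsupp.prod, map_prod, ← Finset.prod_pow_eq_pow_sum, ← Finset.prod_mul_distrib]
  refine Finset.prod_congr rfl fun i _ => ?_; rw [mul_pow, map_pow]

lemma thom_coeff {σ : Type} (p : MvPolynomial σ K) (m : ℕ) : (thom p).coeff m = hcmp m p := by
  conv_lhs => rw [← hcmp_sum p _ (Nat.lt_succ_self _)]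
  rw [map_sum, Polynomial.finsetSum_coeff]; simp_rw [fun i : ℕ => thom_HG (hcmp_mem (i : ℤ) p), Polynomial.coeff_C_mul_X_pow]
  by_cases hm : m < p.totalDegree + 1
  · rw [sum_eq_single m]
    · simp
    · intro b _ hb; rw [if_neg (Ne.symm hb)]
    · intro h; simp at h; omega
  · rw [sum_eq_zero, hcmp_nat, homogeneousComponent_eq_zero _ _ (by omega)]; intro i hi; rw [mem_range] at hi; rw [if_neg (by omega)]

lemma HG_of_thom {σ : Type} {p : MvPolynomial σ K} {m : ℕ} (h : ∀ k, k ≠ m → (thom p).coeff k = 0) : p ∈ HG m := by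
  rw [← hcmp_sum p _ (Nat.lt_succ_self _)]; refine sum_mem fun i _ => ?_; by_cases hi : i = m
  · subst hi; exact hcmp_mem _ _
  · rw [← thom_coeff, h i hi]; exact zero_mem _

lemma HG_factor {σ : Type} {p q : MvPolynomial σ K} {k : ℕ} (h : p * q ∈ HG k) (h0 : p * q ≠ 0) : ∃ e : ℕ, p ∈ HG e := by
  have hth : ∀ p : MvPolynomial σ K, p ≠ 0 → thom p ≠ 0 := fun p hp h => by
    apply hp; rw [← hcmp_sum p _ (Nat.lt_succ_self _)]; refine sum_eq_zero fun i _ => ?_; rw [← thom_coeff, h, Polynomial.coeff_zero]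
  have hp0 := hth p (left_ne_zero_of_mul h0); have hq0 := hth q (right_ne_zero_of_mul h0); have h1 := thom_HG h; rw [map_mul] at h1
  have hd : (thom p).natDegree + (thom q).natDegree = k := by
    rw [← Polynomial.natDegree_mul hp0 hq0, h1, Polynomial.natDegree_C_mul_X_pow _ _ h0]
  have ht : (thom p).natTrailingDegree + (thom q).natTrailingDegree = k := by
    rw [← Polynomial.natTrailingDegree_mul hp0 hq0, h1, Polynomial.C_mul_X_pow_eq_monomial, Polynomial.natTrailingDegree_monomial h0]
  have h2 := Polynomial.natTrailingDegree_le_natDegree (thom p); have h3 := Polynomial.natTrailingDegree_le_natDegree (thom q)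
  refine ⟨(thom p).natDegree, HG_of_thom fun j hj => ?_⟩
  rcases lt_or_gt_of_ne hj with hj | hj
  · exact Polynomial.coeff_eq_zero_of_lt_natTrailingDegree (by omega)
  · exact Polynomial.coeff_eq_zero_of_natDegree_lt hj

lemma hahn_div {R : Type} [CommRing R] {p : R} {f : HahnSeries ℤ R} (h : ∀ i, p ∣ f.coeff i) : ∃ g : HahnSeries ℤ R, HC p * g = f := by
  classical
  choose g hg using h; refine ⟨⟨fun i => if f.coeff i = 0 then 0 else g i, f.isPWO_support.mono ?_⟩, ?_⟩
  · intro i hi; simp only [Function.mem_support, ne_eq, ite_eq_left_iff, not_forall] at hi; exact hi.1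
  · ext i; rw [coeff_Cmul]; show p * (if f.coeff i = 0 then 0 else g i) = f.coeff i
    split_ifs with h
    · rw [h, mul_zero]
    · exact (hg i).symm

namespace Setup
variable {r : ℕ} {I : Ideal (PS K r)} {c : ℕ} {ι : Type} [Fintype ι] (s : Setup K r I d c ι)

lemma nonempty (s : Setup K r I d c ι) : Nonempty ι := by rw [← Fintype.card_pos_iff, s.card]; omega

lemma coeffC {x : PS K r} (hx : x ∈ HG 1) (j : ι) : (s.Φ j x).coeff (-1) = C (constantCoeff ((s.Φ j x).coeff (-1))) := by
  have h := s.gr j 1 x hx (-1); have h2 : (1 : ℤ) + -1 = 0 := by norm_num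
  rw [h2] at h; have h3 := HG_zero_eq h; exact h3

/-- The symbol map. -/
def symb : (HG 1 : Submodule K (PS K r)) →ₗ[K] (ι → K) where
  toFun x j := constantCoeff ((s.Φ j x.1).coeff (-1))
  map_add' x y := by funext j; simp
  map_smul' a x := by
    funext j; simp only [Submodule.coe_smul, map_smul, Pi.smul_apply, RingHom.id_apply]
    rw [HahnSeries.coeff_smul, smul_eq_C_mul, map_mul]; simp

lemma F_eq {a b : PS K r} (h : s.F a = s.F b) : a - b ∈ I := by
  obtain ⟨j⟩ := s.nonempty; rw [← s.ker j, map_sub, sub_eq_zero]; exact congrFun h j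

lemma finrank_HG_one (m : ℕ) : finrank K (HG 1 : Submodule K (MvPolynomial (Fin m) K)) = m := by
  have := finrank_HG (K := K) (σ := Fin m) 1; simpa using this

lemma symb_surj (v : ι → K) (hv : ∑ j, s.γ j * v j = 0) : ∃ x ∈ HG 1, ∀ j, (s.Φ j x).coeff (-1) = C (v j) := by
  classical
  obtain ⟨j0⟩ := s.nonempty; have := s.nonempty; let g : (ι → K) →ₗ[K] K := ∑ j, s.γ j • LinearMap.proj j
  have hg : ∀ v, g v = ∑ j, s.γ j * v j := fun v => by simp [g]
  have hle : LinearMap.range s.symb ≤ LinearMap.ker g := by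
    rintro _ ⟨x, rfl⟩; rw [LinearMap.mem_ker, hg]; have h1 := congrArg constantCoeff (s.γsum x.1 x.2); simpa [smul_eq_C_mul, symb] using h1
  have hfin : Module.Finite K (HG 1 : Submodule K (PS K r)) := inferInstance; have hker : finrank K (LinearMap.ker s.symb) ≤ d := by
    have h2 : (LinearMap.ker s.symb).map (Submodule.subtype _) ≤ (HG 1 : Submodule K (MP K d)).map s.P.toLinearMap := by
      rintro _ ⟨x, hx, rfl⟩; have h3 : ∀ j, Lo 0 (s.F x.1 j) := fun j i hi => by
        by_cases h : i = -1
        · subst h; rw [F_apply, s.coeffC x.2]; have := congrFun (LinearMap.mem_ker.1 hx) j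
          change constantCoeff ((s.Φ j x.1).coeff (-1)) = 0 at this; rw [this, map_zero]
        · exact GG_lo (s.gr j 1 x.1 x.2) i (by omega)
      obtain ⟨p, hp, hxp⟩ := s.U1' (s.HD_F x.2) h3; refine ⟨p, hp, ?_⟩; have h4 := s.nondeg _ (s.F_eq hxp)
        (mem_HG_nat.1 (sub_mem x.2 (s.P_HG hp)))
      rw [sub_eq_zero] at h4; exact h4.symm
    have h5 := Submodule.finrank_mono h2; rw [Submodule.finrank_map_subtype_eq] at h5
    · refine h5.trans ((Submodule.finrank_map_le _ _).trans ?_); rw [finrank_HG_one]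
  have hrn := LinearMap.finrank_range_add_finrank_ker s.symb; rw [finrank_HG_one] at hrn
  have hgk : finrank K (LinearMap.ker g) + 1 = c + 2 := by
    have h6 := LinearMap.finrank_range_add_finrank_ker g; rw [Module.finrank_fintype_fun_eq_card, s.card] at h6
    have h7 : LinearMap.range g = ⊤ := by
      refine LinearMap.range_eq_top.2 (LinearMap.surjective ?_); intro h; have h8 := hg (Pi.single j0 1); rw [h] at h8
      simp [Pi.single_apply] at h8; exact s.γne j0 h8.symm
    rw [h7, finrank_top, Module.finrank_self] at h6; omega
  have heq : LinearMap.range s.symb = LinearMap.ker g := by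
    apply Submodule.eq_of_le_of_finrank_le hle; have := s.hr; omega
  have hvm : v ∈ LinearMap.range s.symb := by rw [heq, LinearMap.mem_ker, hg, hv]
  obtain ⟨x, hx⟩ := hvm; refine ⟨x.1, x.2, fun j => ?_⟩; rw [s.coeffC x.2, ← hx]; rfl

lemma wlift' (v : ι → MP K d) (hs : ∑ j, s.γ j • v j = 0) :
    ∃ x : ι → PS K r, (∀ i, x i ∈ HG 1) ∧ ∀ j, Lo (-1) (s.Φ j (∑ i, s.P (v i) * x i)) ∧
      (s.Φ j (∑ i, s.P (v i) * x i)).coeff (-1) = v j := by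
  classical
  obtain ⟨j0⟩ := s.nonempty; have h1 : ∀ i, ∃ x ∈ HG 1, ∀ j, (s.Φ j x).coeff (-1) =
      C ((Pi.single i 1 : ι → K) j - s.γ i * (s.γ j0)⁻¹ * (Pi.single j0 1 : ι → K) j) := fun i => by
    apply s.symb_surj; simp [mul_sub, sum_sub_distrib, Pi.single_apply]; have := s.γne j0; field_simp; ring
  choose x hx hxs using h1; refine ⟨x, hx, fun j => ⟨?_, ?_⟩⟩
  · rw [map_sum]; refine Lo.sum fun i _ => ?_; rw [map_mul, s.ΦP]; simpa using (Lo.C (v i)).mul (GG_lo (s.gr j 1 _ (hx i)))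
  · rw [map_sum, HahnSeries.coeff_sum]; simp_rw [map_mul, s.ΦP, coeff_Cmul, hxs, map_sub, mul_sub, sum_sub_distrib]
    have h2 : ∑ i, v i * C ((Pi.single i 1 : ι → K) j) = v j := by
      rw [sum_eq_single j]
      · simp
      · intro b _ hb; simp [Pi.single_apply, hb.symm]
      · simp
    have h3 : ∑ i, v i * C (s.γ i * (s.γ j0)⁻¹ * (Pi.single j0 1 : ι → K) j) =
        (∑ i, s.γ i • v i) * C ((s.γ j0)⁻¹ * (Pi.single j0 1 : ι → K) j) := by
      rw [sum_mul]; refine sum_congr rfl fun i _ => ?_; rw [smul_eq_C_mul, mul_assoc (s.γ i), map_mul]; ring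
    rw [h2, h3, hs, zero_mul, sub_zero]

lemma wlift {m : ℤ} (v : ι → MP K d) (hv : ∀ j, v j ∈ HG m) (hs : ∑ j, s.γ j • v j = 0) :
    ∃ a ∈ HG (m + 1), ∀ j, Lo (-1) (s.Φ j a) ∧ (s.Φ j a).coeff (-1) = v j := by
  obtain ⟨x, hx, h⟩ := s.wlift' v hs; exact ⟨_, sum_mem fun i _ => HG_mul (s.P_HG (hv i)) (hx i), h⟩

end Setup
end AMDP
namespace AMDP

variable {K : Type} [Field K] {d : ℕ}
namespace Setup
variable {r : ℕ} {I : Ideal (PS K r)} {c : ℕ} {ι : Type} [Fintype ι] (s : Setup K r I d c ι)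

lemma reduce [DecidableEq ι] {m : ℤ} {G : ι → LS K d} (hG : G ∈ s.HD (m + 1)) (h1 : ∀ j, Lo (-1) (G j)) (a : ι) :
    ∃ Z ∈ s.HD (m + 1), (∀ j, Lo (-1) (Z j)) ∧ ∀ j, (Z j).coeff (-1) = if j = a then (s.γ a)⁻¹ • ∑ i, s.γ i • (G i).coeff (-1) else 0 := by
  classical
  have hc : ∀ j, (G j).coeff (-1) ∈ HG m := fun j => by
    have := hG.2 j (-1); rwa [add_neg_cancel_right] at this
  set g := ∑ i, s.γ i • (G i).coeff (-1) with hg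
  have hgm : g ∈ HG m := sum_mem fun i _ => smul_mem _ _ (hc i); obtain ⟨x, hx, hxs⟩ := s.wlift (m := m)
    (fun j => (G j).coeff (-1) - if j = a then (s.γ a)⁻¹ • g else 0)
    (fun j => sub_mem (hc j) (by
      split_ifs
      · exact smul_mem _ _ hgm
      · exact zero_mem _)) (by
      simp only [smul_sub, sum_sub_distrib, smul_ite, smul_zero]; rw [Finset.sum_ite_eq' Finset.univ a, if_pos (mem_univ _), smul_smul,
        mul_inv_cancel₀ (s.γne a), one_smul, ← hg, sub_self])
  refine ⟨G - s.F x, sub_mem hG (s.HD_F hx), fun j => (h1 j).sub (hxs j).1, fun j => ?_⟩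
  rw [Pi.sub_apply, F_apply, HahnSeries.coeff_sub, (hxs j).2, sub_sub_cancel]

lemma descend [DecidableEq ι] {a : ι} {k : ℕ} {h π : MP K d} {e : ℕ} (he : 0 < e)
    (hπ : π ∈ HG e) (hπ0 : π ≠ 0) (hh : h ∈ HG k) (hh0 : h ≠ 0)
    {Z : ι → LS K d} (hZ : Z ∈ s.HD ((k : ℤ) + 1)) (hZ1 : ∀ j, Lo (-1) (Z j)) (hZs : ∀ j, (Z j).coeff (-1) = if j = a then h else 0)
    (hd1 : ∀ j, ∀ i ≠ 0, π ∣ (Z j).coeff i) (hd0 : ∀ i j, π ∣ (Z i).coeff 0 - (Z j).coeff 0) : ∃ k' < k, ∃ h' ∈ HG (k' : ℤ), h' ≠ 0 ∧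
      ∃ Z' ∈ s.HD ((k' : ℤ) + 1), (∀ j, Lo (-1) (Z' j)) ∧ ∀ j, (Z' j).coeff (-1) = if j = a then h' else 0 := by
  have hf : (Z a).coeff 0 ∈ (HG ((k : ℤ) + 1) : Submodule K (MP K d)) := by
    have := hZ.2 a 0; rwa [add_zero] at this
  have h1 : ∀ j, ∃ g : LS K d, HC π * g = (Z - s.F (s.P ((Z a).coeff 0))) j := fun j => by
    apply hahn_div; intro i; rw [Pi.sub_apply, F_apply, ΦP, HahnSeries.coeff_sub]; by_cases hi : i = 0
    · subst hi; rw [coeff_C_zero']; exact hd0 j a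
    · rw [coeff_C_ne hi, sub_zero]; exact hd1 j i hi
  choose W hW using h1; have hD := sub_mem hZ (s.HD_F (s.P_HG hf))
  have hWc : ∀ j i, π * (W j).coeff i = ((Z - s.F (s.P ((Z a).coeff 0))) j).coeff i := fun j i => by rw [← hW j, coeff_Cmul]
  have hW1 : ∀ j, Lo (-1) (W j) := fun j i hi => by
    have h2 := hWc j i; rw [Pi.sub_apply, F_apply, ΦP, HahnSeries.coeff_sub, hZ1 j i hi, coeff_C_ne (by omega), sub_zero] at h2
    exact (mul_eq_zero.1 h2).resolve_left hπ0
  have hWs : ∀ j, π * (W j).coeff (-1) = if j = a then h else 0 := fun j => by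
    rw [hWc, Pi.sub_apply, F_apply, ΦP, HahnSeries.coeff_sub, hZs, coeff_C_ne (by omega), sub_zero]
  have hha : π * (W a).coeff (-1) = h := by rw [hWs, if_pos rfl]
  have hne : (W a).coeff (-1) ≠ 0 := fun h3 => hh0 (by rw [← hha, h3, mul_zero])
  have hhd : (W a).coeff (-1) ∈ (HG ((k : ℤ) - e) : Submodule K (MP K d)) := HG_div hπ hπ0 (by rw [hha]; exact hh)
  have hek : (e : ℤ) ≤ k := by
    by_contra hcon; exact hne (HG_zero_of_neg (by omega) hhd)
  have hek' : e ≤ k := by exact_mod_cast hek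
  refine ⟨k - e, by omega, (W a).coeff (-1), ?_, hne, W, ⟨?_, ?_⟩, hW1, ?_⟩
  · rwa [Nat.cast_sub hek']
  · refine s.HH_div hπ0 ?_; have : (fun j => HC π * W j) = Z - s.F (s.P ((Z a).coeff 0)) := funext hW; rw [this]; exact hD.1
  · intro j i; have h3 := hD.2 j i; rw [← hWc] at h3; have h4 := HG_div hπ hπ0 h3; rw [Nat.cast_sub hek']; convert h4 using 2; ring
  · intro j
    split_ifs with hj
    · rw [hj]
    · have h5 := hWs j; rw [if_neg hj] at h5; exact (mul_eq_zero.1 h5).resolve_left hπ0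

lemma caseB [DecidableEq ι] (hc : 1 ≤ c) {a0 : ι} {k : ℤ} {h π : MP K d} (hπ : Prime π) (hh : h ∈ HG k) (hdvd : π ∣ h)
    {Z : ι → LS K d} (hZ : Z ∈ s.HD (k + 1)) (hZ1 : ∀ j, Lo (-1) (Z j)) (hZs : ∀ j, (Z j).coeff (-1) = if j = a0 then h else 0)
    (hB : ∀ (m : ℤ), ∀ G ∈ s.HD (m + 1), (∀ j, Lo (-1) (G j)) → π ∣ ∑ j, s.γ j • (G j).coeff (-1)) :
    (∀ j, ∀ i ≠ 0, π ∣ (Z j).coeff i) ∧ (∀ i j, π ∣ (Z i).coeff 0 - (Z j).coeff 0) := by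
  have hp : (Ideal.span {π} : Ideal (MP K d)).IsPrime := (Ideal.span_singleton_prime hπ.ne_zero).2 hπ; constructor
  · intro j i hi; rw [← Ideal.mem_span_singleton]; refine s.const_mod _ hZ.1 (fun j i hi => ?_) j hi; rw [Ideal.mem_span_singleton]
    by_cases h1 : i = -1
    · subst h1; rw [hZs]; split_ifs
      · exact hdvd
      · exact dvd_zero _
    · rw [hZ1 j i (by omega)]; exact dvd_zero _
  · intro i j; by_cases hij : i = j
    · subst hij; simp
    obtain ⟨a, ha⟩ : ∃ a, a ∉ ({i, j} : Finset ι) := by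
      by_contra hcon
      push Not at hcon
      have h1 := Finset.card_le_card (fun x _ => hcon x : (Finset.univ : Finset ι) ⊆ {i, j})
      have h2 := Finset.card_le_two (a := i) (b := j); rw [card_univ, s.card] at h1; omega
    simp only [Finset.mem_insert, Finset.mem_singleton, not_or] at ha
    obtain ⟨x', hx', hxs'⟩ := s.symb_surj (fun t => (s.γ a0 / s.γ a) * (Pi.single a 1 : ι → K) t - (Pi.single a0 1 : ι → K) t) (by
      have := s.γne a; simp [mul_sub, sum_sub_distrib, Pi.single_apply]; field_simp; simp)
    obtain ⟨x, hx, hxs⟩ := s.symb_surj (fun t => (s.γ i)⁻¹ * (Pi.single i 1 : ι → K) t - (s.γ j)⁻¹ * (Pi.single j 1 : ι → K) t) (by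
      have := s.γne i; have := s.γne j; simp [mul_sub, sum_sub_distrib, Pi.single_apply]; field_simp; simp)
    set Z' := Z + s.F (s.P h * x') with hZ'
    have hZ'D : Z' ∈ s.HD (k + 1) := add_mem hZ (s.HD_F (HG_mul (s.P_HG hh) hx'))
    have hxL : ∀ t, Lo (-1) (s.Φ t x) := fun t => GG_lo (s.gr t 1 x hx)
    have hxL' : ∀ t, Lo (-1) (s.Φ t x') := fun t => GG_lo (s.gr t 1 x' hx')
    have hZ'c : ∀ t e, (Z' t).coeff e = (Z t).coeff e + h * (s.Φ t x').coeff e := fun t e => by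
      rw [hZ', Pi.add_apply, F_apply, map_mul, ΦP, HahnSeries.coeff_add, coeff_Cmul]
    have hZ'L : ∀ t, Lo (-1) (Z' t) := fun t e he => by rw [hZ'c, hZ1 t e he, hxL' t e he]; simp
    have hZ's : ∀ t, (Z' t).coeff (-1) = h * C ((s.γ a0 / s.γ a) * (Pi.single a 1 : ι → K) t) := fun t => by
      rw [hZ'c, hZs, hxs']; by_cases ht : t = a0
      · subst ht; simp; ring
      · rw [if_neg ht]; simp [ht]
    have hGL : ∀ t, Lo (-1) ((Z' * s.F x) t) := fun t e he => by
      rw [Pi.mul_apply, F_apply]; by_cases h2 : e = -2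
      · have := coeff_mul_lo0 (hZ'L t) (hxL t); rw [h2]; have e2 : (-2 : ℤ) = -1 + -1 := by norm_num
        rw [e2, this, hZ's, hxs]; by_cases h3 : t = a
        · subst h3; simp [Ne.symm ha.1, Ne.symm ha.2, ha.1, ha.2]
        · simp [h3]
      · exact ((hZ'L t).mul (hxL t)) e (by omega)
    have hGD : Z' * s.F x ∈ s.HD ((k + 1) + 1) := s.HD_mul hZ'D (s.HD_F hx); have h4 := hB _ _ hGD hGL
    have h5 : ∀ t, ((Z' * s.F x) t).coeff (-1) =
        h * (C ((s.γ a0 / s.γ a) * (Pi.single a 1 : ι → K) t) * (s.Φ t x).coeff 0 + (s.Φ t x').coeff 0 * (s.Φ t x).coeff (-1))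
          + (Z t).coeff 0 * (s.Φ t x).coeff (-1) := by
      intro t; have := coeff_mul_lo1 (hZ'L t) (hxL t); have e2 : (-1 : ℤ) + -1 + 1 = -1 := by norm_num
      rw [e2] at this; rw [Pi.mul_apply, F_apply, this, hZ's]; have e3 : (-1 : ℤ) + 1 = 0 := by norm_num
      rw [e3, hZ'c]; ring
    simp_rw [h5, smul_add, sum_add_distrib, ← mul_smul_comm] at h4; rw [← mul_sum, dvd_add_right (Dvd.dvd.mul_right hdvd _)] at h4
    convert h4 using 1; simp_rw [hxs, map_sub]
    have h6 : ∀ b : ι, ∑ t, (Z t).coeff 0 * s.γ t • C ((s.γ b)⁻¹ * (Pi.single b 1 : ι → K) t) = (Z b).coeff 0 := fun b => by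
      rw [sum_eq_single b]
      · rw [smul_eq_C_mul, ← map_mul]; simp [s.γne b]
      · intro t _ ht; simp [ht]
      · simp
    simp_rw [smul_sub, mul_sub, sum_sub_distrib]; rw [h6, h6]

/-- The case where an element of `HD` with simple poles has symbol outside `γ^⊥`. -/
theorem case_two [DecidableEq ι] (hc : 1 ≤ c) (hex : ∃ m : ℤ, ∃ G ∈ s.HD m, (∀ j, Lo (-1) (G j)) ∧ ∑ j, s.γ j • (G j).coeff (-1) ≠ 0) :
    ∃ η : ι → (ι → LS K d), (∀ i, η i ∈ s.HD 1) ∧ ∀ i j, (η i j).coeff (-1) = if j = i then 1 else 0 := by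
  classical
  have hne := s.nonempty; obtain ⟨a0⟩ := s.nonempty
  have key : ∀ (m : ℤ), ∀ G ∈ s.HD (m + 1), (∀ j, Lo (-1) (G j)) → ∑ j, s.γ j • (G j).coeff (-1) ≠ 0 → ∃ k : ℕ, m = k := fun m G hG h1 h2 => by
    by_contra hcon
    push Not at hcon
    apply h2; refine HG_zero_of_neg (D := m) ?_ (sum_mem fun j _ => smul_mem _ _ ?_)
    · by_contra h3
      push Not at h3
      obtain ⟨k, hk⟩ := Int.eq_ofNat_of_zero_le h3; exact hcon k hk
    · have := hG.2 j (-1); rwa [add_neg_cancel_right] at this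
  let Q : ℕ → Prop := fun k => ∃ h' ∈ HG k, h' ≠ 0 ∧ ∃ Z' ∈ s.HD ((k : ℤ) + 1), (∀ j, Lo (-1) (Z' j)) ∧
      ∀ j, (Z' j).coeff (-1) = if j = a0 then h' else 0
  have hQ : ∃ k, Q k := by
    obtain ⟨m, G, hG, h1, h2⟩ := hex; have e : m = (m - 1) + 1 := by ring
    rw [e] at hG; obtain ⟨k, hk⟩ := key _ G hG h1 h2; rw [hk] at hG; obtain ⟨Z, hZ, hZ1, hZs⟩ := s.reduce hG h1 a0
    refine ⟨k, _, ?_, ?_, Z, hZ, hZ1, hZs⟩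
    · have := hZ.2 a0 (-1); rwa [add_neg_cancel_right, hZs, if_pos rfl] at this
    · exact smul_ne_zero (inv_ne_zero (s.γne a0)) h2
  obtain ⟨h, hh, hh0, Z, hZ, hZ1, hZs⟩ := Nat.find_spec hQ
  set k := Nat.find hQ with hk
  have hk0 : k = 0 := by
    by_contra hk0; have hnu : ¬ IsUnit h := by
      intro hu; obtain ⟨a, ha, hab⟩ := MvPolynomial.isUnit_iff_eq_C_of_isReduced.1 hu; have h2 : h ∈ HG 0 := by rw [hab]; exact HG_C a
      have h3 := hcmp_of_mem h2; rw [hcmp_of_mem_ne hh (by omega)] at h3; exact hh0 h3.symm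
    obtain ⟨π, hπ, g, hg⟩ := WfDvdMonoid.exists_irreducible_factor hnu hh0; have hπp : Prime π := hπ.prime
    obtain ⟨e, he⟩ := HG_factor (p := π) (q := g) (by rw [← hg]; exact hh) (by rw [← hg]; exact hh0); have he0 : 0 < e := by
      rcases Nat.eq_zero_or_pos e with h0 | h0
      · exfalso; subst h0; have h4 := HG_zero_eq he; apply hπ.not_isUnit; rw [h4]; refine IsUnit.map C (isUnit_iff_ne_zero.2 ?_); intro h5
        rw [h5, map_zero] at h4; exact hπp.ne_zero h4
      · exact h0
    have hdvd : π ∣ h := ⟨g, hg⟩; have hcl : (∀ j, ∀ i ≠ 0, π ∣ (Z j).coeff i) ∧ (∀ i j, π ∣ (Z i).coeff 0 - (Z j).coeff 0) := by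
      by_cases hB : ∀ (m : ℤ), ∀ G ∈ s.HD (m + 1), (∀ j, Lo (-1) (G j)) → π ∣ ∑ j, s.γ j • (G j).coeff (-1)
      · exact s.caseB hc hπp hh hdvd hZ hZ1 hZs hB
      · push Not at hB
        obtain ⟨m, G, hG, hG1, hGn⟩ := hB; obtain ⟨Z', hZ', hZ'1, hZ's⟩ := s.reduce hG hG1 a0
        set h' := (s.γ a0)⁻¹ • ∑ i, s.γ i • (G i).coeff (-1) with hh'
        have hn' : ¬ π ∣ h' := by
          intro hd; apply hGn; have : ∑ i, s.γ i • (G i).coeff (-1) = C (s.γ a0) * h' := by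
            rw [hh', ← smul_eq_C_mul, smul_smul, mul_inv_cancel₀ (s.γne a0), one_smul]
          rw [this]; exact Dvd.dvd.mul_left hd _
        obtain ⟨p, hp⟩ := s.U1 (G := s.F (s.P h) * Z' - s.F (s.P h') * Z)
          (s.HH.sub_mem (s.HH.mul_mem (s.F_HH _) hZ'.1) (s.HH.mul_mem (s.F_HH _) hZ.1)) (by
            intro j i hi; simp only [Pi.sub_apply, Pi.mul_apply, F_apply, ΦP, HahnSeries.coeff_sub, coeff_Cmul]; by_cases h1 : i = -1
            · subst h1; rw [hZs, hZ's]; split_ifs <;> ring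
            · rw [hZ1 j i (by omega), hZ'1 j i (by omega)]; ring)
        have hp2 : ∀ j i, h * (Z' j).coeff i - h' * (Z j).coeff i = (HC p : LS K d).coeff i := fun j i => by
          rw [← hp j]; simp only [Pi.sub_apply, Pi.mul_apply, F_apply, ΦP, HahnSeries.coeff_sub, coeff_Cmul]
        constructor
        · intro j i hi; have h1 := hp2 j i; rw [coeff_C_ne hi, sub_eq_zero] at h1
          have h2 : π ∣ h' * (Z j).coeff i := by rw [← h1]; exact Dvd.dvd.mul_right hdvd _
          exact (hπp.dvd_or_dvd h2).resolve_left hn'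
        · intro i j; have h1 := (hp2 i 0).trans (hp2 j 0).symm; have h2 : π ∣ h' * ((Z i).coeff 0 - (Z j).coeff 0) := by
            have : h' * ((Z i).coeff 0 - (Z j).coeff 0) = h * ((Z' i).coeff 0 - (Z' j).coeff 0) := by linear_combination -h1
            rw [this]; exact Dvd.dvd.mul_right hdvd _
          exact (hπp.dvd_or_dvd h2).resolve_left hn'
    obtain ⟨k', hk', hh'⟩ := s.descend he0 he hπp.ne_zero hh hh0 hZ hZ1 hZs hcl.1 hcl.2; exact Nat.find_min hQ hk' hh'
  rw [hk0] at hh hZ; have hhC := HG_zero_eq hh; set b := coeff 0 h; have hb0 : b ≠ 0 := fun h0 => hh0 (by rw [hhC, h0, map_zero])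
  have hη : ∀ i, ∃ W ∈ s.HD 1, ∀ j, (W j).coeff (-1) = if j = i then 1 else 0 := fun i => by
    obtain ⟨W, hW, hW1, hWs⟩ := s.reduce hZ hZ1 i; have h1 : ∑ t, s.γ t • (Z t).coeff (-1) = C (s.γ a0 * b) := by
      simp_rw [hZs]; simp only [smul_ite, smul_zero]
      rw [Finset.sum_ite_eq' Finset.univ a0, if_pos (mem_univ _), smul_eq_C_mul, hhC, ← map_mul]
    refine ⟨(s.γ i * (s.γ a0 * b)⁻¹) • W, smul_mem _ _ (by simpa using hW), fun j => ?_⟩; rw [Pi.smul_apply, HahnSeries.coeff_smul, hWs, h1]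
    split_ifs
    · rw [smul_smul, smul_eq_C_mul, ← map_mul]; have h3 := s.γne i; have h4 := s.γne a0
      rw [show s.γ i * (s.γ a0 * b)⁻¹ * (s.γ i)⁻¹ * (s.γ a0 * b) = 1 by field_simp, map_one]
    · rw [smul_zero]
  choose η h1 h2 using hη; exact ⟨η, h1, h2⟩

end Setup
end AMDP
namespace AMDP

variable {K : Type} [Field K] {d : ℕ}

/-- Index type with `c + 2` elements. -/
abbrev TT (c : ℕ) : Type := Option (Option (Fin c))

lemma lo_exists {R : Type} [CommRing R] (f : HahnSeries ℤ R) : ∃ a, Lo a f := by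
  by_cases h : f = 0
  · exact ⟨0, by rw [h]; exact Lo.zero⟩
  · exact ⟨f.order, fun i hi => HahnSeries.coeff_eq_zero_of_lt_order hi⟩

lemma frame_indep {T ι : Type} [Fintype T] [Fintype ι] [DecidableEq T] (e : T → ι → LS K d) (δ : T → ℕ)
    (hlo : ∀ t j, Lo (-(δ t : ℤ)) (e t j)) (V : Matrix T ι K)
    (hV : ∀ t j, (e t j).coeff (-(δ t : ℤ)) = C (V t j)) (M : Matrix ι T K) (hVM : V * M = 1)
    (f : T → LS K d) (h : ∀ j, ∑ t, f t * e t j = 0) (t : T) : f t = 0 := by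
  classical
  choose a ha using fun t => lo_exists (f t); let b : ℤ := ∑ t, (-|a t - δ t|); have hb : ∀ t, Lo (b + δ t) (f t) := fun t => by
    refine (ha t).mono ?_; have h1 : b ≤ -|a t - δ t| := by
      rw [show b = _ from (Finset.add_sum_erase _ _ (mem_univ t)).symm]
      have : ∑ x ∈ Finset.univ.erase t, (-|a x - δ x|) ≤ 0 := Finset.sum_nonpos fun i _ => by simp
      linarith
    have h2 := neg_abs_le (a t - δ t); linarith
  have key : ∀ N : ℕ, ∀ t, Lo (b + N + δ t) (f t) := fun N => by
    induction N with
    | zero => intro t; simpa using hb t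
    | succ N ih =>
      have h1 : ∀ j, ∑ t, (f t).coeff (b + N + δ t) * C (V t j) = 0 := fun j => by
        have h2 := congrArg (fun g => HahnSeries.coeff g (b + N)) (h j); simp only [HahnSeries.coeff_sum, HahnSeries.coeff_zero] at h2
        rw [← h2]; refine sum_congr rfl fun t _ => ?_; rw [← hV, ← coeff_mul_lo0 (ih t) (hlo t j), add_neg_cancel_right]
      have h3 : ∀ s, (f s).coeff (b + N + δ s) = 0 := fun s => by
        have h4 : ∑ j, (∑ t, (f t).coeff (b + N + δ t) * C (V t j)) * C (M j s) = 0 := by simp [h1]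
        simp_rw [sum_mul, mul_assoc, ← map_mul] at h4; rw [sum_comm] at h4; simp_rw [← mul_sum, ← map_sum] at h4
        have h5 : ∀ t, ∑ j, V t j * M j s = (1 : Matrix T T K) t s := fun t => by rw [← hVM, Matrix.mul_apply]
        simp_rw [h5, Matrix.one_apply] at h4; rw [sum_eq_single s] at h4
        · simpa using h4
        · intro b _ hb; simp [hb]
        · simp
      intro t i hi; by_cases h6 : i = b + N + δ t
      · rw [h6, h3]
      · exact ih t i (by push_cast at hi; omega)
  ext1
  funext i; rw [HahnSeries.coeff_zero]; refine key (i - b - δ t + 1).toNat t i ?_; have := Int.self_le_toNat (i - b - δ t + 1); linarith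

namespace Setup
variable {r : ℕ} {I : Ideal (PS K r)} {c : ℕ}

section gen
variable {ι : Type} [Fintype ι] (s : Setup K r I d c ι)

/-- The Noether normalization. -/
def ρ : PS K d →ₐ[K] PS K r := aeval (Fin.cons s.l0 s.l : Fin (d + 1) → PS K r)

lemma ρ_X0 : s.ρ (X 0) = s.l0 := by simp [ρ]
lemma ρ_Xs (i : Fin d) : s.ρ (X i.succ) = s.l i := by simp [ρ]

lemma ρ_HG {m : ℤ} {p : PS K d} (hp : p ∈ HG m) : s.ρ p ∈ HG m := by
  refine HG_aeval (fun i => ?_) hp; refine Fin.cases ?_ (fun i => ?_) i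
  · exact s.l0d
  · exact s.ld i

lemma ρ_ren (p : MP K d) : s.ρ (rename Fin.succ p) = s.P p := by rw [ρ, aeval_rename, P]; congr 1

lemma ren_HG {m : ℤ} {p : MP K d} (hp : p ∈ HG m) : rename Fin.succ p ∈ HG m :=
  HG_algHom (rename Fin.succ) (fun i => by rw [rename_X]; exact HG_X _) hp

lemma Φρ (j : ι) (f : PS K d) : s.Φ j (s.ρ f) = (finSuccEquiv K d f).eval₂ (HC : _ →+* LS K d) (HahnSeries.single (-1 : ℤ) 1) := by
  induction f using MvPolynomial.induction_on with
  | C a =>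
    have h1 : s.ρ (MvPolynomial.C a) = algebraMap K _ a := by simp [ρ]
    rw [h1, AlgHom.commutes, HahnSeries.algebraMap_apply]
    rw [show (finSuccEquiv K d) (MvPolynomial.C a) = PC (MvPolynomial.C a) by simp [finSuccEquiv_apply], Polynomial.eval₂_C]; rfl
  | add p q hp hq => rw [map_add, map_add, hp, hq, map_add, Polynomial.eval₂_add]
  | mul_X p i hp =>
    rw [map_mul, map_mul, hp, map_mul, Polynomial.eval₂_mul]; congr 1; refine Fin.cases ?_ (fun i => ?_) i
    · rw [ρ_X0, s.Φl0, finSuccEquiv_X_zero, Polynomial.eval₂_X]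
    · rw [ρ_Xs, s.Φl, finSuccEquiv_X_succ, Polynomial.eval₂_C]

lemma Φρ_const (j j' : ι) (f : PS K d) : s.Φ j (s.ρ f) = s.Φ j' (s.ρ f) := by rw [Φρ, Φρ]

lemma Φρ_coeff (j : ι) (f : PS K d) (k : ℕ) : (s.Φ j (s.ρ f)).coeff (-(k : ℤ)) = (finSuccEquiv K d f).coeff k := by
  rw [Φρ, Polynomial.eval₂_eq_sum_range, HahnSeries.coeff_sum]
  have h1 : ∀ n : ℕ, (HC ((finSuccEquiv K d f).coeff n) * (HahnSeries.single (-1 : ℤ) (1 : MP K d)) ^ n).coeff (-(k : ℤ)) =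
      if n = k then (finSuccEquiv K d f).coeff n else 0 := by
    intro n; rw [HahnSeries.single_pow, coeff_Cmul, one_pow]
    split_ifs with h
    · subst h; simp
    · rw [HahnSeries.coeff_single_of_ne, mul_zero]; simp; omega
  simp_rw [h1]; rw [Finset.sum_ite_eq' _ k]
  split_ifs with h
  · rfl
  · rw [Polynomial.coeff_eq_zero_of_natDegree_lt]; simp at h; omega

lemma Φρ_inj (j : ι) {f : PS K d} (h : s.Φ j (s.ρ f) = 0) : f = 0 := by
  apply (finSuccEquiv K d).injective; rw [map_zero]
  ext1 k
  rw [← s.Φρ_coeff j, h]; simp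

end gen

variable (s : Setup K r I d c (TT c))

/-- The symbols of the chosen frame. -/
def V : Matrix (TT c) (TT c) K := fun t j => match t with
  | none => 1
  | some none => if j = none then 1 else 0
  | some (some i) => (if j = some (some i) then (s.γ (some (some i)))⁻¹ else 0)
      - (if j = none then (s.γ none)⁻¹ else 0)

lemma γV_none : ∑ j, s.γ j * s.V none j = 0 := by
  have h1 := congrArg constantCoeff (s.γsum s.l0 s.l0d); simp_rw [s.Φl0] at h1; simpa [V, smul_eq_C_mul] using h1

lemma γV_ss (i : Fin c) : ∑ j, s.γ j * s.V (some (some i)) j = 0 := by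
  have h1 := s.γne none; have h2 := s.γne (some (some i)); simp [V, mul_sub, sum_sub_distrib, h1, h2]

lemma γV_sn : ∑ j, s.γ j * s.V (some none) j = s.γ none := by simp [V]

lemma γV (t : TT c) : ∑ j, s.γ j * s.V t j = if t = some none then s.γ none else 0 := by
  rcases t with _ | _ | i
  · simpa using s.γV_none
  · simpa using s.γV_sn
  · simpa using s.γV_ss i

lemma exists_M : ∃ M : Matrix (TT c) (TT c) K, s.V * M = 1 ∧ M * s.V = 1 := by
  have h : IsUnit s.V := by
    rw [← Matrix.vecMul_injective_iff_isUnit]; apply (injective_iff_map_eq_zero (Matrix.vecMulLinear s.V)).2; intro x hx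
    have hx' : ∀ j, ∑ t, x t * s.V t j = 0 := fun j => congrFun hx j; have h1 : x (some none) = 0 := by
      have h2 : ∑ j, s.γ j * ∑ t, x t * s.V t j = 0 := by simp [hx']
      simp_rw [mul_sum] at h2; rw [sum_comm] at h2; simp_rw [mul_left_comm, ← mul_sum] at h2; simp_rw [γV] at h2
      simpa [s.γne none] using h2
    have h3 : x none = 0 := by
      have h4 := hx' (some none); rw [sum_option, sum_option] at h4; simpa [V] using h4
    funext t
    rcases t with _ | _ | i
    · exact h3
    · exact h1
    · have h4 := hx' (some (some i)); rw [sum_option, sum_option] at h4; simpa [V, h1, h3, s.γne (some (some i))] using h4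
  obtain ⟨u, hu⟩ := h; exact ⟨(u⁻¹ : (Matrix (TT c) (TT c) K)ˣ), by rw [← hu]; simp, by rw [← hu]; simp⟩

lemma exists_y : ∃ y : Fin c → PS K r, (∀ i, y i ∈ HG 1) ∧ ∀ i j, (s.Φ j (y i)).coeff (-1) = C (s.V (some (some i)) j) := by
  have h := fun i => s.symb_surj _ (s.γV_ss i); choose y hy h2 using h; exact ⟨y, hy, h2⟩

/-- Free bases. -/
structure Frame (q : ℕ) where
  e : TT c → TT c → LS K d
  δ : TT c → ℕ
  hδ : ∀ t, δ t ≤ q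
  mem : ∀ t, e t ∈ s.HD (δ t)
  hV : ∀ t j, (e t j).coeff (-(δ t : ℤ)) = C (s.V t j)
  e1 : e none = 1
  δ1 : δ none = 0
  y : Fin c → PS K r
  yd : ∀ i, y i ∈ HG 1
  ey : ∀ i, e (some (some i)) = s.F (y i)
  δy : ∀ i, δ (some (some i)) = 1

namespace Frame
variable {s} {q : ℕ} (fr : s.Frame q)

lemma lo (t j : TT c) : Lo (-(fr.δ t : ℤ)) (fr.e t j) := GG_lo ((fr.mem t).2 j)

lemma indep (f : TT c → PS K d) (h : ∑ t, s.F (s.ρ (f t)) * fr.e t = 0) (t : TT c) : f t = 0 := by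
  obtain ⟨M, hM, -⟩ := s.exists_M; apply s.Φρ_inj none
  refine frame_indep fr.e fr.δ fr.lo s.V fr.hV M hM (fun t => s.Φ none (s.ρ (f t))) (fun j => ?_) t; have h1 := congrFun h j
  rw [Finset.sum_apply] at h1; rw [← Pi.zero_apply (M := fun _ => LS K d) j, ← h1]; refine sum_congr rfl fun t _ => ?_
  rw [Pi.mul_apply, F_apply, s.Φρ_const none j]

/-- The graded pieces of the free module. -/
def Sp (D : ℤ) : Submodule K (TT c → LS K d) where
  carrier := {G | ∃ f : TT c → PS K d, (∀ t, f t ∈ HG (D - fr.δ t)) ∧ G = ∑ t, s.F (s.ρ (f t)) * fr.e t}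
  add_mem' := by
    rintro _ _ ⟨f, hf, rfl⟩ ⟨g, hg, rfl⟩; refine ⟨f + g, fun t => add_mem (hf t) (hg t), ?_⟩; simp [add_mul, sum_add_distrib]
  zero_mem' := ⟨0, fun t => zero_mem _, by simp⟩
  smul_mem' := by
    rintro a _ ⟨f, hf, rfl⟩; refine ⟨a • f, fun t => smul_mem _ _ (hf t), ?_⟩; rw [smul_sum]; refine sum_congr rfl fun t _ => ?_
    rw [Pi.smul_apply, map_smul, map_smul, smul_mul_assoc]

lemma Sp_mul {k D : ℤ} {a : PS K d} (ha : a ∈ HG k) {G : TT c → LS K d} (hG : G ∈ fr.Sp D) : s.F (s.ρ a) * G ∈ fr.Sp (k + D) := by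
  obtain ⟨f, hf, rfl⟩ := hG; refine ⟨fun t => a * f t, fun t => ?_, ?_⟩
  · have := HG_mul ha (hf t); rwa [← add_sub_assoc] at this
  · rw [mul_sum]; refine sum_congr rfl fun t _ => ?_; rw [map_mul, map_mul, mul_assoc]

lemma Sp_e (t : TT c) : fr.e t ∈ fr.Sp (fr.δ t) := by
  classical
  refine ⟨fun t' => if t' = t then 1 else 0, fun t' => ?_, ?_⟩
  · dsimp only
    split_ifs with h
    · subst h; rw [sub_self]; exact HG_one
    · exact zero_mem _
  · rw [sum_eq_single t]
    · simp
    · intro b _ hb; simp [hb]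
    · simp

lemma Sp_HD (D : ℤ) : fr.Sp D ≤ s.HD D := by
  rintro _ ⟨f, hf, rfl⟩; refine sum_mem fun t _ => ?_; have := s.HD_mul (s.HD_F (s.ρ_HG (hf t))) (fr.mem t); rwa [sub_add_cancel] at this

lemma Sp_ρ {D : ℤ} {a : PS K d} (ha : a ∈ HG D) : s.F (s.ρ a) ∈ fr.Sp D := by
  have := fr.Sp_mul ha (fr.Sp_e none); rwa [fr.e1, mul_one, fr.δ1, Nat.cast_zero, add_zero] at this

lemma Sp_P {D : ℤ} {a : MP K d} (ha : a ∈ HG D) : s.F (s.P a) ∈ fr.Sp D := by rw [← s.ρ_ren]; exact fr.Sp_ρ (ren_HG ha)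

lemma Sp_Pmul {k D : ℤ} {a : MP K d} (ha : a ∈ HG k) {G : TT c → LS K d} (hG : G ∈ fr.Sp D) : s.F (s.P a) * G ∈ fr.Sp (k + D) := by
  rw [← s.ρ_ren]; exact fr.Sp_mul (ren_HG ha) hG

/-- Linear forms in terms of the frame. -/
lemma lin_span {x : PS K r} (hx : x ∈ HG 1) : ∃ (a : K) (p : MP K d) (b : Fin c → K),
    p ∈ HG 1 ∧ x = a • s.l0 + s.P p + ∑ i, b i • fr.y i := by
  classical
  have := s.nonempty; obtain ⟨M, hM, hM'⟩ := s.exists_M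
  set v : TT c → K := s.symb ⟨x, hx⟩ with hv
  have hvx : ∀ j, (s.Φ j x).coeff (-1) = C (v j) := fun j => s.coeffC hx j
  obtain ⟨b, hvb⟩ : ∃ b : TT c → K, ∀ j, v j = ∑ t, b t * s.V t j := by
    refine ⟨fun t => ∑ j, v j * M j t, fun j => ?_⟩; simp_rw [sum_mul, mul_assoc]; rw [sum_comm]
    simp_rw [← mul_sum, ← Matrix.mul_apply, hM', Matrix.one_apply]; simp
  have hγ : ∑ j, s.γ j * v j = 0 := by
    have h1 := congrArg constantCoeff (s.γsum x hx); simp_rw [hvx] at h1; simpa [smul_eq_C_mul] using h1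
  have hb0 : b (some none) = 0 := by
    have hγ' : ∑ j, s.γ j * ∑ t, b t * s.V t j = 0 := by rw [← hγ]; exact sum_congr rfl fun j _ => by rw [← hvb j]
    simp_rw [mul_sum] at hγ'; rw [sum_comm] at hγ'; simp_rw [mul_left_comm, ← mul_sum, γV] at hγ'; simpa [s.γne none] using hγ'
  set z := x - (b none • s.l0 + ∑ i, b (some (some i)) • fr.y i) with hz
  have hzd : z ∈ HG 1 := sub_mem hx (add_mem (smul_mem _ _ s.l0d) (sum_mem fun i _ => smul_mem _ _ (fr.yd i)))
  have hyc : ∀ i j, (s.Φ j (fr.y i)).coeff (-1) = C (s.V (some (some i)) j) := fun i j => by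
    have := fr.hV (some (some i)) j; rwa [fr.ey, fr.δy, F_apply] at this
  have hzL : ∀ j, Lo 0 (s.F z j) := fun j i hi => by
    rw [F_apply]; by_cases h : i = -1
    · subst h; rw [hz, map_sub, map_add, map_sum, HahnSeries.coeff_sub, HahnSeries.coeff_add, HahnSeries.coeff_sum]
      simp_rw [map_smul, HahnSeries.coeff_smul]; simp_rw [hyc]; rw [hvx, s.Φl0, hvb, sum_option, sum_option, hb0]; simp [V, smul_eq_C_mul]
    · exact GG_lo (s.gr j 1 z hzd) i (by omega)
  obtain ⟨p, hp, hzp⟩ := s.U1' (s.HD_F hzd) hzL; have h4 := s.nondeg _ (s.F_eq hzp) (mem_HG_nat.1 (sub_mem hzd (s.P_HG hp)))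
  refine ⟨b none, p, fun i => b (some (some i)), hp, ?_⟩; rw [sub_eq_zero] at h4; rw [← h4, hz]; abel

lemma Sp_lin {x : PS K r} (hx : x ∈ HG 1) : s.F x ∈ fr.Sp 1 := by
  obtain ⟨a, p, b, hp, hxe⟩ := fr.lin_span hx; rw [hxe, map_add, map_add, map_sum, map_smul]
  refine add_mem (add_mem (smul_mem _ _ ?_) (fr.Sp_P hp))
    (sum_mem fun i _ => ?_)
  · rw [← s.ρ_X0]; exact fr.Sp_ρ (HG_X _)
  · rw [map_smul, ← fr.ey]; refine smul_mem _ _ ?_; have := fr.Sp_e (some (some i)); rwa [fr.δy] at this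

lemma linBasis : LinBasis K r (Fin (d + 1) ⊕ Fin c) (Sum.elim (fun i => s.ρ (X i)) fr.y) where
  deg := by
    rintro (i | i)
    · exact (mem_HG_nat (n := 1)).1 (s.ρ_HG (HG_X _))
    · exact (mem_HG_nat (n := 1)).1 (fr.yd i)
  span := by
    intro x hx; obtain ⟨a, p, b, hp, rfl⟩ := fr.lin_span ((mem_HG_nat (n := 1)).2 hx); refine add_mem (add_mem (smul_mem _ _ ?_) ?_)
      (sum_mem fun i _ => smul_mem _ _ ?_)
    · exact subset_span ⟨Sum.inl 0, by simp [s.ρ_X0]⟩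
    · rw [hom1_eq p ((mem_HG_nat (n := 1)).1 hp), map_sum]; refine sum_mem fun i _ => ?_; rw [map_smul]
      refine smul_mem _ _ (subset_span ⟨Sum.inl i.succ, ?_⟩); simp [s.ρ_Xs, P]
    · exact subset_span ⟨Sum.inr i, rfl⟩

/-- Reduction of poles. -/
lemma pole {m : ℤ} {G : TT c → LS K d} (hG : G ∈ s.HD m) : ∃ G' ∈ fr.Sp m, ∀ j, Lo (-(q : ℤ) + 1) ((G - G') j) := by
  classical
  obtain ⟨M, hM, hM'⟩ := s.exists_M
  have key : ∀ N : ℕ, ∀ G ∈ s.HD m, (∀ j, Lo (-(q : ℤ) + 1 - N) (G j)) → ∃ G' ∈ fr.Sp m, ∀ j, Lo (-(q : ℤ) + 1) ((G - G') j) := fun N => by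
    induction N with
    | zero => intro G _ h; exact ⟨0, zero_mem _, by simpa using h⟩
    | succ N ih =>
      intro G hG hL
      set v : TT c → MP K d := fun j => (G j).coeff (-(q + N : ℤ)) with hv
      have hvd : ∀ j, v j ∈ HG (m - (q + N)) := fun j => (hG.2 j _)
      set w : TT c → MP K d := fun t => ∑ j, v j * C (M j t) with hw
      have hwd : ∀ t, w t ∈ HG (m - (q + N)) := fun t => sum_mem fun j _ => by rw [mul_comm, ← smul_eq_C_mul]; exact smul_mem _ _ (hvd j)
      have hvw : ∀ j, ∑ t, w t * C (s.V t j) = v j := fun j => by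
        simp_rw [hw, sum_mul, mul_assoc, ← map_mul]; rw [sum_comm]
        simp_rw [← mul_sum, ← map_sum, ← Matrix.mul_apply, hM', Matrix.one_apply]; rw [sum_eq_single j]
        · simp
        · intro b _ hb; simp [hb]
        · simp
      set G1 : TT c → LS K d := ∑ t, s.F (s.ρ (rename Fin.succ (w t) * X 0 ^ (q + N - fr.δ t))) * fr.e t with hG1
      have hG1m : G1 ∈ fr.Sp m := by
        refine ⟨fun t => rename Fin.succ (w t) * X 0 ^ (q + N - fr.δ t), fun t => ?_, rfl⟩
        have h1 : (X 0 : PS K d) ^ (q + N - fr.δ t) ∈ HG ((q + N - fr.δ t : ℕ) : ℤ) := by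
          rw [mem_HG_nat]; simpa using (isHomogeneous_X K (0 : Fin (d+1))).pow (q + N - fr.δ t)
        have := HG_mul (ren_HG (hwd t)) h1; have hd := fr.hδ t; rw [Nat.cast_sub (by omega)] at this; convert this using 2; push_cast; ring
      have hterm : ∀ t j, (s.F (s.ρ (rename Fin.succ (w t) * X 0 ^ (q + N - fr.δ t))) * fr.e t) j =
          HC (w t) * (HahnSeries.single (-((q + N - fr.δ t : ℕ) : ℤ)) 1 * fr.e t j) := by
        intro t j; rw [Pi.mul_apply, F_apply, map_mul, map_mul, s.ρ_ren, s.ΦP, map_pow, map_pow, ρ_X0, s.Φl0,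
          HahnSeries.single_pow, one_pow, mul_assoc]
        simp
      have hsl : ∀ k : ℤ, Lo k (HahnSeries.single k (1 : MP K d)) := fun k i hi => HahnSeries.coeff_single_of_ne hi.ne
      have hd' : ∀ t, -((q + N - fr.δ t : ℕ) : ℤ) + -(fr.δ t : ℤ) = -(q + N : ℤ) := fun t => by
        have hd := fr.hδ t; omega
      have hG1L : ∀ j, Lo (-(q + N : ℤ)) (G1 j) := fun j => by
        rw [hG1, Finset.sum_apply]; refine Lo.sum fun t _ => ?_; rw [hterm]
        have := (Lo.C (w t)).mul ((hsl (-((q + N - fr.δ t : ℕ) : ℤ))).mul (fr.lo t j)); rwa [zero_add, hd'] at this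
      have hG1c : ∀ j, (G1 j).coeff (-(q + N : ℤ)) = v j := fun j => by
        rw [hG1, Finset.sum_apply, HahnSeries.coeff_sum, ← hvw]; refine sum_congr rfl fun t _ => ?_
        rw [hterm, coeff_Cmul, ← hd' t, coeff_mul_lo0 (hsl _) (fr.lo t j), fr.hV]; simp
      obtain ⟨G', hG', hL'⟩ := ih (G - G1) (sub_mem hG (fr.Sp_HD _ hG1m)) (by
        intro j i hi; rw [Pi.sub_apply, HahnSeries.coeff_sub]; by_cases h : i = -(q + N : ℤ)
        · rw [h, hG1c, hv, sub_self]
        · rw [hL j i (by push_cast; omega), hG1L j i (by omega), sub_zero])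
      refine ⟨G1 + G', add_mem hG1m hG', ?_⟩; rwa [← sub_sub]
  refine key (m + 1).toNat G hG fun j => (GG_lo (hG.2 j)).mono ?_; have := Int.self_le_toNat (m + 1); linarith

end Frame

/-- Structure in the non Cohen-Macaulay case. -/
lemma Frame.Sp_eq {s : Setup K r I d c (TT c)} (fr : s.Frame 1) (D : ℤ) : fr.Sp D = s.HD D := by
  have := s.nonempty; refine le_antisymm (fr.Sp_HD D) fun G hG => ?_; obtain ⟨G', hG', hL⟩ := fr.pole hG
  obtain ⟨p, hp, h⟩ := s.U1' (sub_mem hG (fr.Sp_HD _ hG')) (by simpa using hL); have : G = s.F (s.P p) + G' := by rw [← h]; abel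
  rw [this]; exact add_mem (fr.Sp_P hp) hG'

lemma frame_two (η : TT c → (TT c → LS K d)) (hη : ∀ i, η i ∈ s.HD 1)
    (hs : ∀ i j, (η i j).coeff (-1) = if j = i then 1 else 0) : ∃ fr : s.Frame 1, fr.e (some none) = η none ∧ fr.δ (some none) = 1 := by
  obtain ⟨y, hy, hys⟩ := s.exists_y
  refine ⟨⟨fun t => match t with
    | none => 1
    | some none => η none
    | some (some i) => s.F (y i), fun t => match t with
    | none => 0
    | some _ => 1, ?_, ?_, ?_, rfl, rfl, y, hy, fun i => rfl, fun i => rfl⟩, rfl, rfl⟩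
  · rintro (_ | t) <;> simp
  · rintro (_ | _ | i)
    · have := s.HD_F (HG_one (K := K)); rwa [map_one] at this
    · exact hη none
    · exact s.HD_F (hy i)
  · rintro (_ | _ | i) j
    · simp [V]
    · simp [V, hs]
    · exact hys i j

lemma frame_one (hc : 1 ≤ c) : ∃ (fr : s.Frame 2) (w : PS K r), fr.e (some none) = s.F w := by
  obtain ⟨y, hy, hys⟩ := s.exists_y; have h0 := s.γne none
  obtain ⟨x, hx, hxs⟩ := s.symb_surj (fun t => (if t = none then s.γ none else 0) -
      if t = some none then (s.γ none)^2 / s.γ (some none) else 0) (by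
    have := s.γne (some none); simp [mul_sub, sum_sub_distrib]; field_simp; simp)
  set i0 : TT c := some (some ⟨0, hc⟩) with hi0
  obtain ⟨x', hx', hxs'⟩ := s.symb_surj (fun t => (if t = none then (s.γ none)⁻¹ else 0) -
      if t = i0 then (s.γ i0)⁻¹ else 0) (by
    have := s.γne i0; simp [mul_sub, sum_sub_distrib]; field_simp; simp)
  have hL : ∀ j, Lo (-1) (s.Φ j x) := fun j => GG_lo (s.gr j 1 x hx); have hL' : ∀ j, Lo (-1) (s.Φ j x') := fun j => GG_lo (s.gr j 1 x' hx')
  refine ⟨⟨fun t => match t with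
    | none => 1
    | some none => s.F (x * x')
    | some (some i) => s.F (y i), fun t => match t with
    | none => 0
    | some none => 2
    | some (some i) => 1, ?_, ?_, ?_, rfl, rfl, y, hy, fun i => rfl, fun i => rfl⟩, x * x', rfl⟩
  · rintro (_ | _ | t) <;> simp
  · rintro (_ | _ | i)
    · have := s.HD_F (HG_one (K := K)); rwa [map_one] at this
    · exact s.HD_F (HG_mul hx hx')
    · exact s.HD_F (hy i)
  · rintro (_ | _ | i) j
    · simp [V]
    · have := coeff_mul_lo0 (hL j) (hL' j); show (s.F (x * x') j).coeff (-2) = _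
      rw [F_apply, map_mul, show (-2 : ℤ) = -1 + -1 by norm_num, this, hxs, hxs', ← map_mul]; congr 1
      rcases j with _ | _ | j
      · simp [V, hi0, h0]
      · simp [V, hi0]
      · simp [V]
    · exact hys i j

end Setup
end AMDP
namespace AMDP

section reg
variable {R A T : Type} [CommRing R] [CommRing A] [Fintype T]

lemma free_mem (ρ : R →+* A) (W : T → A) (hspan : ∀ a, ∃ f : T → R, a = ∑ t, ρ (f t) * W t)
    (J : Ideal R) (a : A) (ha : a ∈ J.map ρ) : ∃ f : T → R, (∀ t, f t ∈ J) ∧ a = ∑ t, ρ (f t) * W t := by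
  let J' : Ideal A :=
    { carrier := {a | ∃ f : T → R, (∀ t, f t ∈ J) ∧ a = ∑ t, ρ (f t) * W t}
      add_mem' := by
        rintro _ _ ⟨f, hf, rfl⟩ ⟨g, hg, rfl⟩; exact ⟨f + g, fun t => J.add_mem (hf t) (hg t), by simp [add_mul, sum_add_distrib]⟩
      zero_mem' := ⟨0, fun _ => J.zero_mem, by simp⟩
      smul_mem' := by
        rintro a _ ⟨f, hf, rfl⟩; choose g hg using fun t => hspan (a * W t)
        refine ⟨fun s => ∑ t, f t * g t s, fun s => J.sum_mem fun t _ => J.mul_mem_right _ (hf t), ?_⟩; rw [smul_eq_mul, mul_sum]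
        simp_rw [map_sum, map_mul, sum_mul]; rw [sum_comm]; refine sum_congr rfl fun t _ => ?_; rw [mul_left_comm, hg t, mul_sum]
        exact sum_congr rfl fun s _ => by ring }
  have h : J.map ρ ≤ J' := by
    rw [Ideal.map_le_iff_le_comap]; intro x hx; obtain ⟨g, hg⟩ := hspan 1; refine ⟨fun t => x * g t, fun t => J.mul_mem_right _ hx, ?_⟩
    rw [← mul_one (ρ x), hg, mul_sum]; exact sum_congr rfl fun s _ => by rw [map_mul]; ring
  exact h ha

lemma regseq_of_free (ρ : R →+* A) (W : T → A) (hspan : ∀ a, ∃ f : T → R, a = ∑ t, ρ (f t) * W t)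
    (hind : ∀ f : T → R, ∑ t, ρ (f t) * W t = 0 → ∀ t, f t = 0) (xs : List R) (h : AMD.IsRegSeq xs) : AMD.IsRegSeq (xs.map ρ) := fun i y hy => by
  have hi : i.1 < xs.length := by have := i.2; simpa using this
  have hsp : Ideal.span {x | x ∈ (xs.map ρ).take i.1} = (Ideal.span {x | x ∈ xs.take i.1}).map ρ := by
    rw [Ideal.map_span]; congr 1; ext x; simp [← List.map_take]
  rw [hsp] at hy ⊢; obtain ⟨f, rfl⟩ := hspan y; obtain ⟨g, hg, hge⟩ := free_mem ρ W hspan _ _ hy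
  have hf : ∀ t, xs.get ⟨i.1, hi⟩ * f t ∈ Ideal.span {x | x ∈ xs.take i.1} := fun t => by
    have h1 := hind (fun t => xs.get ⟨i.1, hi⟩ * f t - g t) (by
      simp_rw [map_sub, sub_mul, sum_sub_distrib, ← hge, mul_sum, map_mul]; simp [mul_assoc]) t
    rw [sub_eq_zero.1 h1]; exact hg t
  refine Ideal.sum_mem _ fun t _ => Ideal.mul_mem_right _ _ (Ideal.mem_map_of_mem _ ?_); exact h ⟨i.1, hi⟩ (f t) (hf t)

end reg

variable {K : Type} [Field K] {d : ℕ}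

lemma regseq_X : AMD.IsRegSeq (List.ofFn (X : Fin (d + 1) → PS K d)) := fun i y hy => by
  have hi : i.1 < d + 1 := by have := i.2; simpa using this
  have hs : {x : PS K d | x ∈ (List.ofFn (X : Fin (d + 1) → PS K d)).take i.1} = X '' {j : Fin (d + 1) | j.1 < i.1} := by
    ext x; simp only [Set.mem_ofPred_eq, Set.mem_image, List.mem_take_iff_getElem]; constructor
    · rintro ⟨j, hj, rfl⟩; simp at hj; exact ⟨⟨j, by omega⟩, by simp; omega, by rw [List.getElem_ofFn]⟩
    · rintro ⟨j, hj, rfl⟩; exact ⟨j.1, by simp; omega, by rw [List.getElem_ofFn]⟩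
  rw [hs, mem_ideal_span_X_image] at hy ⊢; intro m hm
  have hget : (List.ofFn (X : Fin (d + 1) → PS K d)).get i = X ⟨i.1, hi⟩ := by rw [List.get_eq_getElem, List.getElem_ofFn]
  rw [hget] at hy; obtain ⟨j, hj, hne⟩ := hy (single ⟨i.1, hi⟩ 1 + m) (by rw [mem_support_iff, coeff_X_mul]; exact mem_support_iff.1 hm)
  refine ⟨j, hj, ?_⟩; rwa [Finsupp.add_apply, Finsupp.single_eq_of_ne, zero_add] at hne; rintro rfl; simp at hj

namespace Setup
variable {r : ℕ} {I : Ideal (PS K r)} {c : ℕ} (s : Setup K r I d c (TT c))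

lemma case_one (hc : 1 ≤ c) (hno : ∀ m, ∀ G ∈ s.HD m, (∀ j, Lo (-1) (G j)) → ∑ j, s.γ j • (G j).coeff (-1) = 0) :
    ∃ rs : List (PS K r ⧸ I), rs.length = d + 1 ∧ (∀ x ∈ rs, x ∈ AMD.maxIdl K r I) ∧ AMD.IsRegSeq rs := by
  have := s.nonempty; obtain ⟨fr, w, hw⟩ := s.frame_one hc; obtain ⟨W, hW⟩ : ∃ W : TT c → PS K r, ∀ t, fr.e t = s.F (W t) := by
    refine ⟨fun t => match t with | none => 1 | some none => w | some (some i) => fr.y i, ?_⟩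
    rintro (_ | _ | i)
    · rw [map_one, fr.e1]
    · exact hw
    · exact fr.ey i
  have key : ∀ m : ℤ, ∀ a ∈ HG m, s.F a ∈ fr.Sp m := fun m a ha => by
    obtain ⟨G', hG', hL⟩ := fr.pole (s.HD_F ha); have hL' : ∀ j, Lo (-1) ((s.F a - G') j) := hL
    have hD := sub_mem (s.HD_F ha) (fr.Sp_HD _ hG'); have h0 := hno m _ hD hL'
    obtain ⟨x, hx, hxj⟩ := s.wlift' (fun j => ((s.F a - G') j).coeff (-1)) h0
    have hmem : ∑ i, s.F (s.P (((s.F a - G') i).coeff (-1)) * x i) ∈ fr.Sp m := by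
      refine sum_mem fun i _ => ?_; rw [map_mul]; have h1 := fr.Sp_Pmul (hD.2 i (-1)) (fr.Sp_lin (hx i)); rwa [neg_add_cancel_right] at h1
    rw [← map_sum] at hmem; obtain ⟨p, hp, hpe⟩ := s.U1' (sub_mem hD (fr.Sp_HD _ hmem)) (by
      intro j i hi; rw [Pi.sub_apply, HahnSeries.coeff_sub, F_apply]; by_cases h : i = -1
      · rw [h, (hxj j).2, sub_self]
      · rw [hL' j i (by omega), (hxj j).1 i (by omega), sub_zero])
    rw [sub_eq_iff_eq_add, sub_eq_iff_eq_add] at hpe; rw [hpe]; exact add_mem (add_mem (fr.Sp_P hp) hmem) hG'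
  refine ⟨(List.ofFn (X : Fin (d + 1) → PS K d)).map ((Ideal.Quotient.mk I).comp s.ρ.toRingHom), by simp, ?_, ?_⟩
  · intro x hx; simp only [List.mem_map, List.mem_ofFn] at hx; obtain ⟨_, ⟨i, rfl⟩, rfl⟩ := hx; refine Ideal.mem_map_of_mem _ ?_
    have h1 : s.ρ (X i) ∈ HG 1 := s.ρ_HG (HG_X _); show s.ρ (X i) ∈ _; rw [hom1_eq _ ((mem_HG_nat (n := 1)).1 h1)]
    refine Ideal.sum_mem _ fun j _ => ?_; rw [smul_eq_C_mul]; exact Ideal.mul_mem_left _ _ (Ideal.subset_span ⟨j, rfl⟩)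
  · refine regseq_of_free _ (fun t => Ideal.Quotient.mk I (W t)) ?_ ?_ _ regseq_X
    · intro a; obtain ⟨a, rfl⟩ := Ideal.Quotient.mk_surjective a
      have hfin : ∀ a : PS K r, ∃ f : TT c → PS K d, s.F a = ∑ t, s.F (s.ρ (f t)) * fr.e t := fun a => by
        rw [← sum_homogeneousComponent a, map_sum]
        choose f hf1 hf using fun i : ℕ => key i _ ((mem_HG_nat (n := i)).2 (homogeneousComponent_isHomogeneous i a))
        refine ⟨fun t => ∑ i ∈ range (a.totalDegree + 1), f i t, ?_⟩; simp_rw [map_sum, sum_mul]; rw [sum_comm]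
        exact sum_congr rfl fun i _ => hf i
      obtain ⟨f, hf⟩ := hfin a; refine ⟨f, ?_⟩; have h2 : a - ∑ t, s.ρ (f t) * W t ∈ I := by
        apply s.F_eq; rw [hf, map_sum]; exact sum_congr rfl fun t _ => by rw [map_mul, hW]
      rw [← Ideal.Quotient.eq] at h2; rw [h2, map_sum]; rfl
    · intro f hf t; refine fr.indep f ?_ t
      have h3 : ∑ t, s.ρ (f t) * W t ∈ I := by rw [← Ideal.Quotient.eq_zero_iff_mem, map_sum]; exact hf
      simp_rw [hW, ← map_mul, ← map_sum]; funext j; rw [F_apply]; exact (s.ker j _).2 h3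

end Setup
end AMDP
namespace AMDP

variable {K : Type} [Field K] {r : ℕ}

/-- Regularity of linear forms. -/
lemma lin_reg {x : Fin (r + 1) → PS K r} (hb : LinBasis K r (Fin (r + 1)) x) (s : Set (Fin (r + 1)))
    {l : Fin (r + 1)} (hl : l ∉ s) {f : PS K r} (hf : x l * f ∈ Ideal.span (x '' s)) : f ∈ Ideal.span (x '' s) := by
  obtain ⟨e, he, -⟩ := hb.equiv (by simp)
  have hsp : Ideal.span (x '' s) = (Ideal.span ((X : Fin (r + 1) → PS K r) '' s)).map (e : PS K r →+* PS K r) := by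
    rw [Ideal.map_span, Set.image_image]; congr 1; exact Set.image_congr fun i _ => (he i).symm
  have hiff : ∀ g, e g ∈ Ideal.span (x '' s) ↔ g ∈ Ideal.span ((X : Fin (r + 1) → PS K r) '' s) := fun g => by
    rw [hsp]; constructor
    · intro h; obtain ⟨g', hg', h2⟩ := (Ideal.mem_map_iff_of_surjective (e : PS K r →+* PS K r) e.surjective).1 h; rwa [← e.injective h2]
    · exact fun h => Ideal.mem_map_of_mem (e : PS K r →+* PS K r) h
  obtain ⟨f, rfl⟩ := e.surjective f; rw [← he, ← map_mul, hiff, mem_ideal_span_X_image] at hf; rw [hiff, mem_ideal_span_X_image]; intro m hm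
  obtain ⟨j, hj, hne⟩ := hf (single l 1 + m) (by rw [mem_support_iff, coeff_X_mul]; exact mem_support_iff.1 hm); refine ⟨j, hj, ?_⟩
  rwa [Finsupp.add_apply, Finsupp.single_eq_of_ne, zero_add] at hne; rintro rfl; exact hl hj

lemma lin_rep {x : Fin (r + 1) → PS K r} (hx : ∀ i, x i ∈ HG 1) (s : Set (Fin (r + 1))) {f : PS K r} {D : ℤ}
    (hD : f ∈ HG D) (hf : f ∈ Ideal.span (x '' s)) : ∃ g : Fin (r + 1) → PS K r,
      (∀ i, g i ∈ HG (D - 1)) ∧ (∀ i ∉ s, g i = 0) ∧ f = ∑ i, x i * g i := by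
  classical
  have h1 : ∃ g : Fin (r + 1) → PS K r, (∀ i ∉ s, g i = 0) ∧ f = ∑ i, x i * g i := by
    clear hD
    induction hf using Submodule.span_induction with
    | mem y hy =>
      obtain ⟨i, hi, rfl⟩ := hy; refine ⟨Pi.single i 1, fun j hj => ?_, ?_⟩
      · rw [Pi.single_eq_of_ne]; rintro rfl; exact hj hi
      · rw [sum_eq_single i]
        · simp
        · intro b _ hb; simp [Pi.single_eq_of_ne hb]
        · simp
    | zero => exact ⟨0, fun _ _ => rfl, by simp⟩
    | add a b _ _ ha hb =>
      obtain ⟨g, hg, rfl⟩ := ha; obtain ⟨g', hg', rfl⟩ := hb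
      exact ⟨g + g', fun i hi => by simp [hg i hi, hg' i hi], by simp [mul_add, sum_add_distrib]⟩
    | smul a b _ hb =>
      obtain ⟨g, hg, rfl⟩ := hb; refine ⟨fun i => a * g i, fun i hi => by simp [hg i hi], ?_⟩; rw [smul_eq_mul, mul_sum]
      exact sum_congr rfl fun i _ => by ring
  obtain ⟨g, hg, hfe⟩ := h1; refine ⟨fun i => hcmp (D - 1) (g i), fun i => hcmp_mem _ _, fun i hi => by simp [hg i hi], ?_⟩
  rw [← hcmp_of_mem hD, hfe, map_sum]; refine sum_congr rfl fun i _ => ?_; rw [hcmp_HG_mul (hx i)]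

lemma KB_iff {x : ℕ → PS K r} (hx : ∀ i, x i ∈ HG 1) {l : ℕ} (hl : l ≤ r + 1) {D : ℤ} {f : PS K r} (hf : f ∈ HG D) :
    KB x (fun D => (HG D : Submodule K (PS K r)).toAddSubgroup) l D f ↔ f ∈ Ideal.span ((fun i : Fin (r + 1) => x i) '' {i | i.1 < l}) := by
  constructor
  · rintro ⟨g, -, rfl⟩; refine Ideal.sum_mem _ fun i hi => Ideal.mul_mem_right _ _ (Ideal.subset_span ?_); rw [mem_range] at hi
    exact ⟨⟨i, by omega⟩, hi, rfl⟩
  · intro h; obtain ⟨g, hg, hg0, rfl⟩ := lin_rep (x := fun i : Fin (r + 1) => x i) (fun i => hx i) _ hf h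
    refine ⟨fun i => if h : i < r + 1 then g ⟨i, h⟩ else 0, fun i => ?_, ?_⟩
    · dsimp only
      split_ifs with h
      · exact hg _
      · exact zero_mem _
    · rw [Finset.sum_subset (Finset.range_subset_range.2 hl)]
      · rw [Finset.sum_range]; refine sum_congr rfl fun i _ => ?_; simp; intro hh; omega
      · intro i hi hi'; rw [mem_range] at hi hi'; simp only [hi, dif_pos]; rw [hg0 ⟨i, hi⟩ (by simpa using hi'), smul_zero]

lemma goodXS_of_basis {x : ℕ → PS K r} (hx : ∀ i, x i ∈ HG 1) (hb : LinBasis K r (Fin (r + 1)) (fun i => x i)) : GoodXS K r x where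
  deg := hx
  gen := by
    intro a ha f hf; rw [KB_iff hx le_rfl hf]
    have htop : ∀ i, (X i : PS K r) ∈ Ideal.span ((fun i : Fin (r + 1) => x i) '' {i | i.1 < r + 1}) := fun i => by
      have h1 := hb.span (X i) (isHomogeneous_X _ _); have h2 : span K (Set.range fun i : Fin (r + 1) => x i) ≤
          (Ideal.span ((fun i : Fin (r + 1) => x i) '' {i | i.1 < r + 1})).restrictScalars K := by
        rw [Submodule.span_le]; rintro _ ⟨i, rfl⟩; exact Ideal.subset_span ⟨i, i.2, rfl⟩
      exact h2 h1
    have h3 : Ideal.span ((X : Fin (r + 1) → PS K r) '' Set.univ) ≤ Ideal.span ((fun i : Fin (r + 1) => x i) '' {i | i.1 < r + 1}) := by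
      rw [Ideal.span_le]; rintro _ ⟨i, -, rfl⟩; exact htop i
    apply h3; rw [mem_ideal_span_X_image]; intro m hm; by_contra hcon
    push Not at hcon
    have hm0 : m = 0 := by ext i; exact hcon i trivial
    lift a to ℕ using (by omega); have := (mem_HG_nat (n := a)).1 hf (mem_support_iff.1 hm); rw [hm0] at this; simp at this; omega
  reg := by
    intro l hl D f hf h; have hxf : x l * f ∈ HG (D + 1) := by
      have := HG_mul (hx l) hf; rwa [add_comm (1 : ℤ) D] at this
    rw [smul_eq_mul, KB_iff hx hl.le hxf] at h; rw [KB_iff hx hl.le hf]; exact lin_reg hb {i | i.1 < l} (l := ⟨l, hl⟩) (by simp) h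

/-- Koszul vanishing for a submodule. -/
lemma HV_sub {S M : Type} [CommRing S] [AddCommGroup M] [Module S M] {x : ℕ → S} (N : Submodule S M)
    {G G₀ : ℤ → AddSubgroup M} (hG : Compat x G) (hG₀ : ∀ D m, m ∈ G₀ D ↔ m ∈ G D ∧ m ∈ N) (n k : ℕ)
    (hB : ∀ i D : ℤ, i + 2 ≤ D → HV x G (n + k) i D)
    (hreg : ∀ l < n, ∀ D, ∀ b ∈ G D, ∀ g : ℕ → M, (∀ l', g l' ∈ G D) → x l • b - ∑ l' ∈ range l, x l' • g l' ∈ N →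
      ∃ g' : ℕ → M, (∀ l', g' l' ∈ G (D - 1)) ∧ b - ∑ l' ∈ range l, x l' • g' l' ∈ N)
    (hgen : ∀ D : ℤ, 2 ≤ D → ∀ b ∈ G D, ∃ g' : ℕ → M, (∀ l', g' l' ∈ G (D - 1)) ∧ b - ∑ l' ∈ range n, x l' • g' l' ∈ N) :
    ∀ i D : ℤ, i + 3 ≤ D → HV x G₀ (n + k) i D := by
  let G' : ℤ → AddSubgroup (M ⧸ N) := fun D => (G D).map N.mkQ.toAddMonoidHom; have hG' : Compat x G' := by
    rintro l D _ ⟨m, hm, rfl⟩; exact ⟨x l • m, hG l D m hm, by simp⟩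
  have hKB : ∀ l D m, KB x G' l D (N.mkQ m) ↔ ∃ g' : ℕ → M, (∀ l', g' l' ∈ G (D - 1)) ∧ m - ∑ l' ∈ range l, x l' • g' l' ∈ N := fun l D m => by
    constructor
    · rintro ⟨g, hg, h⟩; choose g' hg' hge using hg; refine ⟨g', hg', ?_⟩
      rw [← Submodule.ker_mkQ N, LinearMap.mem_ker, map_sub, h, map_sum, sub_eq_zero]; refine sum_congr rfl fun l _ => ?_
      rw [map_smul, ← hge l]; rfl
    · rintro ⟨g, hg, h⟩; refine ⟨fun l => N.mkQ (g l), fun l => ⟨g l, hg l, rfl⟩, ?_⟩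
      rw [← Submodule.ker_mkQ N, LinearMap.mem_ker, map_sub, sub_eq_zero] at h; rw [h, map_sum]
      exact sum_congr rfl fun l _ => map_smul _ _ _
  have hQ : ∀ i D : ℤ, i + 2 ≤ D → HV x G' (n + k) i D := by
    refine HV_up hG' 2 n ?_ k; intro i D hD
    rcases lt_trichotomy i 0 with hi | rfl | hi
    · exact HV_neg _ _ _ hi
    · rw [HV_h0]; rintro _ ⟨b, hb, rfl⟩; exact (hKB _ _ _).2 (hgen D (by omega) b hb)
    · refine HV_reg hG' n ?_ i D (by omega); rintro l hl D _ ⟨b, hb, rfl⟩ h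
      obtain ⟨g, hg, h⟩ := (hKB l (D + 1) (x l • b)).1 (by rw [map_smul]; exact h); rw [add_sub_cancel_right] at hg
      exact (hKB _ _ _).2 (hreg l hl D b hb g hg h)
  intro i D hD
  refine HV_les (G := G) (G' := G') (x' := x) N.mkQ.toAddMonoidHom hG (n + k) (fun l _ m => map_smul N.mkQ _ _) (fun D m hm => ((hG₀ D m).1 hm).1)
    (fun D m hm => ⟨m, hm, rfl⟩) ?_ ?_ ?_ (hB i D (by omega)) (hQ (i + 1) D (by omega))
  · rintro D _ ⟨m, hm, rfl⟩; exact ⟨m, hm, rfl⟩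
  · intro D m hm h; refine (hG₀ D m).2 ⟨hm, ?_⟩; rw [← Submodule.ker_mkQ N]; exact h
  · intro D m hm; have := ((hG₀ D m).1 hm).2; rw [← Submodule.ker_mkQ N] at this; exact this

end AMDP
namespace AMDP

variable {K : Type} [Field K] {d : ℕ}

lemma exists_xi (W : Submodule K (PS K d)) (hW : W ≤ HG 1) : ∃ (ξ : ℕ → PS K d) (n : ℕ), n ≤ d + 1 ∧
    (∀ l, ξ l ∈ HG 1) ∧ LinBasis K d (Fin (d + 1)) (fun i => ξ i) ∧
    Ideal.span (W : Set (PS K d)) = Ideal.span ((fun i : Fin (d + 1) => ξ i) '' {i | n ≤ i.1}) := by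
  classical
  let W1 : Submodule K (HG 1 : Submodule K (PS K d)) := W.comap (Submodule.subtype _); obtain ⟨W2, hc⟩ := W1.exists_isCompl
  have hfr : finrank K W2 + finrank K W1 = d + 1 := by
    have h1 := Submodule.finrank_add_eq_of_isCompl hc.symm; rw [h1, Setup.finrank_HG_one]
  set n := finrank K W2; set m := finrank K W1; have hf2 : Module.Free K W2 := Module.Free.of_divisionRing K W2
  have hf1 : Module.Free K W1 := Module.Free.of_divisionRing K W1; let b2 := Module.finBasis K W2; let b1 := Module.finBasis K W1
  let ξ : ℕ → PS K d := fun l => if h : l < n then ((b2 ⟨l, h⟩ : W2) : (HG 1 : Submodule K (PS K d))) else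
    if h : l - n < m then ((b1 ⟨l - n, h⟩ : W1) : (HG 1 : Submodule K (PS K d))) else 0
  have hξ : ∀ l, ξ l ∈ HG 1 := fun l => by
    simp only [ξ]; split_ifs
    · exact Subtype.prop _
    · exact Subtype.prop _
    · exact zero_mem _
  have hsp1 : W ≤ span K ((fun i : Fin (d + 1) => ξ i) '' {i | n ≤ i.1}) := fun w hw => by
    have h1 := b1.sum_repr ⟨⟨w, hW hw⟩, hw⟩; have h2 := congrArg (fun v => ((v : W1) : (HG 1 : Submodule K (PS K d))).1) h1
    dsimp only at h2; rw [← h2]; simp only [Submodule.coe_smul, AddSubmonoidClass.coe_finsetSum]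
    refine sum_mem fun i _ => smul_mem _ _ (subset_span ?_); refine ⟨⟨n + i.1, by omega⟩, by simp, ?_⟩
    simp only [ξ, add_tsub_cancel_left, dif_neg (show ¬ n + i.1 < n by omega)]; exact dif_pos i.2
  have hsp2 : ∀ w : W2, (w.1.1 : PS K d) ∈ span K (Set.range (fun i : Fin (d + 1) => ξ i)) := fun w => by
    have h1 := b2.sum_repr w; have h2 := congrArg (fun v => ((v : W2) : (HG 1 : Submodule K (PS K d))).1) h1; rw [← h2]
    simp only [Submodule.coe_smul, AddSubmonoidClass.coe_finsetSum]; refine sum_mem fun i _ => smul_mem _ _ (subset_span ?_)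
    refine ⟨⟨i.1, by omega⟩, ?_⟩; exact dif_pos i.2
  refine ⟨ξ, n, by omega, hξ, ⟨fun i => mem_HG_nat.1 (hξ i), ?_⟩, ?_⟩
  · intro p hp; have h1 : (⟨p, (mem_HG_nat (n := 1)).2 hp⟩ : (HG 1 : Submodule K (PS K d))) ∈ W1 ⊔ W2 := by rw [hc.sup_eq_top]; trivial
    obtain ⟨w1, hw1, w2, hw2, h⟩ := Submodule.mem_sup.1 h1; have h2 := congrArg Subtype.val h; simp only [Submodule.coe_add] at h2
    rw [← h2]; exact add_mem (Submodule.span_mono (Set.image_subset_range _ _) (hsp1 hw1)) (hsp2 ⟨w2, hw2⟩)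
  · apply le_antisymm
    · rw [Ideal.span_le]; intro w hw; have h3 : span K ((fun i : Fin (d + 1) => ξ i) '' {i | n ≤ i.1}) ≤
          (Ideal.span ((fun i : Fin (d + 1) => ξ i) '' {i | n ≤ i.1})).restrictScalars K := Submodule.span_le.2 Ideal.subset_span
      exact h3 (hsp1 hw)
    · rw [Ideal.span_le]; rintro _ ⟨i, hi, rfl⟩; refine Ideal.subset_span ?_; have hi' : ¬ i.1 < n := not_lt.2 hi
      have hi2 : i.1 - n < m := by omega
      simp only [ξ, hi', hi2, dif_neg, dif_pos, not_false_eq_true]; exact (b1 ⟨i.1 - n, hi2⟩).2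

namespace Setup
variable {r : ℕ} {I : Ideal (PS K r)} {c : ℕ} {s : Setup K r I d c (TT c)}
namespace Frame
variable {q : ℕ} (fr : s.Frame q)

/-- Combinations of the frame. -/
def comb (f : TT c → PS K d) : TT c → LS K d := ∑ t, s.F (s.ρ (f t)) * fr.e t

lemma comb_add (f g : TT c → PS K d) : fr.comb (f + g) = fr.comb f + fr.comb g := by simp [comb, add_mul, sum_add_distrib]
lemma comb_sub (f g : TT c → PS K d) : fr.comb (f - g) = fr.comb f - fr.comb g := by simp [comb, sub_mul, sum_sub_distrib]
lemma comb_zero : fr.comb 0 = 0 := by simp [comb]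
lemma comb_sum {ι : Type} (u : Finset ι) (f : ι → TT c → PS K d) : fr.comb (∑ i ∈ u, f i) = ∑ i ∈ u, fr.comb (f i) := by
  classical
  induction u using Finset.induction_on with
  | empty => simp [comb_zero]
  | insert a u ha ih => rw [Finset.sum_insert ha, Finset.sum_insert ha, comb_add, ih]
lemma comb_mul (a : PS K d) (f : TT c → PS K d) : fr.comb (fun t => a * f t) = s.F (s.ρ a) * fr.comb f := by
  rw [comb, comb, mul_sum]; exact sum_congr rfl fun t _ => by rw [map_mul, map_mul, mul_assoc]
lemma comb_inj {f g : TT c → PS K d} (h : fr.comb f = fr.comb g) : f = g := by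
  funext t; rw [← sub_eq_zero]; exact fr.indep (f - g) (by rw [← comb, comb_sub, h, sub_self]) t
lemma comb_single (t : TT c) (a : PS K d) : fr.comb (Pi.single t a) = s.F (s.ρ a) * fr.e t := by
  classical
  rw [comb, sum_eq_single t]
  · simp
  · intro b _ hb; simp [Pi.single_eq_of_ne hb]
  · simp
lemma mem_Sp {D : ℤ} {G : TT c → LS K d} : G ∈ fr.Sp D ↔ ∃ f : TT c → PS K d, (∀ t, f t ∈ HG (D - fr.δ t)) ∧ G = fr.comb f := Iff.rfl

end Frame

/-- Multiplication by quadrics. -/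
lemma Frame.products (fr : s.Frame 1) (hz : fr.δ (some none) = 1) : ∃ (bb : Submodule K (PS K d)) (lam : Fin c → PS K d),
    bb ≤ HG 1 ∧ (∀ i, lam i ∈ HG 1) ∧ 
    ∀ f : TT c → PS K d, (∃ a, s.F a = fr.comb f) ↔ f (some none) ∈ Ideal.span (bb : Set (PS K d)) := by
  classical
  have hyS : ∀ i, s.F (fr.y i) = fr.comb (Pi.single (some (some i)) 1) := by intro i; rw [fr.comb_single, fr.ey]; simp
  have h1S : (1 : TT c → LS K d) = fr.comb (Pi.single none 1) := by rw [fr.comb_single, fr.e1]; simp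
  have hyz : ∀ i, ∃ f : TT c → PS K d, f (some none) ∈ HG 1 ∧ s.F (fr.y i) * fr.e (some none) = fr.comb f := fun i => by
    have h1 := s.HD_mul (s.HD_F (fr.yd i)) (fr.mem (some none)); rw [← fr.Sp_eq] at h1; obtain ⟨f, hf, h⟩ := fr.mem_Sp.1 h1
    refine ⟨f, ?_, h⟩; have := hf (some none); rwa [hz, add_sub_cancel_right] at this
  have hyy : ∀ i j, ∃ f : TT c → PS K d, f (some none) ∈ HG 1 ∧ s.F (fr.y i) * s.F (fr.y j) = fr.comb f := fun i j => by
    have h1 := s.HD_mul (s.HD_F (fr.yd i)) (s.HD_F (fr.yd j)); rw [← fr.Sp_eq] at h1; obtain ⟨f, hf, h⟩ := fr.mem_Sp.1 h1; refine ⟨f, ?_, h⟩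
    have := hf (some none); rwa [hz, Nat.cast_one, add_sub_cancel_right] at this
  choose u hu hue using hyz; choose v hv hve using hyy
  let bb : Submodule K (PS K d) := span K (Set.range fun p : Fin c × Fin c => v p.1 p.2 (some none))
  let B : Ideal (PS K d) := Ideal.span (bb : Set (PS K d))
  have hvB : ∀ i j, v i j (some none) ∈ B := fun i j => Ideal.subset_span (subset_span ⟨(i, j), rfl⟩)
  refine ⟨bb, fun i => u i (some none), Submodule.span_le.2 ?_, hu, ?_⟩
  · rintro _ ⟨⟨i, j⟩, rfl⟩; exact hv i j
  -- the module of combinations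
  let Nm : Submodule K (TT c → LS K d) :=
    { carrier := {G | ∃ f : TT c → PS K d, f (some none) ∈ B ∧ G = fr.comb f}
      add_mem' := by
        rintro _ _ ⟨f, hf, rfl⟩ ⟨g, hg, rfl⟩; exact ⟨f + g, B.add_mem hf hg, (fr.comb_add f g).symm⟩
      zero_mem' := ⟨0, B.zero_mem, fr.comb_zero.symm⟩
      smul_mem' := by
        rintro a _ ⟨f, hf, rfl⟩; refine ⟨fun t => C a * f t, B.mul_mem_left _ hf, ?_⟩; rw [fr.comb_mul]
        have : s.F (s.ρ (C a)) = algebraMap K _ a := by rw [← MvPolynomial.algebraMap_eq, AlgHom.commutes, AlgHom.commutes]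
        rw [this, Algebra.smul_def] }
  have hNR : ∀ a G, G ∈ Nm → s.F (s.ρ a) * G ∈ Nm := by
    rintro a _ ⟨f, hf, rfl⟩; exact ⟨fun t => a * f t, B.mul_mem_left _ hf, (fr.comb_mul a f).symm⟩
  have hNe : ∀ t, t ≠ some none → fr.e t ∈ Nm := fun t ht => by
    refine ⟨Pi.single t 1, ?_, ?_⟩
    · rw [Pi.single_eq_of_ne (Ne.symm ht)]; exact B.zero_mem
    · rw [fr.comb_single]; simp
  have hNy : ∀ i G, G ∈ Nm → s.F (fr.y i - s.ρ (u i (some none))) * G ∈ Nm := by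
    rintro i _ ⟨f, hf, rfl⟩; rw [Frame.comb, mul_sum]; refine sum_mem fun t _ => ?_; rw [mul_left_comm]; apply hNR
    rcases t with _ | _ | j
    · rw [fr.e1, mul_one, map_sub, ← fr.ey]; refine sub_mem (hNe _ (by simp)) ?_; have := hNR (u i (some none)) _ (hNe none (by simp))
      rwa [fr.e1, mul_one] at this
    · refine ⟨u i - Pi.single (some none) (u i (some none)), by simp, ?_⟩; rw [map_sub, sub_mul, hue, fr.comb_sub, fr.comb_single]
    · rw [map_sub, sub_mul]; refine sub_mem ?_ (hNR _ _ (hNe _ (by simp))); rw [fr.ey, hve]; exact ⟨v i j, hvB i j, rfl⟩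
  have hall : ∀ a G, G ∈ Nm → s.F a * G ∈ Nm := by
    let T : Subalgebra K (PS K r) :=
      { carrier := {a | ∀ G ∈ Nm, s.F a * G ∈ Nm}
        mul_mem' := fun {a b} ha hb G hG => by rw [map_mul, mul_assoc]; exact ha _ (hb _ hG)
        add_mem' := fun {a b} ha hb G hG => by rw [map_add, add_mul]; exact add_mem (ha _ hG) (hb _ hG)
        algebraMap_mem' := fun a G hG => by rw [AlgHom.commutes, ← Algebra.smul_def]; exact smul_mem _ _ hG }
    have hT : ∀ i, (X i : PS K r) ∈ T := fun i => by
      have h1 := fr.linBasis.span (X i) (isHomogeneous_X _ _); refine (Submodule.span_le (p := Subalgebra.toSubmodule T)).2 ?_ h1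
      rintro _ ⟨i | i, rfl⟩
      · exact fun G hG => hNR _ G hG
      · intro G hG; have h2 := add_mem (hNy i G hG) (hNR (u i (some none)) G hG); rw [← add_mul, ← map_add, sub_add_cancel] at h2; exact h2
    intro a; have h2 : T = ⊤ := by
      rw [eq_top_iff, ← MvPolynomial.adjoin_range_X, Algebra.adjoin_le_iff]; rintro _ ⟨i, rfl⟩; exact hT i
    have h3 : a ∈ T := by rw [h2]; trivial
    exact h3
  intro f; constructor
  · rintro ⟨a, ha⟩; have h1 := hall a 1 (by have := hNe none (by simp); rwa [fr.e1] at this); rw [mul_one, ha] at h1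
    obtain ⟨g, hg, he⟩ := h1; rw [fr.comb_inj he]; exact hg
  · intro hf
    -- the range of `F` contains `B z`
    have hmem : ∀ t, t ≠ some none → fr.e t ∈ s.F.range := by
      rintro (_ | _ | j) ht
      · rw [fr.e1]; exact one_mem _
      · exact absurd rfl ht
      · rw [fr.ey]; exact ⟨_, rfl⟩
    have hz1 : ∀ i j, s.F (s.ρ (v i j (some none))) * fr.e (some none) ∈ s.F.range := fun i j => by
      have h1 := hve i j; rw [Frame.comb, ← Finset.add_sum_erase _ _ (mem_univ (some none)), ← sub_eq_iff_eq_add] at h1; rw [← h1]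
      refine Subalgebra.sub_mem _ (Subalgebra.mul_mem _ ⟨_, rfl⟩ ⟨_, rfl⟩) (Subalgebra.sum_mem _ fun t ht => ?_)
      exact Subalgebra.mul_mem _ ⟨_, rfl⟩ (hmem t (Finset.ne_of_mem_erase ht))
    have hz2 : ∀ b ∈ B, s.F (s.ρ b) * fr.e (some none) ∈ s.F.range := fun b hb => by
      induction hb using Submodule.span_induction with
      | mem y hy =>
        induction hy using Submodule.span_induction with
        | mem y hy =>
          obtain ⟨⟨i, j⟩, rfl⟩ := hy; exact hz1 i j
        | zero => rw [map_zero, map_zero, zero_mul]; exact zero_mem _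
        | add a b _ _ ha hb => rw [map_add, map_add, add_mul]; exact Subalgebra.add_mem _ ha hb
        | smul a b _ hb => rw [map_smul, map_smul, smul_mul_assoc]; exact Subalgebra.smul_mem _ hb a
      | zero => rw [map_zero, map_zero, zero_mul]; exact zero_mem _
      | add a b _ _ ha hb => rw [map_add, map_add, add_mul]; exact Subalgebra.add_mem _ ha hb
      | smul a b _ hb => rw [smul_eq_mul, map_mul, map_mul, mul_assoc]; exact Subalgebra.mul_mem _ ⟨_, rfl⟩ hb
    have h4 : fr.comb f ∈ s.F.range := by
      rw [Frame.comb]; refine Subalgebra.sum_mem _ fun t _ => ?_; by_cases ht : t = some none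
      · rw [ht]; exact hz2 _ hf
      · exact Subalgebra.mul_mem _ ⟨_, rfl⟩ (hmem t ht)
    obtain ⟨a, ha⟩ := h4; exact ⟨a, ha⟩

end Setup
end AMDP
namespace AMDP
namespace Setup
variable {K : Type} [Field K] {d r : ℕ} {I : Ideal (PS K r)} {c : ℕ} {s : Setup K r I d c (TT c)}

lemma F_hcmp {a : PS K r} {D : ℤ} (h : ∀ j, s.F a j ∈ GG D) : s.F (hcmp D a) = s.F a := by
  classical
  funext j
  ext1
  funext i; have h1 : ∑ m ∈ range (max a.totalDegree D.toNat + 1), hcmp m a = a := hcmp_sum a _ (by omega)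
  have h2 : (s.F a j).coeff i = ∑ m ∈ range (max a.totalDegree D.toNat + 1), (s.Φ j (hcmp m a)).coeff i := by
    conv_lhs => rw [← h1]
    rw [map_sum, Finset.sum_apply, HahnSeries.coeff_sum]; rfl
  have h3 := hcmp_of_mem (h j i); rw [← h3, h2, map_sum]
  have h4 : ∀ m : ℕ, hcmp (D + i) ((s.Φ j (hcmp m a)).coeff i) = if (m : ℤ) = D then (s.Φ j (hcmp m a)).coeff i else 0 := fun m => by
    have h5 := s.gr j m _ (hcmp_mem (m : ℤ) a) i
    split_ifs with hm
    · subst hm; exact hcmp_of_mem h5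
    · exact hcmp_of_mem_ne h5 (by omega)
  simp_rw [h4]; by_cases hD : 0 ≤ D
  · rw [sum_eq_single D.toNat]
    · rw [if_pos (by omega), F_apply, Int.toNat_of_nonneg hD]
    · intro b _ hb; exact if_neg (by omega)
    · intro hb; exact absurd (mem_range.2 (by omega)) hb
  · rw [sum_eq_zero (fun b _ => if_neg (by omega))]; have : hcmp D a = 0 := HG_zero_of_neg (by omega) (hcmp_mem D a)
    rw [this, map_zero]; rfl

lemma xs_basis (fr : s.Frame 1) {ξ : ℕ → PS K d} (hb : LinBasis K d (Fin (d + 1)) (fun i => ξ i)) :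
    ∃ xs : ℕ → PS K r, (∀ i, xs i ∈ HG 1) ∧ LinBasis K r (Fin (r + 1)) (fun i => xs i) ∧ ∀ l < d + 1, xs l = s.ρ (ξ l) := by
  classical
  let xs : ℕ → PS K r := fun l => if l < d + 1 then s.ρ (ξ l) else
    if h : l - (d + 1) < c then fr.y ⟨_, h⟩ else 0
  have hdeg : ∀ i, xs i ∈ HG 1 := fun i => by
    simp only [xs]
    split_ifs with h1 h2
    · exact s.ρ_HG (mem_HG_nat.2 (hb.deg ⟨i, h1⟩))
    · exact fr.yd _
    · exact zero_mem _
  have h1 : ∀ l < d + 1, xs l = s.ρ (ξ l) := fun l hl => if_pos hl; have hr := s.hr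
  refine ⟨xs, hdeg, ⟨fun i => mem_HG_nat.1 (hdeg i), fun p hp => ?_⟩, h1⟩; have h2 := fr.linBasis.span p hp
  refine (Submodule.span_le.2 ?_) h2; rintro _ ⟨i | i, rfl⟩
  · have h3 := hb.span (X i) (isHomogeneous_X _ _); have h4 := Submodule.mem_map_of_mem (f := s.ρ.toLinearMap) h3
    rw [Submodule.map_span] at h4; refine (Submodule.span_mono ?_) h4; rintro _ ⟨_, ⟨k, rfl⟩, rfl⟩; exact ⟨⟨k.1, by omega⟩, h1 _ k.2⟩
  · refine subset_span ⟨⟨d + 1 + i.1, by omega⟩, ?_⟩; have h5 : ¬ d + 1 + i.1 < d + 1 := by omega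
    simp only [xs, if_neg h5, add_tsub_cancel_left, dif_pos i.2, Sum.elim_inr]

lemma betti (fr : s.Frame 1) (hz : fr.δ (some none) = 1) (hI : AMD.IsHomIdeal K r I) : ∃ b : ℕ → ℕ → ℕ, AMD.HasBettiDiagram K r I b ∧
      ∀ i : ℕ, 1 ≤ i → ∀ j : ℕ, b i j ≠ 0 → j = 1 ∨ j = 2 := by
  classical
  obtain ⟨bb, -, hbb, -, hN⟩ := fr.products hz; obtain ⟨ξ, n, hn, hξ, hξb, hsp⟩ := exists_xi bb hbb
  obtain ⟨xs, hxd, hxb, hxs⟩ := xs_basis fr hξb; have hgx := goodXS_of_basis hxd hxb; have hgξ := goodXS_of_basis hξ hξb; have hr := s.hr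
  rw [hsp] at hN; let _ : Module (PS K r) (TT c → LS K d) := Module.compHom _ s.F.toRingHom
  have hsm : ∀ (a : PS K r) (G : TT c → LS K d), a • G = s.F a * G := fun _ _ => rfl; have hcompat : Compat xs (gp s.HD) := by
    intro k D m hm; rw [add_comm]; exact s.HD_mul (s.HD_F (hxd k)) hm
  have hxm : ∀ l < d + 1, ∀ f : TT c → PS K d, xs l • fr.comb f = fr.comb (fun t => ξ l * f t) := fun l hl f => by
    rw [hsm, hxs l hl, fr.comb_mul]
  have hHD : ∀ {D : ℤ} {G}, G ∈ gp s.HD D ↔ ∃ f : TT c → PS K d, (∀ t, f t ∈ HG (D - fr.δ t)) ∧ G = fr.comb f := by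
    intro D G; rw [← fr.mem_Sp, fr.Sp_eq]; rfl
  have hsum : ∀ l ≤ d + 1, ∀ gg : ℕ → TT c → PS K d, ∑ l' ∈ range l, xs l' • fr.comb (gg l') =
      fr.comb (fun t => ∑ l' ∈ range l, ξ l' * gg l' t) := by
    intro l hl gg
    have : (fun t => ∑ l' ∈ range l, ξ l' * gg l' t) = ∑ l' ∈ range l, (fun t => ξ l' * gg l' t) := by funext t; rw [Finset.sum_apply]
    rw [this, fr.comb_sum]; exact sum_congr rfl fun l' hl' => hxm l' (by have := mem_range.1 hl'; omega) _
  have hKB : ∀ l ≤ d + 1, ∀ (D : ℤ) (f : TT c → PS K d),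
      KB xs (gp s.HD) l D (fr.comb f) ↔ ∀ t, KB ξ (fun D => (HG D : Submodule K (PS K d)).toAddSubgroup) l (D - fr.δ t) (f t) := fun l hl D f => by
    constructor
    · rintro ⟨g, hg, he⟩ t; choose gg hgg hgc using fun l' => hHD.1 (hg l'); have h1 : g = fun l' => fr.comb (gg l') := funext hgc; subst h1
      rw [hsum l hl] at he; refine ⟨fun l' => gg l' t, fun l' => ?_, congrFun (fr.comb_inj he) t⟩; have := hgg l' t
      rwa [sub_right_comm] at this
    · intro h; choose g hg he using h; refine ⟨fun l' => fr.comb (fun t => g t l'), fun l' => hHD.2 ⟨_, fun t => ?_, rfl⟩, ?_⟩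
      · have := hg t l'; rwa [sub_right_comm] at this
      · rw [hsum l hl]; congr 1; funext t; exact he t
  have hB1 : ∀ i D : ℤ, i + 2 ≤ D → HV xs (gp s.HD) (d + 1) i D := fun i D hD => by
    rcases lt_trichotomy i 0 with hi | hi | hi
    · exact HV_neg _ _ _ hi
    · subst hi; rw [HV_h0]; intro m hm; obtain ⟨f, hf, rfl⟩ := hHD.1 hm; rw [hKB _ le_rfl]; intro t; have := fr.hδ t
      exact hgξ.gen _ (by omega) _ (hf t)
    · refine HV_reg hcompat _ ?_ i D (by omega); intro l hl D m hm h; obtain ⟨f, hf, rfl⟩ := hHD.1 hm; rw [hxm l hl, hKB l hl.le] at h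
      rw [hKB l hl.le]; intro t; refine hgξ.reg l hl _ _ (hf t) ?_; have := h t; rw [sub_add_eq_add_sub]; exact this
  have hB : ∀ i D : ℤ, i + 2 ≤ D → HV xs (gp s.HD) (n + (r + 1 - n)) i D := by
    have := HV_up hcompat 2 (d + 1) hB1 c; rwa [show d + 1 + c = n + (r + 1 - n) by omega] at this
  let N : Submodule (PS K r) (TT c → LS K d) :=
    { carrier := Set.range s.F
      add_mem' := by rintro _ _ ⟨a, rfl⟩ ⟨b, rfl⟩; exact ⟨a + b, map_add _ _ _⟩
      zero_mem' := ⟨0, map_zero _⟩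
      smul_mem' := by rintro a _ ⟨b, rfl⟩; exact ⟨a * b, map_mul _ _ _⟩ }
  have hNm : ∀ f : TT c → PS K d, fr.comb f ∈ N ↔ f (some none) ∈ Ideal.span ((fun i : Fin (d + 1) => ξ i) '' {i | n ≤ i.1}) :=
    fun f => hN f
  have hZ : ∀ l ≤ n, ∀ (D : ℤ) (f : TT c → PS K d) (g : Fin (d + 1) → PS K d), (∀ i, g i ∈ HG (D - 1 - 1)) →
      (∀ i : Fin (d + 1), l ≤ i.1 → i.1 < n → g i = 0) → f (some none) = ∑ i : Fin (d + 1), ξ i * g i →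
      ∃ g' : ℕ → TT c → LS K d, (∀ l', g' l' ∈ gp s.HD (D - 1)) ∧ fr.comb f - ∑ l' ∈ range l, xs l' • g' l' ∈ N := fun l hl D f g hg h0 hf => by
    let g1 : ℕ → PS K d := fun l' => if h : l' < d + 1 then g ⟨l', h⟩ else 0
    have hg1 : ∀ l', g1 l' ∈ HG (D - 1 - 1) := fun l' => by
      simp only [g1]; split_ifs
      · exact hg _
      · exact zero_mem _
    refine ⟨fun l' => fr.comb (Pi.single (some none) (g1 l')), fun l' => hHD.2 ⟨_, fun t => ?_, rfl⟩, ?_⟩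
    · by_cases ht : t = some none
      · subst ht; rw [hz, Pi.single_eq_same]; exact hg1 l'
      · rw [Pi.single_eq_of_ne ht]; exact zero_mem _
    · rw [hsum l (by omega), ← fr.comb_sub, hNm]; simp only [Pi.sub_apply, Pi.single_eq_same]
      have h1 : ∑ i : Fin (d + 1), ξ i * g i = ∑ l' ∈ range (d + 1), ξ l' * g1 l' := by
        rw [← Fin.sum_univ_eq_sum_range (fun l' => ξ l' * g1 l')]; refine sum_congr rfl fun i _ => ?_; simp only [g1, dif_pos i.2]
      rw [hf, h1, ← Finset.sum_range_add_sum_Ico _ (show l ≤ d + 1 by omega), add_sub_cancel_left]; refine Ideal.sum_mem _ fun i hi => ?_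
      rw [Finset.mem_Ico] at hi; by_cases hin : i < n
      · have h2 : g1 i = 0 := by
          simp only [g1, dif_pos hi.2]; exact h0 _ hi.1 hin
        rw [h2, mul_zero]; exact zero_mem _
      · exact Ideal.mul_mem_right _ _ (Ideal.subset_span ⟨⟨i, hi.2⟩, not_lt.1 hin, rfl⟩)
  have hA := HV_sub (x := xs) N (G := gp s.HD) (G₀ := fun D => gp s.HD D ⊓ N.toAddSubgroup) hcompat
    (fun D m => Iff.rfl) n (r + 1 - n) hB
    (by
      intro l hl D b hb g hg h; obtain ⟨f, hf, rfl⟩ := hHD.1 hb; choose gg hgg hgc using fun l' => hHD.1 (hg l')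
      have h1 : g = fun l' => fr.comb (gg l') := funext hgc; subst h1; rw [hsum l (by omega), hxm l (by omega), ← fr.comb_sub, hNm] at h
      simp only [Pi.sub_apply] at h; have h2 : (fun i : Fin (d + 1) => ξ i) ⟨l, by omega⟩ * f (some none) ∈
          Ideal.span ((fun i : Fin (d + 1) => ξ i) '' {i | i.1 < l ∨ n ≤ i.1}) := by
        have h3 := Ideal.span_mono (Set.image_mono (f := (fun i : Fin (d + 1) => ξ i))
          (show {i : Fin (d + 1) | n ≤ i.1} ⊆ {i | i.1 < l ∨ n ≤ i.1} from fun i hi => Or.inr hi)) h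
        have h4 : ∑ l' ∈ range l, ξ l' * gg l' (some none) ∈ Ideal.span ((fun i : Fin (d + 1) => ξ i) '' {i | i.1 < l ∨ n ≤ i.1}) := by
          refine Ideal.sum_mem _ fun i hi => ?_; rw [mem_range] at hi
          exact Ideal.mul_mem_right _ _ (Ideal.subset_span ⟨⟨i, by omega⟩, Or.inl hi, rfl⟩)
        have := Ideal.add_mem _ h3 h4; rwa [sub_add_cancel] at this
      have h5 := lin_reg hξb _ (by simp; omega) h2; have h6 := hf (some none); rw [hz] at h6
      obtain ⟨g2, hg2, hg0, he⟩ := lin_rep (fun i => hξ i.1) _ h6 h5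
      refine hZ l hl.le D f g2 hg2 (fun i h1 h2 => hg0 i (by simp; omega)) he)
    (by
      intro D hD b hb; obtain ⟨f, hf, rfl⟩ := hHD.1 hb; have h6 := hf (some none); rw [hz] at h6
      have h7 := (KB_iff hξ le_rfl h6).1 (hgξ.gen _ (by push_cast; omega) _ h6)
      obtain ⟨g2, hg2, hg0, he⟩ := lin_rep (fun i => hξ i.1) _ h6 h7; exact hZ n le_rfl D f g2 hg2 (fun i h1 h2 => absurd h2 (by omega)) he)
  rw [show n + (r + 1 - n) = r + 1 by omega] at hA; have hne := s.nonempty; have hFker : ∀ a, s.F a = 0 ↔ a ∈ I := fun a => by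
    constructor
    · intro h; have := s.F_eq (a := a) (b := 0) (by rw [h, map_zero]); rwa [sub_zero] at this
    · intro h; funext j; exact (s.ker j a).2 h
  refine betti_of_HV hgx I hI ?_ ?_
  · intro D hD f hf; obtain ⟨hf1, hf2⟩ := hf; change f ∈ I at hf2; by_cases h0 : D < 0
    · exact HG_zero_of_neg h0 hf1
    have hD' : D = 0 ∨ D = 1 := by omega
    rcases hD' with rfl | rfl
    · obtain ⟨a, rfl⟩ : ∃ a, f = C a := ⟨_, HG_zero_eq hf1⟩; obtain ⟨j⟩ := s.nonempty; have h1 := (s.ker j _).2 hf2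
      have h2 : s.Φ j (C a) = HC (C a) := by
        have := (s.Φ j).commutes a; rw [algebraMap_eq] at this; rw [this, HahnSeries.algebraMap_apply]; rfl
      rw [h2, ← map_zero HC] at h1; have h3 := HahnSeries.C_injective h1; rw [C_eq_zero] at h3; rw [h3, map_zero]
    · exact s.nondeg f hf2 (mem_HG_nat.1 hf1)
  · intro p D hD; refine HV_les (G := fun D => (HG D : Submodule K (PS K r)).toAddSubgroup)
      (x' := xs) (G' := fun D => gp s.HD D ⊓ N.toAddSubgroup) s.F.toRingHom.toAddMonoidHom ?_ _ ?_ ?_ ?_ ?_ ?_ ?_ ?_ (hA (p + 1) D (by omega))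
    · intro k D m hm; have := HG_mul (hxd k) hm; rw [add_comm (1 : ℤ) D] at this; exact this
    · intro l _ m; exact map_mul s.F _ _
    · intro D m hm; exact hm.1
    · intro D m hm; exact ⟨s.HD_F hm, ⟨m, rfl⟩⟩
    · rintro D _ ⟨h1, ⟨a, rfl⟩⟩; refine ⟨hcmp D a, hcmp_mem D a, F_hcmp h1.2⟩
    · intro D m hm h; exact ⟨hm, (hFker m).1 h⟩
    · intro D m hm; exact (hFker m).2 hm.2
    · rcases lt_trichotomy p 0 with hi | hi | hi
      · exact HV_neg _ _ _ hi
      · subst hi; rw [HV_h0]; intro m hm; exact hgx.gen _ (by omega) _ hm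
      · refine HV_reg ?_ _ (fun l hl D m hm h => hgx.reg l hl D m hm h) p D (by omega); intro k D m hm; have := HG_mul (hxd k) hm
        rw [add_comm (1 : ℤ) D] at this; exact this

end Setup
end AMDP
namespace AMDP

variable {K : Type} [Field K] {d : ℕ}

lemma lin_prime {p : MP K d} (hp : p ∈ HG 1) (h0 : p ≠ 0) : Prime p := by
  have hh : p.IsHomogeneous 1 := by
    have := (mem_HG_nat (n := 1) (p := p)).1 (by simpa using hp); exact this
  refine (MvPolynomial.irreducible_of_totalDegree_eq_one (hh.totalDegree h0) ?_).prime; intro x hx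
  obtain ⟨i, hi⟩ := MvPolynomial.ne_zero_iff.1 h0; by_contra hu; have hx0 : x = 0 := by
    by_contra h; exact hu (isUnit_iff_ne_zero.2 h)
  exact hi (by simpa [hx0] using hx i)

/-- Proportionality. -/
def Par (a b : MP K d) : Prop := ∃ κ : K, κ ≠ 0 ∧ a = κ • b

lemma Par.symm {a b : MP K d} (h : Par a b) : Par b a := by
  obtain ⟨κ, h0, rfl⟩ := h; exact ⟨κ⁻¹, inv_ne_zero h0, by rw [smul_smul, inv_mul_cancel₀ h0, one_smul]⟩

lemma Par.trans {a b e : MP K d} (h : Par a b) (h' : Par b e) : Par a e := by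
  obtain ⟨κ, h0, rfl⟩ := h; obtain ⟨κ', h0', rfl⟩ := h'; exact ⟨κ * κ', mul_ne_zero h0 h0', by rw [smul_smul]⟩

lemma par_of_dvd {a b : MP K d} (ha : a ∈ HG 1) (hb : b ∈ HG 1) (ha0 : a ≠ 0) (hb0 : b ≠ 0) (h : a ∣ b) : Par a b := by
  obtain ⟨q, rfl⟩ := h; have h1 := HG_div ha ha0 hb; rw [sub_self] at h1; have h2 := HG_zero_eq h1
  have h3 : coeff 0 q ≠ 0 := fun h => hb0 (by rw [h2, h, map_zero, mul_zero]); refine Par.symm ⟨coeff 0 q, h3, ?_⟩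
  conv_lhs => rw [h2]
  rw [smul_eq_C_mul, mul_comm]

lemma par_or {a b e f : MP K d} (ha : a ∈ HG 1) (he : e ∈ HG 1)
    (hf : f ∈ HG 1) (ha0 : a ≠ 0) (he0 : e ≠ 0) (hf0 : f ≠ 0) (h : a * b = e * f) : Par a e ∨ Par a f := by
  rcases (lin_prime ha ha0).dvd_or_dvd (Dvd.intro b h) with h1 | h1
  · exact Or.inl (par_of_dvd ha he ha0 he0 h1)
  · exact Or.inr (par_of_dvd ha hf ha0 hf0 h1)

/-- The combinatorial data of the constant terms. -/
structure TData (d : ℕ) (K : Type) [Field K] (ι : Type) where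
  E : ι → ι → MP K d
  hE : ∀ i j, E i j ∈ HG 1
  ne : ∀ i j k, i ≠ j → i ≠ k → j ≠ k → E i k - E i j ≠ 0
  rel : ∀ i j k m, i ≠ j → k ≠ i → k ≠ j → m ≠ i → m ≠ j → (E i k - E i j) * (E j k - E j i) = (E i m - E i j) * (E j m - E j i)

namespace TData
variable {ι : Type} (t : TData d K ι)

/-- Constancy. -/
def Q (i j k m : ι) : Prop := Par (t.E i k - t.E i j) (t.E i m - t.E i j)

/-- Four distinct indices. -/
def D4 (i j k m : ι) : Prop := i ≠ j ∧ i ≠ k ∧ i ≠ m ∧ j ≠ k ∧ j ≠ m ∧ k ≠ m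

variable {t}
lemma Q.s34 {i j k m : ι} (h : t.Q i j k m) : t.Q i j m k := Par.symm h

lemma Q.s24 {i j k m : ι} (hD : D4 i j k m) (h : t.Q i j k m) : t.Q i m k j := by
  obtain ⟨κ, h0, h⟩ := h; obtain ⟨h1, h2, h3, h4, h5, h6⟩ := hD
  have e : t.E i k - t.E i m = (κ - 1) • (t.E i m - t.E i j) := by rw [sub_smul, ← h, one_smul]; ring
  have hk : κ - 1 ≠ 0 := by
    intro h7; rw [h7, zero_smul] at e; exact t.ne i m k h3 h2 h6.symm e
  refine ⟨-(κ - 1), neg_ne_zero.2 hk, ?_⟩; rw [e, ← neg_sub (t.E i m), smul_neg, neg_smul, neg_neg]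

lemma Q.s12 {i j k m : ι} (hD : D4 i j k m) (h : t.Q i j k m) : t.Q j i k m := by
  obtain ⟨κ, h0, h⟩ := h; obtain ⟨h1, h2, h3, h4, h5, h6⟩ := hD; have h7 := t.rel i j k m h1 h2.symm h4.symm h3.symm h5.symm
  rw [h, smul_mul_assoc, ← mul_smul_comm] at h7; have h8 := mul_left_cancel₀ (t.ne i j m h1 h3 h5) h7; exact Par.symm ⟨κ, h0, h8.symm⟩

lemma cross {i j k m : ι} (hD : D4 i j k m) (h : ¬ t.Q i j k m) : Par (t.E i k - t.E i j) (t.E j m - t.E j i) := by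
  obtain ⟨h1, h2, h3, h4, h5, h6⟩ := hD; refine (par_or ?_ ?_ ?_ ?_ ?_ ?_ (t.rel i j k m h1 h2.symm h4.symm h3.symm h5.symm)).resolve_left h
  any_goals exact sub_mem (t.hE _ _) (t.hE _ _)
  · exact t.ne _ _ _ h1 h2 h4
  · exact t.ne _ _ _ h1 h3 h5
  · exact t.ne _ _ _ h1.symm h5 h3

lemma five {i j k m n : ι} (hD : D4 i j k m) (hD' : D4 i j k n) (hm : m ≠ n) (h : ¬ t.Q i j k m) (h' : ¬ t.Q i j k n) : False := by
  have hx := hD; have hx' := hD'; obtain ⟨h1, h2, h3, h4, h5, h6⟩ := hx; obtain ⟨h1', h2', h3', h4', h5', h6'⟩ := hx'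
  have a1 : t.Q j i m n := (cross hD h).symm.trans (cross hD' h'); have hE : D4 i k j m := ⟨h2, h1, h3, h4.symm, h6, h5⟩
  have hE' : D4 i k j n := ⟨h2, h1, h3', h4.symm, h6', h5'⟩; have s23 : ∀ {m}, D4 i j k m → t.Q i k j m → t.Q i j k m := by
    intro m hD hq; obtain ⟨h1, h2, h3, h4, h5, h6⟩ := hD; have q1 := Q.s24 ⟨h2, h1, h3, h4.symm, h6, h5⟩ hq; have q2 := q1.s34
    have q3 := Q.s24 ⟨h3, h2, h1, h6.symm, h5.symm, h4.symm⟩ q2; exact q3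
  have a2 : t.Q k i m n := (cross hE fun q => h (s23 hD q)).symm.trans (cross hE' fun q => h' (s23 hD' q))
  have b1 : t.Q i j m n := Q.s12 ⟨h1.symm, h5, h5', h3, h3', hm⟩ a1; have b2 : t.Q i k m n := Q.s12 ⟨h2.symm, h6, h6', h3, h3', hm⟩ a2
  have c1 : t.Q i m n j := (Q.s24 ⟨h1, h3', h3, h5', h5, hm.symm⟩ b1.s34)
  have c2 : t.Q i m n k := (Q.s24 ⟨h2, h3', h3, h6', h6, hm.symm⟩ b2.s34); have c3 : t.Q i m k j := c2.s34.trans c1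
  exact h (Q.s24 ⟨h3, h2, h1, h6.symm, h5.symm, h4.symm⟩ c3)

variable (t)
lemma classify [Fintype ι] (h : ∃ i j k m, D4 i j k m ∧ ¬ t.Q i j k m) : Fintype.card ι ≤ 4 := by
  classical
  by_contra hc
  push Not at hc
  obtain ⟨i, j, k, m, hD, hq⟩ := h; obtain ⟨n, hn⟩ : ∃ n, n ∉ ({i, j, k, m} : Finset ι) := by
    by_contra h
    push Not at h
    have h1 : (Finset.univ : Finset ι) ⊆ {i, j, k, m} := fun x _ => h x; have := Finset.card_le_card h1
    have h2 : ({i, j, k, m} : Finset ι).card ≤ 4 := Finset.card_le_four; rw [card_univ] at this; omega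
  simp only [Finset.mem_insert, Finset.mem_singleton, not_or] at hn; obtain ⟨n1, n2, n3, n4⟩ := hn; have hx := hD
  obtain ⟨h1, h2, h3, h4, h5, h6⟩ := hx; have hD' : D4 i j k n := ⟨h1, h2, Ne.symm n1, h4, Ne.symm n2, Ne.symm n3⟩
  have hE : D4 i j m k := ⟨h1, h3, h2, h5, h4, h6.symm⟩; have hE' : D4 i j m n := ⟨h1, h3, Ne.symm n1, h5, Ne.symm n2, Ne.symm n4⟩
  by_cases q1 : t.Q i j k n
  · by_cases q2 : t.Q i j m n
    · exact hq (q1.trans q2.s34)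
    · exact five hE hE' (Ne.symm n3) (fun q => hq q.s34) q2
  · exact five hD hD' (Ne.symm n4) hq q1

lemma scroll [Fintype ι] (h3 : 3 ≤ Fintype.card ι) (h : ∀ i j k m, D4 i j k m → t.Q i j k m) (i : ι) : ∃ κ ∈ HG 1, ∃ m ∈ HG 1, m ≠ 0 ∧
      ∃ x : ι → K, ∀ j ≠ i, t.E i j = κ + x j • m := by
  classical
  have hex : ∀ s : Finset ι, s.card ≤ 2 → ∃ n, n ∉ s := fun s hs => by
    by_contra h
    push Not at h
    have := Finset.card_le_card (fun x _ => h x : (Finset.univ : Finset ι) ⊆ s); rw [card_univ] at this; omega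
  obtain ⟨j, hj⟩ := hex {i} (by simp); obtain ⟨k, hk⟩ := hex {i, j} Finset.card_le_two
  simp only [Finset.mem_insert, Finset.mem_singleton, not_or] at hj hk; have h0 := t.ne i j k (Ne.symm hj) (Ne.symm hk.1) (Ne.symm hk.2)
  have hx : ∀ l, ∃ x : K, l ≠ i → t.E i l = t.E i j + x • (t.E i k - t.E i j) := fun l => by
    by_cases l1 : l = i
    · exact ⟨0, fun h => absurd l1 h⟩
    by_cases l2 : l = j
    · exact ⟨0, fun _ => by rw [l2]; simp⟩
    by_cases l3 : l = k
    · exact ⟨1, fun _ => by rw [l3]; simp⟩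
    obtain ⟨κ, _, hκ⟩ := h i j l k ⟨Ne.symm hj, Ne.symm l1, Ne.symm hk.1, Ne.symm l2, Ne.symm hk.2, l3⟩
    exact ⟨κ, fun _ => by rw [← hκ]; ring⟩
  choose x hx using hx; exact ⟨t.E i j, t.hE _ _, _, sub_mem (t.hE _ _) (t.hE _ _), h0, x, fun l hl => hx l hl⟩

end TData

namespace Setup
variable {r : ℕ} {I : Ideal (PS K r)} {c : ℕ} {ι : Type} [Fintype ι] (s : Setup K r I d c ι)

variable {s} {η : ι → ι → LS K d} (h1 : ∀ i, η i ∈ s.HD 1)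
  (h2 : ∀ i j, j ≠ i → (η i j).coeff (-1) = 0) (h3 : ∀ i, (η i i).coeff (-1) = 1)

lemma HD_lo {G : ι → LS K d} (h : G ∈ s.HD 1) (j : ι) : Lo (-1) (G j) := GG_lo (h.2 j)

lemma lo_zero {G : ι → LS K d} (h : G ∈ s.HD 1) {j : ι} (h0 : (G j).coeff (-1) = 0) : Lo 0 (G j) := fun i hi => by
  by_cases h : i = -1
  · rw [h]; exact h0
  · exact HD_lo (s := s) ‹_› j i (by omega)

lemma cc_coeff (p : MP K d) (j : ι) : s.F (s.P p) j = HC p := by rw [F_apply, ΦP]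

lemma HD_cc {m : ℤ} {p : MP K d} (hp : p ∈ HG m) : s.F (s.P p) ∈ s.HD m := s.HD_F (s.P_HG hp)

include h1 h2 in
lemma T_rel {i j : ι} (hij : i ≠ j) : ∃ Cc : MP K d, (∀ k, (η i k - HC ((η i j).coeff 0)) * (η j k - HC ((η j i).coeff 0)) = HC Cc) ∧
    ∀ k, k ≠ i → k ≠ j → ((η i k).coeff 0 - (η i j).coeff 0) * ((η j k).coeff 0 - (η j i).coeff 0) = Cc := by
  have := s.nonempty; have hE : ∀ i j, (η i j).coeff 0 ∈ HG 1 := fun i j => by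
    have := (h1 i).2 j 0; rwa [add_zero] at this
  have hd : ∀ i j, η i - s.F (s.P ((η i j).coeff 0)) ∈ s.HD 1 := fun i j => sub_mem (h1 i) (HD_cc (hE i j))
  have hl0 : ∀ i j k, k ≠ i → Lo 0 ((η i - s.F (s.P ((η i j).coeff 0))) k) := fun i j k hk => by
    rw [Pi.sub_apply, cc_coeff]; exact (lo_zero (h1 i) (h2 i k hk)).sub (Lo.C _)
  have hl1 : ∀ i j, j ≠ i → Lo 1 ((η i - s.F (s.P ((η i j).coeff 0))) j) := fun i j hj e he => by
    by_cases h : e = 0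
    · rw [h, Pi.sub_apply, cc_coeff, HahnSeries.coeff_sub, coeff_C_zero', sub_self]
    · exact hl0 i j j hj e (by omega)
  obtain ⟨p, hp, hp'⟩ := s.U1' (s.HD_mul (hd i j) (hd j i)) (by
    intro k; rw [Pi.mul_apply]; by_cases k1 : k = i
    · subst k1; simpa using (HD_lo (hd k j) k).mul (hl1 j k hij)
    · by_cases k2 : k = j
      · subst k2; simpa using (hl1 i k (Ne.symm hij)).mul (HD_lo (hd k i) k)
      · simpa using (hl0 i j k k1).mul (hl0 j i k k2))
  have hp2 : ∀ k, (η i k - HC ((η i j).coeff 0)) * (η j k - HC ((η j i).coeff 0)) = HC p := fun k => by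
    have := congrFun hp' k; simpa only [Pi.mul_apply, Pi.sub_apply, cc_coeff] using this
  refine ⟨p, hp2, fun k k1 k2 => ?_⟩; have a1 := hl0 i j k k1; have a2 := hl0 j i k k2; rw [Pi.sub_apply, cc_coeff] at a1 a2
  have a3 := coeff_mul_lo0 a1 a2; rw [hp2 k] at a3; simpa using a3.symm

/-- The combinatorial data. -/
def tdata : TData d K ι where
  E i j := (η i j).coeff 0
  hE i j := by
    have := (h1 i).2 j 0; rwa [add_zero] at this
  ne i j k hij hik hjk h := by
    have := s.nonempty; obtain ⟨p, hp, hp'⟩ := T_rel h1 h2 hij; have h4 := hp' k hik.symm hjk.symm; rw [h, zero_mul] at h4; have h5 := hp k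
    rw [← h4, map_zero, mul_eq_zero] at h5; have key : ∀ i q, η i k - HC q = 0 → False := fun i q h => by
      have h6 : η i - s.F (s.P q) = 0 := by
        refine s.HH_inj (s.HH.sub_mem (h1 i).1 (s.F_HH _)) (j := k) ?_; rw [Pi.sub_apply, cc_coeff, h]
      have h7 := congrFun h6 i; rw [Pi.sub_apply, cc_coeff] at h7; have h8 := congrArg (fun f => HahnSeries.coeff f (-1)) h7
      simp only [HahnSeries.coeff_sub, h3, Pi.zero_apply, HahnSeries.coeff_zero] at h8; rw [coeff_C_ne (by norm_num)] at h8; simp at h8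
    rcases h5 with h5 | h5
    · exact key _ _ h5
    · exact key _ _ h5
  rel i j k m hij k1 k2 m1 m2 := by
    obtain ⟨p, hp, hp'⟩ := T_rel h1 h2 hij; rw [hp' k k1 k2, hp' m m1 m2]

include h1 h2 h3 in
lemma lift1 [DecidableEq ι] (v : ι → K) (hv : ∑ j, s.γ j * v j = 0) {p : MP K d} (hp : p ∈ HG 1) :
    ∃ x ∈ HG 1, s.F x = ∑ j, v j • η j + s.F (s.P p) := by
  have := s.nonempty; obtain ⟨x, hx, hxv⟩ := s.symb_surj v hv; have hs : ∑ j, v j • η j ∈ s.HD 1 := sum_mem fun j _ => smul_mem _ _ (h1 j)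
  have hd : s.F x - ∑ j, v j • η j ∈ s.HD 1 := sub_mem (s.HD_F hx) hs; obtain ⟨q, hq, hq'⟩ := s.U1' hd (by
    intro k; refine lo_zero hd ?_
    rw [Pi.sub_apply, F_apply, HahnSeries.coeff_sub, hxv, Finset.sum_apply, HahnSeries.coeff_sum, sum_eq_single k]
    · rw [Pi.smul_apply, HahnSeries.coeff_smul, h3, smul_eq_C_mul, mul_one, sub_self]
    · intro j _ hj; rw [Pi.smul_apply, HahnSeries.coeff_smul, h2 j k hj.symm, smul_zero]
    · simp)
  refine ⟨x - s.P q + s.P p, add_mem (sub_mem hx (s.P_HG hq)) (s.P_HG hp), ?_⟩; rw [map_add, map_sub, ← hq']; ring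

end Setup
end AMDP
namespace AMDP
variable {K : Type} [Field K] {d : ℕ}
namespace Setup
variable {r : ℕ} {I : Ideal (PS K r)} {c : ℕ}

section
variable {ι : Type} [Fintype ι] (s : Setup K r I d c ι)

lemma F_cancel {p : MP K d} (hp : p ≠ 0) {a : PS K r} (h : s.F (s.P p) * s.F a = 0) : a ∈ I := by
  obtain ⟨j⟩ := s.nonempty; have h1 := congrFun h j; rw [Pi.mul_apply, F_apply, F_apply, ΦP] at h1
  rcases mul_eq_zero.1 h1 with h2 | h2
  · exact absurd (by simpa using congrArg (fun f => HahnSeries.coeff f (0 : ℤ)) h2) hp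
  · exact (s.ker j a).1 h2

lemma F_zero {a : PS K r} (h : s.F a = 0) : a ∈ I := by
  have := s.F_eq (a := a) (b := 0) (by rw [h, map_zero]); simpa using this

lemma hom_one {x : PS K r} (hx : x ∈ HG 1) : x.IsHomogeneous 1 := (mem_HG_nat (n := 1) (p := x)).1 (by simpa using hx)

lemma one_hom {σ : Type} {x : MvPolynomial σ K} (hx : x.IsHomogeneous 1) : x ∈ HG 1 := by
  have := (mem_HG_nat (n := 1) (p := x)).2 hx; simpa using this

lemma F_one_inj {x y : PS K r} (hx : x ∈ HG 1) (hy : y ∈ HG 1) (h : s.F x = s.F y) : x = y := by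
  rw [← sub_eq_zero]; exact s.nondeg _ (s.F_eq h) (hom_one (sub_mem hx hy))

lemma P_span {p : MP K d} (hp : p ∈ HG 1) : s.P p ∈ span K (Set.range s.l) := by
  rw [hom1_eq p ((mem_HG_nat (n := 1) (p := p)).1 (by simpa using hp)), map_sum]; refine sum_mem fun i _ => ?_; rw [map_smul]
  refine smul_mem _ _ (subset_span ⟨i, ?_⟩); simp [P]

lemma smul_LS (a : K) (f : LS K d) : a • f = HC (C a) * f := by
  ext1; funext i
  rw [coeff_Cmul, HahnSeries.coeff_smul, smul_eq_C_mul]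

lemma smul_cc (a : K) (G : ι → LS K d) : a • G = s.F (s.P (C a)) * G := by
  funext j; rw [Pi.smul_apply, Pi.mul_apply, cc_coeff, smul_LS]

lemma neg_smul_LS (a : K) (G : ι → LS K d) : (-a) • G = -(a • G) := by
  funext j; rw [Pi.neg_apply, Pi.smul_apply, Pi.smul_apply]
  ext1; funext i
  rw [HahnSeries.coeff_neg, HahnSeries.coeff_smul, HahnSeries.coeff_smul, neg_smul]

/-- Linear forms without pole come from the finite part. -/
lemma one_span {x : PS K r} (hx : x ∈ HG 1) (h0 : ∀ j, (s.Φ j x).coeff (-1) = 0) : x ∈ span K (Set.range s.l) := by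
  have := s.nonempty; obtain ⟨p, hp, hp'⟩ := s.U1' (s.HD_F hx) (fun j => lo_zero (s := s) (s.HD_F hx) (h0 j))
  rw [s.F_one_inj hx (s.P_HG hp) hp']; exact s.P_span hp
end

lemma lagr {τ : Type} [Fintype τ] [DecidableEq τ] {x : τ → K} (hx : Injective x)
    (hcard : Fintype.card τ = c + 1) : ∃ w : τ → K, (∀ t, w t ≠ 0) ∧ ∀ k, k ≤ c → ∑ t, w t * x t ^ k = if k = c then 1 else 0 := by
  refine ⟨fun t => (∏ j ∈ Finset.univ.erase t, (x t - x j))⁻¹, fun t => ?_, fun k hk => ?_⟩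
  · refine inv_ne_zero (Finset.prod_ne_zero_iff.2 fun j hj => sub_ne_zero.2 fun h => ?_); exact (Finset.mem_erase.1 hj).1 (hx h).symm
  · have h := Lagrange.coeff_eq_sum (s := Finset.univ) (v := x) hx.injOn (P := PX ^ k) (by
      rw [Polynomial.degree_X_pow, card_univ, hcard]; exact_mod_cast Nat.lt_succ_of_le hk)
    rw [card_univ, hcard, Polynomial.coeff_X_pow, Nat.add_sub_cancel] at h; simp_rw [eq_comm (a := k)]; rw [h]
    refine sum_congr rfl fun t _ => ?_; simp [div_eq_mul_inv, mul_comm]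

set_option maxHeartbeats 800000 in
theorem scroll_J {τ : Type} [Fintype τ] [DecidableEq τ] (s : Setup K r I d c (Option τ)) (hc : 2 ≤ c)
    {η : Option τ → Option τ → LS K d} (h1 : ∀ i, η i ∈ s.HD 1)
    (h2 : ∀ i j, j ≠ i → (η i j).coeff (-1) = 0) (h3 : ∀ i, (η i i).coeff (-1) = 1)
    {κ m0 : MP K d} (hκ : κ ∈ HG 1) (hm0 : m0 ∈ HG 1) (hm : m0 ≠ 0) (x : τ → K)
    (hx : ∀ t, (η none (some t)).coeff 0 = κ + x t • m0) : ∃ J : Ideal (PS K r), J.IsPrime ∧ AMD.IsHomIdeal K r J ∧ AMD.Nondeg K r J ∧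
      J ≤ I ∧ AMD.DimEq K r J (d + 1) ∧ AMD.DegreeEq K r J (d + 1) c := by
  have hcard : Fintype.card τ = c + 1 := by
    have := s.card; rw [Fintype.card_option] at this; omega
  let td := tdata h1 h2 h3; have hE : ∀ i j, (η i j).coeff 0 ∈ HG 1 := td.hE; have hinj : Injective x := by
    intro t t' h; by_contra hne; refine td.ne none (some t) (some t') (by simp) (by simp) (by simpa using hne) ?_
    show (η none (some t')).coeff 0 - (η none (some t)).coeff 0 = 0; rw [hx, hx, h, sub_self]
  -- the basic relation
  have hrel : ∀ t, ∃ μ ∈ HG 1, (η none - s.F (s.P κ)) * (η (some t) - s.F (s.P ((η (some t) none).coeff 0))) =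
        s.F (s.P m0) * (x t • (η (some t) - s.F (s.P ((η (some t) none).coeff 0))) + s.F (s.P μ)) := by
    intro t; obtain ⟨k, hk⟩ : ∃ k, k ≠ t := by
      have : Nontrivial τ := Fintype.one_lt_card_iff_nontrivial.1 (by omega); exact exists_ne t
    obtain ⟨p, hp, hp'⟩ := T_rel h1 h2 (show (some t : Option τ) ≠ none by simp)
    refine ⟨(x k - x t) • ((η (some t) (some k)).coeff 0 - (η (some t) none).coeff 0),
      smul_mem _ _ (sub_mem (hE _ _) (hE _ _)), ?_⟩
    have h4 := hp' (some k) (by simpa using hk) (by simp); rw [hx, hx] at h4; funext j; have h5 := hp j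
    simp only [Pi.mul_apply, Pi.sub_apply, Pi.add_apply, Pi.smul_apply, cc_coeff]; rw [← h4, hx] at h5
    simp only [smul_eq_C_mul, map_add, map_mul, map_sub] at h5 ⊢; rw [smul_LS]; linear_combination h5
  choose μ hμ hrel using hrel; obtain ⟨w, hw0, hw⟩ := lagr hinj hcard
  set cc : MP K d → (Option τ → LS K d) := fun p => s.F (s.P p) with hcc
  have cadd : ∀ p q, cc (p + q) = cc p + cc q := fun p q => by simp only [hcc, map_add]
  have csmul : ∀ (a : K) p, cc (a • p) = a • cc p := fun a p => by simp only [hcc, map_smul]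
  have csum : ∀ f : τ → MP K d, cc (∑ t, f t) = ∑ t, cc (f t) := fun f => by simp only [hcc, map_sum]
  obtain ⟨e0, he0⟩ : ∃ e0, e0 = η none - cc κ := ⟨_, rfl⟩
  obtain ⟨et, het⟩ : ∃ et : τ → _, et = fun t => η (some t) - cc ((η (some t) none).coeff 0) := ⟨_, rfl⟩
  have hrel' : ∀ t, e0 * et t = cc m0 * (x t • et t + cc (μ t)) := fun t => by rw [he0, het]; exact hrel t
  obtain ⟨W, hW⟩ : ∃ W : ℕ → τ → K, W = fun k t => w t * (s.γ (some t))⁻¹ * x t ^ k := ⟨_, rfl⟩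
  obtain ⟨Z, hZ⟩ : ∃ Z : ℕ → _, Z = fun k => ∑ t, W k t • et t := ⟨_, rfl⟩
  obtain ⟨n, hn⟩ : ∃ n : ℕ → _, n = fun k => ∑ t, W k t • μ t := ⟨_, rfl⟩
  have hnH : ∀ k, n k ∈ HG 1 := fun k => by rw [hn]; exact sum_mem fun t _ => smul_mem _ _ (hμ t)
  have hZr : ∀ k, e0 * Z k = cc m0 * (Z (k + 1) + cc (n k)) := fun k => by
    rw [hZ, hn, csum]; simp only; rw [mul_sum, ← sum_add_distrib, mul_sum]; refine sum_congr rfl fun t _ => ?_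
    rw [mul_smul_comm, hrel', csmul, hW]; simp only; rw [pow_succ, ← mul_smul_comm, smul_add, smul_smul, mul_assoc _ (x t ^ k)]
  -- the modified family
  obtain ⟨y, hy⟩ : ∃ y : ℕ → _, y = fun k => Z k - (if k + 1 = c then (s.γ none)⁻¹ else 0) • cc m0 -
    (if k = c then (s.γ none)⁻¹ else 0) • e0 := ⟨_, rfl⟩
  obtain ⟨v, hv⟩ : ∃ v : ℕ → _, v = fun k => n k + (if k + 2 = c then (s.γ none)⁻¹ else 0) • m0 := ⟨_, rfl⟩
  have hvH : ∀ k, v k ∈ HG 1 := fun k => by rw [hv]; exact add_mem (hnH k) (smul_mem _ _ hm0)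
  have hyr : ∀ k, k < c → e0 * y k = cc m0 * (y (k + 1) + cc (v k)) := fun k hk => by
    rw [hy, hv]; simp only; rw [cadd, csmul, if_neg (show k ≠ c by omega)]; simp only [show k + 1 + 1 = k + 2 from rfl, zero_smul, sub_zero]
    rw [mul_sub, mul_add, mul_sub, mul_sub, mul_smul_comm, mul_smul_comm, mul_add, hZr k, mul_add,
      mul_comm e0 (cc m0), mul_smul_comm]
    simp only [mul_smul_comm]; abel
  have hYex : ∀ k, ∃ Y ∈ HG 1, k ≤ c → s.F Y = y k := fun k => by
    by_cases hk : k ≤ c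
    · obtain ⟨Y, hY, hYF⟩ := lift1 h1 h2 h3
        (fun j => Option.elim j (-(if k = c then (s.γ none)⁻¹ else 0)) (W k)) (by
          rw [sum_option]; simp only [Option.elim]; have e1 : ∑ t, s.γ (some t) * W k t = ∑ t, w t * x t ^ k := by
            refine sum_congr rfl fun t _ => ?_; have := s.γne (some t); rw [hW]; simp only; field_simp
          rw [e1, hw k hk]; have := s.γne none; split_ifs
          · field_simp; ring
          · ring)
        (p := -(∑ t, W k t • (η (some t) none).coeff 0) - (if k + 1 = c then (s.γ none)⁻¹ else 0) • m0
          + (if k = c then (s.γ none)⁻¹ else 0) • κ)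
        (add_mem (sub_mem (neg_mem (sum_mem fun t _ =>
          smul_mem _ _ (hE _ _))) (smul_mem _ _ hm0)) (smul_mem _ _ hκ))
      refine ⟨Y, hY, fun _ => ?_⟩; rw [hYF, sum_option, hy, hZ, he0, het]; simp only [Option.elim]
      rw [map_add, map_sub, map_neg, map_sum, map_smul, map_smul, map_add, map_sub, map_neg, map_sum,
        map_smul, map_smul]
      simp only [map_smul, smul_sub, sum_sub_distrib]; rw [neg_smul_LS]; simp only [hcc]; abel
    · exact ⟨0, Submodule.zero_mem _, fun h => absurd h hk⟩
  choose Y hYH hYF using hYex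
  refine J_final s.hr (by omega) I s.nondeg s.l Y (fun k => s.P (v k)) ⟨?_, ?_⟩ (fun k _ => s.P_span (hvH k)) ?_
  · rintro (i | k)
    · exact hom_one (s.ld i)
    · exact hom_one (hYH _)
  · intro p hp; have hpH := one_hom hp
    -- interpolation
    obtain ⟨q, hqd, hq⟩ : ∃ q : Polynomial K, q.degree < (c + 1 : ℕ) ∧ ∀ t, q.eval (x t) =
        (w t)⁻¹ * s.γ (some t) * constantCoeff ((s.Φ (some t) p).coeff (-1)) := by
      refine ⟨Lagrange.interpolate Finset.univ x _, ?_, fun t => Lagrange.eval_interpolate_at_node _ hinj.injOn (mem_univ t)⟩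
      have := Lagrange.degree_interpolate_lt (s := Finset.univ) (v := x)
        (fun t => (w t)⁻¹ * s.γ (some t) * constantCoeff ((s.Φ (some t) p).coeff (-1))) hinj.injOn
      rwa [card_univ, hcard] at this
    have hyc : ∀ k, ∀ t, (y k (some t)).coeff (-1) = C (W k t) := fun k t => by
      have a1 : ∀ p, (cc p (some t)).coeff (-1) = 0 := fun p => by rw [hcc]; simp only; rw [cc_coeff, coeff_C_ne (by norm_num)]
      have a2 : (e0 (some t)).coeff (-1) = 0 := by rw [he0, Pi.sub_apply, HahnSeries.coeff_sub, a1, h2 _ _ (by simp), sub_zero]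
      have a3 : ∀ t', (et t' (some t)).coeff (-1) = if t' = t then 1 else 0 := fun t' => by
        rw [het]; simp only; rw [Pi.sub_apply, HahnSeries.coeff_sub, a1, sub_zero]
        split_ifs with h
        · rw [h, h3]
        · rw [h2 _ _ (by simpa using Ne.symm h)]
      rw [hy]; simp only; rw [Pi.sub_apply, Pi.sub_apply, HahnSeries.coeff_sub, HahnSeries.coeff_sub, Pi.smul_apply,
        Pi.smul_apply, HahnSeries.coeff_smul, HahnSeries.coeff_smul, a1, a2, smul_zero, smul_zero, sub_zero, sub_zero, hZ]
      simp only; rw [Finset.sum_apply, HahnSeries.coeff_sum]; simp only [Pi.smul_apply, HahnSeries.coeff_smul, a3, smul_ite, smul_zero]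
      rw [Finset.sum_ite_eq' Finset.univ t, if_pos (mem_univ _), smul_eq_C_mul, mul_one]
    obtain ⟨b, hb⟩ : ∃ b, b = p - ∑ k ∈ range (c + 1), q.coeff k • Y k := ⟨_, rfl⟩; have hbH : b ∈ HG 1 := by
      rw [hb]; exact sub_mem hpH (sum_mem fun k _ => smul_mem _ _ (hYH k))
    have hbt : ∀ t, (s.Φ (some t) b).coeff (-1) = 0 := fun t => by
      have a1 : ∀ k ∈ range (c + 1), (s.Φ (some t) (q.coeff k • Y k)).coeff (-1) =
          C (w t * (s.γ (some t))⁻¹) * C (q.coeff k * x t ^ k) := by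
        intro k hk; have := congrFun (hYF k (by simpa [Nat.lt_succ_iff] using hk)) (some t); rw [F_apply] at this
        rw [map_smul, HahnSeries.coeff_smul, this, hyc, hW, smul_eq_C_mul, ← map_mul, ← map_mul]; congr 1; ring
      rw [hb, map_sub, map_sum, HahnSeries.coeff_sub, HahnSeries.coeff_sum, sum_congr rfl a1,
        ← mul_sum, ← map_sum, ← Polynomial.eval_eq_sum_range' (by
          by_cases hq0 : q = 0
          · simp [hq0]
          · exact (Polynomial.natDegree_lt_iff_degree_lt hq0).2 hqd), hq, s.coeffC hpH, constantCoeff_C, ← map_mul, ← map_sub]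
      have := hw0 t; have := s.γne (some t)
      rw [show ∀ a : K, a - w t * (s.γ (some t))⁻¹ * ((w t)⁻¹ * s.γ (some t) * a) = 0 by intro a; field_simp; ring, map_zero]
    have hb0 : ∀ j, (s.Φ j b).coeff (-1) = 0 := by
      rintro (_ | t)
      · have := s.γsum b hbH; rw [sum_option, sum_eq_zero (fun t _ => by rw [hbt t, smul_zero]), add_zero] at this
        exact (smul_eq_zero.1 this).resolve_left (s.γne none)
      · exact hbt t
    have hpb : p = b + ∑ k ∈ range (c + 1), q.coeff k • Y k := by rw [hb]; ring
    rw [hpb]; refine add_mem ?_ (sum_mem fun k hk => smul_mem _ _ (subset_span ⟨Sum.inr ⟨k, by simpa using hk⟩, rfl⟩))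
    refine Submodule.span_mono ?_ (s.one_span hbH hb0); rintro _ ⟨i, rfl⟩; exact ⟨Sum.inl i, rfl⟩
  · intro k m hk hm'; refine s.F_cancel hm ?_; have a1 := hyr k hk; have a2 := hyr m hm'
    rw [map_sub, map_mul, map_mul, map_add, map_add, hYF k (by omega), hYF m (by omega), hYF (k + 1) (by omega), hYF (m + 1) (by omega)]
    change cc m0 * (y k * (y (m + 1) + cc (v m)) - y m * (y (k + 1) + cc (v k))) = 0; linear_combination (-(y k)) * a2 + y m * a1

end Setup
end AMDP
namespace AMDP

variable {K : Type} [Field K] {d : ℕ}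

namespace TData
variable {ι : Type} {t : TData d K ι}

lemma half {i j k m : ι} (hD : D4 i j k m) (h : ¬ t.Q i j k m) : ∃ a : K, a ≠ 0 ∧
    t.E j k - t.E j i = -(a • (t.E i m - t.E i j)) ∧ t.E j m - t.E j i = -(a • (t.E i k - t.E i j)) := by
  have hD' : D4 i j m k := by
    obtain ⟨h1, h2, h3, h4, h5, h6⟩ := hD; exact ⟨h1, h3, h2, h5, h4, h6.symm⟩
  obtain ⟨x, hx, e1⟩ := cross hD h; obtain ⟨y, hy, e2⟩ := cross hD' (fun hq => h hq.s34); obtain ⟨h1, h2, h3, h4, h5, h6⟩ := hD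
  have h7 := t.rel i j k m h1 h2.symm h4.symm h3.symm h5.symm; have n1 := t.ne j i k h1.symm h4 h2; have n2 := t.ne j i m h1.symm h5 h3
  have hxy : x = y := by
    rw [e1, e2, smul_mul_assoc, smul_mul_assoc, mul_comm (t.E j k - t.E j i)] at h7; exact smul_left_injective K (mul_ne_zero n2 n1) h7
  subst hxy; refine ⟨-x⁻¹, neg_ne_zero.2 (inv_ne_zero hx), ?_, ?_⟩
  · rw [e2, neg_smul, neg_neg, smul_smul, inv_mul_cancel₀ hx, one_smul]
  · rw [e1, neg_smul, neg_neg, smul_smul, inv_mul_cancel₀ hx, one_smul]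

lemma indep_of_not_par {B C : MP K d} (hB : B ≠ 0) (hC : C ≠ 0) (h : ¬ Par C B) (x y : K) (hxy : x • B + y • C = 0) : x = 0 ∧ y = 0 := by
  have hy : y = 0 := by
    by_contra hy; have h1 : C = (-(y⁻¹ * x)) • B := by
      have : y⁻¹ • (x • B + y • C) = 0 := by rw [hxy, smul_zero]
      rw [smul_add, smul_smul, smul_smul, inv_mul_cancel₀ hy, one_smul] at this; rw [neg_smul]; exact (eq_neg_of_add_eq_zero_right this)
    refine h ⟨_, ?_, h1⟩; intro h2; rw [h2, zero_smul] at h1; exact hC h1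
  subst hy; rw [zero_smul, add_zero] at hxy; exact ⟨(smul_eq_zero.1 hxy).resolve_right hB, rfl⟩
end TData

/-- The multiplication table of the Veronese case. -/
structure VRel {R : Type} [CommRing R] (t0 t1 t2 t3 B C : R) : Prop where
  v01 : t0 * t1 = (C - B) * t0 - B * C
  v02 : t0 * t2 = -(B + C) * t0 - C * t2
  v03 : t0 * t3 = (B + C) * t0 + B * t3
  v23 : t2 * t3 = C * t2 - B * t3
  v13 : t1 * t3 = C ^ 2 + B * C - B * t3
  v12 : t1 * t2 = B ^ 2 + B * C + C * t2

lemma vero_ring {R : Type} [CommRing R] {n0 n1 n2 n3 E01 E02 E03 E10 E12 E13 E20 E21 E23 E30 E31 E32 B C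
    a1 a2 a3 b1 b2 b3 : R} (h1 : a1 * b1 = 1) (h2 : a2 * b2 = 1) (h3 : a3 * b3 = 1)
    (e1 : E02 - E01 = -C) (e2 : E03 - E01 = B) (e3 : E12 - E10 = -(a1 * B)) (e4 : E13 - E10 = a1 * C)
    (e5 : E23 - E20 = -(a2 * C)) (e6 : E21 - E20 = -(a2 * (B + C))) (e7 : E31 - E30 = a3 * (B + C)) (e8 : E32 - E30 = a3 * B)
    (r01 : (n0 - E01) * (n1 - E10) = (E02 - E01) * (E12 - E10)) (r02 : (n0 - E02) * (n2 - E20) = (E01 - E02) * (E21 - E20))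
    (r03 : (n0 - E03) * (n3 - E30) = (E01 - E03) * (E31 - E30)) (r12 : (n1 - E12) * (n2 - E21) = (E10 - E12) * (E20 - E21))
    (r23 : (n2 - E23) * (n3 - E32) = (E20 - E23) * (E30 - E32)) (r13 : (n1 - E13) * (n3 - E31) = (E10 - E13) * (E30 - E31)) :
    VRel (n0 - E01) (-(b1 * (n1 - E10)) + C - B) (-(b2 * (n2 - E20)) - B - C) (-(b3 * (n3 - E30)) + B + C) B C := by
  obtain ⟨z0, rfl⟩ : ∃ z, n0 = z + E01 := ⟨n0 - E01, by ring⟩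
  obtain ⟨z1, rfl⟩ : ∃ z, n1 = a1 * z + E10 := ⟨b1 * (n1 - E10), by linear_combination (E10 - n1) * h1⟩
  obtain ⟨z2, rfl⟩ : ∃ z, n2 = a2 * z + E20 := ⟨b2 * (n2 - E20), by linear_combination (E20 - n2) * h2⟩
  obtain ⟨z3, rfl⟩ : ∃ z, n3 = a3 * z + E30 := ⟨b3 * (n3 - E30), by linear_combination (E30 - n3) * h3⟩
  obtain rfl : E02 = E01 - C := by linear_combination e1
  obtain rfl : E03 = E01 + B := by linear_combination e2
  obtain rfl : E12 = E10 - a1 * B := by linear_combination e3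
  obtain rfl : E13 = E10 + a1 * C := by linear_combination e4
  obtain rfl : E23 = E20 - a2 * C := by linear_combination e5
  obtain rfl : E21 = E20 - a2 * (B + C) := by linear_combination e6
  obtain rfl : E31 = E30 + a3 * (B + C) := by linear_combination e7
  obtain rfl : E32 = E30 + a3 * B := by linear_combination e8
  have k1 : b1 * (a1 * z1 + E10 - E10) = z1 := by linear_combination z1 * h1
  have k2 : b2 * (a2 * z2 + E20 - E20) = z2 := by linear_combination z2 * h2
  have k3 : b3 * (a3 * z3 + E30 - E30) = z3 := by linear_combination z3 * h3
  rw [k1, k2, k3]; have q01 : z0 * z1 = B * C := by linear_combination b1 * r01 - (z0 * z1 - B * C) * h1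
  have q02 : (z0 + C) * z2 = -(C * (B + C)) := by linear_combination b2 * r02 - ((z0 + C) * z2 + C * (B + C)) * h2
  have q03 : (z0 - B) * z3 = -(B * (B + C)) := by linear_combination b3 * r03 - ((z0 - B) * z3 + B * (B + C)) * h3
  have q12 : (z1 + B) * (z2 + B + C) = B * (B + C) := by
    linear_combination b1 * b2 * r12 - ((z1 + B) * (z2 + B + C) - B * (B + C)) * (a2 * b2 * h1 + h2)
  have q23 : (z2 + C) * (z3 - B) = -(B * C) := by linear_combination b2 * b3 * r23 - ((z2 + C) * (z3 - B) + B * C) * (a3 * b3 * h2 + h3)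
  have q13 : (z1 - C) * (z3 - B - C) = C * (B + C) := by
    linear_combination b1 * b3 * r13 - ((z1 - C) * (z3 - B - C) - C * (B + C)) * (a3 * b3 * h1 + h3)
  constructor
  · linear_combination -q01
  · linear_combination -q02
  · linear_combination -q03
  · linear_combination q23
  · linear_combination q13
  · linear_combination q12

namespace Setup
variable {r : ℕ} {I : Ideal (PS K r)} {c : ℕ} {ι : Type} [Fintype ι] {s : Setup K r I d c ι}
  {η : ι → ι → LS K d} (h1 : ∀ i, η i ∈ s.HD 1)
  (h2 : ∀ i j, j ≠ i → (η i j).coeff (-1) = 0) (h3 : ∀ i, (η i i).coeff (-1) = 1)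

/-- The Veronese relations. -/
theorem vero_rel (hc : c = 2) (hex : ∃ i j k m, TData.D4 i j k m ∧ ¬ (tdata h1 h2 h3).Q i j k m) :
    ∃ (e : Fin 4 ≃ ι) (B C : MP K d) (θ : Fin 4 → ι → LS K d) (α : Fin 4 → K)
      (β : Fin 4 → MP K d), B ∈ HG 1 ∧ C ∈ HG 1 ∧ (∀ x y : K, x • B + y • C = 0 → x = 0 ∧ y = 0) ∧
      (∀ j, α j ≠ 0) ∧ (∀ j, β j ∈ HG 1) ∧ (∀ j, θ j = α j • η (e j) + s.F (s.P (β j))) ∧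
      VRel (θ 0) (θ 1) (θ 2) (θ 3) (s.F (s.P B)) (s.F (s.P C)) := by
  obtain ⟨i0, i1, i2, i3, hD, hq⟩ := hex; have hD0 := hD; obtain ⟨h01, h02, h03, h12, h13, h23⟩ := hD0
  have hinj : Injective ![i0, i1, i2, i3] := by
    intro a b hab; fin_cases a <;> fin_cases b <;> first | rfl | (exfalso; simp at hab; first
      | exact h01 hab | exact h02 hab | exact h03 hab | exact h12 hab | exact h13 hab | exact h23 hab
      | exact h01 hab.symm | exact h02 hab.symm | exact h03 hab.symm | exact h12 hab.symm
      | exact h13 hab.symm | exact h23 hab.symm)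
  have hbij : Function.Bijective ![i0, i1, i2, i3] := (Fintype.bijective_iff_injective_and_card _).2 ⟨hinj, by rw [s.card, hc]; simp⟩
  obtain ⟨a1, ha1, p1, p2⟩ := TData.half hD hq
  obtain ⟨a2, ha2, p3, p4⟩ := TData.half (t := tdata h1 h2 h3) (i := i0) (j := i2) (k := i3) (m := i1)
    ⟨h02, h03, h01, h23, h12.symm, h13.symm⟩
    (fun h => hq (h.s24 ⟨h02, h03, h01, h23, h12.symm, h13.symm⟩).s34)
  obtain ⟨a3, ha3, p5, p6⟩ := TData.half (t := tdata h1 h2 h3) (i := i0) (j := i3) (k := i1) (m := i2)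
    ⟨h03, h01, h02, h13.symm, h23.symm, h12⟩
    (fun h => hq (h.s34.s24 ⟨h03, h02, h01, h23.symm, h13.symm, h12.symm⟩))
  obtain ⟨E, hEd⟩ : ∃ E : ι → ι → MP K d, E = fun i j => (η i j).coeff 0 := ⟨_, rfl⟩; have hE' : (tdata h1 h2 h3).E = E := hEd.symm
  have hEH : ∀ i j, E i j ∈ HG 1 := by rw [← hE']; exact (tdata h1 h2 h3).hE
  have hne := (tdata h1 h2 h3).ne; have hQd : ¬ Par (E i0 i2 - E i0 i1) (E i0 i3 - E i0 i1) := by rw [← hE']; exact hq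
  rw [hE'] at p1 p2 p3 p4 p5 p6 hne; have rel : ∀ {i j k}, i ≠ j → k ≠ i → k ≠ j → ∀ x, (η i x - HC (E i j)) * (η j x - HC (E j i)) =
      (HC (E i k) - HC (E i j)) * (HC (E j k) - HC (E j i)) := by
    intro i j k hij hki hkj x; obtain ⟨Cc, hC1, hC2⟩ := T_rel (s := s) h1 h2 hij; rw [← map_sub, ← map_sub, ← map_mul, hEd]; simp only
    rw [hC1, hC2 k hki hkj]
  refine ⟨Equiv.ofBijective _ hbij, E i0 i3 - E i0 i1, E i0 i1 - E i0 i2, ![fun k => η i0 k - HC (E i0 i1),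
      fun k => -(HC (C a1⁻¹) * (η i1 k - HC (E i1 i0))) + HC (E i0 i1 - E i0 i2) - HC (E i0 i3 - E i0 i1),
      fun k => -(HC (C a2⁻¹) * (η i2 k - HC (E i2 i0))) - HC (E i0 i3 - E i0 i1) - HC (E i0 i1 - E i0 i2),
      fun k => -(HC (C a3⁻¹) * (η i3 k - HC (E i3 i0))) + HC (E i0 i3 - E i0 i1) + HC (E i0 i1 - E i0 i2)], ![1, -a1⁻¹, -a2⁻¹, -a3⁻¹],
    ![-E i0 i1, a1⁻¹ • E i1 i0 + (E i0 i1 - E i0 i2) - (E i0 i3 - E i0 i1), a2⁻¹ • E i2 i0 - (E i0 i3 - E i0 i1) - (E i0 i1 - E i0 i2),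
      a3⁻¹ • E i3 i0 + (E i0 i3 - E i0 i1) + (E i0 i1 - E i0 i2)], ?_, ?_, ?_, ?_, ?_, ?_, ?_⟩
  · exact sub_mem (hEH _ _) (hEH _ _)
  · exact sub_mem (hEH _ _) (hEH _ _)
  · refine TData.indep_of_not_par (hne _ _ _ h01 h03 h13) (hne _ _ _ h02 h01 h12.symm) ?_; rintro ⟨x, hx, hx'⟩
    exact hQd ⟨-x, neg_ne_zero.2 hx, by rw [neg_smul, ← hx']; ring⟩
  · intro j; fin_cases j <;> simp [ha1, ha2, ha3]
  · have hs : ∀ (a : K) i j, a • E i j ∈ HG 1 := fun a i j => smul_mem _ _ (hEH i j)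
    have hm : ∀ i j k, E i j - E i k ∈ HG 1 := fun i j k => sub_mem (hEH i j) (hEH i k); intro j; fin_cases j
    · exact neg_mem (hEH _ _)
    · exact sub_mem (add_mem (hs _ _ _) (hm _ _ _)) (hm _ _ _)
    · exact sub_mem (sub_mem (hs _ _ _) (hm _ _ _)) (hm _ _ _)
    · exact add_mem (add_mem (hs _ _ _) (hm _ _ _)) (hm _ _ _)
  · intro j; funext k; rw [Pi.add_apply, Pi.smul_apply, cc_coeff, smul_LS]; fin_cases j
    · simp [sub_eq_add_neg]
    all_goals
      simp only [Equiv.ofBijective_apply, Fin.mk_one, Fin.reduceFinMk, Matrix.cons_val, map_neg, map_sub, map_add,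
        smul_eq_C_mul, map_mul]
      ring
  · have hC : ∀ a : K, a ≠ 0 → (HC (C a) : LS K d) * HC (C a⁻¹) = 1 := fun a ha => by
      rw [← map_mul, ← map_mul, mul_inv_cancel₀ ha, map_one, map_one]
    have key : ∀ k, VRel _ _ _ _ _ _ := fun k => vero_ring (hC a1 ha1) (hC a2 ha2) (hC a3 ha3)
      (n0 := η i0 k) (n1 := η i1 k) (n2 := η i2 k) (n3 := η i3 k)
      (E01 := HC (E i0 i1)) (E02 := HC (E i0 i2)) (E03 := HC (E i0 i3))
      (E10 := HC (E i1 i0)) (E12 := HC (E i1 i2)) (E13 := HC (E i1 i3))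
      (E20 := HC (E i2 i0)) (E21 := HC (E i2 i1)) (E23 := HC (E i2 i3))
      (E30 := HC (E i3 i0)) (E31 := HC (E i3 i1)) (E32 := HC (E i3 i2))
      (B := HC (E i0 i3 - E i0 i1)) (C := HC (E i0 i1 - E i0 i2))
      (by rw [map_sub]; ring) (by rw [map_sub])
      (by rw [← map_sub, p1, smul_eq_C_mul, map_neg, map_mul])
      (by rw [← map_sub, p2, ← map_mul]; congr 1; rw [smul_eq_C_mul]; ring)
      (by rw [← map_sub, p3, smul_eq_C_mul, map_neg, map_mul])
      (by rw [← map_sub, p4, ← map_add, ← map_mul, ← map_neg]; congr 1; rw [smul_eq_C_mul]; ring)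
      (by rw [← map_sub, p5, ← map_add, ← map_mul]; congr 1; rw [smul_eq_C_mul]; ring)
      (by rw [← map_sub, p6, ← map_mul]; congr 1; rw [smul_eq_C_mul]; ring)
      (rel h01 h02.symm h12.symm k) (rel h02 h01.symm h12 k) (rel h03 h01.symm h13 k)
      (rel h12 h01 h02 k) (rel h23 h02 h03 k) (rel h13 h01 h03 k)
    constructor <;> funext k <;> simp only [Pi.mul_apply, Pi.sub_apply, Pi.add_apply, Pi.neg_apply, Pi.pow_apply, cc_coeff]
    · exact (key k).v01
    · exact (key k).v02
    · exact (key k).v03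
    · exact (key k).v23
    · exact (key k).v13
    · exact (key k).v12
end Setup
end AMDP
namespace AMDP

variable {K : Type} [Field K] {d : ℕ}

lemma exists_compl {V : Type} [AddCommGroup V] [Module K V] [FiniteDimensional K V] {k n : ℕ} (v : Fin k → V)
    (hv : LinearIndependent K v) (hn : finrank K V = n + k) : ∃ w : Fin n → V, ∀ x, x ∈ span K (Set.range (Sum.elim w v)) := by
  obtain ⟨W, hW⟩ := Submodule.exists_isCompl (span K (Set.range v)); have h1 := Submodule.finrank_add_eq_of_isCompl hW
  rw [finrank_span_eq_card hv, card_fin, hn] at h1; have h2 : finrank K W = n := by omega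
  let b := Module.finBasisOfFinrankEq K W h2; refine ⟨fun i => (b i : V), fun x => ?_⟩; rw [Set.Sum.elim_range, Submodule.span_union]
  have h3 : W ≤ span K (Set.range fun i => (b i : V)) := fun y hy => by
    have := b.sum_repr ⟨y, hy⟩; have h4 := congrArg Subtype.val this; rw [AddSubmonoidClass.coe_finsetSum] at h4; simp only [] at h4
    rw [← h4]; exact sum_mem fun i _ => smul_mem _ _ (subset_span ⟨i, rfl⟩)
  have h5 : x ∈ span K (Set.range v) ⊔ W := by rw [hW.sup_eq_top]; trivial
  exact (sup_comm (span K (Set.range v)) _).le (sup_le_sup_left h3 _ h5)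

lemma normal_form {P R : Type} [CommRing P] [CommRing R] (π : P →+* R) (t : Fin 4 → R)
    (tab : ∀ i j, i ≠ j → ∃ a b c, t i * t j = π a * t i + π b * t j + π c) (f : R) (hf : f ∈ Subring.closure (Set.range π ∪ Set.range t)) :
    ∃ q : Fin 4 → Polynomial P, f = ∑ j, (q j).eval₂ π (t j) := by
  let N : Set R := {f | ∃ q : Fin 4 → Polynomial P, f = ∑ j, (q j).eval₂ π (t j)}; have hadd : ∀ {a b}, a ∈ N → b ∈ N → a + b ∈ N := by
    rintro a b ⟨q, rfl⟩ ⟨q', rfl⟩; refine ⟨q + q', ?_⟩; rw [← sum_add_distrib]; refine sum_congr rfl fun j _ => ?_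
    rw [Pi.add_apply, Polynomial.eval₂_add]
  have hmul : ∀ {a} (p : P), a ∈ N → π p * a ∈ N := by
    rintro a p ⟨q, rfl⟩; refine ⟨fun j => PC p * q j, ?_⟩; rw [mul_sum]; refine sum_congr rfl fun j _ => ?_
    rw [Polynomial.eval₂_mul, Polynomial.eval₂_C]
  have hsing : ∀ i (q : Polynomial P), q.eval₂ π (t i) ∈ N := fun i q => by
    refine ⟨Pi.single i q, ?_⟩; rw [sum_eq_single i]
    · simp
    · intro j _ hj; rw [Pi.single_eq_of_ne hj, Polynomial.eval₂_zero]
    · simp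
  have hsum : ∀ {α : Type} (s : Finset α) (g : α → R), (∀ i ∈ s, g i ∈ N) → ∑ i ∈ s, g i ∈ N := by
    intro α s g hg; classical
    induction s using Finset.induction_on with
    | empty => exact ⟨0, by simp⟩
    | insert a s ha ih =>
      rw [Finset.sum_insert ha]; exact hadd (hg _ (by simp)) (ih fun i hi => hg i (by simp [hi]))
  have hij : ∀ i j, i ≠ j → ∀ n, t i * t j ^ n ∈ N := fun i j h n => by
    induction n with
    | zero => have := hsing i PX; simpa using this
    | succ n ih =>
      obtain ⟨a, b, c, h3⟩ := tab i j h
      have : t i * t j ^ (n + 1) = π a * (t i * t j ^ n) + (π b * t j ^ (n + 1) + π c * t j ^ n) := by linear_combination t j ^ n * h3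
      rw [this]; refine hadd (hmul _ ih) (hadd (hmul _ ?_) (hmul _ ?_))
      · have := hsing j (PX ^ (n + 1)); simpa using this
      · have := hsing j (PX ^ n); simpa using this
  have hti : ∀ i a, a ∈ N → t i * a ∈ N := by
    rintro i a ⟨q, rfl⟩; rw [mul_sum]; refine hsum _ _ fun j _ => ?_; by_cases h : i = j
    · subst h; have := hsing i (PX * q i); rwa [Polynomial.eval₂_mul, Polynomial.eval₂_X] at this
    · rw [Polynomial.eval₂_eq_sum_range, mul_sum]; refine hsum _ _ fun m _ => ?_; have := hmul ((q j).coeff m) (hij i j h m)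
      convert this using 1; ring
  let T : Subring R :=
    { carrier := {f | ∀ g ∈ N, f * g ∈ N}
      mul_mem' := fun {a b} ha hb g hg => by rw [mul_assoc]; exact ha _ (hb _ hg)
      one_mem' := fun g hg => by rwa [one_mul]
      add_mem' := fun {a b} ha hb g hg => by rw [add_mul]; exact hadd (ha _ hg) (hb _ hg)
      zero_mem' := fun g hg => by rw [zero_mul]; exact ⟨0, by simp⟩
      neg_mem' := fun {a} ha g hg => by
        have := hmul (-1) (ha g hg); rw [map_neg, map_one] at this; convert this using 1; ring }
  have hT : Subring.closure (Set.range π ∪ Set.range t) ≤ T := by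
    rw [Subring.closure_le]; rintro x (⟨p, rfl⟩ | ⟨i, rfl⟩)
    · exact fun g hg => hmul p hg
    · exact fun g hg => hti i g hg
  have := hT hf 1 (by have := hsing 0 1; rwa [Polynomial.eval₂_one] at this); rwa [mul_one] at this

lemma eval₂_lo {f : LS K d} (hf : Lo 0 f) (q : Polynomial (MP K d)) : Lo 0 (q.eval₂ HC f) := by
  rw [Polynomial.eval₂_eq_sum_range]; refine Lo.sum fun n _ => ?_; have := (Lo.C (q.coeff n)).mul (hf.pow n); simpa using this

lemma eval₂_pole {f : LS K d} (hf : Lo (-1) f) (q : Polynomial (MP K d)) :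
    (q.eval₂ HC f).coeff (-(q.natDegree : ℤ)) = q.leadingCoeff * f.coeff (-1) ^ q.natDegree := by
  rw [Polynomial.eval₂_eq_sum_range, HahnSeries.coeff_sum, sum_eq_single q.natDegree]
  · rw [coeff_Cmul, ← coeff_pow_lo hf, mul_neg_one]; rfl
  · intro n hn hne; rw [coeff_Cmul, hf.pow n _ ?_, mul_zero]; simp only [mem_range] at hn; omega
  · simp

/-- The Veronese data. -/
structure Vero {r : ℕ} {I : Ideal (PS K r)} {ι : Type} [Fintype ι] (s : Setup K r I d 2 ι) where
  e : Fin 4 ≃ ι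
  B : MP K d
  C : MP K d
  θ : Fin 4 → ι → LS K d
  α : Fin 4 → K
  hB : B ∈ HG 1
  hC : C ∈ HG 1
  ind : ∀ x y : K, x • B + y • C = 0 → x = 0 ∧ y = 0
  αne : ∀ j, α j ≠ 0
  mem : ∀ j, θ j ∈ s.HD 1
  lead : ∀ j k, (θ j (e k)).coeff (-1) = if k = j then MvPolynomial.C (α j) else 0
  lift : ∀ (v : Fin 4 → K) (p : MP K d), ∑ j, s.γ (e j) * α j * v j = 0 → p ∈ HG 1 → ∃ x ∈ HG 1, s.F x = ∑ j, v j • θ j + s.F (s.P p)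
  rel : VRel (θ 0) (θ 1) (θ 2) (θ 3) (s.F (s.P B)) (s.F (s.P C))

namespace Setup
variable {r : ℕ} {I : Ideal (PS K r)} {ι : Type} [Fintype ι] {s : Setup K r I d 2 ι}
  {η : ι → ι → LS K d} (h1 : ∀ i, η i ∈ s.HD 1)
  (h2 : ∀ i j, j ≠ i → (η i j).coeff (-1) = 0) (h3 : ∀ i, (η i i).coeff (-1) = 1)

theorem vero (hex : ∃ i j k m, TData.D4 i j k m ∧ ¬ (tdata h1 h2 h3).Q i j k m) : ∃ _ : Vero s, True := by
  classical
  obtain ⟨e, B, C, θ, α, β, hB, hC, ind, hα, hβ, hθ, rel⟩ := vero_rel h1 h2 h3 rfl hex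
  have hcc : ∀ p : MP K d, ∀ k, (s.F (s.P p) k).coeff (-1) = 0 := fun p k => by rw [cc_coeff, coeff_C_ne (by norm_num)]
  refine ⟨⟨e, B, C, θ, α, hB, hC, ind, hα, fun j => ?_, fun j k => ?_, fun v p hv hp => ?_, rel⟩, trivial⟩
  · rw [hθ]; exact add_mem (smul_mem _ _ (h1 _)) (HD_cc (hβ j))
  · rw [hθ, Pi.add_apply, HahnSeries.coeff_add, hcc, add_zero, Pi.smul_apply, HahnSeries.coeff_smul]
    split_ifs with h
    · rw [h, h3, smul_eq_C_mul, mul_one]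
    · rw [h2 _ _ (fun h' => h (e.injective h')), smul_zero]
  · obtain ⟨x, hx, hxF⟩ := lift1 h1 h2 h3 (fun i => α (e.symm i) * v (e.symm i)) (by
      rw [← hv, ← Equiv.sum_comp e]; refine sum_congr rfl fun j _ => ?_; rw [e.symm_apply_apply]; ring) (p := p + ∑ j, v j • β j)
      (add_mem hp (sum_mem fun j _ => smul_mem _ _ (hβ j)))
    refine ⟨x, hx, ?_⟩; rw [hxF, ← Equiv.sum_comp e]
    simp only [hθ, e.symm_apply_apply, map_add, map_sum, map_smul, smul_add, sum_add_distrib, mul_smul]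
    rw [add_comm (s.F (s.P p)), ← add_assoc]; congr 2; refine sum_congr rfl fun j _ => ?_; funext k; simp only [Pi.smul_apply]
    rw [smul_LS, smul_LS, smul_LS, smul_LS]; ring
end Setup
end AMDP
namespace AMDP

variable {K : Type} [Field K] {d : ℕ}

namespace Vero
variable {r : ℕ} {I : Ideal (PS K r)} {ι : Type} [Fintype ι] {s : Setup K r I d 2 ι} (V : Vero s)

lemma zero_of (v : Fin 4 → K) (p : MP K d) (h : ∑ j, v j • V.θ j + s.F (s.P p) = 0) : (∀ j, v j = 0) ∧ p = 0 := by
  have h1 : ∀ j, v j = 0 := fun k => by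
    have h2 := congrArg (fun f => HahnSeries.coeff f (-1)) (congrFun h (V.e k))
    simp only [Pi.add_apply, HahnSeries.coeff_add, Setup.cc_coeff, Finset.sum_apply, HahnSeries.coeff_sum,
      Pi.smul_apply, HahnSeries.coeff_smul, V.lead, Pi.zero_apply, HahnSeries.coeff_zero] at h2
    rw [coeff_C_ne (by norm_num), add_zero, sum_eq_single k] at h2
    · rw [if_pos rfl, smul_eq_C_mul, ← map_mul, map_eq_zero] at h2; exact (mul_eq_zero.1 h2).resolve_right (V.αne k)
    · intro j _ hj; rw [if_neg (Ne.symm hj), smul_zero]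
    · simp
  refine ⟨h1, ?_⟩; simp only [h1] at h; have h3 := congrFun h (V.e 0)
  have h4 : (∑ j : Fin 4, (0 : K) • V.θ j) = 0 := sum_eq_zero fun j _ => by rw [s.smul_cc, map_zero, map_zero, map_zero, zero_mul]
  rw [h4, zero_add, Setup.cc_coeff, Pi.zero_apply] at h3; exact HahnSeries.C_injective (by rw [h3, map_zero])

/-- The degenerate Veronese case: there is a suitable quadric of rank three. -/
theorem degen [IsAlgClosed K] (κ : Fin 4 → K) (hκ : ∀ j, κ j ≠ 0) (h0 : κ 0 = 1)
    (hγ : ∀ v : Fin 4 → K, ∑ j, κ j * v j = 0 → ∑ j, s.γ (V.e j) * V.α j * v j = 0)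
    (hdet : κ 1 * κ 2 * κ 3 + κ 1 * κ 2 + κ 2 * κ 3 + κ 1 * κ 3 = 0) :
    ∃ J : Ideal (PS K r), J.IsPrime ∧ AMD.IsHomIdeal K r J ∧ AMD.Nondeg K r J ∧
      J ≤ I ∧ AMD.DimEq K r J (d + 1) ∧ AMD.DegreeEq K r J (d + 1) 2 := by
  obtain ⟨u1, u2, u3, e1, e2, e3, hu⟩ : ∃ u1 u2 u3 : K, κ 1 * u1 = 1 ∧ κ 2 * u2 = 1 ∧ κ 3 * u3 = 1 ∧ u1 + u2 + u3 = -1 := by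
    refine ⟨(κ 1)⁻¹, (κ 2)⁻¹, (κ 3)⁻¹, mul_inv_cancel₀ (hκ 1), mul_inv_cancel₀ (hκ 2), mul_inv_cancel₀ (hκ 3), ?_⟩; have h1 := hκ 1
    have h2 := hκ 2; have h3 := hκ 3; field_simp; linear_combination hdet
  obtain ⟨w1, w2, hw, hw0⟩ : ∃ w1 w2 : K, (w1 + w2) ^ 2 + κ 1 * w1 ^ 2 + κ 2 * w2 ^ 2 = 0 ∧ (w1 ≠ 0 ∨ w2 ≠ 0) := by
    by_cases hk : κ 1 + 1 = 0
    · exact ⟨1, 0, by linear_combination hk, Or.inl one_ne_zero⟩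
    · obtain ⟨x, hx⟩ := IsAlgClosed.exists_root (PC (κ 1 + 1) * PX ^ 2 + PC 2 * PX
        + PC (1 + κ 2)) (by rw [Polynomial.degree_quadratic hk]; norm_num)
      refine ⟨x, 1, ?_, Or.inr one_ne_zero⟩
      simp only [Polynomial.IsRoot, Polynomial.eval_add, Polynomial.eval_mul, Polynomial.eval_C, Polynomial.eval_pow,
        Polynomial.eval_X] at hx
      linear_combination hx
  have hBC : ∀ x y : K, x • V.B + y • V.C ∈ HG 1 := fun x y =>
    add_mem (smul_mem _ _ V.hB) (smul_mem _ _ V.hC)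
  have n1 : u1 ≠ 0 := fun h => by simp [h] at e1
  have n3 : u3 ≠ 0 := fun h => by simp [h] at e3
  obtain ⟨y0, hy0, f0⟩ := V.lift ![1, u1 ^ 2, u2 ^ 2, u3 ^ 2] ((-2 * u1 * u2) • V.B + (2 * u1 * u3) • V.C)
    (hγ _ (by
      simp [Fin.sum_univ_succ, h0]; linear_combination u1 * e1 + u2 * e2 + u3 * e3 + hu)) (hBC _ _)
  obtain ⟨y1, hy1, f1⟩ := V.lift ![-(w1 + w2), u1 * w1, u2 * w2, 0] ((-(u1 * w2 + u2 * w1)) • V.B + (u3 * w1) • V.C)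
    (hγ _ (by
      simp [Fin.sum_univ_succ, h0]; linear_combination w1 * e1 + w2 * e2)) (hBC _ _)
  obtain ⟨y2, hy2, f2⟩ := V.lift ![(w1 + w2) ^ 2, w1 ^ 2, w2 ^ 2, 0] ((-2 * w1 * w2) • V.B + (0 : K) • V.C)
    (hγ _ (by
      simp [Fin.sum_univ_succ, h0]; linear_combination hw)) (hBC _ _)
  have hY : LinearIndependent K ![(⟨y0, hy0⟩ : (HG 1 : Submodule K (PS K r))), ⟨y1, hy1⟩, ⟨y2, hy2⟩] := by
    rw [Fintype.linearIndependent_iff]; intro g hg; have hg1 : g 0 • y0 + g 1 • y1 + g 2 • y2 = 0 := by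
      have := congrArg Subtype.val hg; simpa [Fin.sum_univ_succ, add_assoc] using this
    have hg2 := congrArg s.F hg1; rw [map_zero, map_add, map_add, map_smul, map_smul, map_smul, f0, f1, f2] at hg2
    obtain ⟨z1, z2⟩ := V.zero_of (g 0 • ![1, u1 ^ 2, u2 ^ 2, u3 ^ 2] + g 1 • ![-(w1 + w2), u1 * w1, u2 * w2, 0] +
      g 2 • ![(w1 + w2) ^ 2, w1 ^ 2, w2 ^ 2, 0])
      (g 0 • ((-2 * u1 * u2) • V.B + (2 * u1 * u3) • V.C) + g 1 • ((-(u1 * w2 + u2 * w1)) • V.B + (u3 * w1) • V.C) +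
        g 2 • ((-2 * w1 * w2) • V.B + (0 : K) • V.C)) (by
      rw [← hg2]; simp only [Fin.sum_univ_four, map_add, map_smul]
      simp only [s.smul_cc, map_mul, map_add, Pi.add_apply, Pi.smul_apply, smul_eq_mul, Matrix.cons_val]; ring)
    have c3 := z1 3; have c1 := z1 1; have c2 := z1 2; simp at c3 c1 c2; have g0 : g 0 = 0 := c3.resolve_right n3; rw [g0] at c1 c2 z2
    obtain ⟨b1, b2⟩ := V.ind (g 1 * (-(u1 * w2 + u2 * w1)) + g 2 * (-2 * w1 * w2)) (g 1 * (u3 * w1)) (by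
      rw [← z2]; simp only [smul_eq_C_mul, map_add, map_mul, map_neg, map_zero]; ring)
    have : g 1 = 0 ∧ g 2 = 0 := by
      by_cases hw1 : w1 = 0
      · subst hw1; have hw2 : w2 ≠ 0 := hw0.resolve_left (by simp); have a1 : g 1 * (u1 * w2) = 0 := by linear_combination -b1
        have a2 := (mul_eq_zero.1 a1).resolve_right (mul_ne_zero n1 hw2)
        have a3 : g 2 * w2 ^ 2 = 0 := by rw [a2] at c2; linear_combination c2
        exact ⟨a2, (mul_eq_zero.1 a3).resolve_right (pow_ne_zero _ hw2)⟩
      · have a2 := (mul_eq_zero.1 b2).resolve_right (mul_ne_zero n3 hw1)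
        have a3 : g 2 * w1 ^ 2 = 0 := by rw [a2] at c1; linear_combination c1
        exact ⟨a2, (mul_eq_zero.1 a3).resolve_right (pow_ne_zero _ hw1)⟩
    intro i; fin_cases i
    · exact g0
    · exact this.1
    · exact this.2
  obtain ⟨l, hl⟩ := exists_compl (n := d) _ hY (by rw [Setup.finrank_HG_one]; have := s.hr; omega)
  obtain ⟨Y, hYd⟩ : ∃ Y : ℕ → PS K r, Y = fun n => if n = 0 then y0 else if n = 1 then y1 else y2 := ⟨_, rfl⟩
  have Y0 : Y 0 = y0 := by rw [hYd]; rfl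
  have Y1 : Y 1 = y1 := by rw [hYd]; rfl
  have Y2 : Y 2 = y2 := by rw [hYd]; rfl
  have hq : y0 * y2 - y1 * y1 ∈ I := by
    refine s.F_zero ?_; rw [map_sub, map_mul, map_mul, f0, f1, f2]; simp only [Fin.sum_univ_four, map_add, map_smul]
    simp only [s.smul_cc, map_mul, map_add, map_neg, map_pow, map_one, map_ofNat, map_zero, Matrix.cons_val]
    obtain ⟨v01, v02, v03, v23, v13, v12⟩ := V.rel
    have hu' : s.F (s.P (MvPolynomial.C u1)) + s.F (s.P (MvPolynomial.C u2)) + s.F (s.P (MvPolynomial.C u3)) = -1 := by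
      rw [← map_add, ← map_add, ← map_add, ← map_add, ← map_add, ← map_add, hu, map_neg, map_neg, map_neg,
        map_one, map_one, map_one]
    generalize s.F (s.P (MvPolynomial.C u1)) = U1 at *; generalize s.F (s.P (MvPolynomial.C u2)) = U2 at *
    generalize s.F (s.P (MvPolynomial.C u3)) = U3 at *; generalize s.F (s.P (MvPolynomial.C w1)) = W1 at *
    generalize s.F (s.P (MvPolynomial.C w2)) = W2 at *; generalize s.F (s.P V.B) = B at *; generalize s.F (s.P V.C) = C at *
    generalize V.θ 0 = t0 at *; generalize V.θ 1 = t1 at *; generalize V.θ 2 = t2 at *; generalize V.θ 3 = t3 at *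
    obtain rfl : U3 = -1 - U1 - U2 := by linear_combination hu'
    linear_combination (U1 * W2 - U2 * W1) ^ 2 * (v01 + v02 + v12) + ((-1 - U1 - U2) * W1) ^ 2 * (v01 + v03 + v13) +
      ((-1 - U1 - U2) * W2) ^ 2 * (v02 + v03 + v23) - 2 * (U1 * W2 - U2 * W1) * ((-1 - U1 - U2) * W1) * v01 +
      2 * (U1 * W2 - U2 * W1) * ((-1 - U1 - U2) * W2) * v02 + 2 * ((-1 - U1 - U2) * W1) * ((-1 - U1 - U2) * W2) * v03
  refine J_final s.hr (by omega) I s.nondeg (fun i => (l i : PS K r)) Y (fun _ => 0) ⟨?_, ?_⟩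
    (fun k _ => Submodule.zero_mem _) ?_
  · rintro (i | k)
    · exact Setup.hom_one (l i).2
    · fin_cases k
      · simpa [Y0] using Setup.hom_one hy0
      · simpa [Y1] using Setup.hom_one hy1
      · simpa [Y2] using Setup.hom_one hy2
  · intro p hp; have h1 := hl ⟨p, Setup.one_hom hp⟩; have h2 := Submodule.mem_map_of_mem (f := (HG 1 : Submodule K (PS K r)).subtype) h1
    rw [Submodule.map_span, ← Set.range_comp] at h2; convert h2 using 3
    on_goal 2 => rfl
    funext x
    rcases x with i | k
    · rfl
    · fin_cases k
      · simp [Y0]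
      · simp [Y1]
      · simp [Y2]
  · intro k m hk hm; interval_cases k <;> interval_cases m
    · simp
    · simpa [Y0, Y1, Y2] using hq
    · rw [zero_add, ← neg_mem_iff]; simpa [Y0, Y1, Y2] using hq
    · simp
end Vero
end AMDP
namespace AMDP

variable {K : Type} [Field K] {d : ℕ}

lemma VRel.tab {P R : Type} [CommRing P] [CommRing R] (π : P →+* R) {B C : P} {t : Fin 4 → R}
    (h : VRel (t 0) (t 1) (t 2) (t 3) (π B) (π C)) (i j : Fin 4) (hij : i ≠ j) : ∃ a b c, t i * t j = π a * t i + π b * t j + π c := by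
  have key : ∀ i j : Fin 4, i < j → ∃ a b c, t i * t j = π a * t i + π b * t j + π c := by
    obtain ⟨v01, v02, v03, v23, v13, v12⟩ := h; intro i j hij; fin_cases i <;> fin_cases j <;> first | (exfalso; revert hij; decide) | skip
    · exact ⟨C - B, 0, -(B * C), by simp; linear_combination v01⟩
    · exact ⟨-(B + C), -C, 0, by simp; linear_combination v02⟩
    · exact ⟨B + C, B, 0, by simp; linear_combination v03⟩
    · exact ⟨0, C, B ^ 2 + B * C, by simp; linear_combination v12⟩
    · exact ⟨0, -B, C ^ 2 + B * C, by simp; linear_combination v13⟩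
    · exact ⟨C, -B, 0, by simp; linear_combination v23⟩
  rcases lt_or_gt_of_ne hij with h1 | h1
  · exact key i j h1
  · obtain ⟨a, b, c, h2⟩ := key j i h1; exact ⟨b, a, c, by linear_combination h2⟩

lemma VRel.of_gens {R : Type} [CommRing R] {t0 t1 t2 t3 B C : R} (g1 : (t0 + t1) * (t0 + t2) - (t0 - B) * (t0 - B) = 0)
    (g2 : (t0 + t1) * t0 - (t0 - B) * (t0 + C) = 0) (g3 : (t0 - B) * t0 - (t0 + C) * (t0 + t2) = 0)
    (g4 : (t0 + t1) * (t0 + t3) - (t0 + C) * (t0 + C) = 0) (g5 : (t0 - B) * (t0 + t3) - (t0 + C) * t0 = 0)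
    (g6 : (t0 + t2) * (t0 + t3) - t0 * t0 = 0) : VRel t0 t1 t2 t3 B C := by
  refine ⟨?_, ?_, ?_, ?_, ?_, ?_⟩
  · linear_combination g2
  · linear_combination -g3
  · linear_combination g5
  · linear_combination g6 + g3 - g5
  · linear_combination g4 - g2 - g5
  · linear_combination g1 - g2 + g3

lemma VRel.gens {R : Type} [CommRing R] {t0 t1 t2 t3 B C : R} (h : VRel t0 t1 t2 t3 B C) : (t0 + t1) * (t0 + t2) - (t0 - B) * (t0 - B) = 0 ∧
    (t0 + t1) * t0 - (t0 - B) * (t0 + C) = 0 ∧ (t0 - B) * t0 - (t0 + C) * (t0 + t2) = 0 ∧ (t0 + t1) * (t0 + t3) - (t0 + C) * (t0 + C) = 0 ∧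
    (t0 - B) * (t0 + t3) - (t0 + C) * t0 = 0 ∧ (t0 + t2) * (t0 + t3) - t0 * t0 = 0 := by
  obtain ⟨v01, v02, v03, v23, v13, v12⟩ := h; refine ⟨?_, ?_, ?_, ?_, ?_, ?_⟩
  · linear_combination v01 + v02 + v12
  · linear_combination v01
  · linear_combination -v02
  · linear_combination v01 + v03 + v13
  · linear_combination v03
  · linear_combination v02 + v03 + v23

namespace Vero
variable {r : ℕ} {I : Ideal (PS K r)} {ι : Type} [Fintype ι] {s : Setup K r I d 2 ι} (V : Vero s)

lemma pole_zero (q : Fin 4 → Polynomial (MP K d)) (h : ∀ k, ∑ j, (q j).eval₂ HC (V.θ j k) = 0) : ∃ p : Fin 4 → MP K d,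
      (∀ j, q j = PC (p j)) ∧ ∑ j, p j = 0 := by
  have h1 : ∀ j, (q j).natDegree = 0 := fun j => by
    by_contra hj; have h2 := congrArg (fun f => HahnSeries.coeff f (-((q j).natDegree : ℤ))) (h (V.e j))
    simp only [HahnSeries.coeff_sum, HahnSeries.coeff_zero] at h2; rw [sum_eq_single j] at h2
    · rw [eval₂_pole (Setup.HD_lo (s := s) (V.mem j) _), V.lead, if_pos rfl] at h2
      rcases mul_eq_zero.1 h2 with h3 | h3
      · exact hj (by rw [Polynomial.leadingCoeff_eq_zero.1 h3, Polynomial.natDegree_zero])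
      · exact V.αne j (by simpa using pow_eq_zero_iff hj |>.1 h3)
    · intro k _ hk; refine eval₂_lo (Setup.lo_zero (s := s) (V.mem k) ?_) _ _ (by omega); rw [V.lead, if_neg (Ne.symm hk)]
    · simp
  refine ⟨fun j => (q j).coeff 0, fun j => Polynomial.eq_C_of_natDegree_eq_zero (h1 j), ?_⟩; have h3 := h (V.e 0)
  have h4 : ∑ j, (q j).eval₂ HC (V.θ j (V.e 0)) = HC (∑ j, (q j).coeff 0) := by
    rw [map_sum]; refine sum_congr rfl fun j _ => ?_
    conv_lhs => rw [Polynomial.eq_C_of_natDegree_eq_zero (h1 j)]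
    rw [Polynomial.eval₂_C]
  rw [h4] at h3; exact HahnSeries.C_injective (by rw [h3, map_zero])

lemma span_S1 {κ : Fin 4 → K} {g0 : K} (hg0 : g0 ≠ 0) (hg : ∀ j, s.γ (V.e j) * V.α j = g0 * κ j)
    {x : Fin 4 → PS K r} (hx : ∀ j, x j ∈ HG 1) (hxF : ∀ j, s.F (x j) = V.θ j - κ j • V.θ 0)
    {p : PS K r} (hp : p ∈ HG 1) : ∃ a : Fin 4 → K, p - ∑ j, a j • x j ∈ span K (Set.range s.l) := by
  obtain ⟨cf, hcf⟩ : ∃ cf : ι → K, ∀ j, (s.Φ j p).coeff (-1) = MvPolynomial.C (cf j) := ⟨_, fun j => s.coeffC hp j⟩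
  refine ⟨fun j => (V.α j)⁻¹ * cf (V.e j), s.one_span (sub_mem hp (sum_mem fun j _ =>
    smul_mem _ _ (hx j))) ?_⟩
  have hsum : ∑ j, κ j * ((V.α j)⁻¹ * cf (V.e j)) = 0 := by
    have h1 := s.γsum p hp; rw [← Equiv.sum_comp V.e] at h1; simp only [hcf, smul_eq_C_mul, ← map_mul, ← map_sum, map_eq_zero] at h1
    have h2 : g0 * ∑ j, κ j * ((V.α j)⁻¹ * cf (V.e j)) = 0 := by
      rw [← h1, mul_sum]; refine sum_congr rfl fun j _ => ?_
      rw [← mul_assoc, ← hg, mul_assoc, ← mul_assoc (V.α j), mul_inv_cancel₀ (V.αne j), one_mul]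
    exact (mul_eq_zero.1 h2).resolve_left hg0
  intro i; obtain ⟨k, rfl⟩ := V.e.surjective i; rw [map_sub, HahnSeries.coeff_sub, hcf, map_sum, HahnSeries.coeff_sum]
  have h3 : ∀ j, (s.Φ (V.e k) (((V.α j)⁻¹ * cf (V.e j)) • x j)).coeff (-1) =
      (if k = j then MvPolynomial.C (cf (V.e k)) else 0) - MvPolynomial.C (κ j * ((V.α j)⁻¹ * cf (V.e j))) * (if k = 0 then MvPolynomial.C (V.α 0) else 0) := by
    intro j; have h4 := congrFun (hxF j) (V.e k); rw [Setup.F_apply] at h4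
    rw [map_smul, HahnSeries.coeff_smul, h4, Pi.sub_apply, HahnSeries.coeff_sub, V.lead, Pi.smul_apply,
      HahnSeries.coeff_smul, V.lead, smul_sub, smul_eq_C_mul, smul_eq_C_mul, smul_eq_C_mul]
    congr 1
    · split_ifs with h
      · subst h; rw [← map_mul, mul_right_comm, inv_mul_cancel₀ (V.αne _), one_mul]
      · rw [mul_zero]
    · rw [map_mul (MvPolynomial.C : K →+* MP K d) (κ j)]; ring
  rw [sum_congr rfl fun j _ => h3 j, sum_sub_distrib, ← sum_mul, ← map_sum, hsum]; simp

set_option maxHeartbeats 1000000 in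
theorem nondegen (κ : Fin 4 → K) {g0 : K} (hg0 : g0 ≠ 0) (hg : ∀ j, s.γ (V.e j) * V.α j = g0 * κ j) (h0 : κ 0 = 1)
    (hdet : κ 1 * κ 2 * κ 3 + κ 1 * κ 2 + κ 2 * κ 3 + κ 1 * κ 3 ≠ 0) : AMD.IsGenProjVeroneseCone K r I := by
  classical
  have hxex : ∀ j, ∃ x ∈ HG 1, s.F x = V.θ j - κ j • V.θ 0 := fun j => by
    obtain ⟨x, hx, hxF⟩ := V.lift (Pi.single j 1 - Pi.single 0 (κ j)) 0 (by
      simp only [hg, Pi.sub_apply, mul_sub, sum_sub_distrib]; simp [Pi.single_apply, h0]) (Submodule.zero_mem _)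
    refine ⟨x, hx, ?_⟩; rw [hxF, map_zero, map_zero, add_zero]; simp only [s.smul_cc, Pi.sub_apply, map_sub, sub_mul, sum_sub_distrib]
    congr 1
    · rw [sum_eq_single j (fun i _ hi => by rw [Pi.single_eq_of_ne hi, map_zero, map_zero, map_zero, zero_mul])
        (by simp), Pi.single_eq_same, map_one, map_one, map_one, one_mul]
    · rw [sum_eq_single 0 (fun i _ hi => by rw [Pi.single_eq_of_ne hi, map_zero, map_zero, map_zero, zero_mul])
        (by simp), Pi.single_eq_same]
  choose x hx hxF using hxex; have hx0 : x 0 = 0 := s.F_one_inj (hx 0) (Submodule.zero_mem _) (by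
    rw [hxF, h0, map_zero, s.smul_cc, map_one, map_one, map_one, one_mul, sub_self])
  obtain ⟨ren, hren⟩ : ∃ ren : PS K r →ₐ[K] PS K (r + 1), ren = rename Fin.castSucc := ⟨_, rfl⟩
  obtain ⟨Ψ, hΨr, hΨl⟩ : ∃ Ψ : PS K (r + 1) →ₐ[K] (ι → LS K d), (∀ f, Ψ (ren f) = s.F f) ∧ Ψ (X (Fin.last (r + 1))) = V.θ 0 := by
    refine ⟨aeval (Fin.lastCases (V.θ 0) (fun i => s.F (X i))), fun f => ?_, by simp⟩; rw [hren, aeval_rename]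
    have : (Fin.lastCases (V.θ 0) (fun i => s.F (X i)) ∘ Fin.castSucc : Fin (r + 1) → ι → LS K d) = fun i => s.F (X i) := by funext i; simp
    rw [this]; exact (MvPolynomial.aeval_unique s.F ▸ rfl)
  have hrenH : ∀ {p : PS K r}, p ∈ HG 1 → ren p ∈ HG 1 := by
    intro p hp; rw [hren]; exact Setup.one_hom ((Setup.hom_one hp).rename_isHomogeneous)
  obtain ⟨Θ, hΘ⟩ : ∃ Θ : Fin 4 → PS K (r + 1), ∀ j, Θ j = ren (x j) + κ j • X (Fin.last (r + 1)) := ⟨_, fun _ => rfl⟩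
  have hΘH : ∀ j, Θ j ∈ HG 1 := fun j => by rw [hΘ]; exact add_mem (hrenH (hx j)) (smul_mem _ _ (Setup.one_hom (isHomogeneous_X K _)))
  have hΨΘ : ∀ j, Ψ (Θ j) = V.θ j := fun j => by rw [hΘ, map_add, map_smul, hΨr, hΨl, hxF, sub_add_cancel]
  have hΘ0 : Θ 0 = X (Fin.last (r + 1)) := by rw [hΘ, hx0, map_zero, zero_add, h0, one_smul]
  obtain ⟨π, hπ⟩ : ∃ π : MP K d →ₐ[K] PS K (r + 1), π = ren.comp s.P := ⟨_, rfl⟩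
  have hπa : ∀ p, π p = ren (s.P p) := fun p => by rw [hπ]; rfl
  have hπH : ∀ {p}, p ∈ HG 1 → π p ∈ HG 1 := fun hp => by rw [hπa]; exact hrenH (s.P_HG hp)
  have hπl : ∀ i, π (X i) = ren (s.l i) := fun i => by rw [hπa]; simp [Setup.P]
  -- linear forms
  have hspan : ∀ p ∈ (HG 1 : Submodule K (PS K (r + 1))), p ∈ span K (Set.range (fun i => π (X i)) ∪ Set.range Θ) := fun p hp => by
    rw [hom1_eq p (Setup.hom_one hp)]; refine sum_mem fun i _ => smul_mem _ _ ?_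
    have hl0 : X (Fin.last (r + 1)) ∈ span K (Set.range (fun i => π (X i)) ∪ Set.range Θ) := by
      rw [← hΘ0]; exact subset_span (Or.inr ⟨0, rfl⟩)
    refine Fin.lastCases hl0 (fun i => ?_) i; have h1 : (X i.castSucc : PS K (r + 1)) = ren (X i) := by rw [hren, rename_X]
    obtain ⟨a, ha⟩ := V.span_S1 hg0 hg hx hxF (p := X i) (Setup.one_hom (isHomogeneous_X K i))
    have h2 : ren (X i) = ren (X i - ∑ j, a j • x j) + ∑ j, a j • (Θ j - κ j • X (Fin.last (r + 1))) := by
      simp only [hΘ, add_sub_cancel_right, map_sub, map_sum, map_smul]; ring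
    rw [h1, h2]
    refine add_mem ?_ (sum_mem fun j _ => smul_mem _ _ (Submodule.sub_mem _ (subset_span (Or.inr ⟨j, rfl⟩)) (smul_mem _ _ hl0)))
    have h3 := Submodule.mem_map_of_mem (f := ren.toLinearMap) ha; rw [Submodule.map_span, ← Set.range_comp] at h3
    refine Submodule.span_mono ?_ h3; rintro _ ⟨k, rfl⟩; exact Or.inl ⟨k, by simp [hπl]⟩
  -- a system of coordinates
  have hr := s.hr; have hind : LinearIndependent K ![(⟨V.B, V.hB⟩ : (HG 1 : Submodule K (MP K d))), ⟨V.C, V.hC⟩] := by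
    rw [LinearIndependent.pair_iff]; intro a b hab; exact V.ind a b (congrArg Subtype.val hab)
  have hfr : finrank K (HG 1 : Submodule K (MP K d)) = d := by have := Setup.finrank_HG_one (K := K) d; exact this
  have hd : 2 ≤ d := by
    have := hind.fintype_card_le_finrank; rw [hfr] at this; simpa using this
  obtain ⟨n, rfl⟩ : ∃ n, d = n + 2 := ⟨d - 2, by omega⟩; obtain ⟨k, hk⟩ := exists_compl (n := n) _ hind hfr
  obtain ⟨mv, hmv⟩ : ∃ mv : Fin 6 → PS K (r + 1), mv = ![Θ 0 + Θ 1, Θ 0 - π V.B, Θ 0 + π V.C, Θ 0 + Θ 2, Θ 0, Θ 0 + Θ 3] := ⟨_, rfl⟩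
  have m0 : mv 0 = Θ 0 + Θ 1 := by rw [hmv]; rfl
  have m1 : mv 1 = Θ 0 - π V.B := by rw [hmv]; rfl
  have m2 : mv 2 = Θ 0 + π V.C := by rw [hmv]; rfl
  have m3 : mv 3 = Θ 0 + Θ 2 := by rw [hmv]; rfl
  have m4 : mv 4 = Θ 0 := by rw [hmv]; rfl
  have m5 : mv 5 = Θ 0 + Θ 3 := by rw [hmv]; rfl
  obtain ⟨b, hb⟩ : ∃ b : Fin (r + 2) → PS K (r + 1), ∀ i, b i = if h : i.val < 6 then mv ⟨i, h⟩ else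
    π (k ⟨i - 6, by omega⟩) := ⟨_, fun _ => rfl⟩
  have hle : 6 ≤ r + 2 := by omega
  have hbm : ∀ i : Fin 6, b (Fin.castLE hle i) = mv i := by intro i; rw [hb, dif_pos (by simp)]; rfl
  have hbk : ∀ i : Fin n, π (k i) ∈ Set.range b := fun i => by
    refine ⟨⟨i + 6, by omega⟩, ?_⟩; rw [hb, dif_neg (by simp)]; simp
  have hbasis : LinBasis K (r + 1) (Fin (r + 2)) b := by
    refine ⟨fun i => ?_, fun p hp => ?_⟩
    · refine Setup.hom_one ?_; rw [hb]
      split_ifs with h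
      · generalize (⟨i, h⟩ : Fin 6) = i'; have hB := hπH V.hB; have hC := hπH V.hC
        fin_cases i' <;> simp only [Fin.zero_eta, Fin.mk_one, Fin.reduceFinMk, m0, m1, m2, m3, m4, m5]
        · exact add_mem (hΘH _) (hΘH _)
        · exact sub_mem (hΘH _) hB
        · exact add_mem (hΘH _) hC
        · exact add_mem (hΘH _) (hΘH _)
        · exact hΘH _
        · exact add_mem (hΘH _) (hΘH _)
      · exact hπH (k _).2
    · have hm : ∀ i, mv i ∈ span K (Set.range b) := fun i => subset_span ⟨_, hbm i⟩; have t0 : Θ 0 ∈ span K (Set.range b) := m4 ▸ hm 4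
      have hBm : π V.B ∈ span K (Set.range b) := by have := sub_mem t0 (hm 1); rwa [m1, sub_sub_cancel] at this
      have hCm : π V.C ∈ span K (Set.range b) := by have := sub_mem (hm 2) t0; rwa [m2, add_sub_cancel_left] at this
      have t1 : Θ 1 ∈ span K (Set.range b) := by have := sub_mem (hm 0) t0; rwa [m0, add_sub_cancel_left] at this
      have t2 : Θ 2 ∈ span K (Set.range b) := by have := sub_mem (hm 3) t0; rwa [m3, add_sub_cancel_left] at this
      have t3 : Θ 3 ∈ span K (Set.range b) := by have := sub_mem (hm 5) t0; rwa [m5, add_sub_cancel_left] at this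
      refine Submodule.span_le.2 ?_ (hspan p (Setup.one_hom hp)); rintro _ (⟨i, rfl⟩ | ⟨j, rfl⟩)
      · have h1 := Submodule.mem_map_of_mem (f := π.toLinearMap ∘ₗ Submodule.subtype _)
          (hk ⟨X i, Setup.one_hom (isHomogeneous_X K i)⟩)
        rw [Submodule.map_span, ← Set.range_comp] at h1; refine Submodule.span_le.2 ?_ h1; rintro _ ⟨j, rfl⟩
        rcases j with j | j
        · exact subset_span (hbk j)
        · fin_cases j
          · exact hBm
          · exact hCm
      · fin_cases j
        exacts [t0, t1, t2, t3]
  obtain ⟨ψ, hψ, -⟩ := hbasis.equiv (by simp)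
  obtain ⟨T, hT⟩ : ∃ T : PS K 5 →ₐ[K] PS K (r + 1), T = ψ.toAlgHom.comp (rename (Fin.castLE hle)) := ⟨_, rfl⟩
  have hTX : ∀ i, T (X i) = mv i := fun i => by rw [hT, ← hbm, ← hψ]; simp
  have hTm : ∀ J : Ideal (PS K 5), Ideal.map ψ (Ideal.map (rename (Fin.castLE hle)) J) = Ideal.map T J := by
    intro J; rw [hT]; exact Ideal.map_map (I := J) (rename (Fin.castLE hle)).toRingHom ψ.toAlgHom.toRingHom
  refine ⟨hle, ψ, fun i => by rw [hψ]; exact hbasis.deg i, ?_, ?_⟩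
  · rw [hTm]; intro hcon; have h1 := hcon (Ideal.mem_map_of_mem T (Ideal.subset_span (Set.mem_singleton (AMD.veroneseDet K))))
    obtain ⟨ev, hev⟩ : ∃ ev : PS K (r + 1) →ₐ[K] K, ∀ i, ev (X i) = if i = Fin.last (r + 1) then 1 else 0 :=
      ⟨aeval fun i => if i = Fin.last (r + 1) then 1 else 0, fun i => by simp⟩
    have h2 : AMD.pointIdl K r ≤ RingHom.ker ev := by
      refine Ideal.span_le.2 ?_; rintro _ ⟨i, hi, rfl⟩; exact (hev i).trans (if_neg hi)
    have h3 : ev (T (AMD.veroneseDet K)) = 0 := h2 h1; have h4 : ∀ p ∈ HG 1, ev (ren p) = 0 := fun p hp => by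
      rw [hom1_eq p (Setup.hom_one hp), map_sum, map_sum]; refine sum_eq_zero fun i _ => ?_
      rw [map_smul, map_smul, hren, rename_X, hev, if_neg (Fin.castSucc_lt_last i).ne, smul_zero]
    have h5 : ∀ j, ev (Θ j) = κ j := fun j => by rw [hΘ, map_add, h4 _ (hx j), map_smul, hev, if_pos rfl, zero_add, smul_eq_mul, mul_one]
    have h6 : ev (π V.B) = 0 := by rw [hπa]; exact h4 _ (s.P_HG V.hB)
    have h7 : ev (π V.C) = 0 := by rw [hπa]; exact h4 _ (s.P_HG V.hC)
    rw [AMD.veroneseDet] at h3; simp only [map_add, map_sub, map_mul, hTX, m0, m1, m2, m3, m4, m5, h5, h6, h7, h0, map_ofNat] at h3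
    exact hdet (by linear_combination h3)
  · rw [hTm]; have hQ : Ideal.map T (AMD.veroneseIdeal K) ≤ RingHom.ker Ψ := by
      rw [Ideal.map_le_iff_le_comap]; refine Ideal.span_le.2 ?_; have hΨB : Ψ (π V.B) = s.F (s.P V.B) := by rw [hπa, hΨr]
      have hΨC : Ψ (π V.C) = s.F (s.P V.C) := by rw [hπa, hΨr]
      obtain ⟨w1, w2, w3, w4, w5, w6⟩ := V.rel.gens; intro f hf; change Ψ (T f) = 0
      simp only [Set.mem_insert_iff, Set.mem_singleton_iff] at hf
      rcases hf with rfl | rfl | rfl | rfl | rfl | rfl <;> simp only [map_sub, map_mul, hTX, m0, m1, m2, m3, m4, m5, map_add, hΨΘ, hΨB, hΨC]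
      exacts [w1, w2, w3, w4, w5, w6]
    have hQ' : ∀ f, Ψ f = 0 → f ∈ Ideal.map T (AMD.veroneseIdeal K) := by
      obtain ⟨Q, hQd⟩ : ∃ Q, Q = Ideal.map T (AMD.veroneseIdeal K) := ⟨_, rfl⟩
      have hg1 : ∀ g ∈ AMD.veroneseIdeal K, Ideal.Quotient.mk Q (T g) = 0 := fun g hg => by
        rw [Ideal.Quotient.eq_zero_iff_mem, hQd]; exact Ideal.mem_map_of_mem T hg
      obtain ⟨mk, hmk⟩ : ∃ mk : PS K (r + 1) →+* PS K (r + 1) ⧸ Q, mk = Ideal.Quotient.mk Q := ⟨_, rfl⟩; rw [← hmk] at hg1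
      have hrel : VRel (mk (Θ 0)) (mk (Θ 1)) (mk (Θ 2)) (mk (Θ 3)) (mk (π V.B)) (mk (π V.C)) := by
        have g1 := hg1 (X 0 * X 3 - X 1 * X 1) (Ideal.subset_span (by simp))
        have g2 := hg1 (X 0 * X 4 - X 1 * X 2) (Ideal.subset_span (by simp))
        have g3 := hg1 (X 1 * X 4 - X 2 * X 3) (Ideal.subset_span (by simp))
        have g4 := hg1 (X 0 * X 5 - X 2 * X 2) (Ideal.subset_span (by simp))
        have g5 := hg1 (X 1 * X 5 - X 2 * X 4) (Ideal.subset_span (by simp))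
        have g6 := hg1 (X 3 * X 5 - X 4 * X 4) (Ideal.subset_span (by simp))
        simp only [map_sub, map_mul, hTX, m0, m1, m2, m3, m4, m5, map_add] at g1 g2 g3 g4 g5 g6; exact VRel.of_gens g1 g2 g3 g4 g5 g6
      intro f hf; have hcl : ∀ g, mk g ∈ Subring.closure (Set.range (mk.comp π.toRingHom) ∪ Set.range fun j => mk (Θ j)) := by
        have hp : ∀ p, mk (π p) ∈ Subring.closure (Set.range (mk.comp π.toRingHom) ∪ Set.range fun j => mk (Θ j)) :=
          fun p => Subring.subset_closure (Or.inl ⟨p, rfl⟩)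
        have hCC : ∀ a, mk (MvPolynomial.C a) ∈ Subring.closure (Set.range (mk.comp π.toRingHom) ∪ Set.range fun j => mk (Θ j)) := fun a => by
          have := hp (MvPolynomial.C a); rwa [← algebraMap_eq, AlgHom.commutes, algebraMap_eq] at this
        intro g
        induction g using MvPolynomial.induction_on with
        | C a => exact hCC a
        | add p q hp hq => rw [map_add]; exact add_mem hp hq
        | mul_X p i hp1 =>
          rw [map_mul]; refine mul_mem hp1 ?_; have h1 := hspan (X i) (Setup.one_hom (isHomogeneous_X K i))
          refine Submodule.span_induction (p := fun x _ => mk x ∈ Subring.closure (Set.range (mk.comp π.toRingHom) ∪ Set.range fun j => mk (Θ j))) ?_ ?_ ?_ ?_ h1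
          · rintro _ (⟨i, rfl⟩ | ⟨j, rfl⟩)
            · exact hp _
            · exact Subring.subset_closure (Or.inr ⟨j, rfl⟩)
          · rw [map_zero]; exact zero_mem _
          · intro x y _ _ hx hy; rw [map_add]; exact add_mem hx hy
          · intro a x _ hx; rw [smul_eq_C_mul, map_mul]; exact mul_mem (hCC a) hx
      obtain ⟨q, hq⟩ := normal_form (mk.comp π.toRingHom) (fun j => mk (Θ j))
        (VRel.tab (mk.comp π.toRingHom) (B := V.B) (C := V.C) hrel) (mk f) (hcl f)
      obtain ⟨g, hgd⟩ : ∃ g, g = ∑ j, (q j).eval₂ π.toRingHom (Θ j) := ⟨_, rfl⟩; have hfg : f - g ∈ Q := by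
        rw [← Ideal.Quotient.eq_zero_iff_mem, ← hmk, map_sub, hq, hgd, map_sum, sub_eq_zero]; refine sum_congr rfl fun j _ => ?_
        rw [Polynomial.hom_eval₂]
      have hΨg : Ψ g = 0 := by
        have h1 : Ψ (f - g) = 0 := hQ (hQd ▸ hfg); rw [map_sub, hf, zero_sub, neg_eq_zero] at h1; exact h1
      have h8 : ∀ k, ∑ j, (q j).eval₂ HC (V.θ j k) = 0 := fun k => by
        have h1 := congrFun hΨg k; rw [hgd, map_sum, Finset.sum_apply, Pi.zero_apply] at h1; rw [← h1]; refine sum_congr rfl fun j _ => ?_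
        have h2 := Polynomial.hom_eval₂ (q j) π.toRingHom ((Pi.evalRingHom _ k).comp Ψ.toRingHom) (Θ j)
        have h3 : ((Pi.evalRingHom (fun _ : ι => LS K (n + 2)) k).comp Ψ.toRingHom).comp π.toRingHom = HC := by
          refine RingHom.ext fun p => ?_; change Ψ (π p) k = _; rw [hπa, hΨr, Setup.cc_coeff]
        have h4 : ((Pi.evalRingHom (fun _ : ι => LS K (n + 2)) k).comp Ψ.toRingHom) (Θ j) = V.θ j k := by
          change Ψ (Θ j) k = _; rw [hΨΘ]
        rw [h3, h4] at h2; exact h2.symm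
      obtain ⟨p, hp1, hp2⟩ := V.pole_zero q h8; have hg0 : g = 0 := by
        rw [hgd]; simp only [hp1, Polynomial.eval₂_C]; rw [← map_sum, hp2, map_zero]
      rw [hg0, sub_zero, hQd] at hfg; exact hfg
    ext f; rw [Ideal.mem_comap]; have hf : f ∈ I ↔ s.F f = 0 := ⟨fun h => funext fun j => (s.ker j f).2 h, s.F_zero⟩; rw [hf, ← hΨr, ← hren]
    exact ⟨hQ' _, fun h => hQ h⟩
end Vero
end AMDP
namespace AMDP

variable {K : Type} [Field K]

lemma chain_rule {B : Type} [CommRing B] [Algebra K B] {m : ℕ} (u : Fin m → Polynomial B) (f : MvPolynomial (Fin m) K) :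
    Polynomial.derivative (aeval u f) = ∑ i, aeval u (pderiv i f) * Polynomial.derivative (u i) := by
  induction f using MvPolynomial.induction_on with
  | C a => simp [← algebraMap_eq, Polynomial.algebraMap_apply]
  | add p q hp hq => simp only [map_add, hp, hq, add_mul, sum_add_distrib]
  | mul_X p i hp =>
    have h1 : ∀ j, aeval u (pderiv j (p * X i)) * Polynomial.derivative (u j) = aeval u (pderiv j p) * Polynomial.derivative (u j) * u i +
        aeval u p * (if i = j then Polynomial.derivative (u j) else 0) := by
      intro j; rw [Derivation.leibniz, pderiv_X, smul_eq_mul, smul_eq_mul, map_add, map_mul, map_mul, aeval_X]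
      split_ifs with h
      · subst h; rw [Pi.single_eq_same, map_one]; ring
      · rw [Pi.single_eq_of_ne h, map_zero]; ring
    rw [sum_congr rfl fun j _ => h1 j, sum_add_distrib, ← sum_mul, ← mul_sum,
      Finset.sum_ite_eq, if_pos (mem_univ i), ← hp, map_mul, aeval_X, Polynomial.derivative_mul]

lemma lead_lin {B : Type} [CommRing B] [Algebra K B] {m N : ℕ} (b : Fin m → B) (c : Fin m → K)
    {f : MvPolynomial (Fin m) K} (hf : f.IsHomogeneous N) : (aeval (fun i => PC (b i) + PC (algebraMap K B (c i)) * PX) f).natDegree ≤ N ∧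
    (aeval (fun i => PC (b i) + PC (algebraMap K B (c i)) * PX) f).coeff N = algebraMap K B (eval c f) := by
  obtain ⟨u, hu⟩ : ∃ u : Fin m → Polynomial B, u = fun i => PC (b i) + PC (algebraMap K B (c i)) * PX := ⟨_, rfl⟩; rw [← hu]
  have hu1 : ∀ i, (u i).natDegree ≤ 1 := fun i => by rw [hu]; simp only; compute_degree
  have hu2 : ∀ i, (u i).coeff 1 = algebraMap K B (c i) := fun i => by rw [hu]; simp
  have key : ∀ (s : Fin m →₀ ℕ) (t : Finset (Fin m)), (∏ i ∈ t, u i ^ s i).natDegree ≤ ∑ i ∈ t, s i ∧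
      (∏ i ∈ t, u i ^ s i).coeff (∑ i ∈ t, s i) = algebraMap K B (∏ i ∈ t, c i ^ s i) := by
    intro s t; classical
    induction t using Finset.induction_on with
    | empty => simp
    | insert a t ha ih =>
      rw [Finset.prod_insert ha, Finset.sum_insert ha, Finset.prod_insert ha]
      have h1 : (u a ^ s a).natDegree ≤ s a := by have := Polynomial.natDegree_pow_le_of_le (s a) (hu1 a); rwa [mul_one] at this
      refine ⟨Polynomial.natDegree_mul_le_of_le h1 ih.1, ?_⟩; rw [Polynomial.coeff_mul_add_eq_of_natDegree_le h1 ih.1, ih.2, map_mul]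
      have := Polynomial.coeff_pow_of_natDegree_le (m := s a) (hu1 a); rw [mul_one] at this; rw [this, hu2, map_pow]
  have hs : ∀ s ∈ f.support, ∑ i, s i = N := fun s hs => by
    simpa [Finsupp.weight_apply, Finsupp.sum_fintype] using hf (mem_support_iff.1 hs)
  have e1 : aeval u f = ∑ s ∈ f.support, PC (algebraMap K B (coeff s f)) * ∏ i, u i ^ s i := by
    conv_lhs => rw [f.as_sum]
    rw [map_sum]; refine sum_congr rfl fun s _ => ?_; rw [aeval_monomial, Finsupp.prod_fintype _ _ (fun i => pow_zero _)]; rfl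
  rw [e1]; constructor
  · refine Polynomial.natDegree_sum_le_of_forall_le _ _ fun s h => ?_; refine (Polynomial.natDegree_C_mul_le _ _).trans ?_
    rw [← hs s h]; exact (key s _).1
  · rw [Polynomial.finsetSum_coeff, eval_eq', map_sum]; refine sum_congr rfl fun s h => ?_; rw [Polynomial.coeff_C_mul, map_mul]
    conv_lhs => rw [← hs s h]
    rw [(key s _).2]

lemma pth_power [IsAlgClosed K] {m N : ℕ} {f : MvPolynomial (Fin m) K} (hf : f.IsHomogeneous N) (hN : N ≠ 0) (hf0 : f ≠ 0)
    (h : ∀ i, pderiv i f = 0) : ∃ (p M : ℕ) (g : MvPolynomial (Fin m) K), 2 ≤ p ∧ f = g ^ p ∧ g.IsHomogeneous M ∧ p * M = N := by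
  have h1 : ∀ s i, coeff s f * (s i : K) = 0 := fun s i => by
    have h2 : coeff s (X i * pderiv i f) = coeff s f * (s i : K) := by
      conv_lhs => rw [f.as_sum]
      rw [map_sum, mul_sum, coeff_sum]; simp only [X_mul_pderiv_monomial, nsmul_eq_mul]; rw [sum_eq_single s]
      · rw [← map_natCast (C : K →+* _), coeff_C_mul, coeff_monomial, if_pos rfl, mul_comm]
      · intro t _ ht; rw [← map_natCast (C : K →+* _), coeff_C_mul, coeff_monomial, if_neg ht, mul_zero]
      · intro hs; rw [notMem_support_iff.1 hs]; simp
    rw [← h2, h, mul_zero, coeff_zero]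
  have hs : ∀ s ∈ f.support, ∑ i, s i = N := fun s hs => by
    simpa [Finsupp.weight_apply, Finsupp.sum_fintype] using hf (mem_support_iff.1 hs)
  obtain ⟨s0, hs0⟩ := support_nonempty.2 hf0; obtain ⟨p, hp⟩ := CharP.exists K
  have hpd : ∀ s ∈ f.support, ∀ i, p ∣ s i := fun s hs i => (CharP.cast_eq_zero_iff K p (s i)).1
    ((mul_eq_zero.1 (h1 s i)).resolve_left (mem_support_iff.1 hs))
  have hp0 : p ≠ 0 := by
    rintro rfl; apply hN; rw [← hs s0 hs0]; exact sum_eq_zero fun i _ => Nat.eq_zero_of_zero_dvd (hpd s0 hs0 i)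
  have hpp : p.Prime := (CharP.char_is_prime_or_zero K p).resolve_right hp0; have : Fact p.Prime := ⟨hpp⟩
  obtain ⟨rt, hrt⟩ : ∃ rt : K → K, ∀ a, rt a ^ p = a :=
    ⟨fun a => (IsAlgClosed.exists_pow_nat_eq a hpp.pos).choose, fun a => (IsAlgClosed.exists_pow_nat_eq a hpp.pos).choose_spec⟩
  obtain ⟨q, hq⟩ : ∃ q : (Fin m →₀ ℕ) → (Fin m →₀ ℕ), ∀ s i, q s i = s i / p :=
    ⟨fun s => Finsupp.equivFunOnFinite.symm fun i => s i / p, fun s i => rfl⟩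
  have hqs : ∀ s ∈ f.support, p • q s = s := fun s hs => by
    ext i; rw [Finsupp.smul_apply, hq, smul_eq_mul, Nat.mul_div_cancel' (hpd s hs i)]
  have hdeg : ∀ s ∈ f.support, ∑ i, q s i = N / p := fun s h => by
    rw [← hs s h]
    conv_rhs => rw [← hqs s h]
    simp only [Finsupp.smul_apply, smul_eq_mul, ← mul_sum]; rw [Nat.mul_div_cancel_left _ hpp.pos]
  refine ⟨p, N / p, ∑ s ∈ f.support, monomial (q s) (rt (coeff s f)), hpp.two_le, ?_, ?_, ?_⟩
  · rw [sum_pow_char]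
    conv_lhs => rw [f.as_sum]
    refine sum_congr rfl fun s h => ?_; rw [monomial_pow, hrt, hqs s h]
  · refine IsHomogeneous.sum _ _ _ fun s h => isHomogeneous_monomial _ ?_; rw [Finsupp.degree_eq_sum, hdeg s h]
  · refine Nat.mul_div_cancel' ?_; rw [← hs s0 hs0]; exact Finset.dvd_sum fun i _ => hpd s0 hs0 i

/-- Linear forms over which the coordinate ring is integral and its field of fractions separable. -/
structure LF {r : ℕ} {A : Type} [CommRing A] [Algebra K A] (L : Type) [Field L] [Algebra K L] [Algebra A L]
    (mk : PS K r →ₐ[K] A) (m : ℕ) (l : Fin m → PS K r) : Prop where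
  deg : ∀ i, l i ∈ HG 1
  int : ∀ (B : Type) [CommRing B] [Algebra K B] [Algebra B A] [IsScalarTower K B A],
    (∀ i, mk (l i) ∈ (algebraMap B A).range) → Algebra.IsIntegral B A
  sep : ∀ (E : Type) [Field E] [Algebra K E] [Algebra E L] [IsScalarTower K E L],
    (∀ i, algebraMap A L (mk (l i)) ∈ (algebraMap E L).range) → Algebra.IsSeparable E L

section
variable {r : ℕ} {A : Type} [CommRing A] [Algebra K A] {L : Type} [Field L] [Algebra K L] [Algebra A L]
  [IsScalarTower K A L] [IsFractionRing A L] (mk : PS K r →ₐ[K] A)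

lemma LF_init (hmk : Surjective mk) : LF L mk (r + 1) X := by
  refine ⟨fun i => Setup.one_hom (isHomogeneous_X K i), ?_, ?_⟩
  · intro B _ _ _ _ h; refine ⟨fun a => ?_⟩; have : a ∈ (algebraMap B A).range := by
      obtain ⟨p, rfl⟩ := hmk a
      induction p using MvPolynomial.induction_on with
      | C a => rw [← algebraMap_eq, AlgHom.commutes, tower_apply K B A]; exact ⟨_, rfl⟩
      | add p q hp hq => rw [map_add]; exact add_mem hp hq
      | mul_X p i hp => rw [map_mul]; exact mul_mem hp (h i)
    obtain ⟨b, rfl⟩ := this; exact isIntegral_algebraMap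
  · intro E _ _ _ _ h; have h1 : ∀ a, algebraMap A L a ∈ (algebraMap E L).fieldRange := fun a => by
      obtain ⟨p, rfl⟩ := hmk a
      induction p using MvPolynomial.induction_on with
      | C a =>
        rw [← algebraMap_eq, AlgHom.commutes, ← tower_apply K A L, tower_apply K E L]; exact ⟨_, rfl⟩
      | add p q hp hq => rw [map_add, map_add]; exact add_mem hp hq
      | mul_X p i hp => rw [map_mul, map_mul]; exact mul_mem hp (h i)
    refine ⟨fun x => ?_⟩; obtain ⟨a, b, -, rfl⟩ := IsFractionRing.div_surjective (A := A) x; obtain ⟨e, he⟩ := div_mem (h1 a) (h1 b)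
    rw [← he]; exact isSeparable_algebraMap e

end

variable {K : Type} [Field K]

lemma hcmp_aeval {σ τ : Type} {f : σ → MvPolynomial τ K} (hf : ∀ i, f i ∈ HG 1) (n : ℤ)
    (p : MvPolynomial σ K) : hcmp n (aeval f p) = aeval f (hcmp n p) := by
  by_cases hn : 0 ≤ n
  · lift n to ℕ using hn; have h := hcmp_sum p (max p.totalDegree n + 1) (by omega)
    conv_lhs => rw [← h]
    rw [map_sum, map_sum, sum_eq_single n]
    · exact hcmp_of_mem (HG_aeval hf (hcmp_mem _ _))
    · intro b _ hb; exact hcmp_of_mem_ne (HG_aeval hf (hcmp_mem _ _)) (by omega)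
    · intro h; simp at h
  · simp [hcmp, hn]

lemma exists_hom_rel {s r : ℕ} {A : Type} [CommRing A] [Algebra K A] (mk : PS K r →ₐ[K] A)
    (hh : ∀ p, mk p = 0 → ∀ n : ℕ, mk (hcmp n p) = 0) {l : Fin s → PS K r} (hl : ∀ i, l i ∈ HG 1)
    {p : MvPolynomial (Fin s) K} (hp : p ≠ 0) (h : aeval (fun i => mk (l i)) p = 0) :
    ∃ (n : ℕ) (f : MvPolynomial (Fin s) K), f ≠ 0 ∧ f.IsHomogeneous n ∧ aeval (fun i => mk (l i)) f = 0 := by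
  have e : ∀ q : MvPolynomial (Fin s) K, aeval (fun i => mk (l i)) q = mk (aeval l q) := fun q => by rw [← AlgHom.comp_apply, comp_aeval]
  by_contra hc
  push Not at hc
  apply hp; rw [← hcmp_sum p _ (Nat.lt_succ_self _)]; refine sum_eq_zero fun n _ => ?_; by_contra hn
  refine hc n _ hn (mem_HG_nat.1 (hcmp_mem _ _)) ?_; rw [e, ← hcmp_aeval hl]; exact hh _ (by rw [← e, h]) n

lemma gpoly {B M : Type} [CommRing B] [CommRing M] [Algebra K B] [Algebra K M] [Algebra B M] [IsScalarTower K B M]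
    {m N : ℕ} {f : MvPolynomial (Fin m) K} (hf : f.IsHomogeneous N) (b : Fin m → B) (a : Fin m → K) (y : M) (z : Fin m → M)
    (hz : ∀ i, z i = algebraMap B M (b i) + algebraMap K M (a i) * y) :
    ∃ g : Polynomial B, g.natDegree ≤ N ∧ g.coeff N = algebraMap K B (eval a f) ∧ Polynomial.aeval y g = aeval z f ∧
      Polynomial.aeval y (Polynomial.derivative g) = ∑ i, aeval z (pderiv i f) * algebraMap K M (a i) := by
  obtain ⟨u, hu⟩ : ∃ u : Fin m → Polynomial B, u = fun i => PC (b i) + PC (algebraMap K B (a i)) * PX := ⟨_, rfl⟩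
  have h1 := lead_lin b a hf; rw [← hu] at h1
  have h2 : ∀ p : MvPolynomial (Fin m) K, Polynomial.aeval y (aeval u p) = aeval z p := fun p => by
    have := comp_aeval_apply (f := u) ((Polynomial.aeval (R := B) y).restrictScalars K) p; rw [AlgHom.restrictScalars_apply] at this
    rw [this]; congr 2; funext i
    rw [hz i, hu, AlgHom.restrictScalars_apply, map_add, map_mul, Polynomial.aeval_C, Polynomial.aeval_C, Polynomial.aeval_X,
      ← tower_apply K B M]
  refine ⟨aeval u f, h1.1, h1.2, h2 f, ?_⟩; rw [chain_rule, map_sum]; refine sum_congr rfl fun i _ => ?_; rw [map_mul, h2, hu]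
  simp [← tower_apply K B M]

lemma direction [IsAlgClosed K] {A : Type} [CommRing A] [IsDomain A] [Algebra K A] {s r : ℕ} (mk : PS K r →ₐ[K] A)
    (hh : ∀ p, mk p = 0 → ∀ n : ℕ, mk (hcmp n p) = 0) {l : Fin s → PS K r} (hl : ∀ i, l i ∈ HG 1)
    (hni : ¬ Injective (aeval (fun i => mk (l i)) : MvPolynomial (Fin s) K →ₐ[K] A)) :
    ∃ (N : ℕ) (f : MvPolynomial (Fin s) K) (a : Fin s → K) (k : Fin s), f.IsHomogeneous N ∧
      aeval (fun i => mk (l i)) f = 0 ∧ eval a f ≠ 0 ∧ a k ≠ 0 ∧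
      ∑ i, aeval (fun i => mk (l i)) (pderiv i f) * algebraMap K A (a i) ≠ 0 := by
  classical
  have hex : ∃ N : ℕ, ∃ f : MvPolynomial (Fin s) K, f ≠ 0 ∧ f.IsHomogeneous N ∧ aeval (fun i => mk (l i)) f = 0 := by
    rw [injective_iff_map_eq_zero] at hni
    push Not at hni
    obtain ⟨p, hp, hp0⟩ := hni; exact exists_hom_rel mk hh hl hp0 hp
  obtain ⟨f, hf0, hf, hfz⟩ := Nat.find_spec hex; obtain ⟨N, hN⟩ : ∃ N, N = Nat.find hex := ⟨_, rfl⟩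
  have hmin : ∀ M < N, ∀ g : MvPolynomial (Fin s) K, g.IsHomogeneous M → aeval (fun i => mk (l i)) g = 0 → g = 0 := fun M hM g hg hgz => by
    by_contra hg0; exact Nat.find_min hex (hN ▸ hM) ⟨g, hg0, hg, hgz⟩
  rw [← hN] at hf; have hN0 : N ≠ 0 := by
    intro h0; rw [h0] at hf
    rw [HG_zero_eq (mem_HG_nat.2 hf), ← algebraMap_eq, AlgHom.commutes, map_eq_zero_iff _ (algebraMap K A).injective] at hfz; apply hf0
    rw [HG_zero_eq (mem_HG_nat.2 hf), hfz, map_zero]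
  obtain ⟨i0, hi0⟩ : ∃ i, aeval (fun i => mk (l i)) (pderiv i f) ≠ 0 := by
    by_contra hc
    push Not at hc
    obtain ⟨p, M, g, hp, hfg, hg, hpM⟩ := pth_power hf hN0 hf0 fun i => hmin (N - 1) (by omega) _ hf.pderiv (hc i); have hM : M < N := by
      rw [← hpM]; have : M ≠ 0 := by rintro rfl; omega
      nlinarith [Nat.pos_of_ne_zero this]
    have hg0 := hmin M hM g hg (by
      rw [hfg, map_pow] at hfz; exact eq_zero_of_pow_eq_zero hfz)
    apply hf0; rw [hfg, hg0, zero_pow (by omega)]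
  obtain ⟨w, hw⟩ : ∃ w : Fin s → A, ∀ i, w i = aeval (fun i => mk (l i)) (pderiv i f) := ⟨_, fun i => rfl⟩
  obtain ⟨φ, hφ⟩ : ∃ φ : Module.Dual K A, φ (w i0) ≠ 0 := by
    by_contra hc
    push Not at hc
    exact hi0 (by rw [← hw]; exact (Module.forall_dual_apply_eq_zero_iff K _).1 hc)
  have hL : (∑ i, C (φ (w i)) * X i : MvPolynomial (Fin s) K) ≠ 0 := by
    intro h; have := congrArg (coeff (single i0 1)) h; simp only [coeff_sum, coeff_C_mul, coeff_zero] at this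
    rw [sum_eq_single i0 (fun b _ hb => by rw [coeff_X', if_neg (by simpa [Finsupp.single_left_inj] using hb), mul_zero])
      (by simp), coeff_X, if_pos rfl, mul_one] at this
    exact hφ this
  obtain ⟨a, ha⟩ : ∃ a : Fin s → K, eval a (f * ∑ i, C (φ (w i)) * X i) ≠ 0 := by
    by_contra hc
    push Not at hc
    exact mul_ne_zero hf0 hL (MvPolynomial.funext fun a => by rw [hc a, map_zero])
  rw [map_mul] at ha; have ha2 : ∑ i, φ (w i) * a i ≠ 0 := by
    have := right_ne_zero_of_mul ha; simpa using this
  obtain ⟨k, -, hk⟩ := Finset.exists_ne_zero_of_sum_ne_zero ha2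
  refine ⟨N, f, a, k, hf, hfz, left_ne_zero_of_mul ha, right_ne_zero_of_mul hk, fun h => ha2 ?_⟩; have := congrArg φ h
  rw [map_zero, map_sum] at this; rw [← this]; refine sum_congr rfl fun i _ => ?_
  rw [← hw, mul_comm (w i), ← Algebra.smul_def, map_smul, smul_eq_mul, mul_comm]

section
variable {r : ℕ} {A : Type} [CommRing A] [IsDomain A] [Algebra K A] {L : Type} [Field L] [Algebra K L] [Algebra A L]
  [IsScalarTower K A L] [IsFractionRing A L] (mk : PS K r →ₐ[K] A)

lemma LF_step [IsAlgClosed K] {s : ℕ} (hh : ∀ p, mk p = 0 → ∀ n : ℕ, mk (hcmp n p) = 0) {l : Fin (s + 1) → PS K r} (h : LF L mk (s + 1) l)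
    (hni : ¬ Injective (aeval (fun i => mk (l i)) : MvPolynomial (Fin (s + 1)) K →ₐ[K] A)) : ∃ l' : Fin s → PS K r, LF L mk s l' := by
  obtain ⟨N, f, a, k, hf, hfz, ha, hk, hder⟩ := direction mk hh h.deg hni; obtain ⟨y, hy⟩ : ∃ y : PS K r, y = (a k)⁻¹ • l k := ⟨_, rfl⟩
  have hb : ∀ {M : Type} [CommRing M] (ψ : PS K r →+* M) (S : Subring M),
      (∀ i, ψ (l (k.succAbove i) - a (k.succAbove i) • y) ∈ S) → ∀ i, ψ (l i - a i • y) ∈ S := by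
    intro M _ ψ S hS i; by_cases hik : i = k
    · rw [hik, hy, smul_smul, mul_inv_cancel₀ hk, one_smul, sub_self, map_zero]; exact zero_mem _
    · obtain ⟨j, rfl⟩ := Fin.exists_succAbove_eq hik; exact hS j
  have hl : ∀ i, l i = (l i - a i • y) + a i • y := fun i => by ring
  have hyk : ∀ i, mk (l i) = mk (l i - a i • y) + algebraMap K A (a i) * mk y := fun i => by
    conv_lhs => rw [hl i]
    rw [map_add, map_smul, Algebra.smul_def (a i) (mk y)]
  refine ⟨fun i => l (k.succAbove i) - a (k.succAbove i) • y, ?_, ?_, ?_⟩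
  · intro i; refine sub_mem (h.deg _) (smul_mem _ _ ?_); rw [hy]; exact smul_mem _ _ (h.deg k)
  · intro B _ _ _ _ hB; choose b hb' using hb (mk : PS K r →+* A) _ hB
    obtain ⟨g, hg1, hg2, hg3, -⟩ := gpoly (B := B) hf b a (mk y) (fun i => mk (l i)) (fun i => by rw [hb']; exact hyk i)
    have hyi : IsIntegral B (mk y) := by
      refine ⟨PC (algebraMap K B (eval a f)⁻¹) * g, ?_, ?_⟩
      · refine Polynomial.monic_of_natDegree_le_of_coeff_eq_one N ((Polynomial.natDegree_C_mul_le _ _).trans hg1) ?_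
        rw [Polynomial.coeff_C_mul, hg2, ← map_mul, inv_mul_cancel₀ ha, map_one]
      · rw [← Polynomial.aeval_def, map_mul, hg3, hfz, mul_zero]
    have h1 : Algebra.IsIntegral B (Algebra.adjoin B {mk y}) :=
      Algebra.IsIntegral.adjoin fun x hx => by rw [Set.mem_singleton_iff.1 hx]; exact hyi
    have h2 : Algebra.IsIntegral (Algebra.adjoin B {mk y}) A := by
      refine h.int _ fun i => ?_; refine ⟨⟨mk (l i), ?_⟩, rfl⟩; rw [hyk]; refine add_mem ?_ (mul_mem ?_ (Algebra.subset_adjoin rfl))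
      · have := hb' i; rw [RingHom.coe_coe] at this; rw [← this]; exact Subalgebra.algebraMap_mem _ _
      · rw [tower_apply K B A]; exact Subalgebra.algebraMap_mem _ _
    exact Algebra.IsIntegral.trans (Algebra.adjoin B {mk y})
  · intro E _ _ _ _ hE; choose b hb' using hb ((algebraMap A L).comp (mk : PS K r →+* A)) _ hE
    simp only [RingHom.comp_apply, RingHom.coe_coe] at hb'
    have hyk' : ∀ i, algebraMap A L (mk (l i)) = algebraMap E L (b i) + algebraMap K L (a i) * algebraMap A L (mk y) := fun i => by
      rw [hb', hyk, map_add, map_mul, ← tower_apply K A L]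
    obtain ⟨g, -, -, hg3, hg4⟩ := gpoly (B := E) hf b a (algebraMap A L (mk y)) (fun i => algebraMap A L (mk (l i))) hyk'
    have hev : ∀ p : MvPolynomial (Fin (s + 1)) K, aeval (fun i => algebraMap A L (mk (l i))) p = algebraMap A L (aeval (fun i => mk (l i)) p) :=
      fun p => by
        have := comp_aeval_apply (f := fun i => mk (l i)) (IsScalarTower.toAlgHom K A L) p; rw [IsScalarTower.coe_toAlgHom'] at this
        exact this.symm
    have hinj : Injective (algebraMap A L) := IsFractionRing.injective A L; rw [hev, hfz, map_zero] at hg3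
    have hg5 : Polynomial.aeval (algebraMap A L (mk y)) (Polynomial.derivative g) ≠ 0 := by
      rw [hg4]; intro h0; apply hder; apply hinj; rw [map_zero, ← h0, map_sum]; refine sum_congr rfl fun i _ => ?_
      rw [map_mul, hev, ← tower_apply K A L]
    have hg0 : g ≠ 0 := by rintro rfl; simp at hg5
    have hitg : IsIntegral E (algebraMap A L (mk y)) := (IsAlgebraic.isIntegral ⟨g, hg0, hg3⟩)
    have hsep : IsSeparable E (algebraMap A L (mk y)) := by
      rw [IsSeparable, Polynomial.separable_iff_derivative_ne_zero (minpoly.irreducible hitg)]; intro h0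
      obtain ⟨q, hq⟩ := minpoly.dvd E _ hg3; apply hg5
      rw [hq, Polynomial.derivative_mul, h0, zero_mul, zero_add, map_mul, minpoly.aeval, zero_mul]
    have h1 : Algebra.IsSeparable E (IntermediateField.adjoin E {algebraMap A L (mk y)}) :=
      (IntermediateField.isSeparable_adjoin_simple_iff_isSeparable E L).2 hsep
    have h2 : Algebra.IsSeparable (IntermediateField.adjoin E {algebraMap A L (mk y)}) L := by
      have : IsScalarTower K (IntermediateField.adjoin E {algebraMap A L (mk y)}) L := IsScalarTower.of_algebraMap_eq fun x => rfl
      refine h.sep _ fun i => ?_; refine ⟨⟨algebraMap A L (mk (l i)), ?_⟩, rfl⟩; rw [hyk']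
      refine add_mem (IntermediateField.algebraMap_mem _ _) (mul_mem ?_ (IntermediateField.subset_adjoin _ _ rfl))
      rw [tower_apply K E L]; exact IntermediateField.algebraMap_mem _ _
    exact Algebra.IsSeparable.trans E (IntermediateField.adjoin E {algebraMap A L (mk y)}) L

theorem exists_LF [IsAlgClosed K] (hmk : Surjective mk) (hh : ∀ p, mk p = 0 → ∀ n : ℕ, mk (hcmp n p) = 0)
    {d : ℕ} (hd : ringKrullDim A = (((d : ℕ∞) + 1 : ℕ∞) : WithBot ℕ∞)) : ∃ l : Fin (d + 1) → PS K r, LF L mk (d + 1) l ∧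
      Injective (aeval (fun i => mk (l i)) : PS K d →ₐ[K] A) := by
  classical
  have hex : ∃ s, ∃ l : Fin s → PS K r, LF L mk s l := ⟨_, _, LF_init mk hmk⟩
  obtain ⟨s, ⟨l, hl⟩, hmin⟩ : ∃ s, (∃ l : Fin s → PS K r, LF L mk s l) ∧ ∀ m < s, ∀ l' : Fin m → PS K r, ¬ LF L mk m l' :=
    ⟨_, Nat.find_spec hex, fun m hm l' h => Nat.find_min hex hm ⟨l', h⟩⟩
  have hinj : Injective (aeval (fun i => mk (l i)) : MvPolynomial (Fin s) K →ₐ[K] A) := by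
    by_contra hni
    cases s with
    | zero =>
      apply hni; rw [injective_iff_map_eq_zero]; intro p hp
      rw [eq_C_of_isEmpty p, ← algebraMap_eq, AlgHom.commutes, map_eq_zero_iff _ (algebraMap K A).injective] at hp
      rw [eq_C_of_isEmpty p, hp, map_zero]
    | succ s =>
      obtain ⟨l', hl'⟩ := LF_step mk hh hl hni; exact hmin s (Nat.lt_succ_self s) l' hl'
  have hi : ((aeval (fun i => mk (l i)) : MvPolynomial (Fin s) K →ₐ[K] A) : MvPolynomial (Fin s) K →+* A).IsIntegral := by
    let _ : Algebra (MvPolynomial (Fin s) K) A := ((aeval (fun i => mk (l i)) : MvPolynomial (Fin s) K →ₐ[K] A) : MvPolynomial (Fin s) K →+* A).toAlgebra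
    have : IsScalarTower K (MvPolynomial (Fin s) K) A := IsScalarTower.of_algebraMap_eq fun x => by
      rw [RingHom.algebraMap_toAlgebra]; exact (AlgHom.commutes (aeval (fun i => mk (l i)) : MvPolynomial (Fin s) K →ₐ[K] A) x).symm
    exact (hl.int (MvPolynomial (Fin s) K) fun i => ⟨X i, by rw [RingHom.algebraMap_toAlgebra]; exact aeval_X _ i⟩).isIntegral
  have h1 := krull_integral _ hinj hi; rw [hd, MvPolynomial.ringKrullDim_of_isNoetherianRing, ringKrullDim_eq_zero_of_field] at h1
  have h2 : s = d + 1 := by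
    simp only [Nat.card_eq_fintype_card, card_fin, zero_add] at h1; exact_mod_cast h1
  subst h2; exact ⟨l, hl, hinj⟩

end

variable {K : Type} [Field K] {d : ℕ}

/-- Graded power series. -/
def gps (K : Type) [Field K] (d : ℕ) : Subring (PowerSeries (MP K d)) where
  carrier := {f | ∀ i : ℕ, PowerSeries.coeff i f ∈ HG i}
  mul_mem' := by
    intro f g hf hg i; rw [PowerSeries.coeff_mul]; refine sum_mem fun ij h => ?_; have := HG_mul (hf ij.1) (hg ij.2)
    rwa [← Nat.cast_add, Finset.HasAntidiagonal.mem_antidiagonal.1 h] at this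
  one_mem' := by
    intro i; rw [PowerSeries.coeff_one]
    split_ifs with h
    · subst h; exact HG_one
    · exact zero_mem _
  add_mem' := fun hf hg i => by rw [map_add]; exact add_mem (hf i) (hg i)
  zero_mem' := fun i => by rw [map_zero]; exact zero_mem _
  neg_mem' := fun hf i => by rw [map_neg]; exact neg_mem (hf i)

lemma hensel_graded (q : Polynomial (PowerSeries (MP K d))) (hq : q.Monic) (hg : ∀ k, q.coeff k ∈ gps K d)
    (qb : Polynomial K) (hqb : q.map PowerSeries.constantCoeff = qb.map C) (y : K) (hy : qb.eval y = 0)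
    (hy' : qb.derivative.eval y ≠ 0) : ∃ a ∈ gps K d, q.eval a = 0 ∧ PowerSeries.constantCoeff a = C y := by
  have key : ∀ b, PowerSeries.constantCoeff b = C y → PowerSeries.constantCoeff (q.derivative.eval b) = C (qb.derivative.eval y) := fun b hb => by
    rw [← Polynomial.eval_map_apply, ← Polynomial.derivative_map, hqb, hb, Polynomial.derivative_map, Polynomial.eval_map_apply]
  have hu : IsUnit (C (qb.derivative.eval y) : MP K d) := (IsUnit.mk0 _ hy').map C
  obtain ⟨a, ha, hay⟩ := HenselianRing.is_henselian (I := Ideal.span {(PowerSeries.X : PowerSeries (MP K d))}) q hq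
    (PowerSeries.C (C y)) (by
      rw [Ideal.mem_span_singleton, PowerSeries.X_dvd_iff, ← Polynomial.eval_map_apply, hqb, PowerSeries.constantCoeff_C,
        Polynomial.eval_map_apply, hy, map_zero]) (by
      refine IsUnit.map _ ?_; rw [PowerSeries.isUnit_iff_constantCoeff, key _ (PowerSeries.constantCoeff_C _)]; exact hu)
  rw [Ideal.mem_span_singleton, PowerSeries.X_dvd_iff, map_sub, PowerSeries.constantCoeff_C, sub_eq_zero] at hay; refine ⟨a, ?_, ha, hay⟩
  have main : ∀ m : ℕ, ∀ i < m, PowerSeries.coeff i a ∈ HG i := fun m => by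
    induction m with
    | zero => intro i hi; omega
    | succ m ih =>
      intro i hi
      rcases Nat.lt_succ_iff_lt_or_eq.1 hi with h | rfl
      · exact ih i h
      rcases Nat.eq_zero_or_pos i with rfl | hpos
      · rw [PowerSeries.coeff_zero_eq_constantCoeff_apply, hay]; exact HG_C _
      obtain ⟨b, hb⟩ : ∃ b : PowerSeries (MP K d), ∀ k, PowerSeries.coeff k b = if k < i then PowerSeries.coeff k a else 0 :=
        ⟨PowerSeries.mk _, fun k => PowerSeries.coeff_mk k _⟩
      have hbg : b ∈ gps K d := fun k => by
        rw [hb]; split_ifs with h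
        · exact ih k h
        · exact zero_mem _
      obtain ⟨u, hu'⟩ : PowerSeries.X ^ i ∣ a - b := PowerSeries.X_pow_dvd_iff.2 fun k hk => by rw [map_sub, hb, if_pos hk, sub_self]
      have hby : PowerSeries.constantCoeff b = C y := by
        rw [← PowerSeries.coeff_zero_eq_constantCoeff_apply, hb, if_pos hpos, PowerSeries.coeff_zero_eq_constantCoeff_apply, hay]
      obtain ⟨k, hk⟩ := Polynomial.binomExpansion q b (a - b); rw [add_sub_cancel, ha, hu'] at hk
      have h1 := congrArg (PowerSeries.coeff i) hk; have e1 : Polynomial.eval b (Polynomial.derivative q) * (PowerSeries.X ^ i * u) =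
        PowerSeries.X ^ i * (Polynomial.eval b (Polynomial.derivative q) * u) := by ring
      have e2 : k * (PowerSeries.X ^ i * u) ^ 2 = PowerSeries.X ^ i * (PowerSeries.X ^ i * (k * u ^ 2)) := by ring
      rw [e1, e2, map_add, map_add, PowerSeries.coeff_X_pow_mul', PowerSeries.coeff_X_pow_mul', if_pos le_rfl, if_pos le_rfl, Nat.sub_self,
        PowerSeries.coeff_X_pow_mul', if_neg (by omega), map_zero, add_zero, PowerSeries.coeff_zero_eq_constantCoeff_apply, map_mul, key b hby] at h1
      have h2 : PowerSeries.coeff i a = PowerSeries.constantCoeff u := by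
        have := congrArg (PowerSeries.coeff i) hu'
        rw [PowerSeries.coeff_X_pow_mul', if_pos le_rfl, Nat.sub_self, map_sub, hb, if_neg (lt_irrefl i), sub_zero,
          PowerSeries.coeff_zero_eq_constantCoeff_apply] at this
        exact this
      have h3 : Polynomial.eval b q ∈ gps K d := by
        rw [Polynomial.eval_eq_sum]; exact sum_mem fun k _ => mul_mem (hg k) (pow_mem hbg k)
      rw [h2]; have h4 : PowerSeries.constantCoeff u = (-(qb.derivative.eval y)⁻¹) • PowerSeries.coeff i (Polynomial.eval b q) := by
        rw [eq_neg_of_add_eq_zero_left h1.symm, smul_neg, neg_smul, neg_neg, ← smul_eq_C_mul, smul_smul, inv_mul_cancel₀ hy', one_smul]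
      rw [h4]; exact smul_mem _ _ (h3 i)
  exact fun i => main (i + 1) i (Nat.lt_succ_self i)

lemma roots_GG {p : Polynomial (LS K d)} (hp : p.Monic) (hg : ∀ k ≤ p.natDegree, p.coeff k ∈ GG ((p.natDegree - k : ℕ) : ℤ))
    (pb : Polynomial K) (hpb : ∀ k ≤ p.natDegree, (p.coeff k).coeff (-((p.natDegree - k : ℕ) : ℤ)) = C (pb.coeff k))
    (hdeg : pb.natDegree ≤ p.natDegree) (y : K) (hy : pb.eval y = 0) (hy' : pb.derivative.eval y ≠ 0) :
    ∃ ρ : LS K d, ρ ∈ GG 1 ∧ p.eval ρ = 0 ∧ ρ.coeff (-1) = C y := by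
  obtain ⟨ep, hep⟩ : ∃ ep : ℤ → LS K d, ∀ n, ep n = HahnSeries.single n 1 := ⟨_, fun n => rfl⟩
  have hepm : ∀ a b, ep a * ep b = ep (a + b) := fun a b => by rw [hep, hep, hep, HahnSeries.single_mul_single, one_mul]
  have hepp : ∀ a (k : ℕ), ep a ^ k = ep (k * a) := fun a k => by rw [hep, hep, HahnSeries.single_pow, one_pow, nsmul_eq_mul]
  have hc : ∀ n (f : LS K d) i, (f * ep n).coeff i = f.coeff (i - n) := fun n f i => by
    have := HahnSeries.coeff_mul_single_add (x := f) (r := (1 : MP K d)) (a := i - n) (b := n); rw [sub_add_cancel, mul_one] at this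
    rw [hep, this]
  have hqk : ∀ k, (p.scaleRoots (ep 1)).coeff k ∈ GG 0 := fun k i => by
    rw [Polynomial.coeff_scaleRoots, hepp, mul_one, hc]; by_cases hk : k ≤ p.natDegree
    · convert hg k hk (i - (p.natDegree - k : ℕ)) using 2; ring
    · rw [Polynomial.coeff_eq_zero_of_natDegree_lt (by omega)]; exact zero_mem _
  have hlo : ∀ f : LS K d, Lo 0 f → f ∈ (HahnSeries.ofPowerSeries ℤ (MP K d)).range := fun f hf => by
    refine ⟨PowerSeries.mk fun i => f.coeff i, ?_⟩
    ext1
    funext i; by_cases hi : 0 ≤ i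
    · lift i to ℕ using hi; rw [HahnSeries.ofPowerSeries_apply_coeff, PowerSeries.coeff_mk]
    · rw [hf i (by omega), HahnSeries.ofPowerSeries_apply]; refine HahnSeries.embDomain_notin_range ?_; rintro ⟨n, hn⟩; simp at hn; omega
  obtain ⟨q, hqm, -, hq⟩ := Polynomial.lifts_and_natDegree_eq_and_monic (f := HahnSeries.ofPowerSeries ℤ (MP K d))
    (p := p.scaleRoots (ep 1)) (by
      rw [Polynomial.lifts_iff_coeff_lifts]; intro k; have := hlo _ (GG_lo (hqk k)); exact this) ((Polynomial.monic_scaleRoots_iff _).2 hp)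
  have hqc : ∀ k (i : ℕ), PowerSeries.coeff i (q.coeff k) = ((p.scaleRoots (ep 1)).coeff k).coeff i := fun k i => by
    rw [← hqm, Polynomial.coeff_map, HahnSeries.ofPowerSeries_apply_coeff]
  obtain ⟨a, ha, hqa, hay⟩ := hensel_graded q hq (fun k i => by
      rw [hqc]; have := hqk k i; rwa [zero_add] at this) pb (by
    ext1 k
    rw [Polynomial.coeff_map, Polynomial.coeff_map, ← PowerSeries.coeff_zero_eq_constantCoeff_apply, hqc, Polynomial.coeff_scaleRoots, hepp,
      mul_one, hc]
    by_cases hk : k ≤ p.natDegree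
    · rw [← hpb k hk]; simp
    · rw [Polynomial.coeff_eq_zero_of_natDegree_lt (by omega), Polynomial.coeff_eq_zero_of_natDegree_lt (p := pb) (by omega)]; simp) y hy hy'
  have hag : HahnSeries.ofPowerSeries ℤ _ a ∈ GG (K := K) (d := d) 0 := by
    intro i; by_cases hi : 0 ≤ i
    · lift i to ℕ using hi; rw [HahnSeries.ofPowerSeries_apply_coeff, zero_add]; exact ha i
    · rw [HahnSeries.ofPowerSeries_apply, HahnSeries.embDomain_notin_range]
      · exact zero_mem _
      · rintro ⟨n, hn⟩; simp at hn; omega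
  refine ⟨ep (-1) * HahnSeries.ofPowerSeries ℤ _ a, ?_, ?_, ?_⟩
  · have := GG_mul GG_single hag; rwa [add_zero, ← hep] at this
  · have h1 : (p.scaleRoots (ep 1)).eval (HahnSeries.ofPowerSeries ℤ _ a) = 0 := by rw [← hqm, Polynomial.eval_map_apply, hqa, map_zero]
    have h2 : (p.scaleRoots (ep 1)).scaleRoots (ep (-1)) = p := by
      rw [← Polynomial.scaleRoots_mul, hepm]; have : ep (1 + -1) = 1 := by rw [hep]; rfl
      rw [this, Polynomial.scaleRoots_one]
    conv_lhs => rw [← h2]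
    have := Polynomial.scaleRoots_eval₂_eq_zero (p := p.scaleRoots (ep 1)) (RingHom.id (LS K d)) (r := HahnSeries.ofPowerSeries ℤ _ a) (s := ep (-1)) h1
    simpa using this
  · rw [mul_comm, hc, ← hay, ← PowerSeries.coeff_zero_eq_constantCoeff_apply]; exact HahnSeries.ofPowerSeries_apply_coeff a 0

end AMDP
namespace AMDP

variable {K : Type} [Field K] {d r : ℕ}

lemma GG_aeval {σ : Type} {g : σ → LS K d} (hg : ∀ i, g i ∈ GG 1) {m : ℤ} {f : MvPolynomial σ K} (hf : f ∈ HG m) :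
    aeval g f ∈ GG m ∧ (aeval g f).coeff (-m) = aeval (fun i => (g i).coeff (-1)) f := by
  have key : ∀ s : σ →₀ ℕ, aeval g (monomial s (1 : K)) ∈ GG (s.degree : ℤ) ∧
      (aeval g (monomial s (1 : K))).coeff (-(s.degree : ℤ)) = aeval (fun i => (g i).coeff (-1)) (monomial s (1 : K)) := by
    intro s
    induction s using Finsupp.induction_linear with
    | zero => simpa [← C_apply] using GG_one
    | add s t hs ht =>
      have h1 : monomial (s + t) (1 : K) = monomial s 1 * monomial t 1 := by rw [monomial_mul, one_mul]
      rw [h1, map_mul, map_mul, map_add, Nat.cast_add]; refine ⟨GG_mul hs.1 ht.1, ?_⟩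
      rw [neg_add, coeff_mul_lo0 (GG_lo hs.1) (GG_lo ht.1), hs.2, ht.2]
    | single i n =>
      rw [← X_pow_eq_monomial, map_pow, map_pow, aeval_X, aeval_X, Finsupp.degree_single]; have h1 := GG_pow (hg i) n
      have h2 := coeff_pow_lo (GG_lo (hg i)) n; rw [mul_neg, mul_one] at h2; rw [mul_one] at h1; exact ⟨h1, h2⟩
  have h0 : ∀ s ∈ f.support, ((s.degree : ℕ) : ℤ) = m := fun s hs => hf s (mem_support_iff.1 hs)
  have h2 : f = ∑ s ∈ f.support, coeff s f • monomial s (1 : K) := by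
    conv_lhs => rw [f.as_sum]
    simp [smul_monomial]
  rw [h2, map_sum, map_sum, HahnSeries.coeff_sum]; refine ⟨sum_mem fun s hs => ?_, sum_congr rfl fun s hs => ?_⟩
  · rw [map_smul, ← h0 s hs]; exact smul_mem _ _ (key s).1
  · rw [map_smul, map_smul, HahnSeries.coeff_smul, ← h0 s hs, (key s).2]

lemma exists_bezout {R F : Type} [CommRing R] [IsDomain R] [Field F] [Algebra R F] [IsFractionRing R F] (p : Polynomial R)
    (h : (p.map (algebraMap R F)).Separable) : ∃ D : R, D ≠ 0 ∧ ∃ u v, u * p + v * p.derivative = PC D := by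
  obtain ⟨u, v, h⟩ := h; obtain ⟨b, hb, hu⟩ := IsLocalization.integerNormalization_spec (nonZeroDivisors R) u
  obtain ⟨b', hb', hv⟩ := IsLocalization.integerNormalization_spec (nonZeroDivisors R) v
  refine ⟨b * b', mul_ne_zero (nonZeroDivisors.ne_zero hb) (nonZeroDivisors.ne_zero hb'),
    PC b' * IsLocalization.integerNormalization (nonZeroDivisors R) u, PC b * IsLocalization.integerNormalization (nonZeroDivisors R) v,
    Polynomial.map_injective _ (IsFractionRing.injective R F) ?_⟩
  have e : ∀ (c : R) (w : Polynomial F), c • w = PC (algebraMap R F c) * w := fun c w => by rw [← Polynomial.smul_eq_C_mul, algebraMap_smul]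
  rw [e] at hu hv; simp only [Polynomial.map_add, Polynomial.map_mul, Polynomial.map_C, hu, hv, map_mul]
  rw [Polynomial.derivative_map] at h; linear_combination (PC (algebraMap R F b) * PC (algebraMap R F b')) * h

variable {A L F : Type} [CommRing A] [IsDomain A] [Algebra K A] [Field L] [Algebra A L] [IsFractionRing A L]
  [Algebra (PS K d) A] [Algebra (PS K d) L] [IsScalarTower (PS K d) A L]
  [Field F] [Algebra (PS K d) F] [IsFractionRing (PS K d) F] [Algebra F L]
  [IsScalarTower (PS K d) F L]

lemma hom_minpoly (mk : PS K r →ₐ[K] A) (hh : ∀ p, mk p = 0 → ∀ n : ℕ, mk (hcmp n p) = 0) (l : Fin (d + 1) → PS K r)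
    (hl : ∀ i, l i ∈ HG 1) (hR : ∀ f : PS K d, algebraMap _ A f = mk (aeval l f))
    (hi : ∀ x : A, IsIntegral (PS K d) x) (x : PS K r) (hx : x ∈ HG 1) : ∃ p : Polynomial (PS K d), p.Monic ∧
      (∀ k ≤ p.natDegree, p.coeff k ∈ HG ((p.natDegree - k : ℕ) : ℤ)) ∧ p.map (algebraMap _ F) = minpoly F (algebraMap A L (mk x)) := by
  obtain ⟨p0, hp0⟩ : ∃ p0, p0 = minpoly (PS K d) (mk x) := ⟨_, rfl⟩; have hm0 : p0.Monic := hp0 ▸ minpoly.monic (hi _)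
  obtain ⟨n, hn⟩ : ∃ n, n = p0.natDegree := ⟨_, rfl⟩
  obtain ⟨p, hp⟩ : ∃ p : Polynomial (PS K d), p = ∑ k ∈ range (n + 1), PC (hcmp ((n - k : ℕ) : ℤ) (p0.coeff k)) * PX ^ k := ⟨_, rfl⟩
  have hc : ∀ k, p.coeff k = if k ≤ n then hcmp ((n - k : ℕ) : ℤ) (p0.coeff k) else 0 := fun k => by
    rw [hp, Polynomial.finsetSum_coeff]; simp [Polynomial.coeff_C_mul, Polynomial.coeff_X_pow, Nat.lt_succ_iff]
  have hcn : p.coeff n = 1 := by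
    rw [hc, if_pos le_rfl, hn, Polynomial.Monic.coeff_natDegree hm0, Nat.sub_self]; exact hcmp_of_mem HG_one
  have hle : p.natDegree ≤ n := Polynomial.natDegree_le_iff_coeff_eq_zero.2 fun k hk => by rw [hc, if_neg (by omega)]
  have hpm : p.Monic := Polynomial.monic_of_natDegree_le_of_coeff_eq_one n hle hcn
  have hpn : p.natDegree = n := le_antisymm hle (Polynomial.le_natDegree_of_ne_zero (by rw [hcn]; exact one_ne_zero))
  refine ⟨p, hpm, fun k hk => ?_, ?_⟩
  · rw [hpn] at hk ⊢; rw [hc, if_pos hk]; exact hcmp_mem _ _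
  have hev : Polynomial.aeval (mk x) p = 0 := by
    have h1 : mk (∑ k ∈ range (n + 1), x ^ k * aeval l (p0.coeff k)) = 0 := by
      have := minpoly.aeval (PS K d) (mk x); rw [← hp0, Polynomial.aeval_eq_sum_range, ← hn] at this; rw [map_sum, ← this]
      refine sum_congr rfl fun k _ => ?_; rw [Algebra.smul_def, hR, map_mul, map_pow, mul_comm]
    have h2 := hh _ h1 n; rw [map_sum, map_sum] at h2; rw [hp, map_sum, ← h2]; refine sum_congr rfl fun k hk => ?_
    have hxk : x ^ k ∈ HG k := mem_HG_nat.2 (by simpa using ((mem_HG_nat (n := 1)).1 hx).pow k)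
    rw [hcmp_HG_mul hxk, hcmp_aeval hl, map_mul, map_mul, Polynomial.aeval_C, map_pow, map_pow, Polynomial.aeval_X, hR, mul_comm,
      Nat.cast_sub (by have := mem_range.1 hk; omega)]
  have hmin : minpoly F (algebraMap A L (mk x)) = p0.map (algebraMap _ F) := by
    rw [hp0]; exact minpoly.isIntegrallyClosed_eq_field_fractions F L (hi _)
  refine Polynomial.eq_of_monic_of_dvd_of_natDegree_le (hmin ▸ hm0.map _) (hpm.map _) (minpoly.dvd _ _ ?_) ?_
  · rw [Polynomial.aeval_map_algebraMap, Polynomial.aeval_algebraMap_apply, hev, map_zero]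
  · rw [hmin, hpm.natDegree_map, hm0.natDegree_map, hpn, hn]

/-- The expansion of the coordinate functions around the point `O` at infinity. -/
def thv (O : Fin (d + 1) → K) (i : Fin (d + 1)) : LS K d :=
  O i • HahnSeries.single (-1 : ℤ) (1 : MP K d) + Fin.cases 0 (fun i => HC (X i)) i

lemma thv_GG (O : Fin (d + 1) → K) (i : Fin (d + 1)) : thv O i ∈ GG 1 := by
  refine add_mem (smul_mem _ _ GG_single) ?_; refine Fin.cases (Submodule.zero_mem _) (fun i => GG_C (HG_X i)) i

lemma thv_coeff (O : Fin (d + 1) → K) (i : Fin (d + 1)) : (thv O i).coeff (-1) = C (O i) := by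
  rw [thv, HahnSeries.coeff_add, HahnSeries.coeff_smul, HahnSeries.coeff_single_same, smul_eq_C_mul, mul_one]
  refine Fin.cases ?_ (fun i => ?_) i
  · simp
  · simp only [Fin.cases_succ]; rw [coeff_C_ne (by omega), add_zero]

lemma theta_lead (O : Fin (d + 1) → K) {m : ℤ} {f : PS K d} (hf : f ∈ HG m) : (aeval (thv O) f).coeff (-m) = C (eval O f) := by
  rw [(GG_aeval (thv_GG O) hf).2]; simp only [thv_coeff]
  exact DFunLike.congr_fun (MvPolynomial.algHom_ext (f := aeval fun i => C (O i)) (g := (Algebra.ofId K _).comp (aeval O)) (fun i => by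
    rw [aeval_X, AlgHom.comp_apply, aeval_X]; rfl)) f

lemma theta_psi (O : Fin (d + 1) → K) : ∃ μ : PS K d →+* Polynomial (MP K d),
    (O 0 ≠ 0 → Injective μ) ∧ ∀ f (e : ℤ), (aeval (thv O) f).coeff e = if e ≤ 0 then (μ f).coeff (-e).toNat else 0 := by
  let μ : PS K d →+* Polynomial (MP K d) := eval₂Hom (Polynomial.C.comp C) fun i => PC (C (O i)) * PX + Fin.cases 0 (fun i => PC (X i)) i
  refine ⟨μ, fun hO => ?_, ?_⟩
  · let ν : Polynomial (MP K d) →+* PS K d :=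
      Polynomial.eval₂RingHom (eval₂Hom C fun i => X i.succ - C (O i.succ * (O 0)⁻¹) * X 0) (C (O 0)⁻¹ * X 0)
    have h : ν.comp μ = RingHom.id _ := by
      refine MvPolynomial.ringHom_ext (fun a => by simp [μ, ν]) fun i => ?_; refine Fin.cases ?_ (fun i => ?_) i
      · have h2 : C (O 0) * C (O 0)⁻¹ = (1 : PS K d) := by rw [← C_mul, mul_inv_cancel₀ hO, C_1]
        simp [μ, ν, ← mul_assoc, h2]
      · simp [μ, ν, ← mul_assoc]
    exact Function.LeftInverse.injective (g := ν) fun f => RingHom.congr_fun h f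
  · let ψ : Polynomial (MP K d) →+* LS K d := Polynomial.eval₂RingHom HC (HahnSeries.single (-1 : ℤ) 1)
    have h : ((aeval (thv O) : _ →ₐ[K] LS K d) : _ →+* LS K d) = ψ.comp μ := by
      refine MvPolynomial.ringHom_ext (fun a => ?_) fun i => ?_
      · simp [μ, ψ, HahnSeries.algebraMap_apply, HahnSeries.C_apply]
      · have h1 : O i • HahnSeries.single (-1 : ℤ) (1 : MP K d) = HC (C (O i)) * HahnSeries.single (-1 : ℤ) 1 := by
          ext1; funext k; rw [coeff_Cmul, HahnSeries.coeff_smul, smul_eq_C_mul]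
        rw [RingHom.coe_coe, aeval_X, thv, h1]; refine Fin.cases ?_ (fun i => ?_) i <;> simp [μ, ψ, -HahnSeries.C_apply]
    intro f e; have h1 : aeval (thv O) f = ψ (μ f) := RingHom.congr_fun h f; rw [h1]
    simp only [ψ, Polynomial.coe_eval₂RingHom, Polynomial.eval₂_eq_sum_range, HahnSeries.coeff_sum, coeff_Cmul, HahnSeries.single_pow,
      one_pow, HahnSeries.coeff_single]
    split_ifs with he
    · rw [sum_eq_single (-e).toNat]
      · rw [if_pos (by simp; omega), mul_one]
      · intro b _ hb; rw [if_neg (by simp; omega), mul_zero]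
      · intro hb; rw [Polynomial.coeff_eq_zero_of_natDegree_lt (by simpa [Nat.lt_succ_iff] using hb), zero_mul]
    · refine sum_eq_zero fun b _ => ?_; rw [if_neg (by simp; omega), mul_zero]

lemma theta_inj (O : Fin (d + 1) → K) (hO : O 0 ≠ 0) : Injective (aeval (thv O) : PS K d →ₐ[K] LS K d) := by
  obtain ⟨μ, hμ, h⟩ := theta_psi O; refine (injective_iff_map_eq_zero _).2 fun f hf => (injective_iff_map_eq_zero μ).1 (hμ hO) f ?_
  ext1 k
  have := h f (-(k : ℤ)); rw [hf, if_pos (by omega), neg_neg, Int.toNat_natCast] at this; rw [← this]; simp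

lemma roots_in [IsAlgClosed K] {Ω : Type} [Field Ω] (e : LS K d →+* Ω) (he : Injective e) (O : Fin (d + 1) → K)
    (p : Polynomial (PS K d)) (hp : p.Monic) (hg : ∀ k ≤ p.natDegree, p.coeff k ∈ HG ((p.natDegree - k : ℕ) : ℤ))
    {D : PS K d} {u v} (huv : u * p + v * p.derivative = PC D) (hD : eval O D ≠ 0) (ω : Ω)
    (hω : p.eval₂ (e.comp (aeval (thv O) : _ →ₐ[K] LS K d)) ω = 0) : ∃ ρ : LS K d, ρ ∈ GG 1 ∧ e ρ = ω := by
  classical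
  obtain ⟨pb, hpb⟩ : ∃ pb, pb = p.map (eval O) := ⟨_, rfl⟩; have hbm : pb.Monic := hpb ▸ hp.map _; have hsep : pb.Separable := by
    have h := congrArg (Polynomial.map (eval O)) huv
    rw [Polynomial.map_add, Polynomial.map_mul, Polynomial.map_mul, Polynomial.map_C, ← Polynomial.derivative_map, ← hpb] at h
    refine ⟨PC (eval O D)⁻¹ * u.map (eval O), PC (eval O D)⁻¹ * v.map (eval O), ?_⟩
    rw [mul_assoc, mul_assoc, ← mul_add, h, ← Polynomial.C_mul, inv_mul_cancel₀ hD, Polynomial.C_1]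
  have hn : pb.natDegree = p.natDegree := by rw [hpb, hp.natDegree_map]
  obtain ⟨pt, hpt⟩ : ∃ pt, pt = p.map ((aeval (thv O) : _ →ₐ[K] LS K d) : _ →+* LS K d) := ⟨_, rfl⟩; have htm : pt.Monic := hpt ▸ hp.map _
  have htn : pt.natDegree = p.natDegree := by rw [hpt, hp.natDegree_map]
  have hroot : ∀ y : K, pb.eval y = 0 → ∃ ρ : LS K d, ρ ∈ GG 1 ∧ pt.eval ρ = 0 ∧ ρ.coeff (-1) = C y := fun y hy => by
    refine roots_GG htm (fun k hk => ?_) pb (fun k hk => ?_) (by rw [hn, htn]) y hy ?_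
    · rw [htn] at hk ⊢; rw [hpt, Polynomial.coeff_map]; exact (GG_aeval (thv_GG O) (hg k hk)).1
    · rw [htn] at hk ⊢; rw [hpt, hpb, Polynomial.coeff_map, Polynomial.coeff_map]; exact theta_lead O (hg k hk)
    · intro h'; exact (Polynomial.Separable.aeval_derivative_ne_zero hsep (x := y) (by simpa using hy)) (by simpa using h')
  choose! ρ hρ1 hρ2 hρ3 using hroot; have hS : ∀ y ∈ pb.roots.toFinset, pb.eval y = 0 := fun y hy => by
    rw [Multiset.mem_toFinset, Polynomial.mem_roots hbm.ne_zero] at hy; exact hy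
  have hcard : (pb.roots.toFinset.image fun y => e (ρ y)).card = p.natDegree := by
    rw [Finset.card_image_of_injOn, Multiset.toFinset_card_of_nodup (Polynomial.nodup_roots hsep), ← hn]
    · exact (IsAlgClosed.splits pb).natDegree_eq_card_roots.symm
    · intro y hy y' hy' h; have h1 := congrArg (fun f => HahnSeries.coeff f (-1 : ℤ)) (he h)
      simp only [hρ3 y (hS y hy), hρ3 y' (hS y' hy')] at h1; exact C_injective _ _ h1
  have hPm : (pt.map e).Monic := htm.map e; have hsub : pb.roots.toFinset.image (fun y => e (ρ y)) = (pt.map e).roots.toFinset := by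
    refine Finset.eq_of_subset_of_card_le ?_ ?_
    · intro w hw; obtain ⟨y, hy, rfl⟩ := Finset.mem_image.1 hw
      rw [Multiset.mem_toFinset, Polynomial.mem_roots hPm.ne_zero, Polynomial.IsRoot, Polynomial.eval_map_apply, hρ2 y (hS y hy), map_zero]
    · rw [hcard, ← htn, ← htm.natDegree_map e]; exact (Multiset.toFinset_card_le _).trans (Polynomial.card_roots' _)
  have hw : ω ∈ (pt.map e).roots.toFinset := by
    rw [Multiset.mem_toFinset, Polynomial.mem_roots hPm.ne_zero, Polynomial.IsRoot, hpt, Polynomial.map_map, Polynomial.eval_map]; exact hω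
  rw [← hsub] at hw; obtain ⟨y, hy, rfl⟩ := Finset.mem_image.1 hw; exact ⟨ρ y, hρ1 y (hS y hy), rfl⟩

/-- The family of all expansions at a point `O` at infinity. -/
structure Emb (mk : PS K r → Prop) (tr : PS K r → Prop) (l : Fin (d + 1) → PS K r) (O : Fin (d + 1) → K) (ι : Type) [Fintype ι] where
  Φ : ι → PS K r →ₐ[K] LS K d
  ker : ∀ j f, Φ j f = 0 ↔ mk f
  gr : ∀ j (m : ℤ) (f : PS K r), f ∈ HG m → Φ j f ∈ GG m
  th : ∀ j (f : PS K d), Φ j (aeval l f) = aeval (thv O) f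
  sym : ∀ a : PS K r, ∃ T : Finset ι, (∀ j, ∃ t ∈ T, Φ j a = Φ t a) ∧
    ∀ k, ∀ e : ℤ, 0 < e → ((∏ t ∈ T, (PX - PC (Φ t a))).coeff k).coeff e = 0
  htr : ∀ a, ∑ j, Φ j a = 0 ↔ tr a

lemma emb_core [IsAlgClosed K] [FiniteDimensional F L] [Algebra.IsSeparable F L] (mk : PS K r →ₐ[K] A) (l : Fin (d + 1) → PS K r)
    (hR : ∀ f : PS K d, algebraMap _ A f = mk (aeval l f)) (hi : ∀ x : A, IsIntegral (PS K d) x)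
    {ι : Type} [Fintype ι] (hcard : Fintype.card ι = finrank F L)
    (O : Fin (d + 1) → K) {Ω : Type} [Field Ω] [IsAlgClosed Ω] [Algebra F Ω] (e : LS K d →+* Ω) (he : Injective e)
    (heF : ∀ f, algebraMap F Ω (algebraMap (PS K d) F f) = e (aeval (thv O) f))
    (hrt : ∀ (i : Fin (r + 1)) (ω : Ω), Polynomial.aeval ω (minpoly F (algebraMap A L (mk (X i)))) = 0 → ∃ ρ : LS K d, ρ ∈ GG 1 ∧ e ρ = ω) :
    Nonempty (Emb (fun f => mk f = 0) (fun f => Algebra.trace F L (algebraMap A L (mk f)) = 0) l O ι) := by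
  classical
  let E : ι ≃ (L →ₐ[F] Ω) := Fintype.equivOfCardEq (by rw [hcard, AlgHom.card F L Ω])
  have hroot : ∀ (j : ι) (x : L), Polynomial.aeval (E j x) (minpoly F x) = 0 := fun j x => by
    rw [Polynomial.aeval_algHom_apply, minpoly.aeval, map_zero]
  choose ρ hρ1 hρ2 using fun j i => hrt i (E j (algebraMap A L (mk (X i)))) (hroot j _)
  have hRO : ∀ (j : ι) f, E j (algebraMap A L (mk (aeval l f))) = e (aeval (thv O) f) := fun j f => by
    rw [← hR, ← tower_apply, tower_apply _ F L, AlgHom.commutes, heF]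
  have hΦ : ∀ (j : ι) (a : PS K r), e (aeval (ρ j) a) = E j (algebraMap A L (mk a)) := fun j a => by
    have : e.comp (aeval (ρ j) : PS K r →ₐ[K] LS K d).toRingHom = ((E j : L →+* Ω).comp (algebraMap A L)).comp (mk : PS K r →+* A) := by
      refine MvPolynomial.ringHom_ext (fun b => ?_) fun i => ?_
      · have h1 := hRO j (C b); simp only [algHom_C] at h1; simp only [RingHom.comp_apply]
        exact (congrArg e (by simp)).trans (h1.symm.trans (by simp [← algebraMap_eq]))
      · simpa using hρ2 j i
    exact RingHom.congr_fun this a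
  refine ⟨⟨fun j => aeval (ρ j), fun j f => ?_, fun j m f hf => (GG_aeval (hρ1 j) hf).1, fun j f => ?_, fun a => ?_, fun a => ?_⟩⟩
  · rw [← map_eq_zero_iff e he, hΦ, map_eq_zero_iff (E j) (E j).injective, map_eq_zero_iff _ (IsFractionRing.injective A L)]
  · refine he ?_; rw [hΦ, hRO]
  · obtain ⟨x, hx⟩ : ∃ x, x = algebraMap A L (mk a) := ⟨_, rfl⟩; obtain ⟨P, hP⟩ : ∃ P, P = (minpoly F x).map (algebraMap F Ω) := ⟨_, rfl⟩
    have hPm : P.Monic := hP ▸ (minpoly.monic (Algebra.IsIntegral.isIntegral x)).map _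
    have hPr : P.roots.toFinset = Finset.univ.image fun j => E j x := by
      ext w; rw [Multiset.mem_toFinset, Polynomial.mem_roots hPm.ne_zero, Finset.mem_image]
      have h1 : w ∈ (minpoly F x).rootSet Ω ↔ P.IsRoot w := by
        rw [Polynomial.mem_rootSet_of_ne (minpoly.ne_zero (Algebra.IsIntegral.isIntegral x)), hP, Polynomial.IsRoot, Polynomial.eval_map_algebraMap]
      rw [← h1, ← Algebra.IsAlgebraic.range_eval_eq_rootSet_minpoly Ω x]; constructor
      · rintro ⟨σ, hσ⟩; exact ⟨E.symm σ, mem_univ _, by simpa using hσ⟩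
      · rintro ⟨j, -, hj⟩; exact ⟨E j, hj⟩
    obtain ⟨T, -, hT1, hT2⟩ := Finset.exists_subset_injOn_image_eq_of_surjOn (f := fun j => E j x) Set.univ (Finset.univ.image fun j => E j x)
      (by intro w hw; obtain ⟨j, -, hj⟩ := Finset.mem_image.1 hw; exact ⟨j, trivial, hj⟩)
    refine ⟨T, fun j => ?_, fun k ee hee => ?_⟩
    · have : E j x ∈ T.image fun j => E j x := hT2 ▸ Finset.mem_image_of_mem _ (mem_univ j); obtain ⟨t, ht, htj⟩ := Finset.mem_image.1 this
      exact ⟨t, ht, he (by rw [hΦ, hΦ, ← hx]; exact htj.symm)⟩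
    · have h1 : P = ∏ t ∈ T, (PX - PC (E t x)) := by
        have hnd : P.roots.Nodup := Polynomial.nodup_roots (hP ▸ Polynomial.Separable.map (Algebra.IsSeparable.isSeparable F x))
        rw [(IsAlgClosed.splits P).eq_prod_roots_of_monic hPm]; have h2 := Finset.prod_image (s := T) (f := fun w : Ω => (PX - PC w)) hT1
        rw [← h2, hT2, ← hPr]
        conv_lhs => rw [← (Multiset.toFinset_val P.roots).trans (Multiset.dedup_eq_self.2 hnd)]
        rfl
      have h2 : (∏ t ∈ T, (PX - PC (aeval (ρ t) a))) = (minpoly (PS K d) (mk a)).map ((aeval (thv O) : _ →ₐ[K] LS K d) : _ →+* LS K d) := by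
        refine Polynomial.map_injective e he ?_; rw [Polynomial.map_prod, Polynomial.map_map]
        simp only [Polynomial.map_sub, Polynomial.map_X, Polynomial.map_C, hΦ, ← hx]
        rw [← h1, hP, hx, minpoly.isIntegrallyClosed_eq_field_fractions F L (hi _), Polynomial.map_map]
        exact congrArg (fun g => Polynomial.map g _) (RingHom.ext heF)
      obtain ⟨μ, -, hμ⟩ := theta_psi O; rw [h2, Polynomial.coeff_map]; exact (hμ _ _).trans (if_neg (by omega))
  · rw [← map_eq_zero_iff e he, map_sum, ← map_eq_zero_iff (algebraMap F Ω) (algebraMap F Ω).injective, trace_eq_sum_embeddings]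
    simp only [hΦ]; rw [← Equiv.sum_comp E]

lemma emb [IsAlgClosed K] [FiniteDimensional F L] [Algebra.IsSeparable F L] (mk : PS K r →ₐ[K] A)
    (hh : ∀ p, mk p = 0 → ∀ n : ℕ, mk (hcmp n p) = 0) (l : Fin (d + 1) → PS K r) (hl : ∀ i, l i ∈ HG 1)
    (hR : ∀ f : PS K d, algebraMap _ A f = mk (aeval l f)) (hi : ∀ x : A, IsIntegral (PS K d) x)
    {ι : Type} [Fintype ι] (hcard : Fintype.card ι = finrank F L) (D0 : PS K d) (hD0 : D0 ≠ 0) :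
    ∃ O : Fin (d + 1) → K, O 0 ≠ 0 ∧ eval O D0 ≠ 0 ∧
      Nonempty (Emb (fun f => mk f = 0) (fun f => Algebra.trace F L (algebraMap A L (mk f)) = 0) l O ι) := by
  choose p hpm hpg hpF using fun i => hom_minpoly (F := F) (L := L) mk hh l hl hR hi (X i) (HG_X i)
  choose D hD u v huv using fun i => exists_bezout (F := F) (p i) (by rw [hpF]; exact Algebra.IsSeparable.isSeparable F _)
  have : Infinite K := IsAlgClosed.instInfinite; obtain ⟨O, hO⟩ : ∃ O, eval O (X 0 * D0 * ∏ i, D i) ≠ 0 := by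
    by_contra! h; exact mul_ne_zero (mul_ne_zero (X_ne_zero _) hD0) (Finset.prod_ne_zero_iff.2 fun i _ => hD i)
      (MvPolynomial.funext fun x => by rw [h x, map_zero])
  rw [map_mul, map_mul, map_prod, eval_X] at hO; have hO1 := left_ne_zero_of_mul hO; have hO0 := left_ne_zero_of_mul hO1
  refine ⟨O, hO0, right_ne_zero_of_mul hO1, ?_⟩; let Ω := AlgebraicClosure (FractionRing (LS K d))
  obtain ⟨e, he⟩ : ∃ e : LS K d →+* Ω, Injective e :=
    ⟨(algebraMap (FractionRing (LS K d)) Ω).comp (algebraMap (LS K d) (FractionRing (LS K d))), by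
      rw [RingHom.coe_comp]; exact (algebraMap (FractionRing (LS K d)) Ω).injective.comp (IsFractionRing.injective _ _)⟩
  obtain ⟨g, hg⟩ : ∃ g : PS K d →+* Ω, g = e.comp (aeval (thv O) : _ →ₐ[K] LS K d) := ⟨_, rfl⟩
  have hgi : Injective g := by rw [hg, RingHom.coe_comp]; exact he.comp (theta_inj O hO0)
  let _ : Algebra F Ω := (IsFractionRing.lift (K := F) hgi).toAlgebra
  have heF : ∀ f, algebraMap F Ω (algebraMap (PS K d) F f) = e (aeval (thv O) f) := fun f =>
    (IsFractionRing.lift_algebraMap hgi f).trans (by rw [hg]; rfl)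
  refine emb_core mk l hR hi hcard O e he heF fun i ω hω => ?_
  refine roots_in e he O (p i) (hpm i) (hpg i) (huv i) (Finset.prod_ne_zero_iff.1 (right_ne_zero_of_mul hO) i (mem_univ i)) ω ?_
  rw [← hpF, Polynomial.aeval_def, Polynomial.eval₂_map] at hω; rw [← hω]
  exact congrArg (fun g => Polynomial.eval₂ g ω (p i)) (RingHom.ext fun f => (heF f).symm)

lemma series_neg (q : Polynomial ℤ) (hq : q.eval 1 < 0) : ∀ (D : ℕ) (f : PowerSeries ℤ),
    f * (1 - PowerSeries.X) ^ (D + 1) = PowerSeries.mk (fun n => q.coeff n) → ∃ N, ∀ m ≥ N, PowerSeries.coeff m f < 0 := by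
  have tel : ∀ (f : PowerSeries ℤ) m, ∑ k ∈ range (m + 1), PowerSeries.coeff k (f * (1 - PowerSeries.X)) = PowerSeries.coeff m f := fun f m => by
    induction m with
    | zero => simp
    | succ m ih => rw [sum_range_succ, ih, mul_sub, mul_one, map_sub, PowerSeries.coeff_succ_mul_X]; ring
  have key : ∀ (D : ℕ) (f : PowerSeries ℤ), f * (1 - PowerSeries.X) ^ D = PowerSeries.mk (fun n => q.coeff n) →
      ∃ N, ∀ m ≥ N, ∑ k ∈ range m, PowerSeries.coeff k f < 0 := fun D => by
    induction D with
    | zero =>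
      intro f hf; refine ⟨q.natDegree + 1, fun m hm => ?_⟩; rw [pow_zero, mul_one] at hf
      rw [Polynomial.eval_eq_sum_range' (n := m) (by omega)] at hq; simpa [hf] using hq
    | succ D ih =>
      intro f hf; obtain ⟨N, hN⟩ := ih (f * (1 - PowerSeries.X)) (by rw [← hf]; ring)
      have h1 : ∀ k, ∑ i ∈ range (N + k), PowerSeries.coeff i f ≤ ∑ i ∈ range N, PowerSeries.coeff i f - k := fun k => by
        induction k with
        | zero => simp
        | succ k ihk =>
          have := hN (N + k + 1) (by omega); rw [tel] at this; rw [← add_assoc, sum_range_succ]; push_cast; omega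
      refine ⟨N + ((∑ i ∈ range N, PowerSeries.coeff i f).toNat + 1), fun m hm => ?_⟩; have := h1 (m - N)
      rw [Nat.add_sub_cancel' (by omega)] at this; omega
  intro D f hf; obtain ⟨N, hN⟩ := key D (f * (1 - PowerSeries.X)) (by rw [← hf]; ring)
  exact ⟨N, fun m hm => by rw [← tel]; exact hN _ (by omega)⟩

lemma Emb.upper {A : Type} [CommRing A] [Algebra K A] (mk : PS K r →ₐ[K] A) {tr : PS K r → Prop} {l : Fin (d + 1) → PS K r}
    {O : Fin (d + 1) → K} {n : ℕ} (hn : 0 < n) (E : Emb (fun f => mk f = 0) tr l O (Fin n)) (m : ℕ) :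
    finrank K ((HG m : Submodule K (PS K r)).map mk.toLinearMap) ≤ n * (d + 1).multichoose m := by
  have hsum : ∀ m, ∑ k ∈ range (m + 1), d.multichoose k = (d + 1).multichoose m := fun m => by
    induction m with
    | zero => simp
    | succ m ih => rw [sum_range_succ, ih, Nat.multichoose_succ_succ, add_comm]
  let g : (HG m : Submodule K (PS K r)) →ₗ[K] (Fin n → (k : Fin (m + 1)) → (HG (k : ℕ) : Submodule K (MP K d))) :=
    { toFun := fun a j k => ⟨(E.Φ j a).coeff ((k : ℕ) - m), by
        have := E.gr j m a a.2 ((k : ℕ) - m); rwa [add_sub_cancel] at this⟩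
      map_add' := fun a b => by funext j k; ext1; simp
      map_smul' := fun c a => by funext j k; ext1; simp }
  have hker : LinearMap.ker g ≤ LinearMap.ker (mk.toLinearMap.domRestrict (HG m)) := fun a ha => by
    rw [LinearMap.mem_ker] at ha ⊢; have hlo : ∀ j, Lo 1 (E.Φ j a) := fun j i hi => by
      by_cases h : i < -m
      · exact GG_lo (E.gr j m a a.2) i h
      · have := congrArg Subtype.val (congrFun (congrFun ha j) ⟨(i + m).toNat, by omega⟩)
        have h2 : (((i + m).toNat : ℕ) : ℤ) - m = i := by omega
        simp only [g, LinearMap.coe_mk, AddHom.coe_mk, h2] at this; exact this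
    obtain ⟨T, hT, hs⟩ := E.sym a; obtain ⟨t, ht, -⟩ := hT ⟨0, hn⟩; refine (E.ker t a).1 ?_
    ext1; funext i
    by_cases hi : i = 0
    · exact hlo t i (by omega)
    · exact alg_const T (fun t => E.Φ t a) (fun t _ => (hlo t).mono (by omega)) hs ht hi
  have h1 := LinearMap.finrank_range_add_finrank_ker g
  have h2 := LinearMap.finrank_range_add_finrank_ker (mk.toLinearMap.domRestrict (HG m)); rw [LinearMap.range_domRestrict] at h2
  have h3 := Submodule.finrank_mono hker; have h4 := Submodule.finrank_le (LinearMap.range g)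
  have h5 : finrank K (Fin n → (k : Fin (m + 1)) → (HG (k : ℕ) : Submodule K (MP K d))) = n * (d + 1).multichoose m := by
    rw [Module.finrank_pi_fintype, Finset.sum_const, Module.finrank_pi_fintype, card_univ, card_fin, smul_eq_mul, ← hsum,
      ← Fin.sum_univ_eq_sum_range]
    simp only [finrank_HG, card_fin]
  exact Nat.le_of_add_le_add_right (h2.le.trans (h1.ge.trans (Nat.add_le_add (h4.trans h5.le) h3)))

lemma den_exists (hi : ∀ x : A, IsIntegral (PS K d) x) (hRi : Injective (algebraMap (PS K d) A)) (x : L) : ∃ D : PS K d, D ≠ 0 ∧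
    ∃ a : A, algebraMap _ L D * x = algebraMap A L a := by
  have : FaithfulSMul (PS K d) A := (faithfulSMul_iff_algebraMap_injective _ _).2 hRi
  obtain ⟨a, b, hb, rfl⟩ := IsFractionRing.div_surjective (A := A) x; obtain ⟨y, D, hD, h⟩ := (hi b).isAlgebraic.exists_smul_eq_mul a hb
  refine ⟨D, hD, y, ?_⟩
  have hb0 : algebraMap A L b ≠ 0 := (map_ne_zero_iff _ (IsFractionRing.injective A L)).2 (nonZeroDivisors.ne_zero hb)
  rw [Algebra.smul_def] at h; have h2 := congrArg (algebraMap A L) h; rw [map_mul, map_mul, ← tower_apply] at h2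
  rw [← mul_div_assoc, h2, mul_div_cancel_left₀ _ hb0]

lemma lower [FiniteDimensional F L] (mk : PS K r →ₐ[K] A) (hmk : Surjective mk) (l : Fin (d + 1) → PS K r) (hl : ∀ i, l i ∈ HG 1)
    (hR : ∀ f : PS K d, algebraMap _ A f = mk (aeval l f)) (hi : ∀ x : A, IsIntegral (PS K d) x)
    (hRi : Injective (algebraMap (PS K d) A)) : ∃ e : ℕ, ∀ m : ℕ, finrank F L * (d + 1).multichoose m ≤
      finrank K ((HG ((m + e : ℕ) : ℤ) : Submodule K (PS K r)).map mk.toLinearMap) := by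
  classical
  have hS : ⊤ ≤ span F {y : L | ∃ k : ℕ, ∃ a ∈ HG k, algebraMap A L (mk a) = y} := fun x _ => by
    obtain ⟨D, hD, a, ha⟩ := den_exists hi hRi x; obtain ⟨a, rfl⟩ := hmk a
    have hD0 : algebraMap _ F D ≠ 0 := (map_ne_zero_iff _ (IsFractionRing.injective _ F)).2 hD
    rw [tower_apply _ F L, ← Algebra.smul_def] at ha; rw [← inv_smul_smul₀ hD0 x, ha, ← hcmp_sum a _ (Nat.lt_succ_self _), map_sum, map_sum]
    exact smul_mem _ _ (sum_mem fun k _ => subset_span ⟨k, _, hcmp_mem _ _, rfl⟩)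
  let b := Module.Basis.ofSpan hS
  have hb : ∀ i, ∃ k : ℕ, ∃ a ∈ HG k, algebraMap A L (mk a) = b i := fun i => Module.Basis.ofSpan_subset hS ⟨i, rfl⟩
  have := Module.Finite.finite_basis b; have := Fintype.ofFinite (((linearIndepOn_empty F id).extend (Set.empty_subset
    {y : L | ∃ k : ℕ, ∃ a ∈ HG k, algebraMap A L (mk a) = y})))
  choose k a ha hab using hb; refine ⟨∑ i, k i, fun m => ?_⟩; rw [Module.finrank_eq_card_basis b]
  let G : (_ → (HG m : Submodule K (PS K d))) →ₗ[K] A :=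
    { toFun := fun f => ∑ i, mk (aeval l (f i : PS K d) * (l 0 ^ (∑ i, k i - k i) * a i))
      map_add' := fun f g => by rw [← sum_add_distrib]; simp [add_mul]
      map_smul' := fun c f => by rw [RingHom.id_apply, smul_sum]; simp }
  have hG : Injective G := by
    refine (injective_iff_map_eq_zero G).2 fun f hf => ?_
    have h1 : ∑ i, (algebraMap _ F ((f i : PS K d) * X 0 ^ (∑ i, k i - k i))) • b i = 0 := by
      have := congrArg (algebraMap A L) hf; rw [map_zero] at this; rw [← this]; simp only [G, LinearMap.coe_mk, AddHom.coe_mk, map_sum]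
      refine sum_congr rfl fun i _ => ?_; rw [Algebra.smul_def, ← tower_apply, tower_apply _ A L, hR, ← hab, ← map_mul, ← map_mul]
      simp [mul_assoc]
    funext i
    ext1
    have h2 := Fintype.linearIndependent_iff.1 b.linearIndependent _ h1 i
    exact (mul_eq_zero.1 ((map_eq_zero_iff _ (IsFractionRing.injective _ F)).1 h2)).resolve_right (pow_ne_zero _ (X_ne_zero _))
  have h1 := LinearMap.finrank_range_of_inj hG
  rw [Module.finrank_pi_fintype, Finset.sum_const, card_univ, finrank_HG, card_fin, smul_eq_mul] at h1; rw [← h1]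
  refine Submodule.finrank_mono ?_; rintro _ ⟨f, rfl⟩; refine sum_mem fun i _ => ⟨_, ?_, rfl⟩
  have hle := Finset.single_le_sum (f := k) (fun _ _ => Nat.zero_le _) (mem_univ i)
  have hlp : l 0 ^ (∑ i, k i - k i) ∈ (HG ((∑ i, k i - k i : ℕ) : ℤ) : Submodule K (PS K r)) := mem_HG_nat.2 (by
    simpa using ((mem_HG_nat (n := 1)).1 (hl 0)).pow (∑ i, k i - k i))
  convert HG_mul (HG_aeval hl (f i).2) (HG_mul hlp (ha i)) using 2; rw [Nat.cast_sub hle, sub_add_cancel, Nat.cast_add]; exact Iff.rfl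

/-- The degree of the variety is the degree of the generic projection. -/
lemma deg_eq [IsAlgClosed K] [FiniteDimensional F L] [Algebra.IsSeparable F L] (mk : PS K r →ₐ[K] A) (hmk : Surjective mk)
    (hh : ∀ p, mk p = 0 → ∀ n : ℕ, mk (hcmp n p) = 0) (l : Fin (d + 1) → PS K r) (hl : ∀ i, l i ∈ HG 1)
    (hR : ∀ f : PS K d, algebraMap _ A f = mk (aeval l f))
    (hi : ∀ x : A, IsIntegral (PS K d) x)
    (hRi : Injective (algebraMap (PS K d) A)) (h : Polynomial ℤ)
    (hH : PowerSeries.mk (fun m => (finrank K ((HG m : Submodule K (PS K r)).map mk.toLinearMap) : ℤ)) *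
      (1 - PowerSeries.X) ^ (d + 1) = PowerSeries.mk fun n => h.coeff n) : h.eval 1 = finrank F L := by
  obtain ⟨O, -, -, ⟨E⟩⟩ := emb (F := F) (L := L) mk hh l hl hR hi (ι := Fin (finrank F L)) (card_fin _) 1 one_ne_zero
  obtain ⟨e, he⟩ := lower (F := F) (L := L) mk hmk l hl hR hi hRi; have hup := E.upper mk Module.finrank_pos; have hs := series_HG (d + 1)
  obtain ⟨n, hn⟩ : ∃ n, n = finrank F L := ⟨_, rfl⟩
  have hpoly : ∀ q : Polynomial ℤ, PowerSeries.mk (fun n => q.coeff n) = (q : PowerSeries ℤ) := fun q => rfl; rw [← hn] at hup he ⊢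
  refine le_antisymm ?_ ?_
  · by_contra! hlt; obtain ⟨N, hN⟩ := series_neg (PC (n : ℤ) - h) (by simpa using hlt) d
      (PowerSeries.C (n : ℤ) * PowerSeries.mk (fun m => ((d + 1).multichoose m : ℤ)) - PowerSeries.mk (fun m =>
        (finrank K ((HG m : Submodule K (PS K r)).map mk.toLinearMap) : ℤ))) (by
        rw [sub_mul, hH, mul_assoc, hs, hpoly, hpoly, Polynomial.coe_sub, Polynomial.coe_C, mul_one])
    have h1 := hN N le_rfl; have h2 := hup N; rw [map_sub, PowerSeries.coeff_C_mul, PowerSeries.coeff_mk, PowerSeries.coeff_mk] at h1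
    have h3 : (finrank K ((HG N : Submodule K (PS K r)).map mk.toLinearMap) : ℤ) ≤ n * (d + 1).multichoose N := by exact_mod_cast h2
    omega
  · by_contra! hlt; obtain ⟨N, hN⟩ := series_neg (h - PX ^ e * PC (n : ℤ)) (by simpa using hlt) d
      (PowerSeries.mk (fun m => (finrank K ((HG m : Submodule K (PS K r)).map mk.toLinearMap) : ℤ)) -
        PowerSeries.X ^ e * (PowerSeries.C (n : ℤ) * PowerSeries.mk (fun m => ((d + 1).multichoose m : ℤ)))) (by
        rw [sub_mul, hH, mul_assoc, mul_assoc, hs, hpoly, hpoly, Polynomial.coe_sub, Polynomial.coe_mul, Polynomial.coe_pow, Polynomial.coe_X,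
          Polynomial.coe_C, mul_one])
    have h1 := hN (N + e) (by omega); have h2 := he N
    rw [map_sub, PowerSeries.coeff_X_pow_mul, PowerSeries.coeff_C_mul, PowerSeries.coeff_mk, PowerSeries.coeff_mk] at h1
    have h3 : (n : ℤ) * (d + 1).multichoose N ≤ finrank K ((HG ((N + e : ℕ) : ℤ) : Submodule K (PS K r)).map mk.toLinearMap) := by
      exact_mod_cast h2
    omega

lemma Emb.tr_hom {mk tr : PS K r → Prop} {l : Fin (d + 1) → PS K r} {O : Fin (d + 1) → K} {ι : Type} [Fintype ι]
    (E : Emb mk tr l O ι) {y : PS K r} (hy : tr y) (n : ℕ) : tr (hcmp n y) := by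
  rw [← E.htr] at hy ⊢
  ext1; funext i
  have h := congrArg (fun z : LS K d => hcmp (n + i) (z.coeff i)) hy
  simp only [HahnSeries.coeff_sum, map_sum, HahnSeries.coeff_zero, map_zero] at h ⊢; refine Eq.trans (sum_congr rfl fun j _ => ?_) h
  conv_rhs => rw [← hcmp_sum y (max y.totalDegree n + 1) (by omega), map_sum, HahnSeries.coeff_sum, map_sum]
  rw [sum_eq_single n]
  · rw [hcmp_of_mem (E.gr j n _ (hcmp_mem _ _) i)]
  · intro k _ hk; exact hcmp_of_mem_ne (E.gr j k _ (hcmp_mem _ _) i) (by omega)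
  · intro hk; exact absurd (mem_range.2 (by omega)) hk

lemma exists_tr [FiniteDimensional F L] (mk : PS K r →ₐ[K] A) (hmk : Surjective mk) (l : Fin (d + 1) → PS K r) (hl : ∀ i, l i ∈ HG 1)
    (hR : ∀ f : PS K d, algebraMap _ A f = mk (aeval l f)) (hi : ∀ x : A, IsIntegral (PS K d) x)
    (hRi : Injective (algebraMap (PS K d) A)) {c : ℕ} (hcd : d + c = r) (hn : c + 2 = finrank F L) :
    ∃ a : PS K r, mk a ≠ 0 ∧ ∀ x ∈ HG 1, Algebra.trace F L (algebraMap A L (mk (a * x))) = 0 := by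
  have hli : LinearIndependent K (fun i => (⟨l i, hl i⟩ : (HG 1 : Submodule K (PS K r)))) := by
    refine LinearIndependent.of_comp (HG 1).subtype ?_
    have h1 := (linearIndependent_X (Fin (d + 1)) K).map' (aeval l : PS K d →ₐ[K] PS K r).toLinearMap
      (LinearMap.ker_eq_bot.2 fun f g h => hRi (by rw [hR, hR]; exact congrArg mk h))
    have h2 : ((HG 1).subtype ∘ fun i => (⟨l i, hl i⟩ : (HG 1 : Submodule K (PS K r)))) =
        (aeval l : PS K d →ₐ[K] PS K r).toLinearMap ∘ X := by funext i; simp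
    rw [h2]; exact h1
  obtain ⟨w, hw⟩ := exists_compl (n := c) _ hli (by
    have := finrank_HG (K := K) (σ := Fin (r + 1)) 1; rw [Nat.cast_one] at this; rw [this, card_fin, Nat.multichoose_one_right]; omega)
  have htr : ∀ (f : PS K d) (y : PS K r), Algebra.trace F L (algebraMap A L (mk (aeval l f * y))) =
      algebraMap _ F f * Algebra.trace F L (algebraMap A L (mk y)) := fun f y => by
    rw [map_mul, map_mul, ← hR, ← tower_apply, tower_apply _ F L, ← Algebra.smul_def, map_smul, smul_eq_mul]
  obtain ⟨w', hw0, hws⟩ : ∃ w' : Fin (c + 1) → PS K r, w' 0 = 1 ∧ ∀ i, w' (Fin.succ i) = w i :=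
    ⟨Fin.cases 1 fun i => (w i : PS K r), rfl, fun i => rfl⟩
  let T : L →ₗ[F] (Fin (c + 1) → F) := LinearMap.pi fun i => (Algebra.trace F L).comp (LinearMap.mulRight F (algebraMap A L (mk (w' i))))
  have hker : LinearMap.ker T ≠ ⊥ := LinearMap.ker_ne_bot_of_finrank_lt (by rw [← hn]; simp)
  obtain ⟨x, hx, hx0⟩ := (Submodule.ne_bot_iff _).1 hker; obtain ⟨D, hD, a, ha⟩ := den_exists hi hRi x; obtain ⟨a, rfl⟩ := hmk a
  have hD0 : algebraMap _ L D ≠ 0 := by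
    rw [tower_apply _ F L]; exact (map_ne_zero _).2 ((map_ne_zero_iff _ (IsFractionRing.injective _ F)).2 hD)
  refine ⟨a, fun h0 => ?_, fun y hy => ?_⟩
  · rw [h0, map_zero] at ha; exact (mul_ne_zero hD0 hx0) ha
  · have hT : ∀ i : Fin (c + 1), Algebra.trace F L (algebraMap A L (mk (a * w' i))) = 0 := fun i => by
      have := congrFun (LinearMap.mem_ker.1 hx) i; rw [map_mul, map_mul, ← ha, mul_assoc, tower_apply _ F L, ← Algebra.smul_def, map_smul]
      rw [show Algebra.trace F L (x * _) = 0 from this, smul_zero]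
    have h := hw ⟨y, hy⟩; obtain ⟨z, hz⟩ : ∃ z : (HG 1 : Submodule K (PS K r)), z = ⟨y, hy⟩ := ⟨_, rfl⟩; rw [← hz] at h
    have hzy : (z : PS K r) = y := by rw [hz]
    rw [← hzy]; clear hz hzy
    induction h using Submodule.span_induction with
    | mem z hz =>
      obtain ⟨i | i, rfl⟩ := hz
      · have h2 := hT i.succ; rw [hws] at h2; exact h2
      · have h1 := htr (X i) a; have h2 := hT 0; rw [hw0, mul_one] at h2; rw [aeval_X, h2, mul_zero, mul_comm] at h1; exact h1
    | zero => simp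
    | add p q _ _ hp hq => rw [Submodule.coe_add, mul_add, map_add, map_add, map_add, hp, hq, add_zero]
    | smul k p _ hp =>
      have h1 := htr (C k) (a * (p : PS K r)); rw [hp, mul_zero, algHom_C, ← Algebra.smul_def, ← mul_smul_comm] at h1; exact h1

lemma exists_setup [IsAlgClosed K] [FiniteDimensional F L] [Algebra.IsSeparable F L] (mk : PS K r →ₐ[K] A) (hmk : Surjective mk)
    (hh : ∀ p, mk p = 0 → ∀ n : ℕ, mk (hcmp n p) = 0) (l : Fin (d + 1) → PS K r) (hl : ∀ i, l i ∈ HG 1)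
    (hR : ∀ f : PS K d, algebraMap _ A f = mk (aeval l f)) (hi : ∀ x : A, IsIntegral (PS K d) x)
    (hRi : Injective (algebraMap (PS K d) A)) {c : ℕ} (hcd : d + c = r) (hn : c + 2 = finrank F L)
    (I : Ideal (PS K r)) (hI : ∀ f, mk f = 0 ↔ f ∈ I) (hnd : AMD.Nondeg K r I) {ι : Type} [Fintype ι] (hc : Fintype.card ι = c + 2) :
    Nonempty (Setup K r I d c ι) := by
  obtain ⟨a, ha0, ha⟩ := exists_tr (F := F) (L := L) mk hmk l hl hR hi hRi hcd hn
  obtain ⟨O', -, -, ⟨E'⟩⟩ := emb (F := F) (L := L) mk hh l hl hR hi (ι := ι) (hc.trans hn) 1 one_ne_zero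
  obtain ⟨m, hm⟩ : ∃ m : ℕ, mk (hcmp m a) ≠ 0 := by
    by_contra! h; refine ha0 ?_; rw [← hcmp_sum a _ (Nat.lt_succ_self _), map_sum]; exact sum_eq_zero fun k _ => h k
  obtain ⟨b, hb⟩ : ∃ b, b = hcmp m a := ⟨_, rfl⟩; have hbm : b ∈ HG m := hb ▸ hcmp_mem _ _
  have hbx : ∀ x ∈ HG 1, Algebra.trace F L (algebraMap A L (mk (b * x))) = 0 := fun x hx => by
    have h1 := E'.tr_hom (ha x hx) (m + 1)
    rw [mul_comm a, hcmp_HG_mul hx, mul_comm x, Nat.cast_add, Nat.cast_one, add_sub_cancel_right, ← hb] at h1; exact h1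
  rw [← hb] at hm; have : FaithfulSMul (PS K d) A := (faithfulSMul_iff_algebraMap_injective _ _).2 hRi
  obtain ⟨y, D, hD, hy⟩ := (hi (mk b)).isAlgebraic.exists_smul_eq_mul 1 (mem_nonZeroDivisors_of_ne_zero hm); obtain ⟨y, rfl⟩ := hmk y
  obtain ⟨k, hk⟩ : ∃ k : ℕ, hcmp k D ≠ 0 := by
    by_contra! h; exact hD (by rw [← hcmp_sum D _ (Nat.lt_succ_self _)]; exact sum_eq_zero fun k _ => h k)
  have hbk : mk (aeval l (hcmp k D) - b * hcmp (k - m : ℤ) y) = 0 := by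
    rw [Algebra.smul_def, mul_one, hR, ← map_mul] at hy; have h1 := hh (aeval l D - b * y) (by rw [map_sub, hy, sub_self]) k
    rwa [map_sub, hcmp_aeval hl, hcmp_HG_mul hbm] at h1
  obtain ⟨O, hO, hOk, ⟨E⟩⟩ := emb (F := F) (L := L) mk hh l hl hR hi (ι := ι) (hc.trans hn) _ hk
  have hγ : ∀ j, (E.Φ j b).coeff (-m) = C (MvPolynomial.coeff 0 ((E.Φ j b).coeff (-m))) := fun j => by
    refine HG_zero_eq ?_; have := E.gr j m b hbm (-m); rwa [add_neg_cancel] at this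
  have hγ0 : ∀ j, MvPolynomial.coeff 0 ((E.Φ j b).coeff (-m)) ≠ 0 := fun j h0 => by
    have h1 := (E.ker j _).2 hbk; rw [map_sub, sub_eq_zero, E.th, map_mul] at h1
    have h2 := congrArg (fun z : LS K d => z.coeff (-m + -(k - m : ℤ))) h1
    simp only [coeff_mul_lo0 (GG_lo (E.gr j m b hbm)) (GG_lo (E.gr j (k - m) _ (hcmp_mem _ y)))] at h2
    rw [hγ j, h0, C_0, zero_mul, show -(m : ℤ) + -(k - m : ℤ) = -k by ring, theta_lead O (hcmp_mem _ _)] at h2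
    exact hOk (C_injective _ _ (h2.trans C_0.symm))
  have hlin : ∀ (g : PS K d), g ∈ HG 1 → aeval l g ∈ HG 1 := fun g hg => HG_aeval hl hg
  refine ⟨⟨E.Φ, fun j f => (E.ker j f).trans (hI f), E.gr, aeval l ((O 0)⁻¹ • (X 0 : PS K d)),
    fun i => aeval l ((X i.succ : PS K d) - (O i.succ * (O 0)⁻¹) • X 0), ?_, ?_,
    fun j => ?_, fun j i => ?_, E.sym, fun j => MvPolynomial.coeff 0 ((E.Φ j b).coeff (-m)), hγ0, fun x hx => ?_, hc, hcd, hnd⟩⟩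
  · exact hlin _ (smul_mem _ _ (HG_X _))
  · exact fun i => hlin _ (sub_mem (HG_X _) (smul_mem _ _ (HG_X _)))
  · rw [E.th, map_smul, aeval_X, thv, Fin.cases_zero, add_zero, inv_smul_smul₀ hO]
  · rw [E.th, map_sub, map_smul, aeval_X, aeval_X, thv, thv, Fin.cases_zero, add_zero, Fin.cases_succ, mul_smul, inv_smul_smul₀ hO,
      add_sub_cancel_left]
  · have h1 := congrArg (fun z : LS K d => z.coeff (-m + -1)) ((E.htr _).2 (hbx x hx))
    simp only [HahnSeries.coeff_sum, HahnSeries.coeff_zero] at h1; rw [← h1]; refine sum_congr rfl fun j _ => ?_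
    rw [map_mul, coeff_mul_lo0 (GG_lo (E.gr j m b hbm)) (GG_lo (E.gr j 1 _ hx)), hγ j, smul_eq_C_mul, MvPolynomial.coeff_zero_C]

lemma setup_aux [IsAlgClosed K] {A L : Type} [CommRing A] [IsDomain A] [Algebra K A] [Field L] [Algebra K L] [Algebra A L]
    [IsScalarTower K A L] [IsFractionRing A L] (mk : PS K r →ₐ[K] A) (hmk : Surjective mk)
    (hh : ∀ p, mk p = 0 → ∀ n : ℕ, mk (hcmp n p) = 0) (hd : ringKrullDim A = (((d : ℕ∞) + 1 : ℕ∞) : WithBot ℕ∞))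
    {c : ℕ} (hcd : d + c = r) (h : Polynomial ℤ) (hc2 : h.eval 1 = (c + 2 : ℕ))
    (hH : PowerSeries.mk (fun m => (finrank K ((HG m : Submodule K (PS K r)).map mk.toLinearMap) : ℤ)) *
      (1 - PowerSeries.X) ^ (d + 1) = PowerSeries.mk fun n => h.coeff n)
    (I : Ideal (PS K r)) (hI : ∀ f, mk f = 0 ↔ f ∈ I) (hnd : AMD.Nondeg K r I) {ι : Type} [Fintype ι] (hc : Fintype.card ι = c + 2) :
    Nonempty (Setup K r I d c ι) := by
  obtain ⟨l, hl, hinj⟩ := exists_LF (L := L) mk hmk hh hd; let R := PS K d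
  let _ : Algebra R A := (aeval (fun i => mk (l i)) : R →ₐ[K] A).toAlgebra
  have hRA : ∀ f, algebraMap R A f = aeval (fun i => mk (l i)) f := fun f => rfl
  let _ : Algebra R L := ((algebraMap A L).comp (algebraMap R A)).toAlgebra
  have t1 : IsScalarTower R A L := IsScalarTower.of_algebraMap_eq fun x => rfl
  have t2 : IsScalarTower K R A := IsScalarTower.of_algebraMap_eq fun x => by rw [hRA, MvPolynomial.algebraMap_eq, algHom_C]
  have t3 : IsScalarTower K R L := IsScalarTower.of_algebraMap_eq fun x => by
    rw [tower_apply R A L, ← tower_apply K R A, ← tower_apply K A L]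
  have hinL : Injective (algebraMap R L) := (IsFractionRing.injective A L).comp hinj
  have : FaithfulSMul R L := (faithfulSMul_iff_algebraMap_injective _ _).2 hinL; let F := FractionRing R
  let _ : Algebra F L := FractionRing.liftAlgebra R L; have t4 : IsScalarTower R F L := inferInstance
  have t5 : IsScalarTower K F L := IsScalarTower.of_algebraMap_eq fun x => by
    rw [tower_apply K R F, ← tower_apply R F L, ← tower_apply K R L]
  have hR : ∀ f : R, algebraMap R A f = mk (aeval l f) := fun f => by rw [hRA, ← AlgHom.comp_apply, comp_aeval]
  have hitg : Algebra.IsIntegral R A := hl.int R fun i => ⟨X i, by rw [hRA, aeval_X]⟩; have hi : ∀ x : A, IsIntegral R x := hitg.isIntegral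
  have hsep : Algebra.IsSeparable F L := hl.sep F fun i => ⟨algebraMap R F (X i), by
    rw [← tower_apply R F L, tower_apply R A L, hRA, aeval_X]⟩
  have hft : Algebra.FiniteType R A := by
    have : Algebra.FiniteType K A := Algebra.FiniteType.of_surjective mk hmk; exact Algebra.FiniteType.of_restrictScalars_finiteType K R A
  have hfin : Module.Finite R A := Algebra.IsIntegral.finite; have hfd : FiniteDimensional F L := by
    obtain ⟨S, hS⟩ := hfin.fg_top; classical
    refine ⟨⟨S.image (algebraMap A L), ?_⟩⟩; rw [eq_top_iff]; intro x _; obtain ⟨D, hD, a, ha⟩ := den_exists hi hinj x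
    have hD0 : algebraMap R F D ≠ 0 := (map_ne_zero_iff _ (IsFractionRing.injective R F)).2 hD
    rw [tower_apply R F L, ← Algebra.smul_def] at ha; rw [← inv_smul_smul₀ hD0 x, ha]; refine smul_mem _ _ ?_
    have h1 : a ∈ span R (S : Set A) := hS ▸ trivial; clear ha
    induction h1 using Submodule.span_induction with
    | mem y hy => exact subset_span (by rw [Finset.coe_image]; exact ⟨y, hy, rfl⟩)
    | zero => rw [map_zero]; exact zero_mem _
    | add y z _ _ hy hz => rw [map_add]; exact add_mem hy hz
    | smul k y _ hy =>
      rw [Algebra.smul_def, map_mul, ← tower_apply R A L, tower_apply R F L, ← Algebra.smul_def]; exact smul_mem _ _ hy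
  have hdeg := deg_eq (F := F) (L := L) mk hmk hh l hl.deg hR hi hinj h hH; rw [hc2] at hdeg
  exact exists_setup (F := F) (L := L) mk hmk hh l hl.deg hR hi hinj hcd (by exact_mod_cast hdeg) I hI hnd hc

lemma map_HG (I : Ideal (PS K r)) (n : ℕ) : AMD.quotComponent K r I n =
    (HG n : Submodule K (PS K r)).map (Ideal.Quotient.mkₐ K I).toLinearMap := by
  have : homogeneousSubmodule (Fin (r + 1)) K n = HG n := by ext p; rw [mem_HG_nat, mem_homogeneousSubmodule]
  rw [AMD.quotComponent, this]

theorem setup_of [IsAlgClosed K] {I : Ideal (PS K r)} (hprime : I.IsPrime) (hhom : AMD.IsHomIdeal K r I) (hnd : AMD.Nondeg K r I)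
    {c : ℕ} (hdim : AMD.DimEq K r I d) (hcodim : d + c = r) (hdeg : AMD.DegreeEq K r I d (c + 2)) : Nonempty (Setup K r I d c (TT c)) := by
  obtain ⟨h, hH, hc2⟩ := hdeg; have hmem : ∀ p, Ideal.Quotient.mkₐ K I p = 0 ↔ p ∈ I := fun p => Ideal.Quotient.eq_zero_iff_mem
  refine setup_aux (L := FractionRing (PS K r ⧸ I)) (Ideal.Quotient.mkₐ K I) (Ideal.Quotient.mkₐ_surjective K I) ?_ hdim hcodim h hc2 ?_ I hmem
    hnd ?_
  · intro p hp n; rw [hmem] at hp ⊢; rw [hcmp_nat]; exact hhom p hp n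
  · rw [← hH, AMD.hilbSeries]; congr 2; funext m; rw [map_HG]
  · simp only [TT, Fintype.card_option, card_fin]

lemma bot_deg : AMD.DegreeEq K r ⊥ r 1 := by
  refine ⟨1, ?_, by simp⟩; have h1 : ∀ n, finrank K (AMD.quotComponent K r ⊥ n) = (r + 1).multichoose n := fun n => by
    have h2 : Injective (Ideal.Quotient.mkₐ K (⊥ : Ideal (PS K r))).toLinearMap := fun a b h => by
      have := Ideal.Quotient.eq.1 h; rwa [Ideal.mem_bot, sub_eq_zero] at this
    rw [map_HG, ← (Submodule.equivMapOfInjective _ h2 (HG n)).finrank_eq, finrank_HG, card_fin]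
  rw [AMD.hilbSeries]; simp only [h1]; rw [series_HG]; exact Polynomial.coe_one.symm

lemma dim_PS : ringKrullDim (PS K r) = (((r : ℕ∞) + 1 : ℕ∞) : WithBot ℕ∞) := by
  rw [MvPolynomial.ringKrullDim_of_isNoetherianRing, ringKrullDim_eq_zero_of_field]; simp

lemma bot_dim : AMD.DimEq K r ⊥ r := by
  rw [AMD.DimEq, ← dim_PS (K := K)]; exact ringKrullDim_eq_of_ringEquiv (RingEquiv.quotientBot _)

/-- The case of codimension zero does not occur. -/
lemma codim_pos {I : Ideal (PS K r)} (hdim : AMD.DimEq K r I r) (hdeg : AMD.DegreeEq K r I r 2) : False := by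
  have hI : I = ⊥ := by
    by_contra hne; obtain ⟨x, hx, hx0⟩ := Submodule.exists_mem_ne_zero_of_ne_bot hne
    have h1 := ringKrullDim_succ_le_of_surjective (Ideal.Quotient.mk I) Ideal.Quotient.mk_surjective (mem_nonZeroDivisors_of_ne_zero hx0)
      (Ideal.Quotient.eq_zero_iff_mem.2 hx)
    rw [hdim, dim_PS] at h1; have h2 : ((r + 1 + 1 : ℕ) : WithBot ℕ∞) ≤ ((r + 1 : ℕ) : WithBot ℕ∞) := by exact_mod_cast h1
    have h5 : r + 1 + 1 ≤ r + 1 := by exact_mod_cast h2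
    omega
  subst hI; obtain ⟨h, h1, h2⟩ := hdeg; obtain ⟨h', h1', h2'⟩ := bot_deg (K := K) (r := r); have : h = h' := by
    ext n; have := congrArg (PowerSeries.coeff n) (h1.symm.trans h1'); simpa using this
  rw [this, h2'] at h2; norm_num at h2

end AMDP

end

/-- **Lemma 3.2 (first part).**  A variety `X ⊆ ℙ^r_K` of almost minimal degree which
is not arithmetically Cohen-Macaulay and not a generic projection of (a cone over) the
Veronese surface is contained in a variety `Y` of minimal degree with
`codim(X, Y) = 1`; moreover `Tor_i^S(K, A_X) ≅ K^{u_i}(-i-1) ⊕ K^{v_i}(-i-2)` for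
`1 ≤ i ≤ c + q`, i.e. the Betti diagram of `I_X` is concentrated in the two rows
`j = 1` and `j = 2`. -/
theorem tor_structure_of_almost_minimal_degree
    (K : Type) [Field K] [IsAlgClosed K] (r : ℕ)
    (I : Ideal (PS K r)) (hprime : I.IsPrime)
    (hhom : AMD.IsHomIdeal K r I) (hnd : AMD.Nondeg K r I)
    (d c q t : ℕ) (hdim : AMD.DimEq K r I d) (hcodim : d + c = r)
    (hdeg : AMD.DegreeEq K r I d (c + 2))
    (hACM : ¬ AMD.IsACM K r I)
    (hver : ¬ AMD.IsGenProjVeroneseCone K r I)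
    (hdepth : AMD.DepthEq K r I t) (hq : t + q = d + 1) :
    (∃ J : Ideal (PS K r), J.IsPrime ∧ AMD.IsHomIdeal K r J ∧ AMD.Nondeg K r J ∧
      J ≤ I ∧ AMD.DimEq K r J (d + 1) ∧ AMD.DegreeEq K r J (d + 1) c) ∧
    (∃ b : ℕ → ℕ → ℕ, AMD.HasBettiDiagram K r I b ∧
      ∀ i : ℕ, 1 ≤ i → i ≤ c + q → ∀ j : ℕ, b i j ≠ 0 → j = 1 ∨ j = 2) := by
  classical
  have hc1 : 1 ≤ c := by
    by_contra hc
    obtain rfl : c = 0 := by omega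
    obtain rfl : d = r := by omega
    exact AMDP.codim_pos hdim hdeg
  obtain ⟨s⟩ := AMDP.setup_of hprime hhom hnd hdim hcodim hdeg
  have hex : ∃ m : ℤ, ∃ G ∈ s.HD m, (∀ j, AMDP.Lo (-1) (G j)) ∧ ∑ j, s.γ j • (G j).coeff (-1) ≠ 0 := by
    by_contra! hno
    obtain ⟨rs, h1, h2, h3⟩ := s.case_one hc1 hno
    have h4 := hdepth.2 rs h2 h3
    obtain rfl : t = d + 1 := by omega
    exact hACM ⟨d + 1, by rw [hdim]; norm_cast, hdepth⟩
  obtain ⟨η, h1, hη⟩ := s.case_two hc1 hex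
  refine ⟨?_, ?_⟩
  · have h2 : ∀ i j, j ≠ i → (η i j).coeff (-1) = 0 := fun i j h => by rw [hη, if_neg h]
    have h3 : ∀ i, (η i i).coeff (-1) = 1 := fun i => by rw [hη, if_pos rfl]
    rcases Nat.lt_or_ge c 2 with hlt | hc2
    · obtain rfl : c = 1 := by omega
      subst hcodim
      exact ⟨⊥, Ideal.isPrime_bot, fun p hp n => by rw [Ideal.mem_bot] at hp ⊢; rw [hp, map_zero], fun p hp _ => hp, bot_le, AMDP.bot_dim,
        AMDP.bot_deg⟩
    · by_cases hQ : ∀ i j k m, AMDP.TData.D4 i j k m → (AMDP.Setup.tdata h1 h2 h3).Q i j k m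
      · obtain ⟨κ, hκ, m0, hm0, hm, x, hx⟩ := AMDP.TData.scroll _ (by rw [s.card]; omega) hQ none
        exact AMDP.Setup.scroll_J s hc2 h1 h2 h3 hκ hm0 hm (fun t => x (some t)) fun t => hx (some t) (by simp)
      · push Not at hQ
        have h4 := AMDP.TData.classify _ hQ
        rw [s.card] at h4
        obtain rfl : c = 2 := by omega
        obtain ⟨V, -⟩ := AMDP.Setup.vero h1 h2 h3 hQ
        have hg : ∀ j, s.γ (V.e j) * V.α j ≠ 0 := fun j => mul_ne_zero (s.γne _) (V.αne j)
        obtain ⟨κ, hκ⟩ : ∃ κ : Fin 4 → K, κ = fun j => s.γ (V.e j) * V.α j / (s.γ (V.e 0) * V.α 0) := ⟨_, rfl⟩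
        have hgκ : ∀ j, s.γ (V.e j) * V.α j = (s.γ (V.e 0) * V.α 0) * κ j := fun j => by
          rw [hκ]; exact (mul_div_cancel₀ _ (hg 0)).symm
        have h0 : κ 0 = 1 := by rw [hκ]; exact div_self (hg 0)
        by_cases hdet : κ 1 * κ 2 * κ 3 + κ 1 * κ 2 + κ 2 * κ 3 + κ 1 * κ 3 = 0
        · refine V.degen κ (fun j => ?_) h0 (fun v hv => ?_) hdet
          · rw [hκ]; exact div_ne_zero (hg j) (hg 0)
          · refine (Finset.sum_congr rfl fun j _ => ?_).trans ((Finset.mul_sum _ _ (s.γ (V.e 0) * V.α 0)).symm.trans (by rw [hv, mul_zero]))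
            rw [hgκ j]; ring
        · exact absurd (V.nondegen κ (hg 0) hgκ h0 hdet) hver
  · obtain ⟨fr, -, hz⟩ := s.frame_two η h1 hη
    obtain ⟨b, hb, hj⟩ := AMDP.Setup.betti fr hz hhom
    exact ⟨b, hb, fun i hi _ => hj i hi⟩
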